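/- Interpolation identity for weight-3/2 Kloosterman sums at even moduli: For all integers m, n ≥ 1, the series Σ_{even c>0} (S(m,n,c,ν_Θ³)/√c)·sin(2π√(mn)/c) converges (as the limit of partial sums over even c ≤ x as x → ∞), and its value equals e(−1/8)·√m if m = n and equals 0 if m ≠ n. -/

import Mathlib

open Complex Real Filter Topology BigOperators MeasureTheory

noncomputable section

/-- `ee x = exp(2πix)`. -/
def ee (x : ℂ) : ℂ := Complex.exp (2 * (π : ℂ) * Complex.I * x)

/-- `ε_d`: equals 1 if `d ≡ 1 (mod 4)` and `i` if `d ≡ 3 (mod 4)`. -/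
def epsFactor (d : ℕ) : ℂ := if d % 4 = 1 then 1 else Complex.I

/-- Weight-`w/2` Kloosterman sum with theta multiplier, even modulus `c`:
`S(m,n,c,ν_Θ^w) = Σ_d ε_d^w (2c/d)^w e((m a_d + n d)/(2c))`, the sum over `0 < d < 2c`
with `gcd(d,2c)=1` and `a_d` the inverse of `d` modulo `2c` in `(0,2c)`. -/
def SKe (m n : ℤ) (c : ℕ) (w : ℕ) : ℂ :=
  ∑ d ∈ Finset.Ico 1 (2 * c), ∑ a ∈ Finset.Ico 1 (2 * c),
    if (a * d) % (2 * c) = 1 then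
      epsFactor d ^ w * ((jacobiSym (2 * (c : ℤ)) d : ℤ) : ℂ) ^ w *
        ee (((m * a + n * d : ℤ) : ℂ) / (2 * (c : ℕ)))
    else 0

/-- Weight-`w/2` Kloosterman sum with theta multiplier, odd modulus `c`:
`S(m,n,c,ν_Θ^w) = e(w/8) ε_c^{-w} Σ_d (2d/c)^w e((m a_d + n d)/(2c))`, the sum over even
`0 ≤ d < 2c` with `gcd(d,c)=1` and `a_d` the unique even inverse of `d` mod `c` in `[0,2c)`. -/
def SKo (m n : ℤ) (c : ℕ) (w : ℕ) : ℂ :=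
  ee ((w : ℂ) / 8) * (epsFactor c)⁻¹ ^ w *
    ∑ d ∈ Finset.range (2 * c), ∑ a ∈ Finset.range (2 * c),
      if d % 2 = 0 ∧ a % 2 = 0 ∧ (a * d) % c = 1 % c then
        ((jacobiSym (2 * (d : ℤ)) c : ℤ) : ℂ) ^ w *
          ee (((m * a + n * d : ℤ) : ℂ) / (2 * (c : ℕ)))
      else 0


section

open scoped UpperHalfPlane MatrixGroups ENNReal ComplexConjugate
open UpperHalfPlane hiding I
open ModularGroup
open Finset (range sum_congr sum_mul sum_le_sum sum_nonneg sum_add_distrib mul_sum sum_const mem_range sum_sub_distrib mem_filter)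
open Set (Ioi Ici indicator_of_mem indicator_of_notMem)
open ENNReal (ofReal_lt_top toReal_ofReal ofReal_le_ofReal ofReal_ne_top)
open intervalIntegral (integral_of_le integral_add_adjacent_intervals integral_congr integral_comp_add_right)
open Nat (Coprime)

notation "Γ₂" => CongruenceSubgroup.Gamma 2

variable {α β : ℝ → ℝ} {y₀ y₁ A B y Y : ℝ} {m n : ℕ} {w : ℂ}

open scoped NumberTheorySymbols in
/-- The Jacobi symbol `J(a | ·)` with positive `a` is even modulo `4a`. -/
theorem jacobiSym_eq_of_four_mul_dvd_add (a : ℕ) {b b' : ℕ} (hb : Odd b) (hb' : Odd b')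
    (h : 4 * a ∣ b + b') : J(a | b) = J(a | b') := by
  induction a using Nat.strong_induction_on with
  | _ a ih =>
    rcases Nat.even_or_odd a with ha | ha
    · obtain ⟨e, rfl⟩ := ha
      rcases Nat.eq_zero_or_pos e with rfl | he
      · grind
      have h1 := ih e (by omega) (dvd_trans (by exact ⟨2, by ring⟩) h)
      have h8 : 8 ∣ b + b' := dvd_trans ⟨e, by ring⟩ h
      have h2 : J((2 : ℤ) | b) = J((2 : ℤ) | b') := by
        rw [jacobiSym.at_two hb, jacobiSym.at_two hb']
        rw [ZMod.χ₈_nat_mod_eight b, ZMod.χ₈_nat_mod_eight b']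
        have h3 : b % 2 = 1 := Nat.odd_iff.mp hb
        have : (b % 8 = 1 ∧ b' % 8 = 7) ∨ (b % 8 = 3 ∧ b' % 8 = 5) ∨
          (b % 8 = 5 ∧ b' % 8 = 3) ∨ (b % 8 = 7 ∧ b' % 8 = 1) := by omega
        rcases this with h | h | h | h <;> rw [h.1, h.2] <;> decide
      have : ((e + e : ℕ) : ℤ) = 2 * (e : ℤ) := by push_cast; ring
      rw [this, jacobiSym.mul_left, jacobiSym.mul_left, h1, h2]
    · rw [jacobiSym.quadratic_reciprocity' ha hb, jacobiSym.quadratic_reciprocity' ha hb']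
      have h1 : J((b' : ℤ) | a) = J(-(b : ℤ) | a) := by
        apply jacobiSym.mod_left'
        apply Int.ModEq.symm
        apply (Int.modEq_iff_dvd).mpr
        have : (a : ℤ) ∣ ((b + b' : ℕ) : ℤ) :=
          Int.natCast_dvd_natCast.mpr (dvd_trans ⟨4, by ring⟩ h)
        grind
      have h2 : ZMod.χ₄ b' = -ZMod.χ₄ b := by
        rw [ZMod.χ₄_nat_mod_four b, ZMod.χ₄_nat_mod_four b']
        have h4 : 4 ∣ b + b' := dvd_trans ⟨a, by ring⟩ h
        have h3 : b % 2 = 1 := Nat.odd_iff.mp hb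
        have : (b % 4 = 1 ∧ b' % 4 = 3) ∨ (b % 4 = 3 ∧ b' % 4 = 1) := by omega
        rcases this with h | h <;> rw [h.1, h.2] <;> decide
      rw [h1, jacobiSym.neg _ ha, qrSign, qrSign, h2, jacobiSym.neg _ ha]
      have : ZMod.χ₄ a * ZMod.χ₄ a = 1 := by
        rw [ZMod.χ₄_nat_mod_four a]
        have h3 : a % 2 = 1 := Nat.odd_iff.mp ha
        have : a % 4 = 1 ∨ a % 4 = 3 := by omega
        rcases this with h | h <;> rw [h] <;> decide
      grind

/-- The theta multiplier attached to a bottom row `(c, d)` with `d > 0`. -/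
def thetaMul (c : ℤ) (d : ℕ) : ℂ := (epsFactor d)⁻¹ * ((jacobiSym (2 * c) d : ℤ) : ℂ)

open scoped NumberTheorySymbols in
theorem jacobiSym_two_mul_even (e : ℤ) {d : ℕ} (hd : Odd d) : J(2 * (2 * e) | d) = J(e | d) := by
  have : 2 * (2 * e) = 4 * e := by ring
  rw [this, jacobiSym.mul_left, jacobiSym.at_four hd, one_mul]

theorem epsFactor_mod_four {d d' : ℕ} (h : d % 4 = d' % 4) : epsFactor d = epsFactor d' := by
  simp [epsFactor, h]

theorem thetaMul_sub_two_mul (c s : ℤ) (d : ℕ) : thetaMul (c - 2 * s * d) d = thetaMul c d := by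
  unfold thetaMul
  rw [jacobiSym.mod_left' (a₁ := 2 * (c - 2 * s * d)) (a₂ := 2 * c)]
  apply Int.ModEq.symm
  apply (Int.modEq_iff_dvd).mpr
  exact ⟨-(4 * s), by ring⟩

theorem thetaMul_congr {c : ℤ} (hc : Even c) {d d' : ℕ} (hd : Odd d) (hd' : Odd d')
    (h : d % (2 * c.natAbs) = d' % (2 * c.natAbs)) : thetaMul c d = thetaMul c d' := by
  obtain ⟨e, rfl⟩ := hc
  rw [← two_mul] at *
  have h2 : 2 * (2 * e).natAbs = 4 * e.natAbs := by lia
  rw [h2] at h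
  unfold thetaMul
  rw [jacobiSym_two_mul_even e hd, jacobiSym_two_mul_even e hd', jacobiSym.mod_right e hd, h,
    ← jacobiSym.mod_right e hd']
  congr 2
  apply epsFactor_mod_four
  have : d % (4 * e.natAbs) % 4 = d' % (4 * e.natAbs) % 4 := by rw [h]
  rwa [Nat.mod_mul_right_mod, Nat.mod_mul_right_mod] at this

theorem cpow_half_neg_of_im_pos (hw : 0 < w.im) :
    w ^ (1 / 2 : ℂ) = I * (-w) ^ (1 / 2 : ℂ) := by
  have hw0 : w ≠ 0 := by rintro rfl; simp at hw
  have h1 : Complex.log w = Complex.log (-w) + π * I := by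
    apply Complex.ext
    · simp [log_re]
    · simp only [log_im, add_im, mul_im, ofReal_re, Complex.I_im,
        ofReal_im, Complex.I_re]
      rw [arg_neg_eq_arg_sub_pi_of_im_pos hw]; ring
  rw [cpow_def_of_ne_zero hw0, cpow_def_of_ne_zero (neg_ne_zero.mpr hw0), h1,
    add_mul, Complex.exp_add, mul_comm]
  congr 1
  rw [show (π : ℂ) * I * (1 / 2) = π / 2 * I by ring, exp_pi_div_two_mul_I]

theorem cpow_half_neg_of_im_neg (hw : w.im < 0) :
    w ^ (1 / 2 : ℂ) = -I * (-w) ^ (1 / 2 : ℂ) := by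
  have h := cpow_half_neg_of_im_pos (w := -w) (by simpa using hw)
  rw [neg_neg] at h
  rw [h, ← mul_assoc]
  simp

open scoped NumberTheorySymbols in
theorem thetaMul_flip {c : ℤ} (hc : Even c) {d D : ℕ} (hd : Odd d) (hD : Odd D)
    (h : d + D = 2 * c.natAbs) (hw : 0 < c * w.im) :
    thetaMul (-c) D * (-w) ^ (1 / 2 : ℂ) = thetaMul c d * w ^ (1 / 2 : ℂ) := by
  obtain ⟨e, rfl⟩ := hc
  rw [← two_mul] at *
  have h2 : 2 * (2 * e).natAbs = 4 * e.natAbs := by lia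
  rw [h2] at h
  unfold thetaMul
  rw [← mul_neg 2 e, jacobiSym_two_mul_even (-e) hD, jacobiSym_two_mul_even e hd]
  have hfl := jacobiSym_eq_of_four_mul_dvd_add e.natAbs hd hD (by rw [h])
  have h3 : d % 2 = 1 := Nat.odd_iff.mp hd
  have h4 : (d % 4 = 1 ∧ D % 4 = 3) ∨ (d % 4 = 3 ∧ D % 4 = 1) := by omega
  have c1 : ZMod.χ₄ ((1 : ℕ) : ZMod 4) = 1 := by decide
  have c3 : ZMod.χ₄ ((3 : ℕ) : ZMod 4) = -1 := by decide
  rcases lt_trichotomy e 0 with he | he | he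
  · have hwi : w.im < 0 := by
      have : ((2 * e : ℤ) : ℝ) < 0 := by exact_mod_cast (by omega : 2 * e < 0)
      nlinarith
    have hee : e = -(e.natAbs : ℤ) := by omega
    have e1 : J(-e | D) = J(e.natAbs | d) := by lia
    have e2 : J(e | d) = ZMod.χ₄ d * J(e.natAbs | d) := by
      rw [← jacobiSym.neg _ hd, ← hee]
    rw [e1, e2, cpow_half_neg_of_im_neg hwi, ZMod.χ₄_nat_mod_four d]
    rcases h4 with h4 | h4 <;> simp [epsFactor, h4.1, h4.2, c1, c3]
    · ring
    · linear_combination (((jacobiSym (|e|) d : ℤ) : ℂ) * (-w) ^ ((2 : ℂ)⁻¹)) * I_mul_I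
  · subst he; simp at hw
  · have hwi : 0 < w.im := by simp_all
    have hee : e = (e.natAbs : ℤ) := by omega
    have e1 : J(-e | D) = ZMod.χ₄ D * J(e.natAbs | d) := by
      rw [hfl, ← hee, jacobiSym.neg _ hD]
    have e2 : J(e | d) = J(e.natAbs | d) := by rw [← hee]
    rw [e1, e2, cpow_half_neg_of_im_pos hwi, ZMod.χ₄_nat_mod_four D]
    rcases h4 with h4 | h4 <;> simp [epsFactor, h4.1, h4.2, c1, c3]
    · ring
    · linear_combination (((jacobiSym (|e|) d : ℤ) : ℂ) * (-w) ^ ((2 : ℂ)⁻¹)) * I_mul_I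

theorem cpow_half_mul {u v : ℂ} (hu : u ≠ 0) (hv : v ≠ 0) (h1 : -π < u.arg + v.arg)
    (h2 : u.arg + v.arg ≤ π) : (u * v) ^ (1 / 2 : ℂ) = u ^ (1 / 2 : ℂ) * v ^ (1 / 2 : ℂ) := by
  rw [cpow_def_of_ne_zero (mul_ne_zero hu hv), cpow_def_of_ne_zero hu,
    cpow_def_of_ne_zero hv, Complex.log_mul hu hv ⟨h1, h2⟩, add_mul, Complex.exp_add]

theorem cpow_half_div_of_im_pos {u v : ℂ} (hu : 0 < u.im) (hv : 0 < v.im) :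
    (u / v) ^ (1 / 2 : ℂ) * v ^ (1 / 2 : ℂ) = u ^ (1 / 2 : ℂ) := by
  have hu0 : u ≠ 0 := by rintro rfl; simp at hu
  have hv0 : v ≠ 0 := by rintro rfl; simp at hv
  have au : 0 < u.arg := by
    rcases (arg_nonneg_iff.mpr hu.le).lt_or_eq with h | h
    · exact h
    · exact absurd (arg_eq_zero_iff.mp h.symm).2 hu.ne'
  have av : 0 < v.arg := by
    rcases (arg_nonneg_iff.mpr hv.le).lt_or_eq with h | h
    · exact h
    · exact absurd (arg_eq_zero_iff.mp h.symm).2 hv.ne'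
  have hup := arg_le_pi u
  have hvp := arg_le_pi v
  have key : (u / v).arg = u.arg - v.arg := by
    have := (arg_div_coe_angle hu0 hv0)
    rw [← Angle.coe_sub] at this
    have := congrArg Angle.toReal this
    rwa [Angle.toReal_coe_eq_self_iff.mpr ⟨neg_pi_lt_arg _, arg_le_pi _⟩,
      Angle.toReal_coe_eq_self_iff.mpr ⟨by linarith, by linarith⟩] at this
  rw [← cpow_half_mul (div_ne_zero hu0 hv0) hv0 (by linarith)
    (by rw [key]; linarith), div_mul_cancel₀ _ hv0]

theorem cpow_half_conj (hw : w.im ≠ 0) :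
    (starRingEnd ℂ w) ^ (1 / 2 : ℂ) = starRingEnd ℂ (w ^ (1 / 2 : ℂ)) := by
  have : w.arg ≠ π := fun h => hw (arg_eq_pi_iff.mp h).2
  have h := conj_cpow w (1 / 2) this
  simpa only [map_div₀, map_one, map_ofNat] using h

theorem cpow_half_div_of_im_neg {u v : ℂ} (hu : u.im < 0) (hv : v.im < 0) :
    (u / v) ^ (1 / 2 : ℂ) * v ^ (1 / 2 : ℂ) = u ^ (1 / 2 : ℂ) := by
  have hv0 : v ≠ 0 := by rintro rfl; simp at hv
  have h := cpow_half_div_of_im_pos (u := starRingEnd ℂ u) (v := starRingEnd ℂ v)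
    (by simpa using hu) (by simpa using hv)
  rw [← map_div₀, cpow_half_conj hv.ne, cpow_half_conj hu.ne] at h
  by_cases huv : (u / v).im = 0
  · have hr : u / v = ((u / v).re : ℂ) := Complex.ext (by simp) (by simp [huv])
    have hpos : 0 ≤ (u / v).re := by
      have : u = ((u / v).re : ℂ) * v := by grind
      have h3 : u.im = (u / v).re * v.im := by
        conv_lhs => rw [this]
        simp
      nlinarith
    have h2 : (starRingEnd ℂ (u / v)) ^ (1 / 2 : ℂ) = starRingEnd ℂ ((u / v) ^ (1 / 2 : ℂ)) := by
      have : (u / v).arg ≠ π := by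
        rw [hr, arg_ofReal_of_nonneg hpos]; exact pi_pos.ne
      have h' := conj_cpow (u / v) (1 / 2) this
      rwa [map_div₀ (starRingEnd ℂ) 1 2, map_one, map_ofNat] at h'
    rw [h2, ← map_mul] at h
    exact (starRingEnd ℂ).injective h
  · rw [cpow_half_conj huv, ← map_mul] at h
    exact (starRingEnd ℂ).injective h

theorem jacobiTheta_add_even (z : ℂ) {b : ℤ} (hb : Even b) :
    jacobiTheta (z + b) = jacobiTheta z := by
  have hp : Function.Periodic jacobiTheta 2 := fun x => by
    rw [add_comm, jacobiTheta_two_add]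
  obtain ⟨k, rfl⟩ := hb
  have := hp.int_mul k z
  rw [← this]; congr 1; push_cast; ring

theorem jacobiTheta_neg_inv {z : ℂ} (hz : 0 < z.im) :
    jacobiTheta (-1 / z) = (-I * z) ^ (1 / 2 : ℂ) * jacobiTheta z := by
  have h := jacobiTheta_S_smul ⟨z, hz⟩
  rw [UpperHalfPlane.modular_S_smul] at h
  grind

theorem neg_one_div_im_pos {z : ℂ} (hz : 0 < z.im) : 0 < (-1 / z).im := by
  have hz0 : z ≠ 0 := by rintro rfl; simp at hz
  rw [neg_div, neg_im, one_div, inv_im, neg_div, neg_neg]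
  simp_all

/-- Transformation of theta under `z ↦ z / (2 s z + 1)`. -/
theorem jacobiTheta_div {z : ℂ} (hz : 0 < z.im) (s : ℤ) :
    jacobiTheta (z / (2 * s * z + 1)) = (2 * s * z + 1) ^ (1 / 2 : ℂ) * jacobiTheta z := by
  have hz0 : z ≠ 0 := by rintro rfl; simp at hz
  set w : ℂ := -1 / z + ((-(2 * s) : ℤ) : ℂ) with hw
  have hwim : 0 < w.im := by
    have := neg_one_div_im_pos hz
    simp_all
  have hw0 : w ≠ 0 := by rintro h; simp [h] at hwim
  have h1 : z / (2 * s * z + 1) = -1 / w := by grind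
  have h2 : -I * w * (-I * z) = 2 * s * z + 1 := by
    rw [hw]; push_cast; field_simp
    simp
  have har : ∀ u : ℂ, 0 < u.im → |(-I * u).arg| < π / 2 := by simp_all
  have a1 := abs_lt.mp (har w hwim)
  have a2 := abs_lt.mp (har z hz)
  rw [h1, jacobiTheta_neg_inv hwim, hw, jacobiTheta_add_even _ ⟨-s, by ring⟩, ← hw,
    jacobiTheta_neg_inv hz, ← mul_assoc, ← cpow_half_mul (by simp [hw0]) (by simp [hz0])
      (by linarith [a1.1, a2.1]) (by linarith [a1.2, a2.2]), h2]

theorem thetaMul_zero_one : thetaMul 0 1 = 1 := by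
  simp [thetaMul, epsFactor]

theorem int_linear_ne_zero {z : ℂ} (hz : 0 < z.im) {c d : ℤ} (h : ¬ (c = 0 ∧ d = 0)) :
    (c * z + d : ℂ) ≠ 0 := by
  intro h0
  have h1 := congrArg Complex.im h0
  simp at h1
  aesop

/-- The transformation law of `θ` under `Γ(2)`, for bottom rows with `d > 0`. -/
theorem jacobiTheta_transform_pos (N : ℕ) : ∀ (a b c : ℤ) (d : ℕ) (z : ℂ), 0 < z.im →
    c.natAbs + d ≤ N → 0 < d → Even b → Even c → a * d - b * c = 1 →
    jacobiTheta ((a * z + b) / (c * z + d)) =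
      thetaMul c d * (c * z + d) ^ (1 / 2 : ℂ) * jacobiTheta z := by
  induction N with
  | zero => lia
  | succ N ih =>
    intro a b c d z hz hN hd hb hc hdet
    have hdodd : Odd d := by
      rw [← Nat.not_even_iff_odd]
      intro hde
      have h1 : Even (a * d - b * c : ℤ) :=
        ((Int.even_coe_nat d).mpr hde |>.mul_left a).sub (hc.mul_left b)
      grind
    rcases lt_trichotomy c.natAbs d with hlt | heq | hgt
    · by_cases hc0 : c = 0
      · subst hc0
        have hd1 : (d : ℤ) ∣ 1 := ⟨a, by linarith⟩
        have hd2 : d = 1 := by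
          have := Int.natAbs_dvd_natAbs.mpr hd1
          simpa using this
        subst hd2
        have ha : a = 1 := by simpa using hdet
        subst ha
        simp [thetaMul_zero_one, jacobiTheta_add_even z hb]
      · set s : ℤ := c.sign with hs
        have hsc : s * c = c.natAbs := by lia
        set z' : ℂ := z + ((2 * s : ℤ) : ℂ) with hz'
        have hzi : z'.im = z.im := by simp_all
        have hth : jacobiTheta z' = jacobiTheta z := jacobiTheta_add_even z ⟨s, by ring⟩
        have hnum : (a * z + b : ℂ) = a * z' + ((b - 2 * s * a : ℤ) : ℂ) := by grind
        have hden : (c * z + d : ℂ) = c * z' + ((d - 2 * s * c : ℤ) : ℂ) := by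
          rw [hz']; push_cast; ring
        have hb' : Even (b - 2 * s * a) := hb.sub ⟨s * a, by ring⟩
        rcases lt_or_ge (2 * c.natAbs) d with h2 | h2
        · obtain ⟨D, hD⟩ : ∃ D : ℕ, d = D + 2 * c.natAbs := ⟨d - 2 * c.natAbs, by omega⟩
          have hDz : (d - 2 * s * c : ℤ) = (D : ℕ) := by lia
          have hDo : Odd D := by grind
          rw [hnum, hden, hDz, Int.cast_natCast, ih a (b - 2 * s * a) c D z' (by rw [hzi]; exact hz)
            (by omega) (by omega) hb' hc (by grind), hth,
            thetaMul_congr hc hdodd hDo (by rw [hD]; simp)]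
        · obtain ⟨D, hD⟩ : ∃ D : ℕ, d + D = 2 * c.natAbs := ⟨2 * c.natAbs - d, by omega⟩
          have hDz : (d - 2 * s * c : ℤ) = -(D : ℕ) := by lia
          have hDo : Odd D := by grind
          have hden' : (c * z + d : ℂ) = -(((-c : ℤ) : ℂ) * z' + (D : ℂ)) := by
            rw [hden, hDz]; push_cast; ring
          have key := ih (-a) (-(b - 2 * s * a)) (-c) D z' (by rw [hzi]; exact hz)
            (by lia) hDo.pos hb'.neg hc.neg
            (by grind)
          have hfl := thetaMul_flip hc hdodd hDo hD (w := c * z + d) (by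
            have : (c * z + d : ℂ).im = c * z.im := by simp
            rw [this, ← mul_assoc]
            have : (0 : ℝ) < c * c := by
              have : (c : ℝ) ≠ 0 := by exact_mod_cast hc0
              exact mul_self_pos.mpr this
            positivity)
          grind
    · grind
    · set s : ℤ := c.sign with hs
      have hc0 : c ≠ 0 := by omega
      have hs1 : s = 1 ∧ 0 < c ∨ s = -1 ∧ c < 0 := by lia
      set v : ℂ := 2 * s * z + 1 with hv
      have hv0 : v ≠ 0 := by
        have := int_linear_ne_zero hz (c := 2 * s) (d := 1) (by omega)
        lia
      set z' : ℂ := z / v with hz'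
      have hth : jacobiTheta z' = v ^ (1 / 2 : ℂ) * jacobiTheta z := jacobiTheta_div hz s
      have hzi : 0 < z'.im := by
        have : z' = -1 / (-1 / z + ((-(2 * s) : ℤ) : ℂ)) := by
          have hz0 : z ≠ 0 := by rintro rfl; simp at hz
          grind
        rw [this]
        apply neg_one_div_im_pos
        rw [add_im, intCast_im, add_zero]
        exact neg_one_div_im_pos hz
      have hnum : (((a - 2 * s * b : ℤ) : ℂ) * z' + b) = (a * z + b) / v := by grind
      have hden : (((c - 2 * s * d : ℤ) : ℂ) * z' + d) = (c * z + d) / v := by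
        rw [hz', eq_div_iff hv0, add_mul, mul_assoc, div_mul_cancel₀ _ hv0, hv]; push_cast; ring
      have key := ih (a - 2 * s * b) b (c - 2 * s * d) d z' hzi
        (by lia) hd hb
        (hc.sub ⟨s * d, by ring⟩) (by linear_combination hdet)
      rw [hnum, hden, thetaMul_sub_two_mul, hth, div_div_div_cancel_right₀ hv0] at key
      rw [key, ← mul_assoc, mul_assoc (thetaMul c d)]
      congr 2
      have i1 : (c * z + d : ℂ).im = c * z.im := by simp
      have i2 : v.im = 2 * s * z.im := by rw [hv]; simp
      rcases hs1 with ⟨h, h'⟩ | ⟨h, h'⟩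
      · apply cpow_half_div_of_im_pos
        · simp_all
        simp_all
      · apply cpow_half_div_of_im_neg
        · rw [i1]; have : (c : ℝ) < 0 := by exact_mod_cast h'
          nlinarith
        · rw [i2, h]; push_cast; linarith

theorem coe_smul_eq_div (g : SL(2, ℤ)) (z : ℍ) :
    ((g • z : ℍ) : ℂ) = ((g 0 0 : ℤ) * (z : ℂ) + (g 0 1 : ℤ)) / ((g 1 0 : ℤ) * (z : ℂ) + (g 1 1 : ℤ)) := by
  rw [UpperHalfPlane.coe_specialLinearGroup_apply]
  simp

/-- The automorphy denominator `cz + d`. -/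
def lowj (g : SL(2, ℤ)) (z : ℍ) : ℂ := (g 1 0 : ℤ) * (z : ℂ) + (g 1 1 : ℤ)

theorem lowj_eq_denom (g : SL(2, ℤ)) (z : ℍ) : lowj g z = denom (g : GL (Fin 2) ℝ) z := by norm_cast

theorem lowj_ne_zero (g : SL(2, ℤ)) (z : ℍ) : lowj g z ≠ 0 := by
  rw [lowj_eq_denom]; exact denom_ne_zero _ _

theorem im_smul_lowj (g : SL(2, ℤ)) (z : ℍ) : (g • z).im = z.im / ‖lowj g z‖ ^ 2 := by
  rw [ModularGroup.im_smul_eq_div_normSq, lowj_eq_denom, normSq_eq_norm_sq]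

theorem det_entries (g : SL(2, ℤ)) : g 0 0 * g 1 1 - g 0 1 * g 1 0 = 1 := by
  have := g.det_coe; rwa [Matrix.det_fin_two] at this

theorem gamma_two_even {g : SL(2, ℤ)} (hg : g ∈ Γ₂) :
    Odd (g 0 0) ∧ Even (g 0 1) ∧ Even (g 1 0) ∧ Odd (g 1 1) := by
  rw [CongruenceSubgroup.Gamma_mem] at hg
  obtain ⟨h1, h2, h3, h4⟩ := hg
  refine ⟨?_, ?_, ?_, ?_⟩
  · rw [← ZMod.intCast_eq_one_iff_odd]; exact h1
  · rw [← ZMod.intCast_eq_zero_iff_even]; exact h2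
  · rw [← ZMod.intCast_eq_zero_iff_even]; exact h3
  · rw [← ZMod.intCast_eq_one_iff_odd]; exact h4

theorem norm_thetaMul {c : ℤ} {d : ℕ} (hd : Odd d) (h : Int.gcd c d = 1) : ‖thetaMul c d‖ = 1 := by
  have h2 : Int.gcd (2 * c) d = 1 := by
    have : Coprime 2 d := hd.coprime_two_left
    rw [Int.gcd_eq_natAbs] at h ⊢
    rw [Int.natAbs_mul]
    exact Coprime.mul_left this h
  have h3 : ‖epsFactor d‖ = 1 := by unfold epsFactor; split_ifs <;> simp
  rw [thetaMul, norm_mul, norm_inv, h3]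
  rcases jacobiSym.eq_one_or_neg_one h2 with h | h <;> simp [h]

theorem norm_jacobiTheta_smul {g : SL(2, ℤ)} (hg : g ∈ Γ₂) (z : ℍ) :
    ‖jacobiTheta (g • z : ℍ)‖ = ‖lowj g z‖ ^ (1 / 2 : ℝ) * ‖jacobiTheta z‖ := by
  wlog hd : 0 < g 1 1 generalizing g
  · have hodd := (gamma_two_even hg).2.2.2
    have hn : (-g) ∈ Γ₂ := by simp_all
    have := this hn (by
      simp only [Matrix.SpecialLinearGroup.coe_neg, Matrix.neg_apply]
      grind)
    rw [SL_neg_smul] at this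
    rw [this]
    congr 2
    simp only [lowj, Matrix.SpecialLinearGroup.coe_neg, Matrix.neg_apply, Int.cast_neg]
    rw [← norm_neg]; congr 1; ring
  · obtain ⟨h1, h2, h3, h4⟩ := gamma_two_even hg
    obtain ⟨d, hd'⟩ := Int.eq_ofNat_of_zero_le hd.le
    have hdet := det_entries g
    rw [coe_smul_eq_div, hd']
    have := jacobiTheta_transform_pos _ (g 0 0) (g 0 1) (g 1 0) d z z.im_pos le_rfl (by omega) h2 h3
      (by lia)
    rw [show ((d : ℤ) : ℂ) = (d : ℂ) by norm_cast, this, norm_mul, norm_mul, norm_thetaMul, one_mul]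
    · congr 1
      rw [show (1 / 2 : ℂ) = ((1 / 2 : ℝ) : ℂ) by norm_num, norm_cpow_real, lowj, hd']
      norm_cast
    · grind
    · rw [← hd', ← Int.isCoprime_iff_gcd_eq_one]
      exact ⟨-g 0 1, g 0 0, by linarith⟩

/-- The weight `|θ|⁶ y^{3/2}`. -/
def thetaWt (z : ℍ) : ℝ := ‖jacobiTheta z‖ ^ 6 * z.im ^ (3 / 2 : ℝ)

theorem thetaWt_smul {g : SL(2, ℤ)} (hg : g ∈ Γ₂) (z : ℍ) :
    thetaWt (g • z) = thetaWt z := by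
  have h0 : 0 < ‖lowj g z‖ := norm_pos_iff.mpr (lowj_ne_zero g z)
  rw [thetaWt, thetaWt, norm_jacobiTheta_smul hg, im_smul_lowj, mul_pow,
    div_rpow z.im_pos.le (by positivity), ← rpow_natCast, ← rpow_mul h0.le,
    ← rpow_natCast (‖lowj g z‖) 2, ← rpow_mul h0.le]
  field_simp; ring

/-- `θ₂(z) = Σ e^{πi(n+1/2)²z}`. -/
def thetaTwo (z : ℂ) : ℂ := cexp (π * I * z / 4) * jacobiTheta₂ (z / 2) z

theorem jacobiTheta_one_add (w : ℂ) : jacobiTheta (1 + w) = jacobiTheta₂ (1 / 2) w := by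
  rw [jacobiTheta, jacobiTheta₂]
  refine tsum_congr fun n => ?_
  rw [jacobiTheta₂_term]
  have : cexp (π * I * (n : ℂ) ^ 2 * (1 + w)) =
      cexp (2 * π * I * n * (1 / 2) + π * I * (n : ℂ) ^ 2 * w) := by
    rw [exp_eq_exp_iff_exists_int]
    obtain ⟨k, hk⟩ : Even ((n : ℤ) * (n - 1)) := Int.even_mul_pred_self n
    refine ⟨k, ?_⟩
    have : (n : ℂ) * (n - 1) = k + k := by exact_mod_cast hk
    grind
  exact this

theorem jacobiTheta_one_sub_inv {z : ℂ} (hz : 0 < z.im) :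
    jacobiTheta (1 + -1 / z) = (-I * z) ^ (1 / 2 : ℂ) * thetaTwo z := by
  have hz0 : z ≠ 0 := by rintro rfl; simp at hz
  have h := jacobiTheta₂_functional_equation (z / 2) z
  rw [jacobiTheta_one_add, thetaTwo, h, show z / 2 / z = 1 / 2 by field_simp,
    show -π * I * (z / 2) ^ 2 / z = -(π * I * z / 4) by field_simp; ring, Complex.exp_neg]
  field_simp

theorem thetaTwo_add_two (z : ℂ) : thetaTwo (z + 2) = I * thetaTwo z := by
  rw [thetaTwo, thetaTwo, show (z + 2) / 2 = z / 2 + 1 by ring, jacobiTheta₂_add_left,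
    jacobiTheta₂_add_right, ← mul_assoc]
  congr 1
  rw [show π * I * (z + 2) / 4 = (π / 2 : ℂ) * I + π * I * z / 4 by ring, Complex.exp_add]
  simp

theorem differentiableAt_thetaTwo {z : ℂ} (hz : 0 < z.im) : DifferentiableAt ℂ thetaTwo z := by
  have h := (hasFDerivAt_jacobiTheta₂ (z / 2) hz).differentiableAt
  have h2 : DifferentiableAt ℂ (fun w : ℂ => (w / 2, w)) z := by fun_prop
  have h3 : DifferentiableAt ℂ (fun w : ℂ => jacobiTheta₂ (w / 2) w) z :=
    DifferentiableAt.comp (𝕜 := ℂ) z (f := fun w : ℂ => (w / 2, w))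
      (g := fun p : ℂ × ℂ => jacobiTheta₂ p.1 p.2) h h2
  have h4 : DifferentiableAt ℂ (fun w : ℂ => cexp (π * I * w / 4)) z := by fun_prop
  exact h4.mul h3

theorem exp_neg_pi_mul_lt (hy : 3 ≤ 4 * y ^ 2) (hy0 : 0 < y) :
    Real.exp (-π * y) < 1 / 4 := by
  have h1 : (0.86 : ℝ) ≤ y := by nlinarith
  have h2 := pi_gt_three
  have h3 : (2 : ℝ) ≤ π * y := by nlinarith
  have h4 : Real.exp (-π * y) ≤ Real.exp (-2) := exp_le_exp.mpr (by linarith)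
  have h5 : (4 : ℝ) < Real.exp 2 := by
    have := exp_one_gt_d9
    rw [show (2 : ℝ) = 1 + 1 by norm_num, Real.exp_add]
    nlinarith
  rw [Real.exp_neg] at h4
  have : (Real.exp 2)⁻¹ < 1 / 4 := by
    rw [inv_lt_comm₀ (by positivity) (by norm_num)]; simpa using h5
  linarith

theorem jacobiTheta_ne_zero_of_im {z : ℂ} (hz : 0 < z.im) (h : 3 ≤ 4 * z.im ^ 2) :
    jacobiTheta z ≠ 0 := by
  intro h0
  have h1 := norm_jacobiTheta_sub_one_le hz
  rw [h0] at h1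
  have h2 := exp_neg_pi_mul_lt h hz
  have h3 : 0 < 1 - Real.exp (-π * z.im) := by linarith
  rw [div_mul_eq_mul_div, le_div_iff₀ h3] at h1
  simp at h1
  simp at h2
  linarith

theorem thetaTwo_ne_zero_of_im {z : ℂ} (hz : 0 < z.im) (h : 3 ≤ 4 * z.im ^ 2) :
    thetaTwo z ≠ 0 := by
  have hq := exp_neg_pi_mul_lt h hz
  set q := Real.exp (-π * z.im) with hqd
  have hq0 : 0 < q := exp_pos _
  have hs := hasSum_jacobiTheta₂_term (z / 2) hz
  have hpair := hs.nat_add_neg_add_one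
  have hterm : ∀ n : ℤ, jacobiTheta₂_term n (z / 2) z = cexp (π * I * ((n : ℂ) * (n + 1)) * z) := by
    intro n; rw [jacobiTheta₂_term]; congr 1; ring
  have hf : (fun n : ℕ => jacobiTheta₂_term (n : ℤ) (z / 2) z +
      jacobiTheta₂_term (-((n : ℤ) + 1)) (z / 2) z) =
      fun n : ℕ => 2 * cexp (π * I * ((n : ℂ) * (n + 1)) * z) := by
    funext n
    rw [hterm, hterm, two_mul]
    simp; ring
  rw [hf] at hpair
  have hsucc := (hasSum_nat_add_iff' 1).mpr hpair
  simp only [Finset.sum_range_one] at hsucc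
  have hb : ∀ n : ℕ, ‖2 * cexp (π * I * (((n + 1 : ℕ) : ℂ) * ((n + 1 : ℕ) + 1)) * z)‖ ≤ 2 * q * q ^ n := by
    intro n
    rw [norm_mul, norm_exp]
    simp only [RCLike.norm_ofNat]
    rw [mul_assoc 2 q]
    refine mul_le_mul_of_nonneg_left ?_ (zero_le_two (α := ℝ))
    rw [← pow_succ', hqd, ← Real.exp_nat_mul]
    refine exp_le_exp.mpr ?_
    have : (π * I * (((n + 1 : ℕ) : ℂ) * ((n + 1 : ℕ) + 1)) * z).re =
        -(π * (((n : ℝ) + 1) * ((n + 1) + 1)) * z.im) := by simp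
    rw [this]
    push_cast
    have h1 : 0 < π * z.im := mul_pos pi_pos hz
    have h2 : (0 : ℝ) ≤ n := n.cast_nonneg
    nlinarith [mul_nonneg h1.le h2, mul_nonneg (mul_nonneg h1.le h2) h2]
  have hgeo : Summable fun n : ℕ => 2 * q * q ^ n :=
    (summable_geometric_of_lt_one hq0.le (by linarith)).mul_left _
  have hle := hsucc.norm_le_of_bounded hgeo.hasSum hb
  rw [tsum_mul_left, tsum_geometric_of_lt_one hq0.le (by linarith)] at hle
  intro h0
  have h00 : jacobiTheta₂ (z / 2) z = 0 := by
    rw [thetaTwo, mul_eq_zero] at h0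
    simp_all
  rw [h00] at hle
  simp at hle
  have h3 : 0 < 1 - q := by linarith
  rw [← div_eq_mul_inv, le_div_iff₀ h3] at hle
  linarith

/-- Representatives of the three cusps of `Γ(2)`. -/
def cuspRep : Fin 3 → SL(2, ℤ) := ![1, S, T * S]

theorem exists_gamma_two_mul_cuspRep (g : SL(2, ℤ)) :
    ∃ γ ∈ Γ₂, ∃ j : Fin 3, ∃ i : ℕ, g = γ * cuspRep j * T ^ i := by
  have key : ∃ j : Fin 3, ∃ i : ℕ, g * (cuspRep j * T ^ i)⁻¹ ∈ Γ₂ := by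
    have hdet := det_entries g
    have hdet2 : ((g 0 0 : ℤ) : ZMod 2) * ((g 1 1 : ℤ) : ZMod 2) -
        ((g 0 1 : ℤ) : ZMod 2) * ((g 1 0 : ℤ) : ZMod 2) = 1 := by exact_mod_cast congrArg (Int.cast (R := ZMod 2)) hdet
    have hfin : ∀ a b c d : ZMod 2, a * d - b * c = 1 →
      (a = 1 ∧ b = 0 ∧ c = 0 ∧ d = 1) ∨ (a = 1 ∧ b = 1 ∧ c = 0 ∧ d = 1) ∨
      (a = 0 ∧ b = 1 ∧ c = 1 ∧ d = 0) ∨ (a = 0 ∧ b = 1 ∧ c = 1 ∧ d = 1) ∨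
      (a = 1 ∧ b = 1 ∧ c = 1 ∧ d = 0) ∨ (a = 1 ∧ b = 0 ∧ c = 1 ∧ d = 1) := by decide
    have neg1 : (-1 : ZMod 2) = 1 := by decide
    have add1 : (1 + 1 : ZMod 2) = 0 := by decide
    rcases hfin _ _ _ _ hdet2 with ⟨ha, hb, hc, hd⟩ | ⟨ha, hb, hc, hd⟩ | ⟨ha, hb, hc, hd⟩ |
      ⟨ha, hb, hc, hd⟩ | ⟨ha, hb, hc, hd⟩ | ⟨ha, hb, hc, hd⟩ <;>
    [refine ⟨0, 0, ?_⟩; refine ⟨0, 1, ?_⟩; refine ⟨1, 0, ?_⟩; refine ⟨1, 1, ?_⟩;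
      refine ⟨2, 0, ?_⟩; refine ⟨2, 1, ?_⟩] <;>
    rw [CongruenceSubgroup.Gamma_mem] <;>
    simp [cuspRep, Matrix.mul_apply, Matrix.SpecialLinearGroup.coe_inv, Matrix.adjugate_fin_two,
      Matrix.SpecialLinearGroup.coe_mul, coe_S, coe_T, ha, hb, hc, hd, neg1, add1]
  obtain ⟨j, i, h⟩ := key
  exact ⟨_, h, j, i, by group⟩

/-- The theta functions attached to the three cusps. -/
def cuspTheta : Fin 3 → ℂ → ℂ := ![jacobiTheta, jacobiTheta, thetaTwo]

theorem differentiableAt_cuspTheta (j : Fin 3) {z : ℂ} (hz : 0 < z.im) :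
    DifferentiableAt ℂ (cuspTheta j) z := by
  fin_cases j
  · exact differentiableAt_jacobiTheta hz
  · exact differentiableAt_jacobiTheta hz
  · exact differentiableAt_thetaTwo hz

theorem cuspTheta_ne_zero_of_im (j : Fin 3) {z : ℂ} (hz : 0 < z.im) (h : 3 ≤ 4 * z.im ^ 2) :
    cuspTheta j z ≠ 0 := by
  fin_cases j
  · exact jacobiTheta_ne_zero_of_im hz h
  · exact jacobiTheta_ne_zero_of_im hz h
  · exact thetaTwo_ne_zero_of_im hz h

theorem norm_jacobiTheta_cuspRep_smul (j : Fin 3) (z : ℍ) :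
    ‖jacobiTheta (cuspRep j • z : ℍ)‖ = ‖lowj (cuspRep j) z‖ ^ (1 / 2 : ℝ) * ‖cuspTheta j z‖ := by
  have hS : ((S • z : ℍ) : ℂ) = -1 / z := by
    rw [coe_smul_eq_div]; simp [S]
  have hn : ‖(-I * z : ℂ) ^ (1 / 2 : ℂ)‖ = ‖(z : ℂ)‖ ^ (1 / 2 : ℝ) := by
    rw [show (1 / 2 : ℂ) = ((1 / 2 : ℝ) : ℂ) by norm_num, norm_cpow_real]
    simp
  fin_cases j
  · simp [cuspRep, cuspTheta, lowj]
  · have : lowj S z = z := by simp [lowj, S]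
    simp only [cuspRep, cuspTheta, Fin.mk_one, Matrix.cons_val_one, Matrix.cons_val_zero, this]
    rw [hS, jacobiTheta_neg_inv z.im_pos, norm_mul, hn]
  · have : lowj (T * S) z = z := by simp [lowj, coe_S, coe_T, Matrix.SpecialLinearGroup.coe_mul, Matrix.mul_apply]
    simp only [cuspRep, cuspTheta, Fin.reduceFinMk, Matrix.cons_val, this]
    rw [show ((((T * S) • z : ℍ)) : ℂ) = 1 + -1 / z by
      rw [mul_smul, modular_T_smul, UpperHalfPlane.coe_vadd, hS]; simp,
      jacobiTheta_one_sub_inv z.im_pos, norm_mul, hn]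

theorem thetaWt_cuspRep_smul (j : Fin 3) (z : ℍ) :
    thetaWt (cuspRep j • z) = ‖cuspTheta j z‖ ^ 6 * z.im ^ (3 / 2 : ℝ) := by
  have h0 : 0 < ‖lowj (cuspRep j) z‖ := norm_pos_iff.mpr (lowj_ne_zero _ z)
  rw [thetaWt, norm_jacobiTheta_cuspRep_smul, im_smul_lowj, mul_pow,
    div_rpow z.im_pos.le (by positivity), ← rpow_natCast, ← rpow_mul h0.le,
    ← rpow_natCast (‖lowj (cuspRep j) z‖) 2, ← rpow_mul h0.le]
  field_simp; ring

/-- `θ` has no zeros in the upper half-plane. -/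
theorem jacobiTheta_ne_zero (z : ℍ) : jacobiTheta z ≠ 0 := by
  obtain ⟨g, hg⟩ := exists_smul_mem_fd z
  obtain ⟨γ, hγ, j, i, h⟩ := exists_gamma_two_mul_cuspRep g⁻¹
  have him := three_le_four_mul_im_sq_of_mem_fd hg
  have hz : z = γ • cuspRep j • T ^ i • g • z := by
    rw [← mul_smul, ← mul_smul, ← h, inv_smul_smul]
  have h1 : cuspTheta j (T ^ i • g • z : ℍ) ≠ 0 := by
    have e : (T ^ i • g • z : ℍ).im = (g • z).im := by
      have := im_T_zpow_smul (g • z) i; simpa using this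
    apply cuspTheta_ne_zero_of_im j (UpperHalfPlane.im_pos _)
    rw [UpperHalfPlane.coe_im, e]; exact him
  rw [hz, ← norm_ne_zero_iff, norm_jacobiTheta_smul hγ, norm_jacobiTheta_cuspRep_smul]
  have h2 : ∀ (g : SL(2, ℤ)) (w : ℍ), ‖lowj g w‖ ^ (1 / 2 : ℝ) ≠ 0 := fun g w =>
    (rpow_pos_of_pos (norm_pos_iff.mpr (lowj_ne_zero g w)) _).ne'
  exact mul_ne_zero (h2 _ _) (mul_ne_zero (h2 _ _) (norm_ne_zero_iff.mpr h1))

/-- Right multiplication of a row by a matrix. -/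
def rowMul (p : ℤ × ℤ) (g : SL(2, ℤ)) : ℤ × ℤ :=
  (p.1 * g 0 0 + p.2 * g 1 0, p.1 * g 0 1 + p.2 * g 1 1)

theorem rowMul_mul (p : ℤ × ℤ) (g h : SL(2, ℤ)) : rowMul p (g * h) = rowMul (rowMul p g) h := by
  ext <;> simp only [rowMul, Matrix.SpecialLinearGroup.coe_mul, Matrix.mul_apply, Fin.sum_univ_two] <;> ring

theorem rowMul_one (p : ℤ × ℤ) : rowMul p 1 = p := by
  ext <;> simp [rowMul]

/-- Right multiplication of rows as a permutation. -/
def rowMulEquiv (g : SL(2, ℤ)) : ℤ × ℤ ≃ ℤ × ℤ where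
  toFun p := rowMul p g
  invFun p := rowMul p g⁻¹
  left_inv p := by change rowMul (rowMul p g) g⁻¹ = p; rw [← rowMul_mul, mul_inv_cancel, rowMul_one]
  right_inv p := by change rowMul (rowMul p g⁻¹) g = p; rw [← rowMul_mul, inv_mul_cancel, rowMul_one]

theorem isCoprime_rowMul {p : ℤ × ℤ} (hp : IsCoprime p.1 p.2) (g : SL(2, ℤ)) :
    IsCoprime (rowMul p g).1 (rowMul p g).2 := by
  obtain ⟨a, b, h⟩ := hp
  have hd := det_entries g
  refine ⟨a * g 1 1 - b * g 0 1, -a * g 1 0 + b * g 0 0, ?_⟩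
  simp only [rowMul]
  grind

/-- The linear form `cz + d`. -/
def rowj (p : ℤ × ℤ) (z : ℍ) : ℂ := (p.1 : ℂ) * z + p.2

theorem rowj_smul (p : ℤ × ℤ) (g : SL(2, ℤ)) (z : ℍ) :
    rowj p (g • z) * lowj g z = rowj (rowMul p g) z := by
  have h2 : lowj g z ≠ 0 := lowj_ne_zero g z
  rw [rowj, coe_smul_eq_div]
  unfold lowj at h2 ⊢
  rw [add_mul, ← mul_div_assoc, div_mul_cancel₀ _ h2]
  simp only [rowj, rowMul]
  push_cast
  ring

/-- Coprime rows `(c,d)` with `Im z / |cz+d|² ≥ Y`. -/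
def cuspSet (Y : ℝ) (z : ℍ) : Set (ℤ × ℤ) :=
  {p | IsCoprime p.1 p.2 ∧ Y * ‖rowj p z‖ ^ 2 ≤ z.im}

theorem mem_cuspSet_smul {z : ℍ} {p : ℤ × ℤ} (g : SL(2, ℤ)) :
    p ∈ cuspSet Y (g • z) ↔ rowMulEquiv g p ∈ cuspSet Y z := by
  have h2 : 0 < ‖lowj g z‖ := norm_pos_iff.mpr (lowj_ne_zero g z)
  have h3 : IsCoprime p.1 p.2 ↔ IsCoprime (rowMul p g).1 (rowMul p g).2 := by
    refine ⟨fun h => isCoprime_rowMul h g, fun h => ?_⟩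
    have := isCoprime_rowMul h g⁻¹
    rwa [← rowMul_mul, mul_inv_cancel, rowMul_one] at this
  have h4 : ‖rowj (rowMul p g) z‖ = ‖rowj p (g • z)‖ * ‖lowj g z‖ := by
    rw [← rowj_smul, norm_mul]
  simp only [cuspSet, Set.mem_ofPred_eq, rowMulEquiv, Equiv.coe_fn_mk, ← h3, h4, im_smul_lowj]
  field_simp

theorem cuspSet_smul (Y : ℝ) (z : ℍ) (g : SL(2, ℤ)) :
    rowMulEquiv g '' cuspSet Y (g • z) = cuspSet Y z := by
  ext p
  constructor
  · rintro ⟨q, hq, rfl⟩; exact (mem_cuspSet_smul g).mp hq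
  · intro hp
    exact ⟨(rowMulEquiv g).symm p, (mem_cuspSet_smul g).mpr (by simpa using hp), by simp⟩

theorem norm_rowj_sq (p : ℤ × ℤ) (z : ℍ) :
    ‖rowj p z‖ ^ 2 = (p.1 * z.re + p.2) ^ 2 + (p.1 * z.im) ^ 2 := by
  rw [← normSq_eq_norm_sq, normSq_apply]
  simp [rowj]; ring

theorem fd_facts {w : ℍ} (hw : w ∈ ModularGroup.fd) :
    |w.re| ≤ 1 / 2 ∧ 3 ≤ 4 * w.im ^ 2 ∧ 0.86 < w.im := by
  have h1 := three_le_four_mul_im_sq_of_mem_fd hw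
  exact ⟨hw.2, h1, by nlinarith [w.im_pos]⟩

theorem abs_le_sq_int (c : ℤ) : |(c : ℝ)| ≤ (c : ℝ) ^ 2 := by
  have : |c| ≤ c ^ 2 := by
    rcases eq_or_ne c 0 with rfl | h
    · simp
    · have := Int.one_le_abs h
      nlinarith [sq_abs c]
  exact_mod_cast this

theorem cuspSet_subset_box (hY : 0 < Y) {w : ℍ} (hw : w ∈ ModularGroup.fd) :
    cuspSet Y w ⊆ ↑(Finset.Icc (-((⌊2 / Y⌋₊ + 1 : ℕ) : ℤ)) (⌊2 / Y⌋₊ + 1 : ℕ) ×ˢ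
      Finset.Icc (-((⌊2 / Y⌋₊ + 1 : ℕ) : ℤ)) (⌊2 / Y⌋₊ + 1 : ℕ)) := by
  rintro ⟨c, d⟩ ⟨hcop, hle⟩
  obtain ⟨hx, h34, hy⟩ := fd_facts hw
  rw [norm_rowj_sq] at hle
  simp only at hcop hle
  set N : ℕ := ⌊2 / Y⌋₊ + 1 with hN
  have hNr : 2 / Y ≤ N := by rw [hN]; push_cast; exact (Nat.lt_floor_add_one _).le
  have main : |(c : ℝ)| ≤ N ∧ |(d : ℝ)| ≤ N := by
    rcases eq_or_ne c 0 with rfl | hc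
    · rw [isCoprime_zero_left, Int.isUnit_iff] at hcop
      refine ⟨by simp, ?_⟩
      aesop
    · have hc1 : (1 : ℝ) ≤ (c : ℝ) ^ 2 := by
        have : 1 ≤ c ^ 2 := by have := Int.one_le_abs hc; nlinarith [sq_abs c]
        exact_mod_cast this
      have h1 : Y * ((c : ℝ) ^ 2 * w.im) ≤ 1 := by nlinarith
      have hc2 : (c : ℝ) ^ 2 * Y ≤ 2 := by nlinarith
      have hc3 : |(c : ℝ)| ≤ 2 / Y := (abs_le_sq_int c).trans (by rwa [le_div_iff₀ hY])
      refine ⟨hc3.trans hNr, ?_⟩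
      have hyY : w.im * Y ≤ 1 := by nlinarith
      have h2 : (c * w.re + d) ^ 2 ≤ (1 / Y) ^ 2 := by
        rw [div_pow, one_pow, le_div_iff₀ (by positivity)]
        nlinarith
      have h3 : |c * w.re + d| ≤ 1 / Y := abs_le_of_sq_le_sq h2 (by positivity)
      have h4 : |(d : ℝ)| ≤ |c * w.re + d| + |(c : ℝ)| * |w.re| := by
        rw [← abs_mul]
        have := abs_sub (c * w.re + d) (c * w.re)
        simpa using this
      have h5 : |(c : ℝ)| * |w.re| ≤ (2 / Y) * (1 / 2) := by gcongr
      grind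
  simp only [Finset.coe_product, Set.mem_prod, Finset.coe_Icc, Set.mem_Icc]
  have e1 : |c| ≤ (N : ℤ) := by exact_mod_cast main.1
  have e2 : |d| ≤ (N : ℤ) := by exact_mod_cast main.2
  exact ⟨abs_le.mp e1, abs_le.mp e2⟩

theorem cuspSet_finite (hY : 0 < Y) (z : ℍ) : (cuspSet Y z).Finite := by
  obtain ⟨g, hg⟩ := exists_smul_mem_fd z
  rw [← cuspSet_smul Y z g]
  exact ((Finset.finite_toSet _).subset (cuspSet_subset_box hY hg)).image _

theorem cuspSet_ncard_le (hY : 0 < Y) (z : ℍ) :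
    ((cuspSet Y z).ncard : ℝ) ≤ (4 / Y + 3) ^ 2 := by
  obtain ⟨g, hg⟩ := exists_smul_mem_fd z
  rw [← cuspSet_smul Y z g, Set.ncard_image_of_injective _ (rowMulEquiv g).injective]
  have h := Set.ncard_le_ncard (cuspSet_subset_box hY hg) (Finset.finite_toSet _)
  rw [Set.ncard_coe_finset, Finset.card_product, Int.card_Icc] at h
  have hfl : (⌊2 / Y⌋₊ : ℝ) ≤ 2 / Y := Nat.floor_le (by positivity)
  have h2 : ((((⌊2 / Y⌋₊ + 1 : ℕ) : ℤ) + 1 - -((⌊2 / Y⌋₊ + 1 : ℕ) : ℤ)).toNat : ℝ) =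
      2 * ⌊2 / Y⌋₊ + 3 := by
    have : (((⌊2 / Y⌋₊ + 1 : ℕ) : ℤ) + 1 - -((⌊2 / Y⌋₊ + 1 : ℕ) : ℤ)).toNat = 2 * ⌊2 / Y⌋₊ + 3 := by omega
    norm_cast
  have h3 := (Nat.cast_le (α := ℝ)).mpr h
  rw [Nat.cast_mul, h2] at h3
  refine h3.trans ?_
  have h4 : 2 * (⌊2 / Y⌋₊ : ℝ) + 3 ≤ 4 / Y + 3 := by grind
  nlinarith

theorem cuspSet_ncard_le_six (hY : 1 / 2 < Y) (z : ℍ) : (cuspSet Y z).ncard ≤ 6 := by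
  obtain ⟨g, hg⟩ := exists_smul_mem_fd z
  rw [← cuspSet_smul Y z g, Set.ncard_image_of_injective _ (rowMulEquiv g).injective]
  set w := g • z
  obtain ⟨hx, h34, hy⟩ := fd_facts hg
  have hx' := abs_le.mp hx
  let s : ℤ := if 0 ≤ w.re then -1 else 1
  have hsub : cuspSet Y w ⊆ (({(0, 1), (0, -1), (1, 0), (-1, 0), (1, s), (-1, -s)} : Finset (ℤ × ℤ)) : Set (ℤ × ℤ)) := by
    rintro ⟨c, d⟩ ⟨hcop, hle⟩
    rw [norm_rowj_sq] at hle
    simp only at hcop hle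
    have hlt : (c * w.re + d) ^ 2 + (c * w.im) ^ 2 < 2 * w.im ∨ (c = 0 ∧ d = 0) := by
      by_cases h0 : (c * w.re + d) ^ 2 + (c * w.im) ^ 2 = 0
      · grind
      · left
        nlinarith
    rcases hlt with hlt | ⟨rfl, rfl⟩
    swap
    · norm_cast
    have hc : (c : ℝ) ^ 2 < 4 := by nlinarith
    have hc' : c ^ 2 < 4 := by exact_mod_cast hc
    have hc1 : -2 < c := by nlinarith
    have hc2 : c < 2 := by nlinarith
    have hone : (c : ℝ) ^ 2 = 1 → (c * w.re + d) ^ 2 < 1 := by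
      intro h
      have : (c * w.im) ^ 2 = w.im ^ 2 := by grind
      nlinarith [sq_nonneg (w.im - 1)]
    have hd0 : c ≠ 0 → (c = 1 ∧ (d = 0 ∨ d = s)) ∨ (c = -1 ∧ (d = 0 ∨ d = -s)) := by
      intro hc0
      have hcc : c = 1 ∨ c = -1 := by omega
      rcases hcc with rfl | rfl
      · left
        have h := hone (by simp)
        simp only [Int.cast_one, one_mul] at h
        obtain ⟨h1, h2⟩ := abs_lt.mp ((sq_lt_one_iff_abs_lt_one _).mp h)
        refine ⟨rfl, ?_⟩
        have hd1 : -2 < (d : ℝ) := by linarith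
        have hd2 : (d : ℝ) < 2 := by linarith
        have hd1' : -2 < d := by exact_mod_cast hd1
        have hd2' : d < 2 := by exact_mod_cast hd2
        simp only [s]
        split_ifs with hre
        · have : (d : ℝ) < 1 := by linarith
          have : d < 1 := by exact_mod_cast this
          omega
        · have : -1 < (d : ℝ) := by linarith
          have : -1 < d := by exact_mod_cast this
          omega
      · right
        have h := hone (by simp)
        obtain ⟨h1, h2⟩ := abs_lt.mp ((sq_lt_one_iff_abs_lt_one _).mp h)
        push_cast at h1 h2
        refine ⟨rfl, ?_⟩
        have hd1 : -2 < (d : ℝ) := by linarith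
        have hd2 : (d : ℝ) < 2 := by linarith
        have hd1' : -2 < d := by exact_mod_cast hd1
        have hd2' : d < 2 := by exact_mod_cast hd2
        simp only [s]
        split_ifs with hre
        · have : -1 < (d : ℝ) := by linarith
          have : -1 < d := by exact_mod_cast this
          omega
        · have : (d : ℝ) < 1 := by linarith
          have : d < 1 := by exact_mod_cast this
          omega
    simp only [Finset.coe_insert, Finset.coe_singleton, Set.mem_insert_iff, Set.mem_singleton_iff,
      Prod.mk.injEq]
    rcases eq_or_ne c 0 with rfl | hc0
    · rw [isCoprime_zero_left, Int.isUnit_iff] at hcop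
      omega
    · have := hd0 hc0; omega
  have h := Set.ncard_le_ncard hsub (Finset.finite_toSet _)
  rw [Set.ncard_coe_finset] at h
  exact h.trans Finset.card_le_six

theorem two_le_cuspSet_ncard (hY0 : 0 < Y) (hY : 4 * Y ^ 2 ≤ 3) (z : ℍ) :
    2 ≤ (cuspSet Y z).ncard := by
  obtain ⟨g, hg⟩ := exists_smul_mem_fd z
  have hfin := cuspSet_finite hY0 (g • z)
  rw [← cuspSet_smul Y z g, Set.ncard_image_of_injective _ (rowMulEquiv g).injective]
  obtain ⟨hx, h34, hy⟩ := fd_facts hg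
  have hYy : Y ≤ (g • z).im := by nlinarith
  have hsub : (({(0, 1), (0, -1)} : Finset (ℤ × ℤ)) : Set (ℤ × ℤ)) ⊆ cuspSet Y (g • z) := by
    intro p hp
    simp only [Finset.coe_insert, Finset.coe_singleton, Set.mem_insert_iff, Set.mem_singleton_iff] at hp
    rcases hp with rfl | rfl
    · exact ⟨isCoprime_zero_left.mpr isUnit_one, by rw [norm_rowj_sq]; simpa using hYy⟩
    · refine ⟨?_, by rw [norm_rowj_sq]; simpa using hYy⟩
      norm_num
  have h := Set.ncard_le_ncard hsub hfin
  simp_all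

instance countable_SL2Z : Countable SL(2, ℤ) :=
  @Subtype.countable (Fin 2 → Fin 2 → ℤ) _ _

theorem measurePreserving_SL_smul (g : SL(2, ℤ)) :
    MeasurePreserving (fun z : ℍ => g • z) volume volume :=
  measurePreserving_smul (g : GL (Fin 2) ℝ) (volume : Measure ℍ)

theorem continuous_SL_smul (g : SL(2, ℤ)) : Continuous (fun z : ℍ => g • z) :=
  continuous_const_smul (g : GL (Fin 2) ℝ)

/-- The half strip `0 ≤ Re z < 1`, `Im z ≥ Y`. -/
def halfStrip (Y : ℝ) : Set ℍ := {z | 0 ≤ z.re ∧ z.re < 1 ∧ Y ≤ z.im}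

theorem measurableSet_halfStrip (Y : ℝ) : MeasurableSet (halfStrip Y) := by
  have h1 : MeasurableSet {z : ℍ | 0 ≤ z.re} :=
    measurableSet_le measurable_const UpperHalfPlane.continuous_re.measurable
  have h2 : MeasurableSet {z : ℍ | z.re < 1} :=
    measurableSet_lt UpperHalfPlane.continuous_re.measurable measurable_const
  have h3 : MeasurableSet {z : ℍ | Y ≤ z.im} :=
    measurableSet_le measurable_const UpperHalfPlane.continuous_im.measurable
  exact h1.inter (h2.inter h3)

theorem exists_bottom_row {p : ℤ × ℤ} (hp : IsCoprime p.1 p.2) :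
    ∃ g : SL(2, ℤ), g 1 0 = p.1 ∧ g 1 1 = p.2 := by
  obtain ⟨g, -, hg⟩ := bottom_row_surj (R := ℤ) (a := ![p.1, p.2]) (by simpa using hp)
  exact ⟨g, by simp_all, by simp_all⟩

theorem eq_T_zpow_mul_of_bottom_row {g h : SL(2, ℤ)} (h0 : g 1 0 = h 1 0) (h1 : g 1 1 = h 1 1) :
    ∃ k : ℤ, g = T ^ k * h := by
  have hd := det_entries g
  have hd' := det_entries h
  refine ⟨g 0 1 * h 0 0 - g 0 0 * h 0 1, ?_⟩
  ext i j
  rw [Matrix.SpecialLinearGroup.coe_mul, coe_T_zpow]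
  rw [h0, h1] at hd
  fin_cases i <;> fin_cases j <;>
    simp only [Matrix.mul_apply, Fin.sum_univ_two, Fin.zero_eta, Fin.mk_one, Matrix.of_apply, Matrix.cons_val', Matrix.cons_val_zero,
      Matrix.cons_val_one, Matrix.cons_val_fin_one, one_mul, zero_mul, zero_add]
  · grind
  · grind
  · exact h0
  · exact h1

theorem re_zpow_smul (k : ℤ) (z : ℍ) : (T ^ k • z).re = z.re + k := re_T_zpow_smul z k

theorem im_zpow_smul (k : ℤ) (z : ℍ) : (T ^ k • z).im = z.im := im_T_zpow_smul z k

theorem le_im_smul_iff {g : SL(2, ℤ)} {z : ℍ} :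
    Y ≤ (g • z).im ↔ (g 1 0, g 1 1) ∈ cuspSet Y z := by
  have h2 : 0 < ‖lowj g z‖ := norm_pos_iff.mpr (lowj_ne_zero g z)
  have h3 : IsCoprime (g 1 0) (g 1 1) := by
    have hd := det_entries g
    exact ⟨-g 0 1, g 0 0, by linear_combination hd⟩
  rw [im_smul_lowj, le_div_iff₀ (by positivity)]
  exact ⟨fun h => ⟨h3, h⟩, fun h => h.2⟩

theorem tsum_indicator_halfStrip (hY : 0 < Y) (z : ℍ) :
    ∑' g : SL(2, ℤ), (halfStrip Y).indicator (fun _ => (1 : ℝ≥0∞)) (g • z) = (cuspSet Y z).ncard := by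
  let A : Set SL(2, ℤ) := {g | g • z ∈ halfStrip Y}
  have h1 : ∀ g : SL(2, ℤ), (halfStrip Y).indicator (fun _ => (1 : ℝ≥0∞)) (g • z) =
      A.indicator (fun _ => (1 : ℝ≥0∞)) g := fun g => by norm_cast
  simp_rw [h1]
  rw [← tsum_subtype A (fun _ => (1 : ℝ≥0∞)), ENNReal.tsum_set_one]
  have h2 : A.encard = (cuspSet Y z).encard := by
    let f : SL(2, ℤ) → ℤ × ℤ := fun g => (g 1 0, g 1 1)
    have hinj : Set.InjOn f A := by
      intro g hg h hh hgh
      obtain ⟨k, rfl⟩ := eq_T_zpow_mul_of_bottom_row (g := g) (h := h)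
        (congrArg Prod.fst hgh) (congrArg Prod.snd hgh)
      have hg1 : 0 ≤ (T ^ k • (h • z)).re ∧ (T ^ k • (h • z)).re < 1 := by
        rw [← mul_smul]; exact ⟨hg.1, hg.2.1⟩
      rw [re_zpow_smul] at hg1
      have hh1 := hh.1
      have hh2 := hh.2.1
      have a1 : (k : ℝ) < 1 := by linarith
      have a2 : (-1 : ℝ) < k := by linarith
      have a1' : k < 1 := by exact_mod_cast a1
      have a2' : -1 < k := by exact_mod_cast a2
      have : k = 0 := by omega
      simp [this]
    have himg : f '' A = cuspSet Y z := by
      ext p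
      constructor
      · rintro ⟨g, hg, rfl⟩
        exact le_im_smul_iff.mp hg.2.2
      · intro hp
        obtain ⟨g, hg0, hg1⟩ := exists_bottom_row hp.1
        refine ⟨T ^ (-⌊(g • z).re⌋) * g, ?_, ?_⟩
        · change _ ∧ _ ∧ _
          rw [mul_smul, re_zpow_smul, im_zpow_smul]
          push_cast
          refine ⟨by linarith [Int.floor_le (g • z).re], by linarith [Int.lt_floor_add_one (g • z).re], ?_⟩
          rw [le_im_smul_iff, hg0, hg1]
          exact hp
        · simp only [f]
          rw [Matrix.SpecialLinearGroup.coe_mul, coe_T_zpow]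
          ext <;> simp [Matrix.mul_apply, Fin.sum_univ_two, hg0, hg1]
    rw [← himg, hinj.encard_image]
  rw [h2, ← (cuspSet_finite hY z).cast_ncard_eq]
  simp

theorem measurable_cuspSet_ncard (hY : 0 < Y) :
    Measurable fun z : ℍ => ((cuspSet Y z).ncard : ℝ≥0∞) := by
  simp_rw [← tsum_indicator_halfStrip hY]
  refine Measurable.tsum fun g => ?_
  exact (measurable_const.indicator (measurableSet_halfStrip Y)).comp (continuous_SL_smul g).measurable

theorem cuspSet_ncard_smul (Y : ℝ) (g : SL(2, ℤ)) (z : ℍ) :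
    (cuspSet Y (g • z)).ncard = (cuspSet Y z).ncard := by
  rw [← cuspSet_smul Y z g, Set.ncard_image_of_injective _ (rowMulEquiv g).injective]

/-- The height `√3/2` of the bottom of the standard fundamental domain. -/
def baseY : ℝ := √3 / 2

theorem baseY_pos : 0 < baseY := by unfold baseY; positivity

theorem four_mul_baseY_sq : 4 * baseY ^ 2 = 3 := by
  rw [baseY, div_pow, sq_sqrt (by norm_num)]; norm_num

theorem baseY_bounds : 0.86 < baseY ∧ baseY < 0.87 := by
  have := four_mul_baseY_sq
  have := baseY_pos
  constructor <;> nlinarith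

/-- A weight with total mass one on every `SL(2,ℤ)`-orbit. -/
def cuspDens (z : ℍ) : ℝ≥0∞ :=
  (halfStrip baseY).indicator (fun z => ((cuspSet baseY z).ncard : ℝ≥0∞)⁻¹) z

theorem measurable_cuspDens : Measurable cuspDens :=
  (measurable_cuspSet_ncard baseY_pos).inv.indicator (measurableSet_halfStrip _)

theorem tsum_cuspDens (z : ℍ) : ∑' g : SL(2, ℤ), cuspDens (g • z) = 1 := by
  have h : ∀ g : SL(2, ℤ), cuspDens (g • z) =
      ((cuspSet baseY z).ncard : ℝ≥0∞)⁻¹ * (halfStrip baseY).indicator (fun _ => (1 : ℝ≥0∞)) (g • z) := by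
    intro g
    unfold cuspDens
    by_cases hg : g • z ∈ halfStrip baseY
    · rw [indicator_of_mem hg, indicator_of_mem hg, cuspSet_ncard_smul, mul_one]
    simp_all
  simp_rw [h]
  rw [ENNReal.tsum_mul_left, tsum_indicator_halfStrip baseY_pos]
  refine ENNReal.inv_mul_cancel ?_ (ENNReal.natCast_ne_top _)
  have := two_le_cuspSet_ncard baseY_pos four_mul_baseY_sq.le z
  positivity

/-- The measure representing integration over `SL(2,ℤ)\ℍ`. -/
def cuspMeas : Measure ℍ := volume.withDensity cuspDens

theorem lintegral_tsum_smul {h : ℍ → ℝ≥0∞} (hh : Measurable h) :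
    ∫⁻ z, ∑' g : SL(2, ℤ), h (g • z) ∂cuspMeas = ∫⁻ z, h z := by
  have hm : ∀ g : SL(2, ℤ), Measurable fun z : ℍ => h (g • z) := fun g =>
    hh.comp (continuous_SL_smul g).measurable
  rw [cuspMeas, lintegral_withDensity_eq_lintegral_mul _ measurable_cuspDens (Measurable.tsum hm)]
  simp only [Pi.mul_apply, ← ENNReal.tsum_mul_left]
  rw [lintegral_tsum (f := fun g z => cuspDens z * h (g • z)) (fun g => (measurable_cuspDens.mul (hm g)).aemeasurable)]
  have h1 : ∀ g : SL(2, ℤ), ∫⁻ z, cuspDens z * h (g • z) = ∫⁻ z, cuspDens (g⁻¹ • z) * h z := by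
    intro g
    have := (measurePreserving_SL_smul g).lintegral_comp (f := fun z => cuspDens (g⁻¹ • z) * h z)
      ((measurable_cuspDens.comp (continuous_SL_smul g⁻¹).measurable).mul hh)
    simpa using this
  simp_rw [h1]
  rw [← lintegral_tsum (f := fun g z => cuspDens (g⁻¹ • z) * h z) (fun g => ((measurable_cuspDens.comp (continuous_SL_smul g⁻¹).measurable).mul hh).aemeasurable)]
  refine lintegral_congr fun z => ?_
  have h2 := (Equiv.inv SL(2, ℤ)).tsum_eq (fun g => cuspDens (g • z))
  simp only [Equiv.inv_apply] at h2
  rw [ENNReal.tsum_mul_right, h2, tsum_cuspDens, one_mul]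

theorem lintegral_halfStrip (hY : 0 < Y) {Φ : ℍ → ℝ≥0∞} (hΦ : Measurable Φ)
    (hinv : ∀ (g : SL(2, ℤ)) z, Φ (g • z) = Φ z) :
    ∫⁻ z in halfStrip Y, Φ z = ∫⁻ z, (cuspSet Y z).ncard * Φ z ∂cuspMeas := by
  rw [← lintegral_indicator (measurableSet_halfStrip Y),
    ← lintegral_tsum_smul (hΦ.indicator (measurableSet_halfStrip Y))]
  refine lintegral_congr fun z => ?_
  rw [← tsum_indicator_halfStrip hY, ← ENNReal.tsum_mul_right]
  refine tsum_congr fun g => ?_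
  by_cases hg : g • z ∈ halfStrip Y
  · simp_all
  simp_all

/-- Rectangular coordinates `(y, x)` on the upper half plane. -/
def rectCoord (p : ℝ × ℝ) : ℍ := ofComplex ⟨p.2, p.1⟩

theorem coe_rectCoord {p : ℝ × ℝ} (hp : 0 < p.1) : (rectCoord p : ℂ) = ⟨p.2, p.1⟩ := by
  rw [rectCoord, ofComplex_apply_of_im_pos (by simpa using hp)]

theorem re_rectCoord {p : ℝ × ℝ} (hp : 0 < p.1) : (rectCoord p).re = p.2 := by
  rw [← coe_re, coe_rectCoord hp]

theorem im_rectCoord {p : ℝ × ℝ} (hp : 0 < p.1) : (rectCoord p).im = p.1 := by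
  rw [← coe_im, coe_rectCoord hp]

theorem measurable_rectCoord : Measurable rectCoord := by
  rw [← measurableEmbedding_coe.measurable_comp_iff]
  have h : (UpperHalfPlane.coe ∘ rectCoord) = fun p : ℝ × ℝ =>
      if 0 < p.1 then (⟨p.2, p.1⟩ : ℂ) else (ofComplex 0 : ℍ) := by
    ext1 p
    simp only [Function.comp]
    split_ifs with hp
    · exact coe_rectCoord hp
    · rw [rectCoord, ofComplex_apply_eq_of_im_nonpos (w' := 0) (by simpa using hp) (by simp)]
  rw [h]
  refine Measurable.ite (measurableSet_lt measurable_const measurable_fst) ?_ measurable_const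
  exact measurableEquivRealProd.symm.measurable.comp measurable_swap

theorem volume_uhp_eq :
    (volume : Measure ℍ) = (((volume.restrict (Ioi (0 : ℝ))).prod volume).withDensity
      (fun p => ENNReal.ofReal (1 / p.1 ^ 2))).map rectCoord := by
  ext s hs
  have hpre := measurable_rectCoord hs
  rw [Measure.map_apply measurable_rectCoord hs, withDensity_apply _ hpre, volume_eq_lintegral]
  have hmp : MeasurePreserving (fun p : ℝ × ℝ => (⟨p.2, p.1⟩ : ℂ)) volume volume :=
    (volume_preserving_equiv_real_prod.symm _).comp (Measure.measurePreserving_swap)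
  have hemb : MeasurableEmbedding (fun p : ℝ × ℝ => (⟨p.2, p.1⟩ : ℂ)) :=
    measurableEquivRealProd.symm.measurableEmbedding.comp
      MeasurableEquiv.prodComm.measurableEmbedding
  rw [← hmp.setLIntegral_comp_preimage_emb hemb]
  have h1 : (fun p : ℝ × ℝ => (⟨p.2, p.1⟩ : ℂ)) ⁻¹' (UpperHalfPlane.coe '' s) =
      rectCoord ⁻¹' s ∩ Ioi 0 ×ˢ Set.univ := by
    ext p
    simp only [Set.mem_preimage, Set.mem_image, Set.mem_inter_iff, Set.mem_prod, Set.mem_Ioi,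
      Set.mem_univ, and_true]
    constructor
    · rintro ⟨z, hz, h⟩
      have hp : 0 < p.1 := by
        have := congrArg Complex.im h
        simp only at this
        rw [← this]; exact z.im_pos
      refine ⟨?_, hp⟩
      have : rectCoord p = z := by
        apply UpperHalfPlane.ext
        rw [coe_rectCoord hp, h]
      rwa [this]
    · rintro ⟨h, hp⟩
      exact ⟨_, h, coe_rectCoord hp⟩
  have h2 : (volume.restrict (Ioi (0 : ℝ))).prod (volume : Measure ℝ) =
      (volume : Measure (ℝ × ℝ)).restrict (Ioi 0 ×ˢ Set.univ) := by
    rw [Measure.volume_eq_prod, ← Measure.prod_restrict, Measure.restrict_univ]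
  rw [h1, h2, Measure.restrict_restrict hpre]
  refine setLIntegral_congr_fun (hpre.inter (measurableSet_Ioi.prod MeasurableSet.univ)) ?_
  rintro p ⟨-, hp, -⟩
  simp only
  rw [← ENNReal.ofReal_coe_nnreal]
  simp

theorem lintegral_uhp {Φ : ℍ → ℝ≥0∞} (hΦ : Measurable Φ) :
    ∫⁻ z, Φ z = ∫⁻ y in Ioi (0 : ℝ), ∫⁻ x, ENNReal.ofReal (1 / y ^ 2) * Φ (rectCoord (y, x)) := by
  have hm : Measurable fun p : ℝ × ℝ => ENNReal.ofReal (1 / p.1 ^ 2) := by fun_prop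
  rw [volume_uhp_eq, lintegral_map hΦ measurable_rectCoord,
    lintegral_withDensity_eq_lintegral_mul _ hm (g := fun p => Φ (rectCoord p)) (hΦ.comp measurable_rectCoord)]
  exact lintegral_prod _ (hm.mul (hΦ.comp measurable_rectCoord)).aemeasurable

theorem lintegral_halfStrip_eq (hY : 0 < Y) {Φ : ℍ → ℝ≥0∞} (hΦ : Measurable Φ) :
    ∫⁻ z in halfStrip Y, Φ z =
      ∫⁻ y in Ici Y, ∫⁻ x in Set.Ico (0 : ℝ) 1,
        ENNReal.ofReal (1 / y ^ 2) * Φ (rectCoord (y, x)) := by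
  rw [← lintegral_indicator (measurableSet_halfStrip Y),
    lintegral_uhp (hΦ.indicator (measurableSet_halfStrip Y)),
    ← lintegral_indicator measurableSet_Ioi, ← lintegral_indicator measurableSet_Ici]
  refine lintegral_congr fun y => ?_
  by_cases hy : Y ≤ y
  · have hy0 : 0 < y := hY.trans_le hy
    rw [indicator_of_mem (show y ∈ Ioi (0:ℝ) from hy0), indicator_of_mem (show y ∈ Ici Y from hy),
      ← lintegral_indicator measurableSet_Ico]
    refine lintegral_congr fun x => ?_
    have hmem : rectCoord (y, x) ∈ halfStrip Y ↔ x ∈ Set.Ico (0 : ℝ) 1 := by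
      simp [halfStrip, re_rectCoord (p := (y, x)) hy0, im_rectCoord (p := (y, x)) hy0, hy]
    by_cases hx : x ∈ Set.Ico (0 : ℝ) 1
    · simp_all
    simp_all
  · rw [indicator_of_notMem (show y ∉ Ici Y from hy)]
    by_cases hy0 : 0 < y
    · rw [indicator_of_mem (show y ∈ Ioi (0:ℝ) from hy0)]
      have : ∀ x, (halfStrip Y).indicator Φ (rectCoord (y, x)) = 0 := fun x =>
        indicator_of_notMem (fun h => hy (by simpa [im_rectCoord (p := (y, x)) hy0] using h.2.2)) _
      simp [this]
    simp_all

/-- Bottom rows of matrices in `Γ(2)`. -/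
def Rw : Type := {v : ℤ × ℤ // IsCoprime v.1 v.2 ∧ Even v.1}

theorem exists_gamma_two_row (v : Rw) :
    ∃ g ∈ Γ₂, g 1 0 = v.1.1 ∧ g 1 1 = v.1.2 := by
  obtain ⟨⟨c, d⟩, hcop, hc⟩ := v
  simp only at hcop hc
  obtain ⟨g, h0, h1⟩ := exists_bottom_row (p := (c, d)) hcop
  simp only at h0 h1
  have hdet := det_entries g
  have hd : Odd (g 1 1) := by
    rw [h1]
    by_contra h
    rw [Int.not_odd_iff_even] at h
    obtain ⟨a, b, hab⟩ := hcop
    have : Even (1 : ℤ) := by rw [← hab]; exact (hc.mul_left a).add (h.mul_left b)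
    norm_cast
  have ha : Odd (g 0 0) := by
    by_contra h
    rw [Int.not_odd_iff_even] at h
    have : Even (1 : ℤ) := by
      rw [← hdet]; exact (h.mul_right _).sub ((h0 ▸ hc).mul_left _)
    norm_cast
  have key : ∀ k : ℤ, Even (g 0 1 + k * g 1 1) → ∃ g ∈ Γ₂, g 1 0 = c ∧ g 1 1 = d := by
    intro k hk
    have e : ∀ i j, (T ^ k * g) i j = !![g 0 0 + k * g 1 0, g 0 1 + k * g 1 1; g 1 0, g 1 1] i j := by
      intro i j
      rw [Matrix.SpecialLinearGroup.coe_mul, coe_T_zpow]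
      fin_cases i <;> fin_cases j <;> simp [Matrix.mul_apply, Fin.sum_univ_two]
    refine ⟨T ^ k * g, ?_, ?_, ?_⟩
    · rw [CongruenceSubgroup.Gamma_mem]
      simp only [e]
      simp only [Matrix.of_apply, Matrix.cons_val', Matrix.cons_val_zero, Matrix.cons_val_one, Matrix.cons_val_fin_one]
      have hcE : Even (g 1 0) := h0 ▸ hc
      refine ⟨(ZMod.intCast_eq_one_iff_odd).mpr (ha.add_even (hcE.mul_left k)), (ZMod.intCast_eq_zero_iff_even).mpr hk,
        (ZMod.intCast_eq_zero_iff_even).mpr hcE, (ZMod.intCast_eq_one_iff_odd).mpr hd⟩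
    · rw [e]; simpa using h0
    simp_all
  rcases Int.even_or_odd (g 0 1) with h | h
  · exact key 0 (by simpa using h)
  · exact key 1 (by grind)

/-- A matrix in `Γ(2)` with given bottom row. -/
def rowRep (v : Rw) : SL(2, ℤ) := (exists_gamma_two_row v).choose

theorem rowRep_mem (v : Rw) : rowRep v ∈ Γ₂ := (exists_gamma_two_row v).choose_spec.1

theorem rowRep_zero (v : Rw) : rowRep v 1 0 = v.1.1 := (exists_gamma_two_row v).choose_spec.2.1

theorem rowRep_one (v : Rw) : rowRep v 1 1 = v.1.2 := (exists_gamma_two_row v).choose_spec.2.2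

theorem isCoprime_bottom (g : SL(2, ℤ)) : IsCoprime (g 1 0) (g 1 1) :=
  ⟨-g 0 1, g 0 0, by linear_combination det_entries g⟩

/-- The bottom row of an element of `Γ(2)`. -/
def rowOf (g : Γ₂) : Rw :=
  ⟨((g : SL(2, ℤ)) 1 0, (g : SL(2, ℤ)) 1 1), isCoprime_bottom _, (gamma_two_even g.2).2.2.1⟩

theorem exists_two_zpow_mul {g : SL(2, ℤ)} (hg : g ∈ Γ₂) {v : Rw}
    (h0 : g 1 0 = v.1.1) (h1 : g 1 1 = v.1.2) : ∃ l : ℤ, g = T ^ (2 * l) * rowRep v := by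
  obtain ⟨k, hk⟩ := eq_T_zpow_mul_of_bottom_row (g := g) (h := rowRep v)
    (by rw [h0, rowRep_zero]) (by rw [h1, rowRep_one])
  have hT : T ^ k ∈ Γ₂ := by
    have : T ^ k = g * (rowRep v)⁻¹ := by rw [hk]; group
    rw [this]; exact mul_mem hg (inv_mem (rowRep_mem v))
  have h := (gamma_two_even hT).2.1
  rw [coe_T_zpow] at h
  obtain ⟨l, hl⟩ := h
  refine ⟨l, ?_⟩
  have : k = 2 * l := by simp at hl; omega
  rw [← this]; exact hk

/-- Right translation on bottom rows. -/
def rwMul (γ : Γ₂) : Rw ≃ Rw where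
  toFun v := ⟨rowMul v.1 γ, isCoprime_rowMul v.2.1 _, by
    have h := (gamma_two_even γ.2).2.2.1
    exact (v.2.2.mul_right _).add (h.mul_left _)⟩
  invFun v := ⟨rowMul v.1 (γ⁻¹ : Γ₂), isCoprime_rowMul v.2.1 _, by
    have h := (gamma_two_even (γ⁻¹).2).2.2.1
    exact (v.2.2.mul_right _).add (h.mul_left _)⟩
  left_inv v := by
    apply Subtype.ext
    simp only [← rowMul_mul]
    simp [rowMul_one]
  right_inv v := by
    apply Subtype.ext
    simp only [← rowMul_mul]
    simp [rowMul_one]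

/-- The unitary factor `(cz+d)/conj(cz+d)`. -/
def chiFac (p : ℤ × ℤ) (z : ℍ) : ℂ := rowj p z / conj (rowj p z)

theorem rowj_ne_zero {p : ℤ × ℤ} (hp : IsCoprime p.1 p.2) (z : ℍ) : rowj p z ≠ 0 := by
  obtain ⟨g, h0, h1⟩ := exists_bottom_row hp
  have := lowj_ne_zero g z
  bound

theorem lowj_eq_rowj (g : SL(2, ℤ)) (z : ℍ) : lowj g z = rowj (g 1 0, g 1 1) z := rfl

theorem norm_chiFac {p : ℤ × ℤ} (hp : IsCoprime p.1 p.2) (z : ℍ) : ‖chiFac p z‖ = 1 := by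
  have : ‖rowj p z‖ ≠ 0 := norm_ne_zero_iff.mpr (rowj_ne_zero hp z)
  rw [chiFac, norm_div, RCLike.norm_conj, div_self this]

theorem chiFac_smul (p : ℤ × ℤ) (g : SL(2, ℤ)) (z : ℍ) :
    chiFac p (g • z) * chiFac (g 1 0, g 1 1) z = chiFac (rowMul p g) z := by
  rw [chiFac, chiFac, chiFac, ← rowj_smul, ← lowj_eq_rowj, map_mul, div_mul_div_comm]

/-- The seed `α(Im z) e(mz/2) θ(z)⁻³`. -/
def seedFn (m : ℕ) (α : ℝ → ℝ) (z : ℍ) : ℂ :=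
  (α z.im : ℂ) * cexp (π * I * m * z) / jacobiTheta z ^ 3

theorem jacobiTheta_add_two_mul (l : ℤ) (z : ℂ) : jacobiTheta (z + 2 * l) = jacobiTheta z := by
  have hper : Function.Periodic jacobiTheta (2 : ℂ) := fun w => by
    rw [add_comm, jacobiTheta_two_add]
  have := hper.int_mul l z
  rw [mul_comm]; exact this

theorem coe_T_zpow_smul (k : ℤ) (z : ℍ) : ((T ^ k • z : ℍ) : ℂ) = z + k := by
  rw [modular_T_zpow_smul]; simp [add_comm]

theorem seedFn_zpow (m : ℕ) (α : ℝ → ℝ) (l : ℤ) (z : ℍ) :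
    seedFn m α (T ^ (2 * l) • z) = seedFn m α z := by
  have h : ((T ^ (2 * l) • z : ℍ) : ℂ) = z + 2 * l := by rw [coe_T_zpow_smul]; push_cast; ring
  rw [seedFn, seedFn, im_zpow_smul, h, jacobiTheta_add_two_mul]
  congr 2
  rw [show (π : ℂ) * I * m * (z + 2 * l) = π * I * m * z + ((m * l : ℤ) : ℂ) * (2 * π * I) by push_cast; ring,
    Complex.exp_add, exp_int_mul_two_pi_mul_I, mul_one]

theorem seedFn_smul_eq {g : SL(2, ℤ)} (hg : g ∈ Γ₂) {v : Rw}
    (h0 : g 1 0 = v.1.1) (h1 : g 1 1 = v.1.2) (z : ℍ) :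
    seedFn m α (g • z) = seedFn m α (rowRep v • z) := by
  obtain ⟨l, rfl⟩ := exists_two_zpow_mul hg h0 h1
  rw [mul_smul, seedFn_zpow]

/-- The Poincaré series attached to the seed `α`. -/
def poin (m κ : ℕ) (α : ℝ → ℝ) (z : ℍ) : ℂ :=
  ∑' v : Rw, chiFac v.1 z ^ κ * seedFn m α (rowRep v • z)

theorem poin_smul (m κ : ℕ) (α : ℝ → ℝ) (γ : Γ₂) (z : ℍ) :
    poin m κ α ((γ : SL(2, ℤ)) • z) * chiFac ((γ : SL(2, ℤ)) 1 0, (γ : SL(2, ℤ)) 1 1) z ^ κ =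
      poin m κ α z := by
  rw [poin, poin, ← tsum_mul_right, ← (rwMul γ).tsum_eq (fun v : Rw => chiFac v.1 z ^ κ * seedFn m α (rowRep v • z))]
  refine tsum_congr fun v => ?_
  have h1 : ((rwMul γ v).1 : ℤ × ℤ) = rowMul v.1 γ := rfl
  rw [h1, ← chiFac_smul, mul_pow, ← seedFn_smul_eq (g := rowRep v * γ) (v := rwMul γ v)
    (mul_mem (rowRep_mem v) γ.2), mul_smul]
  · ring
  · rw [h1, Matrix.SpecialLinearGroup.coe_mul]
    simp [Matrix.mul_apply, Fin.sum_univ_two, rowMul, rowRep_zero, rowRep_one]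
  · rw [h1, Matrix.SpecialLinearGroup.coe_mul]
    simp [Matrix.mul_apply, Fin.sum_univ_two, rowMul, rowRep_zero, rowRep_one]

theorem norm_poin_smul (m κ : ℕ) (α : ℝ → ℝ) (γ : Γ₂) (z : ℍ) :
    ‖poin m κ α ((γ : SL(2, ℤ)) • z)‖ = ‖poin m κ α z‖ := by
  rw [← poin_smul m κ α γ z, norm_mul, norm_pow, norm_chiFac (isCoprime_bottom _), one_pow, mul_one]

/-- Continuous bounded functions vanishing below height `y₀`. -/
structure IsSeed (y₀ A : ℝ) (α : ℝ → ℝ) : Prop where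
  pos : 0 < y₀
  cont : Continuous α
  zero : ∀ y < y₀, α y = 0
  bdd : ∀ y, |α y| ≤ A

theorem IsSeed.mem_cuspSet (h : IsSeed y₀ A α) {v : Rw} {z : ℍ}
    (hne : seedFn m α (rowRep v • z) ≠ 0) : v.1 ∈ cuspSet y₀ z := by
  have h1 : y₀ ≤ (rowRep v • z).im := by
    by_contra hlt
    exact hne (by rw [seedFn, h.zero _ (not_le.mp hlt)]; simp)
  rw [le_im_smul_iff, rowRep_zero, rowRep_one] at h1
  exact h1

theorem cuspSet_near (hY : 0 < Y) {z₀ z : ℍ} (h : ‖(z : ℂ) - z₀‖ ≤ z₀.im / 2) :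
    cuspSet Y z ⊆ cuspSet (Y / 8) z₀ := by
  rintro p ⟨hp, hle⟩
  refine ⟨hp, ?_⟩
  have h1 : ‖rowj p z - rowj p z₀‖ ≤ ‖rowj p z₀‖ / 2 := by
    have e : rowj p z - rowj p z₀ = p.1 * ((z : ℂ) - z₀) := by simp only [rowj]; ring
    have e2 : |(p.1 : ℝ)| * z₀.im ≤ ‖rowj p z₀‖ := by
      have : (rowj p z₀).im = p.1 * z₀.im := by simp [rowj]
      have h3 := abs_im_le_norm (rowj p z₀)
      rwa [this, abs_mul, abs_of_pos z₀.im_pos] at h3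
    rw [e, norm_mul, norm_intCast]
    calc |(p.1 : ℝ)| * ‖(z : ℂ) - z₀‖ ≤ |(p.1 : ℝ)| * (z₀.im / 2) := by gcongr
      _ ≤ _ := by linarith
  have h2 : ‖rowj p z₀‖ ≤ 2 * ‖rowj p z‖ := by
    have := norm_sub_norm_le (rowj p z₀) (rowj p z)
    rw [norm_sub_rev] at this
    linarith
  have h3 : z.im ≤ 3 / 2 * z₀.im := by
    have := abs_im_le_norm ((z : ℂ) - z₀)
    rw [sub_im, coe_im, coe_im] at this
    grind
  have h4 : ‖rowj p z₀‖ ^ 2 ≤ 4 * ‖rowj p z‖ ^ 2 := by nlinarith [norm_nonneg (rowj p z₀)]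
  nlinarith [z₀.im_pos]

theorem finite_rows (hY : 0 < Y) (z : ℍ) : {v : Rw | v.1 ∈ cuspSet Y z}.Finite :=
  (cuspSet_finite hY z).preimage (Subtype.val_injective.injOn)

theorem IsSeed.exists_finset (h : IsSeed y₀ A α) (m : ℕ) (z₀ : ℍ) :
    ∃ F : Finset Rw, ∀ z : ℍ, ‖(z : ℂ) - z₀‖ ≤ z₀.im / 2 → ∀ v ∉ F, seedFn m α (rowRep v • z) = 0 := by
  refine ⟨(finite_rows (Y := y₀ / 8) (by have := h.pos; positivity) z₀).toFinset, fun z hz v hv => ?_⟩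
  by_contra hne
  exact hv (by simpa using cuspSet_near h.pos hz (h.mem_cuspSet hne))

theorem IsSeed.summable (h : IsSeed y₀ A α) (m κ : ℕ) (z : ℍ) :
    Summable fun v : Rw => chiFac v.1 z ^ κ * seedFn m α (rowRep v • z) := by
  obtain ⟨F, hF⟩ := h.exists_finset m z
  refine summable_of_ne_finset_zero (s := F) fun v hv => ?_
  rw [hF z (by simpa using (half_pos z.im_pos).le) v hv, mul_zero]

theorem seedFn_add (m : ℕ) (α β : ℝ → ℝ) (z : ℍ) :
    seedFn m (fun y => α y + β y) z = seedFn m α z + seedFn m β z := by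
  simp only [seedFn]; push_cast; ring

theorem seedFn_smul (m : ℕ) (a : ℝ) (α : ℝ → ℝ) (z : ℍ) :
    seedFn m (fun y => a * α y) z = a * seedFn m α z := by
  simp only [seedFn]; push_cast; ring

theorem poin_add (hα : IsSeed y₀ A α) (hβ : IsSeed y₁ B β) (m κ : ℕ) (z : ℍ) :
    poin m κ (fun y => α y + β y) z = poin m κ α z + poin m κ β z := by
  rw [poin, poin, poin, ← (hα.summable m κ z).tsum_add (hβ.summable m κ z)]
  refine tsum_congr fun v => ?_
  rw [seedFn_add]; ring

theorem poin_const_mul (m κ : ℕ) (a : ℝ) (α : ℝ → ℝ) (z : ℍ) :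
    poin m κ (fun y => a * α y) z = a * poin m κ α z := by
  rw [poin, poin, ← tsum_mul_left]
  refine tsum_congr fun v => ?_
  rw [seedFn_smul]; ring

theorem continuous_jacobiTheta_uhp : Continuous fun z : ℍ => jacobiTheta z := by
  rw [continuous_iff_continuousAt]
  intro z
  exact ((differentiableAt_jacobiTheta z.im_pos).continuousAt).comp UpperHalfPlane.continuous_coe.continuousAt

theorem continuous_seedFn (h : Continuous α) : Continuous (seedFn m α) := by
  have h1 : Continuous fun z : ℍ => (α z.im : ℂ) :=
    continuous_ofReal.comp (h.comp UpperHalfPlane.continuous_im)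
  have h2 : Continuous fun z : ℍ => cexp (π * I * m * z) :=
    Complex.continuous_exp.comp (continuous_const.mul UpperHalfPlane.continuous_coe)
  exact (h1.mul h2).div (continuous_jacobiTheta_uhp.pow 3) fun z => pow_ne_zero _ (jacobiTheta_ne_zero z)

theorem continuous_chiFac {p : ℤ × ℤ} (hp : IsCoprime p.1 p.2) : Continuous (chiFac p) := by
  have h1 : Continuous fun z : ℍ => rowj p z :=
    (continuous_const.mul UpperHalfPlane.continuous_coe).add continuous_const
  exact h1.div (continuous_conj.comp h1) fun z => by simpa using rowj_ne_zero hp z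

theorem IsSeed.continuous_poin (h : IsSeed y₀ A α) (m κ : ℕ) :
    Continuous (poin m κ α) := by
  rw [continuous_iff_continuousAt]
  intro z₀
  obtain ⟨F, hF⟩ := h.exists_finset m z₀
  have hev : ∀ᶠ z : ℍ in 𝓝 z₀, ‖(z : ℂ) - z₀‖ ≤ z₀.im / 2 := by
    have hc : Continuous fun z : ℍ => ‖(z : ℂ) - z₀‖ := (UpperHalfPlane.continuous_coe.sub continuous_const).norm
    have := hc.continuousAt (x := z₀)
    have h0 : ‖(z₀ : ℂ) - z₀‖ < z₀.im / 2 := by simpa using half_pos z₀.im_pos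
    exact (this.eventually (gt_mem_nhds h0)).mono fun z hz => le_of_lt hz
  have heq : poin m κ α =ᶠ[𝓝 z₀] fun z => ∑ v ∈ F, chiFac v.1 z ^ κ * seedFn m α (rowRep v • z) := by
    filter_upwards [hev] with z hz
    exact tsum_eq_sum fun v hv => by grind
  refine ContinuousAt.congr ?_ heq.symm
  refine Continuous.continuousAt (continuous_finsetSum _ fun v _ => ?_)
  exact ((continuous_chiFac v.2.1).pow κ).mul ((continuous_seedFn h.cont).comp (continuous_SL_smul _))

/-- The coset space `SL(2,ℤ)/Γ(2)`. -/
abbrev Cst : Type := SL(2, ℤ) ⧸ Γ₂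

instance fintype_Cst : Fintype Cst := Fintype.ofFinite _

/-- Decomposition of `SL(2,ℤ)` as `⨆ Γ(2) q⁻¹`. -/
def cosetEquiv : Cst × Γ₂ ≃ SL(2, ℤ) :=
  Equiv.ofBijective (fun p => (p.2 : SL(2, ℤ)) * p.1.out⁻¹) (by
    constructor
    · rintro ⟨q, γ⟩ ⟨q', γ'⟩ h
      simp only at h
      have h' : q.out * (γ : SL(2, ℤ))⁻¹ = q'.out * (γ' : SL(2, ℤ))⁻¹ := by
        have := congrArg (·⁻¹) h
        simpa using this
      have hq : q = q' := by
        have := congrArg (QuotientGroup.mk (s := Γ₂)) h'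
        rw [QuotientGroup.mk_mul_of_mem _ (inv_mem γ.2), QuotientGroup.mk_mul_of_mem _ (inv_mem γ'.2),
          QuotientGroup.out_eq', QuotientGroup.out_eq'] at this
        exact this
      simp_all
    · intro g
      obtain ⟨h, hh⟩ := QuotientGroup.mk_out_eq_mul (Γ₂) g⁻¹
      refine ⟨((g⁻¹ : SL(2, ℤ)), h), ?_⟩
      simp_all)

theorem cosetEquiv_apply (q : Cst) (γ : Γ₂) :
    cosetEquiv (q, γ) = (γ : SL(2, ℤ)) * q.out⁻¹ := rfl

theorem cuspDens_lt_top (z : ℍ) : cuspDens z < ⊤ := by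
  unfold cuspDens
  by_cases h : z ∈ halfStrip baseY
  · rw [indicator_of_mem h, ENNReal.inv_lt_top]
    have := two_le_cuspSet_ncard baseY_pos four_mul_baseY_sq.le z
    positivity
  simp_all

theorem tsum_lintegral_enorm_smul {H : ℍ → ℝ} (hm : StronglyMeasurable H) :
    ∑' g : SL(2, ℤ), ∫⁻ z, ‖H (g • z)‖ₑ ∂cuspMeas = ∫⁻ z, ‖H z‖ₑ := by
  rw [← lintegral_tsum_smul hm.measurable.enorm, ← lintegral_tsum]
  exact fun g => (hm.measurable.enorm.comp (continuous_SL_smul g).measurable).aemeasurable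

theorem stronglyMeasurable_smul {H : ℍ → ℝ} (hm : StronglyMeasurable H) (g : SL(2, ℤ)) :
    StronglyMeasurable fun z : ℍ => H (g • z) :=
  hm.comp_measurable (continuous_SL_smul g).measurable

theorem tsum_integral_smul {H : ℍ → ℝ} (hm : StronglyMeasurable H) (hi : Integrable H) :
    ∑' g : SL(2, ℤ), ∫ z, H (g • z) ∂cuspMeas = ∫ z, H z := by
  have h1 : ∀ g : SL(2, ℤ), ∫ z, H (g • z) ∂cuspMeas = ∫ z, (cuspDens (g⁻¹ • z)).toReal * H z := by
    intro g
    rw [cuspMeas, integral_withDensity_eq_integral_toReal_smul measurable_cuspDens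
      (Eventually.of_forall cuspDens_lt_top)]
    have := (measurePreserving_SL_smul g).integral_comp
      ((Homeomorph.smul (g : GL (Fin 2) ℝ) : ℍ ≃ₜ ℍ).measurableEmbedding)
      (fun z => (cuspDens (g⁻¹ • z)).toReal * H z)
    simpa using this
  have hmd : ∀ g : SL(2, ℤ), StronglyMeasurable fun z : ℍ => (cuspDens (g • z)).toReal := fun g =>
    ((measurable_cuspDens.comp (continuous_SL_smul g).measurable).ennreal_toReal).stronglyMeasurable
  simp_rw [h1]
  rw [← integral_tsum]
  · refine integral_congr_ae (Eventually.of_forall fun z => ?_)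
    simp only
    have h2 := (Equiv.inv SL(2, ℤ)).tsum_eq (fun g => cuspDens (g • z))
    simp only [Equiv.inv_apply] at h2
    rw [tsum_mul_right, ← ENNReal.tsum_toReal_eq (fun g => (cuspDens_lt_top _).ne), h2, tsum_cuspDens]
    simp
  · exact fun g => ((hmd g⁻¹).mul hm).aestronglyMeasurable
  · have h3 : ∀ g : SL(2, ℤ), ∫⁻ z, ‖(cuspDens (g⁻¹ • z)).toReal * H z‖ₑ = ∫⁻ z, cuspDens (g⁻¹ • z) * ‖H z‖ₑ := by
      intro g
      refine lintegral_congr fun z => ?_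
      rw [enorm_mul, enorm_of_nonneg ENNReal.toReal_nonneg, ENNReal.ofReal_toReal (cuspDens_lt_top _).ne]
    simp_rw [h3]
    rw [← lintegral_tsum (f := fun g z => cuspDens (g⁻¹ • z) * ‖H z‖ₑ)
      (fun g => ((measurable_cuspDens.comp (continuous_SL_smul g⁻¹).measurable).mul hm.measurable.enorm).aemeasurable)]
    have h4 : ∀ z, ∑' g : SL(2, ℤ), cuspDens (g⁻¹ • z) * ‖H z‖ₑ = ‖H z‖ₑ := by
      intro z
      have h2 := (Equiv.inv SL(2, ℤ)).tsum_eq (fun g => cuspDens (g • z))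
      simp only [Equiv.inv_apply] at h2
      rw [ENNReal.tsum_mul_right, h2, tsum_cuspDens, one_mul]
    simp_rw [h4]
    exact hi.2.ne

theorem sum_integral_coset {H : ℍ → ℝ} (hm : StronglyMeasurable H) (hi : Integrable H) :
    ∑ q : Cst, ∫ z, ∑' γ : Γ₂, H ((γ : SL(2, ℤ)) • q.out⁻¹ • z) ∂cuspMeas =
      ∫ z, H z := by
  have hfin : ∑' g : SL(2, ℤ), ∫⁻ z, ‖H (g • z)‖ₑ ∂cuspMeas ≠ ⊤ := by
    rw [tsum_lintegral_enorm_smul hm]; exact hi.2.ne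
  have hq : ∀ q : Cst, ∑' γ : Γ₂, ∫⁻ z, ‖H ((γ : SL(2, ℤ)) • q.out⁻¹ • z)‖ₑ ∂cuspMeas ≠ ⊤ := by
    intro q
    refine ne_top_of_le_ne_top hfin ?_
    have hinj : Function.Injective fun γ : Γ₂ => (γ : SL(2, ℤ)) * q.out⁻¹ :=
      fun a b h => Subtype.ext (mul_right_cancel h)
    have := ENNReal.tsum_comp_le_tsum_of_injective hinj (fun g => ∫⁻ z, ‖H (g • z)‖ₑ ∂cuspMeas)
    simpa only [mul_smul] using this
  have h1 : ∀ q : Cst, ∫ z, ∑' γ : Γ₂, H ((γ : SL(2, ℤ)) • q.out⁻¹ • z) ∂cuspMeas =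
      ∑' γ : Γ₂, ∫ z, H ((γ : SL(2, ℤ)) • q.out⁻¹ • z) ∂cuspMeas := by
    intro q
    refine integral_tsum (fun γ => ?_) (hq q)
    have := stronglyMeasurable_smul hm ((γ : SL(2, ℤ)) * q.out⁻¹)
    simp only [mul_smul] at this
    exact this.aestronglyMeasurable
  rw [← tsum_integral_smul hm hi, ← cosetEquiv.tsum_eq]
  have hsum : Summable fun g : SL(2, ℤ) => ∫ z, H (g • z) ∂cuspMeas := by
    have hs : Summable fun g : SL(2, ℤ) => (∫⁻ z, ‖H (g • z)‖ₑ ∂cuspMeas).toReal := ENNReal.summable_toReal hfin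
    refine Summable.of_norm_bounded hs fun g => ?_
    have := norm_integral_le_lintegral_norm (μ := cuspMeas) (fun z : ℍ => H (g • z))
    simp only [ofReal_norm] at this
    exact this
  have hsum' := (cosetEquiv.summable_iff).mpr hsum
  have h5 := hsum'.tsum_prod
  simp only [Function.comp_def] at h5
  rw [h5, tsum_fintype]
  refine sum_congr rfl fun q _ => ?_
  rw [h1]
  refine tsum_congr fun γ => ?_
  simp only [Function.comp, cosetEquiv_apply, mul_smul]

instance isFiniteMeasure_cuspMeas : IsFiniteMeasure cuspMeas := by
  constructor
  rw [cuspMeas, withDensity_apply _ MeasurableSet.univ, Measure.restrict_univ]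
  have h1 : ∫⁻ z, cuspDens z ≤ ∫⁻ z in halfStrip baseY, (1 : ℝ≥0∞) := by
    rw [← lintegral_indicator (measurableSet_halfStrip _)]
    refine lintegral_mono fun z => ?_
    unfold cuspDens
    refine Set.indicator_le_indicator ?_
    have := two_le_cuspSet_ncard baseY_pos four_mul_baseY_sq.le z
    rw [ENNReal.inv_le_one]
    exact_mod_cast (by omega : 1 ≤ (cuspSet baseY z).ncard)
  refine h1.trans_lt ?_
  rw [lintegral_halfStrip_eq baseY_pos measurable_const]
  simp only [mul_one, lintegral_const, Measure.restrict_apply MeasurableSet.univ, Set.univ_inter,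
    volume_Ico, sub_zero, ENNReal.ofReal_one]
  have hint : IntegrableOn (fun y : ℝ => y ^ (-2 : ℝ)) (Ioi baseY) :=
    integrableOn_Ioi_rpow_of_lt (by norm_num) baseY_pos
  rw [← integrableOn_Ici_iff_integrableOn_Ioi] at hint
  have h2 := hint.2
  rw [hasFiniteIntegral_iff_enorm] at h2
  refine lt_of_le_of_lt (le_of_eq ?_) h2
  refine setLIntegral_congr_fun measurableSet_Ici fun y hy => ?_
  have hy0 : 0 < y := baseY_pos.trans_le hy
  rw [enorm_of_nonneg (by positivity), rpow_neg hy0.le]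
  norm_num

theorem thetaWt_nonneg (z : ℍ) : 0 ≤ thetaWt z := by
  unfold thetaWt; positivity

theorem continuous_thetaWt : Continuous thetaWt := by
  refine (continuous_jacobiTheta_uhp.norm.pow 6).mul ?_
  fun_prop (disch := positivity)

theorem norm_seedFn_sq_mul_thetaWt (m : ℕ) (α : ℝ → ℝ) (z : ℍ) :
    ‖seedFn m α z‖ ^ 2 * thetaWt z = α z.im ^ 2 * Real.exp (-(2 * π * m * z.im)) * z.im ^ (3 / 2 : ℝ) := by
  have h := norm_pos_iff.mpr (jacobiTheta_ne_zero z)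
  have hre : (π * I * m * z : ℂ).re = -(π * m * z.im) := by simp
  rw [seedFn, thetaWt, norm_div, norm_mul, norm_real, norm_pow, norm_exp, hre,
    div_pow, mul_pow, norm_eq_abs, sq_abs, ← Real.exp_nat_mul]
  field_simp
  ring_nf

theorem rpow_three_halves_le_exp (hy : 0 < y) : y ^ (3 / 2 : ℝ) ≤ Real.exp (2 * y) := by
  have h1 : y ^ (3 / 2 : ℝ) ≤ (y + 1) ^ (3 / 2 : ℝ) := rpow_le_rpow hy.le (by linarith) (by norm_num)
  have h2 : (y + 1) ^ (3 / 2 : ℝ) ≤ (y + 1) ^ (2 : ℝ) :=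
    rpow_le_rpow_of_exponent_le (by linarith) (by norm_num)
  have h3 : (y + 1) ^ (2 : ℝ) ≤ (Real.exp y) ^ (2 : ℝ) :=
    rpow_le_rpow (by linarith) (add_one_le_exp y) (by norm_num)
  have h4 : (Real.exp y) ^ (2 : ℝ) = Real.exp (2 * y) := by
    rw [← exp_mul]; ring_nf
  linarith

theorem norm_seedFn_sq_mul_thetaWt_le (hm : 1 ≤ m) (hA : ∀ y, |α y| ≤ A) (z : ℍ) :
    ‖seedFn m α z‖ ^ 2 * thetaWt z ≤ A ^ 2 := by
  rw [norm_seedFn_sq_mul_thetaWt]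
  have hy := z.im_pos
  have hm' : (1 : ℝ) ≤ m := by exact_mod_cast hm
  have h1 : Real.exp (-(2 * π * m * z.im)) * z.im ^ (3 / 2 : ℝ) ≤ 1 := by
    calc _ ≤ Real.exp (-(2 * π * m * z.im)) * Real.exp (2 * z.im) := by
          gcongr; exact rpow_three_halves_le_exp hy
      _ = Real.exp (-(2 * π * m * z.im) + 2 * z.im) := by rw [Real.exp_add]
      _ ≤ 1 := by
          rw [exp_le_one_iff]
          have : 1 ≤ π * m := by nlinarith [pi_gt_three]
          nlinarith
  have h2 : α z.im ^ 2 ≤ A ^ 2 := by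
    rw [← sq_abs]; gcongr; exact hA _
  nlinarith

/-- The bound for the normalized Poincaré series. -/
def poinBd (y₀ A : ℝ) : ℝ := (4 / y₀ + 3) ^ 2 * A

theorem IsSeed.norm_poin_le (h : IsSeed y₀ A α) (hm : 1 ≤ m) (κ : ℕ) (z : ℍ) :
    ‖poin m κ α z‖ * √(thetaWt z) ≤ poinBd y₀ A := by
  have hA : 0 ≤ A := (abs_nonneg _).trans (h.bdd 0)
  have hterm : ∀ v : Rw, ‖chiFac v.1 z ^ κ * seedFn m α (rowRep v • z)‖ * √(thetaWt z) ≤ A := by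
    intro v
    rw [norm_mul, norm_pow, norm_chiFac v.2.1, one_pow, one_mul, ← thetaWt_smul (rowRep_mem v)]
    refine abs_le_of_sq_le_sq' ?_ hA |>.2
    rw [mul_pow, sq_sqrt (thetaWt_nonneg _)]
    exact norm_seedFn_sq_mul_thetaWt_le hm h.bdd _
  set F := (finite_rows h.pos z).toFinset
  have hF : ∀ v ∉ F, chiFac v.1 z ^ κ * seedFn m α (rowRep v • z) = 0 := by
    intro v hv
    by_contra hne
    exact hv (by simpa [F] using h.mem_cuspSet (right_ne_zero_of_mul hne))
  have hcard : (F.card : ℝ) ≤ (4 / y₀ + 3) ^ 2 := by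
    refine le_trans ?_ (cuspSet_ncard_le h.pos z)
    have : F.card ≤ (cuspSet y₀ z).ncard := by
      rw [← Set.ncard_coe_finset]
      refine Set.ncard_le_ncard_of_injOn (fun v : Rw => v.1) ?_ Subtype.val_injective.injOn (cuspSet_finite h.pos z)
      aesop
    exact_mod_cast this
  rw [poin, tsum_eq_sum hF]
  calc _ ≤ (∑ v ∈ F, ‖chiFac v.1 z ^ κ * seedFn m α (rowRep v • z)‖) * √(thetaWt z) := by bound
    _ = ∑ v ∈ F, ‖chiFac v.1 z ^ κ * seedFn m α (rowRep v • z)‖ * √(thetaWt z) := sum_mul _ _ _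
    _ ≤ ∑ v ∈ F, A := sum_le_sum fun v _ => hterm v
    _ = F.card * A := by simp
    _ ≤ poinBd y₀ A := by unfold poinBd; gcongr

/-- The pointwise pairing of two Poincaré series. -/
def poinPair (m κ : ℕ) (α β : ℝ → ℝ) (z : ℍ) : ℝ :=
  (poin m κ α z * conj (poin m κ β z)).re * thetaWt z

theorem poinPair_comm (m κ : ℕ) (α β : ℝ → ℝ) (z : ℍ) : poinPair m κ α β z = poinPair m κ β α z := by
  unfold poinPair; congr 1; simp; ring

theorem poinPair_self (m κ : ℕ) (α : ℝ → ℝ) (z : ℍ) :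
    poinPair m κ α α z = ‖poin m κ α z‖ ^ 2 * thetaWt z := by
  unfold poinPair
  rw [mul_conj, ofReal_re, normSq_eq_norm_sq]

theorem abs_poinPair_le (hα : IsSeed y₀ A α) (hβ : IsSeed y₁ B β)
    (hm : 1 ≤ m) (κ : ℕ) (z : ℍ) : |poinPair m κ α β z| ≤ poinBd y₀ A * poinBd y₁ B := by
  have h1 := hα.norm_poin_le hm κ z
  have h2 := hβ.norm_poin_le hm κ z
  have h3 : |poinPair m κ α β z| ≤ (‖poin m κ α z‖ * √(thetaWt z)) * (‖poin m κ β z‖ * √(thetaWt z)) := by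
    unfold poinPair
    rw [abs_mul, abs_of_nonneg (thetaWt_nonneg z)]
    calc _ ≤ ‖poin m κ α z * conj (poin m κ β z)‖ * thetaWt z := by
          gcongr
          · exact thetaWt_nonneg z
          bound
      _ = _ := by
          rw [norm_mul, norm_conj]
          nth_rewrite 1 [← mul_self_sqrt (thetaWt_nonneg z)]; ring
  exact h3.trans (mul_le_mul h1 h2 (by positivity) ((by positivity : (0:ℝ) ≤ _).trans h1))

theorem continuous_poinPair (hα : IsSeed y₀ A α) (hβ : IsSeed y₁ B β) (m κ : ℕ) :
    Continuous (poinPair m κ α β) :=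
  (Complex.continuous_re.comp ((hα.continuous_poin m κ).mul
    (continuous_conj.comp (hβ.continuous_poin m κ)))).mul continuous_thetaWt

theorem integrable_poinPair_smul (hα : IsSeed y₀ A α) (hβ : IsSeed y₁ B β)
    (hm : 1 ≤ m) (κ : ℕ) (g : SL(2, ℤ)) : Integrable (fun z => poinPair m κ α β (g • z)) cuspMeas := by
  refine Integrable.of_bound (C := poinBd y₀ A * poinBd y₁ B) ?_ (Eventually.of_forall fun z => ?_)
  · exact ((continuous_poinPair hα hβ m κ).comp (continuous_SL_smul g)).aestronglyMeasurable
  · exact abs_poinPair_le hα hβ hm κ _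

/-- The Petersson pairing of two Poincaré series on `Γ(2)`. -/
def bform (m κ : ℕ) (α β : ℝ → ℝ) : ℝ :=
  ∑ q : Cst, ∫ z, poinPair m κ α β (q.out⁻¹ • z) ∂cuspMeas

theorem bform_comm (m κ : ℕ) (α β : ℝ → ℝ) : bform m κ α β = bform m κ β α := by
  unfold bform
  simp_rw [poinPair_comm m κ α β]

theorem bform_self_nonneg (m κ : ℕ) (α : ℝ → ℝ) : 0 ≤ bform m κ α α := by
  refine sum_nonneg fun q _ => integral_nonneg fun z => ?_
  simp only [Pi.zero_apply, poinPair_self]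
  exact mul_nonneg (sq_nonneg _) (thetaWt_nonneg _)

theorem bform_add_left {y₀ A y₁ B y₂ C : ℝ} {α β γ : ℝ → ℝ} (hα : IsSeed y₀ A α) (hβ : IsSeed y₁ B β)
    (hγ : IsSeed y₂ C γ) (hm : 1 ≤ m) (κ : ℕ) :
    bform m κ (fun y => α y + β y) γ = bform m κ α γ + bform m κ β γ := by
  unfold bform
  rw [← sum_add_distrib]
  refine sum_congr rfl fun q _ => ?_
  rw [← integral_add (integrable_poinPair_smul hα hγ hm κ _) (integrable_poinPair_smul hβ hγ hm κ _)]
  refine integral_congr_ae (Eventually.of_forall fun z => ?_)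
  simp only [poinPair, poin_add hα hβ]
  simp; ring

theorem bform_const_mul_left (m κ : ℕ) (a : ℝ) (α γ : ℝ → ℝ) :
    bform m κ (fun y => a * α y) γ = a * bform m κ α γ := by
  unfold bform
  rw [mul_sum]
  refine sum_congr rfl fun q _ => ?_
  rw [← integral_const_mul]
  refine integral_congr_ae (Eventually.of_forall fun z => ?_)
  simp only [poinPair, poin_const_mul]
  simp; ring

theorem bform_add_right {y₀ A y₁ B y₂ C : ℝ} {α β γ : ℝ → ℝ} (hα : IsSeed y₀ A α) (hβ : IsSeed y₁ B β)
    (hγ : IsSeed y₂ C γ) (hm : 1 ≤ m) (κ : ℕ) :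
    bform m κ γ (fun y => α y + β y) = bform m κ γ α + bform m κ γ β := by
  rw [bform_comm, bform_add_left hα hβ hγ hm, bform_comm m κ α, bform_comm m κ β]

theorem bform_const_mul_right (m κ : ℕ) (a : ℝ) (α γ : ℝ → ℝ) :
    bform m κ γ (fun y => a * α y) = a * bform m κ γ α := by
  rw [bform_comm, bform_const_mul_left, bform_comm]

theorem IsSeed.const_mul (h : IsSeed y₀ A α) (a : ℝ) :
    IsSeed y₀ (|a| * A) (fun y => a * α y) :=
  ⟨h.pos, continuous_const.mul h.cont, fun y hy => by rw [h.zero y hy, mul_zero], fun y => by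
    rw [abs_mul]; gcongr; exact h.bdd y⟩

theorem IsSeed.add (h : IsSeed y₀ A α) (h' : IsSeed y₀ B β) :
    IsSeed y₀ (A + B) (fun y => α y + β y) :=
  ⟨h.pos, h.cont.add h'.cont, fun y hy => by rw [h.zero y hy, h'.zero y hy, add_zero], fun y =>
    (abs_add_le _ _).trans (add_le_add (h.bdd y) (h'.bdd y))⟩

theorem two_mul_bform_le (hα : IsSeed y₀ A α) (hβ : IsSeed y₀ B β)
    (hm : 1 ≤ m) (κ : ℕ) (ε : ℝ) :
    2 * ε * bform m κ α β ≤ ε ^ 2 * bform m κ α α + bform m κ β β := by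
  have hc := hα.const_mul ε
  have hd := hβ.const_mul (-1)
  have h := bform_self_nonneg m κ (fun y => ε * α y + (-1) * β y)
  rw [bform_add_left hc hd (hc.add hd) hm, bform_add_right hc hd hc hm, bform_add_right hc hd hd hm] at h
  simp only [bform_const_mul_left, bform_const_mul_right] at h
  rw [bform_comm m κ β α] at h
  linarith

theorem abs_bform_le (y₀ : ℝ) : ∃ C : ℝ, 0 ≤ C ∧ ∀ (m κ : ℕ) (A B : ℝ) (α β : ℝ → ℝ), 1 ≤ m → IsSeed y₀ A α →
    IsSeed y₀ B β → |bform m κ α β| ≤ C * A * B := by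
  refine ⟨(Fintype.card Cst : ℝ) * (((4 / y₀ + 3) ^ 2) ^ 2 * cuspMeas.real Set.univ), by positivity, ?_⟩
  intro m κ A B α β hm hα hβ
  unfold bform
  refine (Finset.abs_sum_le_sum_abs _ _).trans ?_
  have h : ∀ q ∈ (Finset.univ : Finset Cst), |∫ z, poinPair m κ α β (q.out⁻¹ • z) ∂cuspMeas| ≤
      (poinBd y₀ A * poinBd y₀ B) * cuspMeas.real Set.univ := by
    intro q _
    exact norm_integral_le_of_norm_le_const (μ := cuspMeas) (f := fun z => poinPair m κ α β (q.out⁻¹ • z))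
      (C := poinBd y₀ A * poinBd y₀ B) (Eventually.of_forall fun z => abs_poinPair_le hα hβ hm κ _)
  refine (sum_le_sum h).trans (le_of_eq ?_)
  rw [sum_const, nsmul_eq_mul, Finset.card_univ, poinBd, poinBd]
  ring

/-- The vertical strip of width two. -/
def strip2 : Set ℍ := {z | 0 ≤ z.re ∧ z.re < 2}

theorem measurableSet_strip2 : MeasurableSet strip2 :=
  (measurableSet_le measurable_const UpperHalfPlane.continuous_re.measurable).inter
    (measurableSet_lt UpperHalfPlane.continuous_re.measurable measurable_const)

theorem T_two_mul_mem (l : ℤ) : T ^ (2 * l) ∈ Γ₂ := by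
  rw [CongruenceSubgroup.Gamma_mem]
  have h2 : (2 : ZMod 2) = 0 := rfl
  simp [coe_T_zpow, h2]

/-- The representative of a bottom row moving `z` into the strip. -/
def stripRep (z : ℍ) (v : Rw) : Γ₂ :=
  ⟨T ^ (2 * (-⌊(rowRep v • z).re / 2⌋)) * rowRep v, mul_mem (T_two_mul_mem _) (rowRep_mem v)⟩

theorem T_zpow_mul_row (k : ℤ) (g : SL(2, ℤ)) : (T ^ k * g) 1 0 = g 1 0 ∧ (T ^ k * g) 1 1 = g 1 1 := by simp

theorem stripRep_row (z : ℍ) (v : Rw) :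
    (stripRep z v : SL(2, ℤ)) 1 0 = v.1.1 ∧ (stripRep z v : SL(2, ℤ)) 1 1 = v.1.2 := by
  have h := T_zpow_mul_row (2 * (-⌊(rowRep v • z).re / 2⌋)) (rowRep v)
  exact ⟨h.1.trans (rowRep_zero v), h.2.trans (rowRep_one v)⟩

theorem stripRep_mem (z : ℍ) (v : Rw) : (stripRep z v : SL(2, ℤ)) • z ∈ strip2 := by
  unfold stripRep
  simp only [mul_smul]
  constructor
  · rw [re_zpow_smul]; push_cast
    have := Int.floor_le ((rowRep v • z).re / 2)
    linarith
  · rw [re_zpow_smul]; push_cast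
    have := Int.lt_floor_add_one ((rowRep v • z).re / 2)
    linarith

theorem eq_stripRep {z : ℍ} {γ : Γ₂} (h : (γ : SL(2, ℤ)) • z ∈ strip2) :
    stripRep z (rowOf γ) = γ := by
  obtain ⟨l, hl⟩ := exists_two_zpow_mul γ.2 (v := rowOf γ) rfl rfl
  apply Subtype.ext
  rw [hl, mul_smul] at h
  obtain ⟨h1, h2⟩ := h
  rw [re_zpow_smul] at h1 h2
  push_cast at h1 h2
  have : ⌊(rowRep (rowOf γ) • z).re / 2⌋ = -l := by
    rw [Int.floor_eq_iff]; grind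
  rw [hl]
  simp only [stripRep, this, neg_neg]

/-- The function on `ℍ` whose `Γ(2)`-average is the pairing. -/
def unfoldFn (m κ : ℕ) (α β : ℝ → ℝ) : ℍ → ℝ :=
  strip2.indicator fun z => (seedFn m α z * conj (poin m κ β z)).re * thetaWt z

theorem tsum_unfoldFn (hα : IsSeed y₀ A α) (m κ : ℕ) (z : ℍ) :
    ∑' γ : Γ₂, unfoldFn m κ α β ((γ : SL(2, ℤ)) • z) = poinPair m κ α β z := by
  have hinj : Function.Injective (stripRep z) := by
    intro v w h
    have hv := stripRep_row z v
    have hw := stripRep_row z w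
    rw [h] at hv
    exact Subtype.ext (Prod.ext (hv.1.symm.trans hw.1) (hv.2.symm.trans hw.2))
  rw [← hinj.tsum_eq (f := fun γ : Γ₂ => unfoldFn m κ α β ((γ : SL(2, ℤ)) • z))]
  · have hterm : ∀ v : Rw, unfoldFn m κ α β ((stripRep z v : SL(2, ℤ)) • z) =
        ((chiFac v.1 z ^ κ * seedFn m α (rowRep v • z)) * conj (poin m κ β z)).re * thetaWt z := by
      intro v
      rw [unfoldFn, indicator_of_mem (stripRep_mem z v), thetaWt_smul (stripRep z v).2,
        seedFn_smul_eq (stripRep z v).2 (stripRep_row z v).1 (stripRep_row z v).2]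
      have h := poin_smul m κ β (stripRep z v) z
      rw [(stripRep_row z v).1, (stripRep_row z v).2] at h
      have hn : chiFac v.1 z ^ κ * conj (chiFac v.1 z ^ κ) = 1 := by
        rw [mul_conj, normSq_eq_norm_sq, norm_pow, norm_chiFac v.2.1]; simp
      grind
    simp_rw [hterm]
    have h1 : poin m κ α z * conj (poin m κ β z) =
        ∑' v : Rw, chiFac v.1 z ^ κ * seedFn m α (rowRep v • z) * conj (poin m κ β z) := by
      rw [tsum_mul_right]; rfl
    rw [tsum_mul_right, poinPair, h1, re_tsum ((hα.summable m κ z).mul_right _)]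
  · intro γ hγ
    refine ⟨rowOf γ, eq_stripRep ?_⟩
    by_contra hne
    exact hγ (indicator_of_notMem hne _)

theorem volume_strip2_lt_top (hy : 0 < y₀) : volume (strip2 ∩ {z | y₀ ≤ z.im}) < ⊤ := by
  have hms : MeasurableSet (strip2 ∩ {z | y₀ ≤ z.im}) :=
    measurableSet_strip2.inter (measurableSet_le measurable_const UpperHalfPlane.continuous_im.measurable)
  rw [← lintegral_indicator_one hms, lintegral_uhp (measurable_one.indicator hms)]
  have hint : IntegrableOn (fun y : ℝ => y ^ (-2 : ℝ)) (Ioi y₀) :=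
    integrableOn_Ioi_rpow_of_lt (by norm_num) hy
  rw [← integrableOn_Ici_iff_integrableOn_Ioi] at hint
  have h2 := hint.2
  rw [hasFiniteIntegral_iff_enorm, ← lintegral_indicator measurableSet_Ici] at h2
  have h3 := ENNReal.mul_lt_top h2 (by simp : (2 : ℝ≥0∞) < ⊤)
  refine lt_of_le_of_lt ?_ h3
  rw [← lintegral_mul_const' _ _ (by simp), ← lintegral_indicator measurableSet_Ioi]
  refine lintegral_mono fun y => ?_
  by_cases hy0 : 0 < y
  · rw [indicator_of_mem (by exact hy0)]
    by_cases hyy : y₀ ≤ y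
    · rw [indicator_of_mem (by exact hyy)]
      have : ∀ x : ℝ, ENNReal.ofReal (1 / y ^ 2) * (strip2 ∩ {z | y₀ ≤ z.im}).indicator 1 (rectCoord (y, x)) ≤
          (Set.Ico (0 : ℝ) 2).indicator (fun _ => ENNReal.ofReal (1 / y ^ 2)) x := by
        intro x
        by_cases hx : x ∈ Set.Ico (0 : ℝ) 2
        · rw [indicator_of_mem hx]
          calc _ ≤ ENNReal.ofReal (1 / y ^ 2) * 1 := by
                gcongr; exact Set.indicator_le_self' (by simp) _
            _ = _ := mul_one _
        · rw [indicator_of_notMem hx, indicator_of_notMem]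
          · simp
          · rintro ⟨⟨h1, h2⟩, -⟩
            rw [re_rectCoord hy0] at h1 h2
            exact hx ⟨h1, h2⟩
      refine (lintegral_mono this).trans ?_
      rw [lintegral_indicator measurableSet_Ico, lintegral_const]
      simp only [Measure.restrict_apply MeasurableSet.univ, Set.univ_inter, volume_Ico, sub_zero]
      rw [enorm_of_nonneg (by positivity), rpow_neg hy0.le]
      norm_num
    · have : ∀ x : ℝ, ENNReal.ofReal (1 / y ^ 2) * (strip2 ∩ {z | y₀ ≤ z.im}).indicator 1 (rectCoord (y, x)) = 0 := by
        intro x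
        rw [indicator_of_notMem, mul_zero]
        rintro ⟨-, h⟩
        rw [Set.mem_ofPred_eq, im_rectCoord hy0] at h
        exact hyy h
      simp_all
  simp_all

theorem stronglyMeasurable_unfoldFn (hα : IsSeed y₀ A α) (hβ : IsSeed y₁ B β)
    (m κ : ℕ) : StronglyMeasurable (unfoldFn m κ α β) := by
  refine StronglyMeasurable.indicator ?_ measurableSet_strip2
  exact ((Complex.continuous_re.comp ((continuous_seedFn hα.cont).mul
    (continuous_conj.comp (hβ.continuous_poin m κ)))).mul continuous_thetaWt).stronglyMeasurable

theorem abs_unfoldFn_le (hα : IsSeed y₀ A α) (hβ : IsSeed y₁ B β)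
    (hm : 1 ≤ m) (κ : ℕ) (z : ℍ) :
    |unfoldFn m κ α β z| ≤ (strip2 ∩ {z | y₀ ≤ z.im}).indicator (fun _ => A * poinBd y₁ B) z := by
  have hA : 0 ≤ A := (abs_nonneg _).trans (hα.bdd 0)
  by_cases hz : z ∈ strip2
  · by_cases hy : y₀ ≤ z.im
    · rw [unfoldFn, indicator_of_mem hz,
        indicator_of_mem (show z ∈ strip2 ∩ {z | y₀ ≤ z.im} from ⟨hz, hy⟩)]
      have h1 : ‖seedFn m α z‖ * √(thetaWt z) ≤ A := by
        refine abs_le_of_sq_le_sq' ?_ hA |>.2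
        rw [mul_pow, sq_sqrt (thetaWt_nonneg _)]
        exact norm_seedFn_sq_mul_thetaWt_le hm hα.bdd _
      have h2 := hβ.norm_poin_le hm κ z
      have h3 : |(seedFn m α z * conj (poin m κ β z)).re * thetaWt z| ≤
          (‖seedFn m α z‖ * √(thetaWt z)) * (‖poin m κ β z‖ * √(thetaWt z)) := by
        rw [abs_mul, abs_of_nonneg (thetaWt_nonneg z)]
        calc _ ≤ ‖seedFn m α z * conj (poin m κ β z)‖ * thetaWt z := by
              gcongr
              · exact thetaWt_nonneg z
              bound
          _ = _ := by
              rw [norm_mul, norm_conj]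
              nth_rewrite 1 [← mul_self_sqrt (thetaWt_nonneg z)]; ring
      exact h3.trans (mul_le_mul h1 h2 (by positivity) hA)
    · rw [unfoldFn, indicator_of_mem hz, indicator_of_notMem (fun h => hy h.2), seedFn,
        hα.zero _ (not_le.mp hy)]
      simp
  · rw [unfoldFn, indicator_of_notMem hz, indicator_of_notMem (fun h => hz h.1), abs_zero]

theorem integrable_unfoldFn (hα : IsSeed y₀ A α) (hβ : IsSeed y₁ B β)
    (hm : 1 ≤ m) (κ : ℕ) : Integrable (unfoldFn m κ α β) := by
  have hms : MeasurableSet (strip2 ∩ {z | y₀ ≤ z.im}) :=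
    measurableSet_strip2.inter (measurableSet_le measurable_const UpperHalfPlane.continuous_im.measurable)
  refine Integrable.mono' (g := (strip2 ∩ {z | y₀ ≤ z.im}).indicator (fun _ => A * poinBd y₁ B)) ?_
    (stronglyMeasurable_unfoldFn hα hβ m κ).aestronglyMeasurable
    (Eventually.of_forall fun z => abs_unfoldFn_le hα hβ hm κ z)
  rw [integrable_indicator_iff hms]
  exact integrableOn_const (volume_strip2_lt_top hα.pos).ne

theorem bform_eq_integral (hα : IsSeed y₀ A α) (hβ : IsSeed y₁ B β)
    (hm : 1 ≤ m) (κ : ℕ) : bform m κ α β = ∫ z, unfoldFn m κ α β z := by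
  rw [← sum_integral_coset (stronglyMeasurable_unfoldFn hα hβ m κ) (integrable_unfoldFn hα hβ hm κ)]
  simp only [tsum_unfoldFn hα]
  rfl

/-- Bochner integrals over `ℍ` in rectangular coordinates. -/
theorem integral_uhp {H : ℍ → ℝ} (hm : StronglyMeasurable H) (hi : Integrable H) :
    ∫ z, H z = ∫ y in Ioi (0 : ℝ), ∫ x, 1 / y ^ 2 * H (rectCoord (y, x)) := by
  have hd : Measurable fun p : ℝ × ℝ => ENNReal.ofReal (1 / p.1 ^ 2) := by fun_prop
  have h1 := hi
  rw [volume_uhp_eq] at h1 ⊢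
  rw [integral_map measurable_rectCoord.aemeasurable hm.aestronglyMeasurable,
    integral_withDensity_eq_integral_toReal_smul hd (Eventually.of_forall fun _ => ofReal_lt_top)]
  rw [integrable_map_measure hm.aestronglyMeasurable measurable_rectCoord.aemeasurable,
    integrable_withDensity_iff_integrable_smul' hd (Eventually.of_forall fun _ => ofReal_lt_top)] at h1
  refine (integral_prod _ h1).trans ?_
  refine setIntegral_congr_fun measurableSet_Ioi fun y hy => ?_
  refine integral_congr_ae (Eventually.of_forall fun x => ?_)
  simp only [smul_eq_mul, Function.comp]
  rw [toReal_ofReal (by positivity)]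

/-- The Fourier coefficients of `θ³ P`. -/
def fourC (n m κ : ℕ) (β : ℝ → ℝ) (y : ℝ) : ℂ :=
  ∫ x in (0 : ℝ)..2, jacobiTheta (rectCoord (y, x)) ^ 3 * poin m κ β (rectCoord (y, x)) * cexp (-(π * I * n * x))

theorem continuous_rectCoord (hy : 0 < y) : Continuous fun x : ℝ => rectCoord (y, x) := by
  rw [UpperHalfPlane.isEmbedding_coe.continuous_iff]
  have : (UpperHalfPlane.coe ∘ fun x : ℝ => rectCoord (y, x)) = fun x : ℝ => (x : ℂ) + y * I := by
    ext1 x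
    simp only [Function.comp]
    rw [coe_rectCoord hy]
    apply Complex.ext <;> simp
  rw [this]; fun_prop

theorem bform_eq_fourC (hα : IsSeed y₀ A α) (hβ : IsSeed y₁ B β)
    (hm : 1 ≤ m) (κ : ℕ) :
    bform m κ α β = ∫ y in Ioi (0 : ℝ),
      α y * y ^ (-1 / 2 : ℝ) * Real.exp (-(π * m * y)) * (fourC m m κ β y).re := by
  rw [bform_eq_integral hα hβ hm, integral_uhp (stronglyMeasurable_unfoldFn hα hβ m κ) (integrable_unfoldFn hα hβ hm κ)]
  refine setIntegral_congr_fun measurableSet_Ioi fun y hy => ?_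
  have hy' : 0 < y := hy
  have hpt : ∀ x : ℝ, 1 / y ^ 2 * unfoldFn m κ α β (rectCoord (y, x)) =
      (Set.Ico (0 : ℝ) 2).indicator (fun x => α y * y ^ (-1 / 2 : ℝ) * Real.exp (-(π * m * y)) *
        (jacobiTheta (rectCoord (y, x)) ^ 3 * poin m κ β (rectCoord (y, x)) * cexp (-(π * I * m * x))).re) x := by
    intro x
    have hiff : rectCoord (y, x) ∈ strip2 ↔ x ∈ Set.Ico (0 : ℝ) 2 := by
      simp only [strip2, Set.mem_ofPred_eq, re_rectCoord (p := (y, x)) hy', Set.mem_Ico]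
    by_cases hx : x ∈ Set.Ico (0 : ℝ) 2
    · rw [unfoldFn, indicator_of_mem hx, indicator_of_mem (hiff.mpr hx)]
      set θ := jacobiTheta (rectCoord (y, x)) with hθ
      have hθ0 : θ ≠ 0 := jacobiTheta_ne_zero _
      set P := poin m κ β (rectCoord (y, x))
      have hexp : cexp (π * I * m * (rectCoord (y, x) : ℍ)) = cexp (π * I * m * x) * Real.exp (-(π * m * y)) := by
        rw [coe_rectCoord (p := (y, x)) hy', ofReal_exp, ← Complex.exp_add]
        congr 1
        have : (⟨x, y⟩ : ℂ) = x + y * I := by apply Complex.ext <;> simp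
        rw [this]; push_cast
        linear_combination (π * m * y : ℂ) * I_sq
      have hconj : conj (cexp (-(π * I * m * x))) = cexp (π * I * m * x) := by
        rw [← exp_conj]; congr 1; simp
      have hre : ((jacobiTheta (rectCoord (y, x)) ^ 3 * P * cexp (-(π * I * m * x))).re) =
          (conj θ ^ 3 * conj P * cexp (π * I * m * x)).re := by
        rw [← hconj, ← map_pow, ← map_mul, ← map_mul, conj_re]
      have hn : θ * conj θ = ((‖θ‖ ^ 2 : ℝ) : ℂ) := by
        rw [mul_conj, normSq_eq_norm_sq]
      have hpow : y ^ (3 / 2 : ℝ) = y ^ 2 * y ^ (-1 / 2 : ℝ) := by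
        rw [← rpow_natCast y 2, ← rpow_add hy']; norm_num
      rw [hre, seedFn, im_rectCoord (p := (y, x)) hy', ← hθ, hexp, thetaWt, im_rectCoord (p := (y, x)) hy', ← hθ, hpow]
      have e1 : ((‖θ‖ ^ 6 : ℝ) : ℂ) = θ ^ 3 * conj θ ^ 3 := by
        rw [← mul_pow, hn]; push_cast; ring
      have e2 : ((α y : ℂ) * (cexp (π * I * m * x) * Real.exp (-(π * m * y))) / θ ^ 3 * conj P).re * ‖θ‖ ^ 6 =
          α y * Real.exp (-(π * m * y)) * (conj θ ^ 3 * conj P * cexp (π * I * m * x)).re := by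
        rw [← re_mul_ofReal, e1, ← re_ofReal_mul]
        congr 1
        push_cast
        field_simp
      have hy2 : y ^ 2 ≠ 0 := by positivity
      grind
    · rw [unfoldFn, indicator_of_notMem hx, indicator_of_notMem (fun h => hx (hiff.mp h)), mul_zero]
  simp_rw [hpt]
  rw [integral_indicator measurableSet_Ico, integral_const_mul, fourC,
    integral_of_le (by norm_num), integral_Ico_eq_integral_Ioc]
  congr 1
  have hc : Continuous fun x : ℝ => jacobiTheta (rectCoord (y, x)) ^ 3 * poin m κ β (rectCoord (y, x)) *
      cexp (-(π * I * m * x)) := by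
    have h1 := continuous_jacobiTheta_uhp.comp (continuous_rectCoord hy')
    have h2 := (hβ.continuous_poin m κ).comp (continuous_rectCoord hy')
    fun_prop
  have hi := (hc.integrableOn_Icc (μ := volume) (a := 0) (b := 2)).mono_set Set.Ioc_subset_Icc_self
  exact integral_re hi

theorem contDiffAt_mul_im_comp {h G : ℂ → ℂ} {w₀ : ℂ} (hh : AnalyticAt ℂ h w₀) (hG : AnalyticAt ℂ G w₀)
    (hα : ContDiff ℝ 1 α) : ContDiffAt ℝ 1 (fun w => (α (G w).im : ℂ) * h w) w₀ := by
  have h1 : ContDiffAt ℝ 1 h w₀ := (hh.contDiffAt (n := 1)).restrict_scalars ℝ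
  have h2 : ContDiffAt ℝ 1 G w₀ := (hG.contDiffAt (n := 1)).restrict_scalars ℝ
  have h3 : ContDiffAt ℝ 1 (fun w => (G w).im) w₀ := imCLM.contDiff.contDiffAt.comp w₀ h2
  have h4 : ContDiffAt ℝ 1 (fun w => α (G w).im) w₀ := hα.contDiffAt.comp w₀ h3
  exact (ofRealCLM.contDiff.contDiffAt.comp w₀ h4).mul h1

theorem dbar_mul_im_comp {h G : ℂ → ℂ} {w₀ : ℂ} (hh : AnalyticAt ℂ h w₀) (hG : AnalyticAt ℂ G w₀)
    (hα : ContDiff ℝ 1 α) :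
    fderiv ℝ (fun w => (α (G w).im : ℂ) * h w) w₀ 1 + I * fderiv ℝ (fun w => (α (G w).im : ℂ) * h w) w₀ I =
      I * conj (deriv G w₀) * deriv α (G w₀).im * h w₀ := by
  have h1 := hh.differentiableAt.hasDerivAt.hasFDerivAt.restrictScalars ℝ
  have h2 := hG.differentiableAt.hasDerivAt.hasFDerivAt.restrictScalars ℝ
  have h3 := (imCLM.hasFDerivAt (x := G w₀)).comp w₀ h2
  have h4 := ((hα.differentiable one_ne_zero) (G w₀).im).hasDerivAt.hasFDerivAt
  have h4' : HasFDerivAt α _ ((imCLM ∘ G) w₀) := h4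
  have h5 := (ofRealCLM.hasFDerivAt (x := α (G w₀).im)).comp w₀ (h4'.comp w₀ h3)
  have h6 := h5.mul h1
  have h7 : HasFDerivAt (fun w => (α (G w).im : ℂ) * h w) _ w₀ := h6
  rw [h7.fderiv]
  have hc : conj (deriv G w₀) = (deriv G w₀).re - (deriv G w₀).im * I := by
    apply Complex.ext <;> simp
  rw [hc]
  simp
  ring_nf
  simp

/-- The operator `y d/dy`. -/
def Dop (α : ℝ → ℝ) (y : ℝ) : ℝ := y * deriv α y

/-- The holomorphic factor in the terms of the Poincaré series. -/
def holTerm (m : ℕ) (j : Fin 3) (g : SL(2, ℤ)) (w : ℂ) : ℂ :=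
  cuspTheta j w ^ 3 * (cexp (π * I * m * ((g 0 0 * w + g 0 1) / (g 1 0 * w + g 1 1))) /
    jacobiTheta ((g 0 0 * w + g 0 1) / (g 1 0 * w + g 1 1)) ^ 3)

theorem moeb_facts (g : SL(2, ℤ)) (hw : 0 < w.im) :
    (g 1 0 * w + g 1 1 : ℂ) ≠ 0 ∧ ((g 0 0 * w + g 0 1 : ℂ) / (g 1 0 * w + g 1 1)) = ((g • ofComplex w : ℍ) : ℂ) := by
  have hz : ((ofComplex w : ℍ) : ℂ) = w := by rw [ofComplex_apply_of_im_pos hw]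
  have h1 := lowj_ne_zero g (ofComplex w)
  have h2 := coe_smul_eq_div g (ofComplex w)
  rw [lowj, hz] at h1
  lia

theorem analyticAt_moeb (g : SL(2, ℤ)) (hw : 0 < w.im) :
    AnalyticAt ℂ (fun w => (g 0 0 * w + g 0 1 : ℂ) / (g 1 0 * w + g 1 1)) w := by
  have hopen : {w : ℂ | 0 < w.im} ∈ 𝓝 w := (isOpen_lt continuous_const Complex.continuous_im).mem_nhds hw
  refine DifferentiableOn.analyticAt (s := {w : ℂ | 0 < w.im}) (fun u hu => ?_) hopen
  have := (moeb_facts g (w := u) hu).1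
  refine DifferentiableAt.differentiableWithinAt ?_
  fun_prop

theorem deriv_moeb (g : SL(2, ℤ)) (hw : 0 < w.im) :
    deriv (fun w => (g 0 0 * w + g 0 1 : ℂ) / (g 1 0 * w + g 1 1)) w = 1 / (g 1 0 * w + g 1 1) ^ 2 := by
  have h0 := (moeb_facts g hw).1
  have h1 : HasDerivAt (fun w : ℂ => (g 0 0 * w + g 0 1 : ℂ)) (g 0 0) w := by
    simpa using ((hasDerivAt_id w).const_mul (g 0 0 : ℂ)).add_const (g 0 1 : ℂ)
  have h2 : HasDerivAt (fun w : ℂ => (g 1 0 * w + g 1 1 : ℂ)) (g 1 0) w := by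
    simpa using ((hasDerivAt_id w).const_mul (g 1 0 : ℂ)).add_const (g 1 1 : ℂ)
  rw [(h1.fun_div h2 h0).deriv]
  congr 1
  have hd : (g 0 0 * g 1 1 - g 0 1 * g 1 0 : ℂ) = 1 := by exact_mod_cast det_entries g
  linear_combination hd

theorem analyticAt_holTerm (m : ℕ) (j : Fin 3) (g : SL(2, ℤ)) (hw : 0 < w.im) :
    AnalyticAt ℂ (holTerm m j g) w := by
  have hopen : {w : ℂ | 0 < w.im} ∈ 𝓝 w := (isOpen_lt continuous_const Complex.continuous_im).mem_nhds hw
  refine DifferentiableOn.analyticAt (s := {w : ℂ | 0 < w.im}) (fun u hu => ?_) hopen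
  refine DifferentiableAt.differentiableWithinAt ?_
  have hM := (analyticAt_moeb g (w := u) hu).differentiableAt
  have hMz := (moeb_facts g (w := u) hu).2
  have hθ : DifferentiableAt ℂ jacobiTheta ((g 0 0 * u + g 0 1 : ℂ) / (g 1 0 * u + g 1 1)) := by
    rw [hMz]; exact differentiableAt_jacobiTheta (g • ofComplex u).im_pos
  have hθ0 : jacobiTheta ((g 0 0 * u + g 0 1 : ℂ) / (g 1 0 * u + g 1 1)) ^ 3 ≠ 0 := by
    rw [hMz]; exact pow_ne_zero _ (jacobiTheta_ne_zero _)
  have h1 : DifferentiableAt ℂ (fun w => jacobiTheta ((g 0 0 * w + g 0 1 : ℂ) / (g 1 0 * w + g 1 1))) u :=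
    DifferentiableAt.comp (g := jacobiTheta) u hθ hM
  unfold holTerm
  exact ((differentiableAt_cuspTheta j hu).pow 3).mul
    (((hM.const_mul _).cexp).div (h1.pow 3) hθ0)

theorem holTerm_mul_seed (m : ℕ) (j : Fin 3) (g : SL(2, ℤ)) (α : ℝ → ℝ) (hw : 0 < w.im) :
    cuspTheta j w ^ 3 * seedFn m α (g • ofComplex w) =
      (α ((g 0 0 * w + g 0 1 : ℂ) / (g 1 0 * w + g 1 1)).im : ℂ) * holTerm m j g w := by
  rw [holTerm, (moeb_facts g hw).2, seedFn, coe_im]; ring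

theorem dbar_term (m : ℕ) (j : Fin 3) (g : SL(2, ℤ)) (α : ℝ → ℝ) (hw : 0 < w.im) :
    I * conj (1 / (g 1 0 * w + g 1 1) ^ 2 : ℂ) *
      deriv α ((g 0 0 * w + g 0 1 : ℂ) / (g 1 0 * w + g 1 1)).im * holTerm m j g w =
      I / w.im * cuspTheta j w ^ 3 * (chiFac (g 1 0, g 1 1) (ofComplex w) * seedFn m (Dop α) (g • ofComplex w)) := by
  have h0 := (moeb_facts g hw).1
  have hz : ((ofComplex w : ℍ) : ℂ) = w := by rw [ofComplex_apply_of_im_pos hw]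
  have him : (ofComplex w).im = w.im := by rw [← coe_im, hz]
  have h1 := holTerm_mul_seed m j g (Dop α) hw
  rw [show I / w.im * cuspTheta j w ^ 3 * (chiFac (g 1 0, g 1 1) (ofComplex w) * seedFn m (Dop α) (g • ofComplex w)) =
    I / w.im * chiFac (g 1 0, g 1 1) (ofComplex w) * (cuspTheta j w ^ 3 * seedFn m (Dop α) (g • ofComplex w)) by ring,
    h1, Dop, (moeb_facts g hw).2, coe_im, im_smul_lowj, him, chiFac, rowj, lowj, hz]
  set J : ℂ := g 1 0 * w + g 1 1
  have hJ : ((‖J‖ ^ 2 : ℝ) : ℂ) = J * conj J := by rw [mul_conj, normSq_eq_norm_sq]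
  have hJ0 : conj J ≠ 0 := by simpa using h0
  have hy : (w.im : ℂ) ≠ 0 := by exact_mod_cast hw.ne'
  rw [ofReal_mul, ofReal_div, hJ]
  simp only [map_div₀, map_one, map_pow]
  field_simp

/-- `θ_j³ P` near the cusp `j`. -/
def cuspFun (m : ℕ) (j : Fin 3) (α : ℝ → ℝ) (w : ℂ) : ℂ :=
  cuspTheta j w ^ 3 * poin m 0 α (cuspRep j • ofComplex w)

/-- The image of `cuspFun` under `∂_x + i ∂_y`. -/
def cuspDbar (m : ℕ) (j : Fin 3) (α : ℝ → ℝ) (w : ℂ) : ℂ :=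
  I / w.im * cuspTheta j w ^ 3 * (chiFac (cuspRep j 1 0, cuspRep j 1 1) (ofComplex w) *
    poin m 1 (Dop α) (cuspRep j • ofComplex w))

theorem cuspFun_local (h : IsSeed y₀ A α) (m : ℕ) (j : Fin 3) {w₀ : ℂ} (hw : 0 < w₀.im) :
    ∃ F : Finset Rw, ∀ F' : Finset Rw, F ⊆ F' → cuspFun m j α =ᶠ[𝓝 w₀] fun w => ∑ v ∈ F',
      (α (((rowRep v * cuspRep j) 0 0 * w + (rowRep v * cuspRep j) 0 1 : ℂ) /
        ((rowRep v * cuspRep j) 1 0 * w + (rowRep v * cuspRep j) 1 1)).im : ℂ) * holTerm m j (rowRep v * cuspRep j) w := by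
  obtain ⟨F, hF⟩ := h.exists_finset m (cuspRep j • ofComplex w₀)
  refine ⟨F, fun F' hFF => ?_⟩
  have hopen : {w : ℂ | 0 < w.im} ∈ 𝓝 w₀ := (isOpen_lt continuous_const Complex.continuous_im).mem_nhds hw
  have hcont : ContinuousAt (fun w : ℂ => ‖((cuspRep j • ofComplex w : ℍ) : ℂ) - (cuspRep j • ofComplex w₀ : ℍ)‖) w₀ := by
    have h1 : ContinuousAt (fun w : ℂ => ((cuspRep j • ofComplex w : ℍ) : ℂ)) w₀ := by
      refine (analyticAt_moeb (cuspRep j) hw).continuousAt.congr ?_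
      filter_upwards [hopen] with w hw'
      exact (moeb_facts _ hw').2
    fun_prop
  have hlt : ‖((cuspRep j • ofComplex w₀ : ℍ) : ℂ) - (cuspRep j • ofComplex w₀ : ℍ)‖ <
      (cuspRep j • ofComplex w₀ : ℍ).im / 2 := by simpa using half_pos (cuspRep j • ofComplex w₀ : ℍ).im_pos
  filter_upwards [hopen, hcont.eventually (gt_mem_nhds hlt)] with w hw' hnear
  rw [cuspFun, poin, tsum_eq_sum (s := F') (fun v hv => by grind), mul_sum]
  refine sum_congr rfl fun v _ => ?_
  rw [pow_zero, one_mul, ← mul_smul, holTerm_mul_seed m j _ α hw']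

theorem contDiffAt_cuspFun (h : IsSeed y₀ A α) (hα : ContDiff ℝ 1 α) (m : ℕ) (j : Fin 3)
    {w₀ : ℂ} (hw : 0 < w₀.im) : ContDiffAt ℝ 1 (cuspFun m j α) w₀ := by
  obtain ⟨F, hF⟩ := cuspFun_local h m j hw
  refine ContDiffAt.congr_of_eventuallyEq ?_ (hF F subset_rfl)
  refine ContDiffAt.sum fun v _ => ?_
  exact contDiffAt_mul_im_comp (analyticAt_holTerm m j _ hw) (analyticAt_moeb _ hw) hα

theorem dbar_cuspFun (h : IsSeed y₀ A α) (hD : IsSeed y₀ B (Dop α)) (hα : ContDiff ℝ 1 α)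
    (m : ℕ) (j : Fin 3) {w₀ : ℂ} (hw : 0 < w₀.im) :
    fderiv ℝ (cuspFun m j α) w₀ 1 + I * fderiv ℝ (cuspFun m j α) w₀ I = cuspDbar m j α w₀ := by
  classical
  obtain ⟨F, hF⟩ := cuspFun_local h m j hw
  obtain ⟨F₂, hF₂⟩ := hD.exists_finset m (cuspRep j • ofComplex w₀)
  rw [(hF (F ∪ F₂) Finset.subset_union_left).fderiv_eq, fderiv_fun_sum fun v _ =>
    (contDiffAt_mul_im_comp (analyticAt_holTerm m j _ hw) (analyticAt_moeb _ hw) hα).differentiableAt one_ne_zero]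
  rw [_root_.sum_apply, _root_.sum_apply, mul_sum, ← sum_add_distrib,
    cuspDbar, poin, tsum_eq_sum (s := F ∪ F₂), mul_sum, mul_sum]
  · refine sum_congr rfl fun v _ => ?_
    rw [dbar_mul_im_comp (analyticAt_holTerm m j _ hw) (analyticAt_moeb _ hw) hα, deriv_moeb _ hw,
      dbar_term m j _ α hw, pow_one, ← mul_smul]
    have h1 : (((rowRep v * cuspRep j) 1 0, (rowRep v * cuspRep j) 1 1) : ℤ × ℤ) = rowMul v.1 (cuspRep j) := by
      rw [Matrix.SpecialLinearGroup.coe_mul]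
      simp [Matrix.mul_apply, Fin.sum_univ_two, rowMul, rowRep_zero, rowRep_one]
    rw [h1, ← chiFac_smul]
    ring
  · intro v hv
    rw [hF₂ _ (by simpa using (half_pos (cuspRep j • ofComplex w₀ : ℍ).im_pos).le) v
      (fun hv' => hv (Finset.mem_union_right _ hv')), mul_zero]

/-- The Fourier coefficient of frequency `ν/2` over a period of length two. -/
def modeC (f : ℂ → ℂ) (ν y : ℝ) : ℂ := ∫ x in (0 : ℝ)..2, f (x + y * I) * cexp (-(π * I * ν * x))

theorem isOpen_uhp_set : IsOpen {w : ℂ | 0 < w.im} := isOpen_lt continuous_const Complex.continuous_im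

theorem continuousOn_fderiv_uhp {f : ℂ → ℂ} (hf : ∀ w : ℂ, 0 < w.im → ContDiffAt ℝ 1 f w) (u : ℂ) :
    ContinuousOn (fun w => fderiv ℝ f w u) {w : ℂ | 0 < w.im} := by
  have h1 : ContDiffOn ℝ 1 f {w : ℂ | 0 < w.im} := fun w hw => (hf w hw).contDiffWithinAt
  have h2 := h1.continuousOn_fderiv_of_isOpen isOpen_uhp_set le_rfl
  fun_prop

theorem hasDerivAt_im_line {f : ℂ → ℂ} (hf : ∀ w : ℂ, 0 < w.im → ContDiffAt ℝ 1 f w) (x : ℝ) (hy : 0 < y) :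
    HasDerivAt (fun y : ℝ => f (x + y * I)) (fderiv ℝ f (x + y * I) I) y := by
  have h1 := ((hf (x + y * I) (by simpa using hy)).differentiableAt one_ne_zero).hasFDerivAt
  have h2 : HasDerivAt (fun y : ℝ => (x + y * I : ℂ)) I y := by
    simpa using ((ofRealCLM.hasDerivAt (x := y)).mul_const I).const_add (x : ℂ)
  exact h1.comp_hasDerivAt y h2

theorem hasDerivAt_re_line {f : ℂ → ℂ} (hf : ∀ w : ℂ, 0 < w.im → ContDiffAt ℝ 1 f w) (x : ℝ) (hy : 0 < y) :
    HasDerivAt (fun x : ℝ => f (x + y * I)) (fderiv ℝ f (x + y * I) 1) x := by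
  have h1 := ((hf (x + y * I) (by simpa using hy)).differentiableAt one_ne_zero).hasFDerivAt
  have h2 : HasDerivAt (fun x : ℝ => (x + y * I : ℂ)) 1 x := by
    simpa using (ofRealCLM.hasDerivAt (x := x)).add_const (y * I : ℂ)
  exact h1.comp_hasDerivAt x h2

theorem continuous_line {F : ℂ → ℂ} (hF : ContinuousOn F {w : ℂ | 0 < w.im}) (hy : 0 < y) :
    Continuous fun x : ℝ => F (x + y * I) :=
  hF.comp_continuous (by fun_prop) fun x => by simpa using hy

theorem continuousOn_modeC {F : ℂ → ℂ} (hF : ContinuousOn F {w : ℂ | 0 < w.im}) (ν : ℝ) :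
    ContinuousOn (modeC F ν) (Ioi 0) := by
  have : Continuous fun y : Ioi (0 : ℝ) => modeC F ν y := by
    unfold modeC
    refine intervalIntegral.continuous_parametric_intervalIntegral_of_continuous' ?_ _ _
    refine Continuous.mul ?_ (by fun_prop)
    refine hF.comp_continuous (by fun_prop) fun p => ?_
    aesop
  exact continuousOn_iff_continuous_domRestrict.mpr this

theorem hasDerivAt_modeC {f : ℂ → ℂ} (hf : ∀ w : ℂ, 0 < w.im → ContDiffAt ℝ 1 f w) {ν : ℝ}
    (hper : ∀ w : ℂ, 0 < w.im → f (w + 2) = cexp (2 * π * I * ν) * f w) (hy : 0 < y) :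
    HasDerivAt (modeC f ν) (-(π * ν) * modeC f ν y -
      I * modeC (fun w => fderiv ℝ f w 1 + I * fderiv ℝ f w I) ν y) y := by
  have hfc : ContinuousOn f {w : ℂ | 0 < w.im} := fun w hw => (hf w hw).continuousAt.continuousWithinAt
  have hx := continuousOn_fderiv_uhp hf 1
  have hI := continuousOn_fderiv_uhp hf I
  set e : ℝ → ℂ := fun x => cexp (-(π * I * ν * x)) with he
  have hec : Continuous e := by fun_prop
  have hen : ∀ x, ‖e x‖ = 1 := by
    intro x
    rw [he]; simp only
    rw [show (-(π * I * ν * x) : ℂ) = ((-(π * ν * x) : ℝ) : ℂ) * I by push_cast; ring, norm_exp_ofReal_mul_I]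
  have hcI := continuous_line hI hy
  have hcx := continuous_line hx hy
  have hcf := continuous_line hfc hy
  have hd1 : HasDerivAt (modeC f ν) (∫ x in (0 : ℝ)..2, fderiv ℝ f (x + y * I) I * e x) y := by
    obtain ⟨B, hB⟩ : ∃ B, ∀ p ∈ Set.Icc (0 : ℝ) 2 ×ˢ Set.Icc (y / 2) (2 * y),
        ‖fderiv ℝ f (p.1 + p.2 * I) I‖ ≤ B := by
      refine (isCompact_Icc.prod isCompact_Icc).exists_bound_of_continuousOn ?_
      refine hI.comp (by fun_prop) ?_
      rintro ⟨a, b⟩ ⟨-, hb⟩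
      have : 0 < b := lt_of_lt_of_le (by positivity) hb.1
      simpa using this
    refine (intervalIntegral.hasDerivAt_integral_of_dominated_loc_of_deriv_le
      (F := fun (y : ℝ) (x : ℝ) => f (x + y * I) * e x) (F' := fun (y : ℝ) (x : ℝ) => fderiv ℝ f (x + y * I) I * e x)
      (bound := fun _ => B) (s := Set.Ioo (y / 2) (2 * y)) (Ioo_mem_nhds (by linarith) (by linarith)) ?_ ?_ ?_ ?_ ?_ ?_).2
    · filter_upwards [lt_mem_nhds hy] with y' hy'
      exact ((continuous_line hfc hy').mul hec).aestronglyMeasurable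
    · exact (hcf.mul hec).intervalIntegrable _ _
    · exact (hcI.mul hec).aestronglyMeasurable
    · refine Eventually.of_forall fun x hx' y' hy' => ?_
      rw [Set.uIoc_of_le (by norm_num)] at hx'
      rw [norm_mul, hen, mul_one]
      exact hB (x, y') ⟨⟨hx'.1.le, hx'.2⟩, ⟨hy'.1.le, hy'.2.le⟩⟩
    · simp
    · refine Eventually.of_forall fun x hx' y' hy' => ?_
      have : 0 < y' := lt_trans (by positivity) hy'.1
      exact (hasDerivAt_im_line hf x this).mul_const _
  have hibp : ∫ x in (0 : ℝ)..2, fderiv ℝ f (x + y * I) 1 * e x = π * I * ν * modeC f ν y := by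
    have hde : ∀ x : ℝ, HasDerivAt e (-(π * I * ν) * e x) x := by
      intro x
      have h := ((ofRealCLM.hasDerivAt (x := x)).const_mul (-(π * I * ν) : ℂ)).cexp
      simp only [ofRealCLM_apply, ofReal_one, mul_one] at h
      convert h using 1
      · grind
      grind
    have h := intervalIntegral.integral_mul_deriv_eq_deriv_mul (a := 0) (b := 2) (u := fun x : ℝ => f (x + y * I))
      (v := e) (fun x _ => hasDerivAt_re_line hf x hy) (fun x _ => hde x)
      (hcx.intervalIntegrable _ _) ((continuous_const.mul hec).intervalIntegrable _ _)
    have hb : f ((2 : ℝ) + y * I) * e 2 - f ((0 : ℝ) + y * I) * e 0 = 0 := by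
      have h2 := hper (y * I) (by simpa using hy)
      rw [show ((2 : ℝ) + y * I : ℂ) = y * I + 2 by push_cast; ring, h2,
        show ((0 : ℝ) + y * I : ℂ) = y * I by simp, he]
      simp only
      rw [mul_right_comm, ← Complex.exp_add]
      push_cast; ring
    rw [hb, zero_sub] at h
    have h3 : ∫ x in (0 : ℝ)..2, f (x + y * I) * (-(π * I * ν) * e x) = -(π * I * ν) * modeC f ν y := by
      rw [modeC, ← intervalIntegral.integral_const_mul]
      grind
    grind
  convert hd1 using 1
  have h4 : modeC (fun w => fderiv ℝ f w 1 + I * fderiv ℝ f w I) ν y =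
      (∫ x in (0 : ℝ)..2, fderiv ℝ f (x + y * I) 1 * e x) + I * ∫ x in (0 : ℝ)..2, fderiv ℝ f (x + y * I) I * e x := by
    rw [modeC, ← intervalIntegral.integral_const_mul, ← intervalIntegral.integral_add
      (f := fun x : ℝ => fderiv ℝ f (x + y * I) 1 * e x) (g := fun x : ℝ => I * (fderiv ℝ f (x + y * I) I * e x))
      ((hcx.mul hec).intervalIntegrable _ _) ((continuous_const.mul (hcI.mul hec)).intervalIntegrable _ _)]
    grind
  rw [h4, hibp]
  linear_combination (-(π * ν * modeC f ν y) - (∫ x in (0 : ℝ)..2, fderiv ℝ f (x + y * I) I * e x)) * I_sq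

theorem coe_ofComplex (hw : 0 < w.im) : ((ofComplex w : ℍ) : ℂ) = w := by
  rw [ofComplex_apply_of_im_pos hw]

theorem im_ofComplex (hw : 0 < w.im) : (ofComplex w).im = w.im := by
  rw [← coe_im, coe_ofComplex hw]

theorem ofComplex_add_int (hw : 0 < w.im) (k : ℤ) : ofComplex (w + k) = T ^ k • ofComplex w := by
  apply UpperHalfPlane.ext
  rw [coe_T_zpow_smul, coe_ofComplex hw, coe_ofComplex (by simpa using hw)]

/-- The frequency shifts at the three cusps. -/
def cuspNu : Fin 3 → ℝ := ![0, 0, -1 / 4]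

theorem poin_zero_smul (m : ℕ) (α : ℝ → ℝ) {γ : SL(2, ℤ)} (hγ : γ ∈ Γ₂) (z : ℍ) :
    poin m 0 α (γ • z) = poin m 0 α z := by
  simpa using poin_smul m 0 α ⟨γ, hγ⟩ z

theorem cuspTheta_add_two (j : Fin 3) (w : ℂ) :
    cuspTheta j (w + 2) ^ 3 = cexp (2 * π * I * cuspNu j) * cuspTheta j w ^ 3 := by
  have h1 : jacobiTheta (w + 2) = jacobiTheta w := by
    have := jacobiTheta_add_two_mul 1 w
    simpa using this
  have h2 : cexp (2 * π * I * ((-1 / 4 : ℝ) : ℂ)) = -I := by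
    rw [show (2 * π * I * ((-1 / 4 : ℝ) : ℂ) : ℂ) = -(π / 2 * I) by push_cast; ring, Complex.exp_neg,
      exp_pi_div_two_mul_I, inv_I]
  fin_cases j
  · simp [cuspTheta, cuspNu, h1]
  · simp [cuspTheta, cuspNu, h1]
  · have h3 := thetaTwo_add_two w
    simp only [cuspTheta, cuspNu]
    show thetaTwo (w + 2) ^ 3 = cexp (2 * π * I * ((-1 / 4 : ℝ) : ℂ)) * thetaTwo w ^ 3
    rw [h2, h3, mul_pow, show I ^ 3 = -I by simp]

theorem cuspFun_add_two (m : ℕ) (j : Fin 3) (α : ℝ → ℝ) (hw : 0 < w.im) (k : ℤ) :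
    cuspFun m j α (w + 2) = cexp (2 * π * I * ((cuspNu j + k : ℝ) : ℂ)) * cuspFun m j α w := by
  have h1 : cuspRep j • ofComplex (w + 2) =
      (cuspRep j * T ^ (2 : ℤ) * (cuspRep j)⁻¹) • (cuspRep j • ofComplex w) := by
    have := ofComplex_add_int hw 2
    push_cast at this
    rw [this, ← mul_smul, ← mul_smul]
    congr 1
    group
  have h2 : cuspRep j * T ^ (2 : ℤ) * (cuspRep j)⁻¹ ∈ Γ₂ :=
    (CongruenceSubgroup.Gamma_normal 2).conj_mem _ (T_two_mul_mem 1) _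
  have h3 : cexp (2 * π * I * ((cuspNu j + k : ℝ) : ℂ)) = cexp (2 * π * I * cuspNu j) := by
    rw [show (2 * π * I * ((cuspNu j + k : ℝ) : ℂ) : ℂ) = 2 * π * I * cuspNu j + (k : ℂ) * (2 * π * I) by push_cast; ring,
      Complex.exp_add, exp_int_mul_two_pi_mul_I, mul_one]
  rw [cuspFun, cuspFun, h1, poin_zero_smul _ _ h2, cuspTheta_add_two, h3, mul_assoc]

theorem row_of_high (hy₀ : 0 < y₀) {z : ℍ} (hz : 1 / y₀ < z.im) {p : ℤ × ℤ} (hp : p ∈ cuspSet y₀ z) :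
    p.1 = 0 := by
  by_contra hne
  obtain ⟨-, h⟩ := hp
  rw [norm_rowj_sq] at h
  have h1 : (1 : ℝ) ≤ (p.1 : ℝ) ^ 2 := by
    have : 1 ≤ p.1 ^ 2 := by have := sq_pos_of_ne_zero hne; omega
    exact_mod_cast this
  have h2 : 1 < y₀ * z.im := by rwa [div_lt_iff₀' hy₀] at hz
  have hy := z.im_pos
  nlinarith [mul_pos hy₀ hy, sq_nonneg ((p.1 : ℝ) * z.re + p.2), mul_nonneg (mul_nonneg hy₀.le hy.le) (mul_nonneg hy.le (sub_nonneg.mpr h1))]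

theorem mem_cuspSet_rowMul (h : IsSeed y₀ A α) {v : Rw} {g : SL(2, ℤ)} {z : ℍ}
    (hne : seedFn m α (rowRep v • g • z) ≠ 0) : rowMul v.1 g ∈ cuspSet y₀ z :=
  (mem_cuspSet_smul g).mp (h.mem_cuspSet hne)

theorem cuspFun_eq_zero (h : IsSeed y₀ A α) (m : ℕ) {j : Fin 3} (hj : j ≠ 0)
    (hw : 0 < w.im) (hy : 1 / y₀ < w.im) : cuspFun m j α w = 0 := by
  have hz : ∀ v : Rw, seedFn m α (rowRep v • cuspRep j • ofComplex w) = 0 := by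
    intro v
    by_contra hne
    have h1 := row_of_high h.pos (by rwa [im_ofComplex hw]) (mem_cuspSet_rowMul h hne)
    have hev := v.2.2
    have hco := v.2.1
    have h2 : v.1.1 = 0 ∨ v.1.2 = 0 ∨ v.1.1 + v.1.2 = 0 → (v.1.2 = 0 ∨ v.1.1 + v.1.2 = 0) → False := by
      rintro - h3
      rcases h3 with h3 | h3
      · rw [h3, isCoprime_zero_right] at hco
        rw [Int.isUnit_iff] at hco
        grind
      · have h5 : v.1.2 = -v.1.1 := by omega
        rw [h5] at hco
        have := hco.neg_right
        rw [neg_neg, isCoprime_self, Int.isUnit_iff] at this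
        grind
    fin_cases j
    · exact hj rfl
    · simp [rowMul, cuspRep, S] at h1
      lia
    · simp [rowMul, cuspRep, coe_S, coe_T, Matrix.SpecialLinearGroup.coe_mul, Matrix.mul_apply, Fin.sum_univ_two] at h1
      lia
  rw [cuspFun, poin]
  simp_all

theorem poin_high (h : IsSeed y₀ A α) (m : ℕ) {z : ℍ} (hy : 1 / y₀ < z.im) :
    poin m 0 α z = 2 * seedFn m α z := by
  classical
  let v1 : Rw := ⟨(0, 1), by norm_num, by simp⟩
  let v2 : Rw := ⟨(0, -1), isCoprime_one_right.neg_right, by simp⟩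
  have hne : v1 ≠ v2 := by lia
  rw [poin, tsum_eq_sum (s := ({v1, v2} : Finset Rw)), Finset.sum_pair hne]
  · have e1 : seedFn m α (rowRep v1 • z) = seedFn m α z := by
      have := seedFn_smul_eq (m := m) (α := α) (g := 1) (one_mem _) (v := v1) (by simp [v1]) (by simp [v1]) z
      rw [← this, one_smul]
    have e2 : seedFn m α (rowRep v2 • z) = seedFn m α z := by
      have hm : (-1 : SL(2, ℤ)) ∈ Γ₂ := by simp
      have := seedFn_smul_eq (m := m) (α := α) (g := -1) hm (v := v2) (by simp [v2]) (by simp [v2]) z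
      simp_all
    rw [e1, e2]; ring
  · intro v hv
    rw [pow_zero, one_mul]
    by_contra hs
    have h1 := row_of_high h.pos hy (h.mem_cuspSet hs)
    have hco := v.2.1
    rw [h1, isCoprime_zero_left, Int.isUnit_iff] at hco
    apply hv
    rcases hco with h2 | h2
    · exact Finset.mem_insert.mpr (Or.inl (Subtype.ext (Prod.ext h1 h2)))
    · exact Finset.mem_insert.mpr (Or.inr (Finset.mem_singleton.mpr (Subtype.ext (Prod.ext h1 h2))))

theorem cuspRep_zero : cuspRep 0 = 1 := rfl

theorem cuspFun_zero_high (h : IsSeed y₀ A α) (m : ℕ)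
    (hw : 0 < w.im) (hy : 1 / y₀ < w.im) : cuspFun m 0 α w = 2 * α w.im * cexp (π * I * m * w) := by
  have h0 := jacobiTheta_ne_zero (ofComplex w)
  rw [coe_ofComplex hw] at h0
  rw [cuspFun, cuspRep_zero, one_smul, poin_high h m (by rwa [im_ofComplex hw]), seedFn, coe_ofComplex hw, im_ofComplex hw]
  show jacobiTheta w ^ 3 * _ = _
  field_simp

theorem norm_cuspFun_sq (m : ℕ) (j : Fin 3) (α : ℝ → ℝ) (hw : 0 < w.im) :
    ‖poin m 0 α (cuspRep j • ofComplex w)‖ ^ 2 * thetaWt (cuspRep j • ofComplex w) =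
      ‖cuspFun m j α w‖ ^ 2 * w.im ^ (3 / 2 : ℝ) := by
  rw [thetaWt_cuspRep_smul, coe_ofComplex hw, im_ofComplex hw, cuspFun, norm_mul, norm_pow]; ring

theorem norm_cuspDbar_sq (m : ℕ) (j : Fin 3) (α : ℝ → ℝ) (hw : 0 < w.im) :
    ‖poin m 1 (Dop α) (cuspRep j • ofComplex w)‖ ^ 2 * thetaWt (cuspRep j • ofComplex w) =
      ‖cuspDbar m j α w‖ ^ 2 * w.im ^ 2 * w.im ^ (3 / 2 : ℝ) := by
  rw [thetaWt_cuspRep_smul, coe_ofComplex hw, im_ofComplex hw, cuspDbar, norm_mul, norm_mul, norm_mul, norm_chiFac (isCoprime_bottom _), norm_pow,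
    norm_div, norm_I, norm_real, norm_eq_abs, abs_of_pos hw]
  field_simp

/-- `c` solves the inhomogeneous mode equation of frequency `ν` with source `h`. -/
structure IsMode (ν : ℝ) (c h : ℝ → ℂ) : Prop where
  deriv : ∀ y, 0 < y → HasDerivAt c (-(π * ν) * c y - I * h y) y
  cont : ContinuousOn h (Ioi 0)

theorem IsMode.contC {ν : ℝ} {c h : ℝ → ℂ} (hm : IsMode ν c h) : ContinuousOn c (Ioi 0) :=
  fun y hy => (hm.deriv y hy).continuousAt.continuousWithinAt

theorem IsMode.norm_sq {ν : ℝ} {c h : ℝ → ℂ} (hm : IsMode ν c h) (hy : 0 < y) :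
    ∃ e : ℝ, |e| ≤ 2 * (‖c y‖ * ‖h y‖) ∧ HasDerivAt (fun y => ‖c y‖ ^ 2) (-2 * (π * ν) * ‖c y‖ ^ 2 + e) y := by
  refine ⟨2 * inner ℝ (c y) (-(I * h y)), ?_, ?_⟩
  · rw [abs_mul, abs_of_pos (by norm_num : (0:ℝ) < 2)]
    have := abs_real_inner_le_norm (c y) (-(I * h y))
    simp_all
  · convert (hm.deriv y hy).norm_sq using 1
    rw [sub_eq_add_neg, inner_add_right]
    have : inner ℝ (c y) (-(π * ν : ℂ) * c y) = -(π * ν) * ‖c y‖ ^ 2 := by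
      rw [show (-(π * ν : ℂ) * c y) = (-(π * ν) : ℝ) • c y by simp, inner_smul_right,
        real_inner_self_eq_norm_sq]
    rw [this]; ring

theorem continuousOn_rpow_pos (s : ℝ) : ContinuousOn (fun y : ℝ => y ^ s) (Ioi 0) :=
  fun y hy => (continuousAt_rpow_const y s (Or.inl (ne_of_gt hy))).continuousWithinAt

theorem IsMode.contU {ν : ℝ} {c h : ℝ → ℂ} (hm : IsMode ν c h) :
    ContinuousOn (fun y : ℝ => y ^ (-1 / 2 : ℝ) * ‖c y‖ ^ 2) (Ioi 0) :=
  (continuousOn_rpow_pos _).mul (hm.contC.norm.pow 2)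

theorem IsMode.contV {ν : ℝ} {c h : ℝ → ℂ} (hm : IsMode ν c h) :
    ContinuousOn (fun y : ℝ => y ^ (3 / 2 : ℝ) * ‖h y‖ ^ 2) (Ioi 0) :=
  (continuousOn_rpow_pos _).mul (hm.cont.norm.pow 2)

theorem rpow_half_facts (hy : 0 < y) : 0 < y ^ (-1 / 2 : ℝ) ∧ y * (y ^ (-1 / 2 : ℝ)) ^ 2 = 1 ∧
    y ^ (3 / 2 : ℝ) = y ^ 2 * y ^ (-1 / 2 : ℝ) ∧ y ^ (1 / 2 : ℝ) = y * y ^ (-1 / 2 : ℝ) ∧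
    y ^ (-1 / 2 - 1 : ℝ) = y ^ (-1 / 2 : ℝ) / y ∧ y ^ (1 / 2 - 1 : ℝ) = y ^ (-1 / 2 : ℝ) := by
  refine ⟨by positivity, ?_, ?_, ?_, ?_, ?_⟩
  · rw [← rpow_natCast, ← rpow_mul hy.le]; norm_num [rpow_neg_one]; field_simp
  · rw [← rpow_natCast y 2, ← rpow_add hy]; norm_num
  · nth_rewrite 2 [← rpow_one y]; rw [← rpow_add hy]; norm_num
  · rw [rpow_sub hy, rpow_one]
  · norm_num

theorem intervalIntegrable_pos {f : ℝ → ℝ} (hf : ContinuousOn f (Ioi 0)) {a b : ℝ} (ha : 0 < a) (hab : a ≤ b) :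
    IntervalIntegrable f volume a b :=
  (hf.mono (by rw [Set.uIcc_of_le hab]; grind)).intervalIntegrable

theorem mode_bound {ν : ℝ} {c h : ℝ → ℂ} (hm : IsMode ν c h) {w w' : ℝ → ℝ}
    {a b p q : ℝ} (ha : 0 < a) (hab : a ≤ b) (hw : ∀ y, 0 < y → HasDerivAt w (w' y) y)
    (hle : ∀ y ∈ Set.Ioo a b, ∀ e : ℝ, |e| ≤ 2 * (‖c y‖ * ‖h y‖) → w' y * ‖c y‖ ^ 2 + w y * (-2 * (π * ν) * ‖c y‖ ^ 2 + e) ≤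
      p * (y ^ (-1 / 2 : ℝ) * ‖c y‖ ^ 2) + q * (y ^ (3 / 2 : ℝ) * ‖h y‖ ^ 2)) :
    w b * ‖c b‖ ^ 2 - w a * ‖c a‖ ^ 2 ≤ p * (∫ y in a..b, y ^ (-1 / 2 : ℝ) * ‖c y‖ ^ 2) +
      q * ∫ y in a..b, y ^ (3 / 2 : ℝ) * ‖h y‖ ^ 2 := by
  have hpos : Set.Icc a b ⊆ Ioi 0 := fun y hy => ha.trans_le hy.1
  rw [← intervalIntegral.integral_const_mul, ← intervalIntegral.integral_const_mul,
    ← intervalIntegral.integral_add ((intervalIntegrable_pos hm.contU ha hab).const_mul p)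
      ((intervalIntegrable_pos hm.contV ha hab).const_mul q)]
  have hE : ∀ y, ∃ e : ℝ, 0 < y → |e| ≤ 2 * (‖c y‖ * ‖h y‖) ∧
      HasDerivAt (fun y => ‖c y‖ ^ 2) (-2 * (π * ν) * ‖c y‖ ^ 2 + e) y := by
    intro y
    by_cases hy : 0 < y
    · obtain ⟨e, he⟩ := hm.norm_sq hy
      grind
    simp_all
  choose E hE using hE
  have hd : ∀ y, 0 < y → HasDerivAt (fun y => w y * ‖c y‖ ^ 2)
      (w' y * ‖c y‖ ^ 2 + w y * (-2 * (π * ν) * ‖c y‖ ^ 2 + E y)) y := fun y hy => (hw y hy).mul (hE y hy).2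
  refine intervalIntegral.sub_le_integral_of_hasDeriv_right_of_le (g := fun y => w y * ‖c y‖ ^ 2)
    (g' := fun y => w' y * ‖c y‖ ^ 2 + w y * (-2 * (π * ν) * ‖c y‖ ^ 2 + E y)) hab ?_ ?_ ?_ ?_
  · exact fun y hy => (hd y (hpos hy)).continuousAt.continuousWithinAt
  · exact fun y hy => (hd y (hpos ⟨hy.1.le, hy.2.le⟩)).hasDerivWithinAt
  · exact (((hm.contU.mono hpos).const_mul p).add ((hm.contV.mono hpos).const_mul q)).integrableOn_Icc
  grind

theorem mode_neg {ν : ℝ} {c h : ℝ → ℂ} (hm : IsMode ν c h) (hν : ν ≤ 0) {a b : ℝ} (ha : 0 < a) (hab : a ≤ b)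
    (hb : c b = 0) :
    (∫ y in a..b, y ^ (-1 / 2 : ℝ) * ‖c y‖ ^ 2) ≤ 16 * ∫ y in a..b, y ^ (3 / 2 : ℝ) * ‖h y‖ ^ 2 := by
  have := mode_bound hm (w := fun y => -(y ^ (1 / 2 : ℝ))) (w' := fun y => -(1 / 2 * y ^ (1 / 2 - 1 : ℝ))) (p := -1 / 4) (q := 4) ha hab
    (fun y hy => (hasDerivAt_rpow_const (Or.inl hy.ne')).neg) ?_
  · rw [hb] at this
    have h0 : 0 ≤ a ^ (1 / 2 : ℝ) * ‖c a‖ ^ 2 := by positivity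
    norm_num at this h0 ⊢
    linarith
  · intro y hy e he
    have hy0 := ha.trans hy.1
    obtain ⟨f0, f1, f2, f3, f4, f5⟩ := rpow_half_facts hy0
    rw [f5, f3, f2]
    set s := y ^ (-1 / 2 : ℝ)
    have h1 : -(y * s) * e ≤ s * (1 / 4 * ‖c y‖ ^ 2 + 4 * (y * ‖h y‖) ^ 2) := by
      have := (abs_le.mp he).1
      have h2 : -(y * s) * e ≤ (y * s) * (2 * (‖c y‖ * ‖h y‖)) := by nlinarith
      nlinarith [mul_nonneg f0.le (sq_nonneg (1 / 2 * ‖c y‖ - 2 * (y * ‖h y‖)))]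
    have h2 : 0 ≤ (y * s) * (-2 * (π * ν) * ‖c y‖ ^ 2) := by
      have : 0 ≤ -(π * ν) := by nlinarith [pi_pos]
      have := mul_nonneg this (sq_nonneg ‖c y‖)
      nlinarith
    nlinarith

theorem mode_ineq_high {y s u v e lam : ℝ} (hy : 0 < y) (hy2 : 1 / 2 ≤ y ^ 2) (hs : 0 < s) (hlam : 2.35 ≤ lam)
    (he : |e| ≤ 2 * (u * v)) :
    -1 / 2 * (s / y) * u ^ 2 + s * (-2 * lam * u ^ 2 + e) ≤ -4.6 * (s * u ^ 2) + 20 * (y ^ 2 * s * v ^ 2) := by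
  have e1 : s * e ≤ s * (1 / 10 * u ^ 2 + 10 * v ^ 2) := by
    apply mul_le_mul_of_nonneg_left _ hs.le
    have := (abs_le.mp he).2
    nlinarith [sq_nonneg (u - 10 * v)]
  have e2 : 0 ≤ s / y * u ^ 2 := by positivity
  have e3 : s * (47 / 20 * u ^ 2) ≤ s * (lam * u ^ 2) :=
    mul_le_mul_of_nonneg_left (mul_le_mul_of_nonneg_right (by linarith) (sq_nonneg _)) hs.le
  have e4 : s * v ^ 2 * (1 / 2) ≤ s * v ^ 2 * y ^ 2 := mul_le_mul_of_nonneg_left hy2 (by positivity)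
  linarith

theorem mode_ineq_low {y s u v e lam : ℝ} (hy : 51 / 100 ≤ y) (hy2 : y ≤ 0.8661) (hs : 0 < s) (hys : y * s ^ 2 = 1)
    (hlam : 2.35 ≤ lam) (he : |e| ≤ 2 * (u * v)) :
    (1 + 2.35 * (2 * (y - 51 / 100))) * u ^ 2 + ((y - 51 / 100) + 2.35 * (y - 51 / 100) ^ 2) * (-2 * lam * u ^ 2 + e) ≤
      0.941 * (s * u ^ 2) + 400 * (y ^ 2 * s * v ^ 2) := by
  have hs1 : 1.0745 ≤ s := by nlinarith
  obtain ⟨x, hx⟩ : ∃ x, x = y - 51 / 100 := ⟨_, rfl⟩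
  rw [← hx]
  have hx0 : 0 ≤ x := by linarith
  have hx1 : x ≤ 0.3561 := by linarith
  obtain ⟨w, hw⟩ : ∃ w, w = x + 2.35 * x ^ 2 := ⟨_, rfl⟩
  rw [← hw]
  have hw0 : 0 ≤ w := by rw [hw]; positivity
  have hw1 : w ≤ 1 := by rw [hw]; nlinarith
  have e1 : w * e ≤ 1 / 100 * u ^ 2 + 100 * v ^ 2 := by
    have := (abs_le.mp he).2
    have k0 : 0 ≤ 2 * (u * v) := (abs_nonneg _).trans he
    have k1 : w * e ≤ w * (2 * (u * v)) := mul_le_mul_of_nonneg_left this hw0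
    have k2 : w * (2 * (u * v)) ≤ 1 * (2 * (u * v)) := mul_le_mul_of_nonneg_right hw1 k0
    nlinarith [sq_nonneg (1 / 10 * u - 10 * v)]
  have e3 : w * (2.35 * u ^ 2) ≤ w * (lam * u ^ 2) :=
    mul_le_mul_of_nonneg_left (mul_le_mul_of_nonneg_right hlam (sq_nonneg _)) hw0
  have e4 : 0 ≤ x ^ 2 * u ^ 2 := by positivity
  have e5 : 1.0745 * u ^ 2 ≤ s * u ^ 2 := mul_le_mul_of_nonneg_right hs1 (sq_nonneg u)
  have e6 : 0.25 * v ^ 2 ≤ y ^ 2 * s * v ^ 2 := by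
    have h1 : 0.26 ≤ y ^ 2 := by nlinarith
    have : 0.25 ≤ y ^ 2 * s := by nlinarith
    gcongr
  have e7 := sq_nonneg u
  have key : (1 + 2.35 * (2 * x)) * u ^ 2 - 2 * (w * (2.35 * u ^ 2)) ≤ u ^ 2 := by bound
  linarith

theorem mode_pos {ν : ℝ} {c h : ℝ → ℂ} (hm : IsMode ν c h) (hν : 3 / 4 ≤ ν) {b : ℝ} (hb : baseY ≤ b) :
    (∫ y in baseY..b, y ^ (-1 / 2 : ℝ) * ‖c y‖ ^ 2) ≤ 2 / 5 * (∫ y in (51 / 100)..baseY, y ^ (-1 / 2 : ℝ) * ‖c y‖ ^ 2) +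
      200 * ∫ y in (51 / 100)..b, y ^ (3 / 2 : ℝ) * ‖h y‖ ^ 2 := by
  have hbp := baseY_pos
  have hbb := baseY_bounds
  have hb4 := four_mul_baseY_sq
  have hY : 0.866 < baseY := by nlinarith
  have hY' : baseY < 0.8661 := by nlinarith
  have hlam : 2.35 ≤ π * ν := by nlinarith [pi_gt_d2]
  have h1 := mode_bound hm (w := fun y => (y - 51 / 100) + 2.35 * (y - 51 / 100) ^ 2)
    (w' := fun y => 1 + 2.35 * (2 * (y - 51 / 100))) (p := 0.941) (q := 400) (a := 51 / 100) (b := baseY) (by norm_num) (by linarith)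
    (fun y hy => by
      have e1 : HasDerivAt (fun y : ℝ => y - 51 / 100) 1 y := (hasDerivAt_id y).sub_const _
      exact (e1.fun_add ((e1.fun_pow 2).const_mul 2.35)).congr_deriv (by norm_num)) ?_
  · have h2 := mode_bound hm (w := fun y => y ^ (-1 / 2 : ℝ)) (w' := fun y => -1 / 2 * y ^ (-1 / 2 - 1 : ℝ)) (p := -4.6) (q := 20) hbp hb
      (fun y hy => hasDerivAt_rpow_const (Or.inl hy.ne')) ?_
    · obtain ⟨f0, f1, f2, f3, f4, f5⟩ := rpow_half_facts hbp
      have hsplit : (∫ y in (51 / 100)..b, y ^ (3 / 2 : ℝ) * ‖h y‖ ^ 2) =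
          (∫ y in (51 / 100)..baseY, y ^ (3 / 2 : ℝ) * ‖h y‖ ^ 2) + ∫ y in baseY..b, y ^ (3 / 2 : ℝ) * ‖h y‖ ^ 2 :=
        (integral_add_adjacent_intervals (intervalIntegrable_pos hm.contV (by norm_num) (by linarith))
          (intervalIntegrable_pos hm.contV hbp hb)).symm
      have hn1 : 0 ≤ ∫ y in (51 / 100)..baseY, y ^ (3 / 2 : ℝ) * ‖h y‖ ^ 2 :=
        intervalIntegral.integral_nonneg (by linarith) (fun y hy => by have : (0:ℝ) ≤ y := by linarith [hy.1]
                                                                       positivity)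
      have hn2 : 0 ≤ ∫ y in baseY..b, y ^ (3 / 2 : ℝ) * ‖h y‖ ^ 2 :=
        intervalIntegral.integral_nonneg hb (fun y hy => by have : (0:ℝ) ≤ y := by linarith [hy.1]
                                                            positivity)
      have hn3 : 0 ≤ ∫ y in (51 / 100)..baseY, y ^ (-1 / 2 : ℝ) * ‖c y‖ ^ 2 :=
        intervalIntegral.integral_nonneg (by linarith) (fun y hy => by have : (0:ℝ) ≤ y := by linarith [hy.1]
                                                                       positivity)
      have hnb : 0 ≤ b ^ (-1 / 2 : ℝ) * ‖c b‖ ^ 2 := by have := hbp.trans_le hb; positivity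
      rw [hsplit]
      set Z := ∫ y in (51 / 100)..baseY, y ^ (-1 / 2 : ℝ) * ‖c y‖ ^ 2
      set X := ∫ y in baseY..b, y ^ (-1 / 2 : ℝ) * ‖c y‖ ^ 2
      set H1 := ∫ y in (51 / 100)..baseY, y ^ (3 / 2 : ℝ) * ‖h y‖ ^ 2
      set H2 := ∫ y in baseY..b, y ^ (3 / 2 : ℝ) * ‖h y‖ ^ 2
      have hs : baseY ^ (-1 / 2 : ℝ) ≤ 1.0747 := by nlinarith
      have hu : 0.653 * ‖c baseY‖ ^ 2 ≤ 0.941 * Z + 400 * H1 := by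
        have hw : 0.653 ≤ (baseY - 51 / 100) + 2.35 * (baseY - 51 / 100) ^ 2 := by nlinarith
        have := mul_le_mul_of_nonneg_right hw (sq_nonneg ‖c baseY‖)
        linarith
      have hu2 : baseY ^ (-1 / 2 : ℝ) * ‖c baseY‖ ^ 2 ≤ 1.0747 * ‖c baseY‖ ^ 2 := mul_le_mul_of_nonneg_right hs (sq_nonneg _)
      grind
    · intro y hy e he
      have hy0 := hbp.trans hy.1
      obtain ⟨f0, f1, f2, f3, f4, f5⟩ := rpow_half_facts hy0
      rw [f4, f2]
      exact mode_ineq_high hy0 (by nlinarith [hy.1]) f0 hlam he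
  · intro y hy e he
    have hy0 : 0 < y := by linarith [hy.1]
    obtain ⟨f0, f1, f2, f3, f4, f5⟩ := rpow_half_facts hy0
    rw [f2]
    exact mode_ineq_low hy.1.le (by linarith [hy.2]) f0 f1 hlam he

theorem lintegral_Ioc_eq {f : ℝ → ℝ} (hf : ContinuousOn f (Ioi 0)) (hn : ∀ y, 0 < y → 0 ≤ f y) {a b : ℝ} (ha : 0 < a)
    (hab : a ≤ b) : ∫⁻ y in Set.Ioc a b, ENNReal.ofReal (f y) = ENNReal.ofReal (∫ y in a..b, f y) := by
  rw [integral_of_le hab, ofReal_integral_eq_lintegral_ofReal]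
  · exact (intervalIntegrable_iff_integrableOn_Ioc_of_le hab).mp (intervalIntegrable_pos hf ha hab)
  · refine (ae_restrict_iff' measurableSet_Ioc).mpr (Eventually.of_forall fun y hy => hn y (ha.trans hy.1))

theorem aemeasurable_pos {f : ℝ → ℝ} (hf : ContinuousOn f (Ioi 0)) {s : Set ℝ} (hs : s ⊆ Ioi 0) :
    AEMeasurable (fun y => ENNReal.ofReal (f y)) (volume.restrict s) :=
  ((hf.aemeasurable measurableSet_Ioi).mono_measure (Measure.restrict_mono hs le_rfl)).ennreal_ofReal

theorem lintegral_Ioi_le {f : ℝ → ℝ≥0∞} {a : ℝ} (hf : AEMeasurable f (volume.restrict (Ioi a))) {K : ℝ≥0∞}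
    (h : ∀ b, a ≤ b → ∫⁻ y in Set.Ioc a b, f y ≤ K) : ∫⁻ y in Ioi a, f y ≤ K := by
  have h1 := (aecover_Iic (μ := volume.restrict (Ioi a)) (l := atTop) (b := fun b : ℝ => b) tendsto_id).lintegral_tendsto_of_countably_generated hf
  refine le_of_tendsto h1 (eventually_atTop.mpr ⟨a, fun b hb => ?_⟩)
  rw [Measure.restrict_restrict measurableSet_Iic, Set.inter_comm, Set.Ioi_inter_Iic]
  exact h b hb

theorem mode_gap {ν : ℝ} {c h : ℝ → ℂ} (hm : IsMode ν c h)
    (hν : 3 / 4 ≤ ν ∨ (ν ≤ 0 ∧ ∃ R, ∀ y, R < y → c y = 0)) :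
    ∫⁻ y in Ioi baseY, ENNReal.ofReal (y ^ (-1 / 2 : ℝ) * ‖c y‖ ^ 2) ≤
      ENNReal.ofReal (2 / 5) * (∫⁻ y in Set.Ioc (51 / 100) baseY, ENNReal.ofReal (y ^ (-1 / 2 : ℝ) * ‖c y‖ ^ 2)) +
      ENNReal.ofReal 200 * ∫⁻ y in Ioi (51 / 100), ENNReal.ofReal (y ^ (3 / 2 : ℝ) * ‖h y‖ ^ 2) := by
  have hbp := baseY_pos
  have hbb := baseY_bounds
  have nU : ∀ y : ℝ, 0 < y → 0 ≤ y ^ (-1 / 2 : ℝ) * ‖c y‖ ^ 2 := fun y hy => by positivity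
  have nV : ∀ y : ℝ, 0 < y → 0 ≤ y ^ (3 / 2 : ℝ) * ‖h y‖ ^ 2 := fun y hy => by positivity
  refine lintegral_Ioi_le (aemeasurable_pos hm.contU fun y hy => hbp.trans hy) fun b hb => ?_
  have h51 : (0 : ℝ) < 51 / 100 := by norm_num
  have h51b : (51 / 100 : ℝ) ≤ baseY := by linarith
  rcases hν with hν | ⟨hν, R, hR⟩
  · rw [lintegral_Ioc_eq hm.contU nU hbp hb, lintegral_Ioc_eq hm.contU nU h51 h51b]
    refine (ofReal_le_ofReal (mode_pos hm hν hb)).trans ?_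
    rw [ENNReal.ofReal_add, ENNReal.ofReal_mul (by norm_num), ENNReal.ofReal_mul (by norm_num)]
    · gcongr
      rw [← lintegral_Ioc_eq hm.contV nV h51 (h51b.trans hb)]
      exact lintegral_mono_set Set.Ioc_subset_Ioi_self
    · refine mul_nonneg (by norm_num) (intervalIntegral.integral_nonneg h51b fun y hy => nU y (h51.trans_le hy.1))
    · refine mul_nonneg (by norm_num) (intervalIntegral.integral_nonneg (h51b.trans hb) fun y hy => nV y (h51.trans_le hy.1))
  · refine le_add_left ?_
    have hb' : baseY ≤ max b (R + 1) := hb.trans (le_max_left _ _)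
    calc _ ≤ ∫⁻ y in Set.Ioc baseY (max b (R + 1)), ENNReal.ofReal (y ^ (-1 / 2 : ℝ) * ‖c y‖ ^ 2) :=
          lintegral_mono_set (Set.Ioc_subset_Ioc_right (le_max_left _ _))
      _ = _ := lintegral_Ioc_eq hm.contU nU hbp hb'
      _ ≤ _ := ofReal_le_ofReal (mode_neg hm hν hbp hb' (hR _ (lt_of_lt_of_le (by linarith) (le_max_right _ _))))
      _ = _ := by rw [ENNReal.ofReal_mul (by norm_num)]
      _ ≤ _ := by
        rw [← lintegral_Ioc_eq hm.contV nV hbp hb']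
        exact mul_le_mul' (ofReal_le_ofReal (by norm_num)) (lintegral_mono_set fun y hy => lt_of_le_of_lt h51b hy.1)

/-- The squared `L²` norm over a horizontal period. -/
def normTwo (F : ℂ → ℂ) (y : ℝ) : ℝ := ∫ x in (0 : ℝ)..2, ‖F (x + y * I)‖ ^ 2

theorem hasSum_modeC {F : ℂ → ℂ} (hF : ContinuousOn F {w : ℂ | 0 < w.im}) (ν : ℝ) (hy : 0 < y) :
    HasSum (fun k : ℤ => ‖modeC F (ν + k) y‖ ^ 2) (2 * normTwo F y) := by
  have hc := continuous_line hF hy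
  set f : ℝ → ℂ := fun x => F (x + y * I) * cexp (-(π * I * ν * x)) with hf
  have hfc : Continuous f := hc.mul (by fun_prop)
  have hL2 : MemLp f 2 (volume.restrict (Set.Ioc 0 2)) := by
    obtain ⟨C, hC⟩ := isCompact_Icc.exists_bound_of_continuousOn (s := Set.Icc (0:ℝ) 2) hfc.continuousOn
    refine MemLp.of_bound hfc.aestronglyMeasurable C ?_
    exact (ae_restrict_iff' measurableSet_Ioc).mpr (Eventually.of_forall fun x hx => hC x ⟨hx.1.le, hx.2⟩)
  have h1 := hasSum_sq_fourierCoeffOn (by norm_num : (0:ℝ) < 2) hL2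
  have h2 : ∀ k : ℤ, fourierCoeffOn (by norm_num : (0:ℝ) < 2) f k = (1 / 2 : ℝ) • modeC F (ν + k) y := by
    intro k
    rw [fourierCoeffOn_eq_integral, modeC]
    norm_num only [sub_zero]
    congr 1
    refine integral_congr fun x _ => ?_
    simp only [hf, smul_eq_mul]
    rw [fourier_coe_apply, mul_comm, mul_assoc, ← Complex.exp_add]
    congr 2
    push_cast; ring
  have h3 := h1.mul_left 4
  have e1 : (fun k : ℤ => 4 * ‖fourierCoeffOn (by norm_num : (0:ℝ) < 2) f k‖ ^ 2) = fun k : ℤ => ‖modeC F (ν + k) y‖ ^ 2 := by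
    funext k
    rw [h2, norm_smul, mul_pow]; norm_num; ring
  have e2 : ∀ x : ℝ, ‖f x‖ = ‖F (x + y * I)‖ := by
    intro x
    rw [hf]; simp only
    rw [norm_mul, show (-(π * I * ν * x) : ℂ) = ((-(π * ν * x) : ℝ) : ℂ) * I by push_cast; ring, norm_exp_ofReal_mul_I,
      mul_one]
  have e3 : 4 * ((2 - 0 : ℝ)⁻¹ • ∫ x in (0 : ℝ)..2, ‖f x‖ ^ 2) = 2 * normTwo F y := by
    simp only [e2, normTwo, smul_eq_mul]
    norm_num; ring
  lia

theorem tsum_modeC {F : ℂ → ℂ} (hF : ContinuousOn F {w : ℂ | 0 < w.im}) (ν s : ℝ) (hy : 0 < y) :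
    ∑' k : ℤ, ENNReal.ofReal (y ^ s * ‖modeC F (ν + k) y‖ ^ 2) = ENNReal.ofReal 2 * ENNReal.ofReal (y ^ s * normTwo F y) := by
  have h1 := hasSum_modeC hF ν hy
  have h2 := h1.mul_left (y ^ s)
  rw [← ENNReal.ofReal_tsum_of_nonneg (fun k => by positivity) h2.summable, h2.tsum_eq, ← ENNReal.ofReal_mul (by norm_num)]
  congr 1; ring

theorem lintegral_normTwo {F : ℂ → ℂ} (hF : ContinuousOn F {w : ℂ | 0 < w.im}) (ν s : ℝ) {A : Set ℝ} (hA : A ⊆ Ioi 0)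
    (hAm : MeasurableSet A) :
    ENNReal.ofReal 2 * ∫⁻ y in A, ENNReal.ofReal (y ^ s * normTwo F y) =
      ∑' k : ℤ, ∫⁻ y in A, ENNReal.ofReal (y ^ s * ‖modeC F (ν + k) y‖ ^ 2) := by
  rw [← lintegral_const_mul' _ _ ofReal_ne_top, ← lintegral_tsum]
  · exact setLIntegral_congr_fun hAm fun y hy => (tsum_modeC hF ν s (hA hy)).symm
  · exact fun k => aemeasurable_pos ((continuousOn_rpow_pos s).mul ((continuousOn_modeC hF _).norm.pow 2)) hA

theorem fun_gap {f g : ℂ → ℂ} (hf : ∀ w : ℂ, 0 < w.im → ContDiffAt ℝ 1 f w) {ν₀ : ℝ}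
    (hper : ∀ (k : ℤ) (w : ℂ), 0 < w.im → f (w + 2) = cexp (2 * π * I * ((ν₀ + k : ℝ) : ℂ)) * f w)
    (hg : ∀ w : ℂ, 0 < w.im → fderiv ℝ f w 1 + I * fderiv ℝ f w I = g w)
    (hν : ∀ k : ℤ, 3 / 4 ≤ ν₀ + k ∨ (ν₀ + k ≤ 0 ∧ ∃ R, ∀ y, R < y → modeC f (ν₀ + k) y = 0)) :
    ∫⁻ y in Ioi baseY, ENNReal.ofReal (y ^ (-1 / 2 : ℝ) * normTwo f y) ≤
      ENNReal.ofReal (2 / 5) * (∫⁻ y in Set.Ioc (51 / 100) baseY, ENNReal.ofReal (y ^ (-1 / 2 : ℝ) * normTwo f y)) +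
      ENNReal.ofReal 200 * ∫⁻ y in Ioi (51 / 100), ENNReal.ofReal (y ^ (3 / 2 : ℝ) * normTwo g y) := by
  have hfc : ContinuousOn f {w : ℂ | 0 < w.im} := fun w hw => (hf w hw).continuousAt.continuousWithinAt
  have hgc : ContinuousOn g {w : ℂ | 0 < w.im} := by
    refine ContinuousOn.congr ?_ (fun w hw => (hg w hw).symm)
    exact (continuousOn_fderiv_uhp hf 1).add (continuousOn_const.mul (continuousOn_fderiv_uhp hf I))
  have hmode : ∀ k : ℤ, IsMode (ν₀ + k) (modeC f (ν₀ + k)) (modeC g (ν₀ + k)) := by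
    refine fun k => ⟨fun y hy => ?_, continuousOn_modeC hgc _⟩
    have h1 := hasDerivAt_modeC hf (hper k) hy
    have h2 : modeC (fun w => fderiv ℝ f w 1 + I * fderiv ℝ f w I) (ν₀ + k) y = modeC g (ν₀ + k) y := by
      refine integral_congr fun x _ => ?_
      simp_all
    lia
  have h2 : ENNReal.ofReal 2 ≠ 0 := by simp
  have hbp := baseY_pos
  have s1 : Ioi baseY ⊆ Ioi 0 := Set.Ioi_subset_Ioi hbp.le
  have s2 : Set.Ioc (51 / 100) baseY ⊆ Ioi 0 := fun y hy => lt_trans (by norm_num) hy.1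
  have s3 : Ioi (51 / 100 : ℝ) ⊆ Ioi 0 := Set.Ioi_subset_Ioi (by norm_num)
  refine (ENNReal.mul_le_mul_iff_right h2 ofReal_ne_top).mp ?_
  rw [mul_add, mul_left_comm (ENNReal.ofReal 2) (ENNReal.ofReal (2 / 5)), mul_left_comm (ENNReal.ofReal 2) (ENNReal.ofReal 200), lintegral_normTwo hfc ν₀ _ s1 measurableSet_Ioi,
    lintegral_normTwo hfc ν₀ _ s2 measurableSet_Ioc, lintegral_normTwo hgc ν₀ _ s3 measurableSet_Ioi,
    ← ENNReal.tsum_mul_left, ← ENNReal.tsum_mul_left, ← ENNReal.tsum_add]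
  exact ENNReal.tsum_le_tsum fun k => mode_gap (hmode k) (hν k)

theorem integral_exp_int {k : ℤ} (hk : k ≠ 0) : ∫ x in (0 : ℝ)..2, cexp (π * I * k * x) = 0 := by
  have hne : (π * I * k : ℂ) ≠ 0 := by simp_all
  rw [integral_exp_mul_complex hne]
  have h1 : cexp (π * I * k * (2 : ℝ)) = 1 := by
    rw [show (π * I * k * (2 : ℝ) : ℂ) = (k : ℂ) * (2 * π * I) by push_cast; ring, exp_int_mul_two_pi_mul_I]
  rw [h1]; simp

theorem cusp_gap (h : IsSeed y₀ A α) (hD : IsSeed y₀ B (Dop α)) (hα : ContDiff ℝ 1 α)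
    (hm : 1 ≤ m) (j : Fin 3) :
    ∫⁻ y in Ioi baseY, ENNReal.ofReal (y ^ (-1 / 2 : ℝ) * normTwo (cuspFun m j α) y) ≤
      ENNReal.ofReal (2 / 5) * (∫⁻ y in Set.Ioc (51 / 100) baseY, ENNReal.ofReal (y ^ (-1 / 2 : ℝ) * normTwo (cuspFun m j α) y)) +
      ENNReal.ofReal 200 * ∫⁻ y in Ioi (51 / 100), ENNReal.ofReal (y ^ (3 / 2 : ℝ) * normTwo (cuspDbar m j α) y) := by
  refine fun_gap (fun w hw => contDiffAt_cuspFun h hα m j hw) (fun k w hw => cuspFun_add_two m j α hw k)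
    (fun w hw => dbar_cuspFun h hD hα m j hw) (fun k => ?_)
  rcases le_or_gt 1 k with hk | hk
  · left
    have : (1 : ℝ) ≤ k := by exact_mod_cast hk
    fin_cases j <;> simp [cuspNu] <;> linarith
  · right
    have hk0 : k ≤ 0 := by omega
    have hk' : (k : ℝ) ≤ 0 := by exact_mod_cast hk0
    refine ⟨by fin_cases j <;> simp [cuspNu] <;> linarith, 1 / y₀, fun y hy => ?_⟩
    have hy0 : 0 < y := lt_trans (by have := h.pos; positivity) hy
    by_cases hj : j = 0
    · subst hj
      rw [modeC]
      have h1 : ∀ x : ℝ, cuspFun m 0 α (x + y * I) * cexp (-(π * I * ((cuspNu 0 + k : ℝ) : ℂ) * x)) =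
          (2 * α y * cexp (-(π * m * y))) * cexp (π * I * ((m - k : ℤ) : ℂ) * x) := by
        intro x
        rw [cuspFun_zero_high h m (by simpa using hy0) (by simpa using hy)]
        have e1 : ((x : ℂ) + y * I).im = y := by simp
        rw [e1, mul_assoc, mul_assoc (2 * (α y : ℂ)), ← Complex.exp_add, ← Complex.exp_add]
        congr 2
        simp only [cuspNu, Matrix.cons_val_zero]
        push_cast
        linear_combination (π * m * y : ℂ) * I_sq
      simp_rw [h1]
      rw [intervalIntegral.integral_const_mul, integral_exp_int (by omega), mul_zero]
    · rw [modeC]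
      have h1 : ∀ x : ℝ, cuspFun m j α (x + y * I) = 0 := fun x =>
        cuspFun_eq_zero h m hj (by simpa using hy0) (by simpa using hy)
      simp [h1]

/-- The average of a `Γ(2)`-invariant function over cosets. -/
def cosetSum (P : ℍ → ℝ) (z : ℍ) : ℝ≥0∞ := ∑ q : Cst, ENNReal.ofReal (P (q.out⁻¹ • z))

theorem cosetSum_smul {P : ℍ → ℝ} (hinv : ∀ γ ∈ Γ₂, ∀ z, P (γ • z) = P z) (g : SL(2, ℤ)) (z : ℍ) :
    cosetSum P (g • z) = cosetSum P z := by
  unfold cosetSum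
  rw [← Equiv.sum_comp (MulAction.toPerm g⁻¹ : Equiv.Perm Cst) fun q => ENNReal.ofReal (P (q.out⁻¹ • z))]
  refine sum_congr rfl fun q _ => ?_
  congr 1
  rw [MulAction.toPerm_apply]
  set q' : Cst := g⁻¹ • q with hq'
  have h1 : (q'.out : Cst) = ((g⁻¹ * q.out : SL(2, ℤ)) : Cst) := by
    rw [QuotientGroup.out_eq', hq', ← smul_eq_mul g⁻¹, ← MulAction.Quotient.smul_coe, QuotientGroup.out_eq']
  have h2 := QuotientGroup.eq.mp h1
  rw [← hinv _ h2 (q.out⁻¹ • g • z), ← mul_smul, ← mul_smul]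
  congr 2
  group

theorem measurable_cosetSum {P : ℍ → ℝ} (hP : Continuous P) : Measurable (cosetSum P) :=
  Finset.measurable_sum _ fun _ _ => ((hP.comp (continuous_SL_smul _)).measurable).ennreal_ofReal

theorem lintegral_cosetSum {m κ : ℕ} (h : IsSeed y₀ A α) (hm : 1 ≤ m) :
    ∫⁻ z, cosetSum (poinPair m κ α α) z ∂cuspMeas = ENNReal.ofReal (bform m κ α α) := by
  unfold cosetSum bform
  have hmeas : ∀ q : Cst, Measurable fun z : ℍ => ENNReal.ofReal (poinPair m κ α α (q.out⁻¹ • z)) := fun q =>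
    (((continuous_poinPair h h m κ).comp (continuous_SL_smul q.out⁻¹)).measurable).ennreal_ofReal
  rw [lintegral_finsetSum _ fun q _ => hmeas q, ENNReal.ofReal_sum_of_nonneg]
  · refine sum_congr rfl fun q _ => ?_
    rw [ofReal_integral_eq_lintegral_ofReal (integrable_poinPair_smul h h hm κ _)]
    exact Eventually.of_forall fun z => by
      show 0 ≤ poinPair m κ α α (q.out⁻¹ • z)
      rw [poinPair_self]; exact mul_nonneg (by positivity) (thetaWt_nonneg _)
  · exact fun q _ => integral_nonneg fun z => by
      show 0 ≤ poinPair m κ α α (q.out⁻¹ • z)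
      rw [poinPair_self]; exact mul_nonneg (by positivity) (thetaWt_nonneg _)

/-- The cusp of a coset. -/
theorem exists_cuspIdx (q : Cst) : ∃ (j : Fin 3) (i : ℕ), ∀ P : ℍ → ℝ,
    (∀ γ ∈ Γ₂, ∀ z, P (γ • z) = P z) → ∀ z, P (q.out⁻¹ • z) = P (cuspRep j • T ^ i • z) := by
  obtain ⟨γ, hγ, j, i, h⟩ := exists_gamma_two_mul_cuspRep q.out⁻¹
  refine ⟨j, i, fun P hP z => ?_⟩
  rw [h, mul_smul, mul_smul, hP γ hγ]

def cuspIdx (q : Cst) : Fin 3 := (exists_cuspIdx q).choose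

theorem T_pow_smul_rectCoord (i : ℕ) (hy : 0 < y) (x : ℝ) : T ^ i • rectCoord (y, x) = rectCoord (y, x + i) := by
  apply UpperHalfPlane.ext
  have := coe_T_zpow_smul (i : ℤ) (rectCoord (y, x))
  rw [zpow_natCast] at this
  rw [this, coe_rectCoord (by simpa using hy), coe_rectCoord (by simpa using hy)]
  apply Complex.ext <;> simp

theorem integral_coset_line {P : ℍ → ℝ} (hinv : ∀ γ ∈ Γ₂, ∀ z, P (γ • z) = P z) (q : Cst)
    (hy : 0 < y) :
    ∫ x in (0 : ℝ)..2, P (q.out⁻¹ • rectCoord (y, x)) = ∫ x in (0 : ℝ)..2, P (cuspRep (cuspIdx q) • rectCoord (y, x)) := by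
  obtain ⟨i, hi⟩ := (exists_cuspIdx q).choose_spec
  have hper : Function.Periodic (fun x : ℝ => P (cuspRep (cuspIdx q) • rectCoord (y, x))) 2 := by
    intro x
    have e1 : rectCoord (y, x + 2) = T ^ (2 : ℤ) • rectCoord (y, x) := by
      rw [show (2 : ℤ) = ((2 : ℕ) : ℤ) by rfl, zpow_natCast, T_pow_smul_rectCoord 2 hy]; norm_num
    have h2 : cuspRep (cuspIdx q) * T ^ (2 : ℤ) * (cuspRep (cuspIdx q))⁻¹ ∈ Γ₂ :=
      (CongruenceSubgroup.Gamma_normal 2).conj_mem _ (T_two_mul_mem 1) _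
    show P _ = P _
    rw [e1, ← hinv _ h2 (cuspRep (cuspIdx q) • rectCoord (y, x)), ← mul_smul, ← mul_smul]
    congr 2
    group
  have h1 : ∀ x : ℝ, P (q.out⁻¹ • rectCoord (y, x)) = (fun x : ℝ => P (cuspRep (cuspIdx q) • rectCoord (y, x))) (x + i) := by
    intro x
    rw [hi P hinv, T_pow_smul_rectCoord i hy]; rfl
  rw [integral_congr fun x _ => h1 x, integral_comp_add_right
    (fun x : ℝ => P (cuspRep (cuspIdx q) • rectCoord (y, x))) (i : ℝ)]
  have := hper.intervalIntegral_add_eq (0 + i : ℝ) 0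
  grind

theorem lintegral_Ico_two {f : ℝ → ℝ≥0∞} (hf : ∀ x, f (x + 1) = f x) :
    ∫⁻ x in Set.Ico (0 : ℝ) 2, f x = 2 * ∫⁻ x in Set.Ico (0 : ℝ) 1, f x := by
  have h1 : Set.Ico (0 : ℝ) 2 = Set.Ico 0 1 ∪ Set.Ico 1 2 := (Set.Ico_union_Ico_eq_Ico (by norm_num) (by norm_num)).symm
  rw [h1, lintegral_union measurableSet_Ico (Set.Ico_disjoint_Ico_same)]
  have h2 : ∫⁻ x in Set.Ico (1 : ℝ) 2, f x = ∫⁻ x in Set.Ico (0 : ℝ) 1, f x := by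
    have := (measurePreserving_add_right volume (1 : ℝ)).setLIntegral_comp_preimage_emb (measurableEmbedding_addRight 1) f (Set.Ico 1 2)
    rw [← this]
    simp only [hf]
    norm_num
  rw [h2, two_mul]

theorem two_mul_lintegral_cosetSum {P : ℍ → ℝ} (hP : Continuous P) (hn : ∀ z, 0 ≤ P z)
    (hinv : ∀ γ ∈ Γ₂, ∀ z, P (γ • z) = P z) (hY : 0 < Y) :
    2 * ∫⁻ z in halfStrip Y, cosetSum P z =
      ∑ q : Cst, ∫⁻ y in Ioi Y, ENNReal.ofReal (1 / y ^ 2 * ∫ x in (0 : ℝ)..2, P (cuspRep (cuspIdx q) • rectCoord (y, x))) := by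
  rw [lintegral_halfStrip_eq hY (measurable_cosetSum hP), setLIntegral_congr Ioi_ae_eq_Ici.symm,
    ← lintegral_const_mul' _ _ (by simp)]
  have hpt : ∀ y ∈ Ioi Y, (2 * ∫⁻ x in Set.Ico (0 : ℝ) 1, ENNReal.ofReal (1 / y ^ 2) * cosetSum P (rectCoord (y, x))) =
      ∑ q : Cst, ENNReal.ofReal (1 / y ^ 2 * ∫ x in (0 : ℝ)..2, P (cuspRep (cuspIdx q) • rectCoord (y, x))) := by
    intro y hy
    have hy0 : 0 < y := hY.trans hy
    rw [← lintegral_Ico_two]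
    · unfold cosetSum
      have hc : ∀ q : Cst, Continuous fun x : ℝ => P (q.out⁻¹ • rectCoord (y, x)) := fun q =>
        (hP.comp (continuous_SL_smul _)).comp (continuous_rectCoord hy0)
      simp_rw [mul_sum]
      rw [lintegral_finsetSum _ fun q _ => ((hc q).measurable.ennreal_ofReal).const_mul _]
      refine sum_congr rfl fun q _ => ?_
      rw [lintegral_const_mul' _ _ ofReal_ne_top, ENNReal.ofReal_mul (by positivity), ← integral_coset_line hinv q hy0,
        integral_of_le (by norm_num), ofReal_integral_eq_lintegral_ofReal, setLIntegral_congr Ico_ae_eq_Ioc]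
      · exact ((hc q).integrableOn_Ioc)
      · exact Eventually.of_forall fun x => hn _
    · intro x
      have := T_pow_smul_rectCoord 1 hy0 x
      rw [Nat.cast_one] at this
      rw [← this, cosetSum_smul hinv]
  rw [setLIntegral_congr_fun measurableSet_Ioi hpt, lintegral_finsetSum']
  intro q _
  have hm : StronglyMeasurable fun p : ℝ × ℝ => P (cuspRep (cuspIdx q) • rectCoord (p.1, p.2)) :=
    ((hP.comp (continuous_SL_smul _)).measurable.comp measurable_rectCoord).stronglyMeasurable
  have hm2 : Measurable fun y : ℝ => ∫ x in (0 : ℝ)..2, P (cuspRep (cuspIdx q) • rectCoord (y, x)) := by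
    simp_rw [integral_of_le (by norm_num : (0:ℝ) ≤ 2)]
    exact (hm.integral_prod_right (ν := volume.restrict (Set.Ioc 0 2))).measurable
  fun_prop

theorem poinPair_gamma_smul (m κ : ℕ) (α : ℝ → ℝ) {γ : SL(2, ℤ)} (hγ : γ ∈ Γ₂) (z : ℍ) :
    poinPair m κ α α (γ • z) = poinPair m κ α α z := by
  rw [poinPair_self, poinPair_self, thetaWt_smul hγ]
  congr 2
  exact norm_poin_smul m κ α ⟨γ, hγ⟩ z

theorem poinPair_self_nonneg (m κ : ℕ) (α : ℝ → ℝ) (z : ℍ) : 0 ≤ poinPair m κ α α z := by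
  rw [poinPair_self]; exact mul_nonneg (by positivity) (thetaWt_nonneg _)

theorem halfStrip_le_six {Φ : ℍ → ℝ≥0∞} (hΦ : Measurable Φ) (hinv : ∀ (g : SL(2, ℤ)) (z : ℍ), Φ (g • z) = Φ z) :
    ∫⁻ z in halfStrip (51 / 100), Φ z ≤ 6 * ∫⁻ z, Φ z ∂cuspMeas := by
  rw [lintegral_halfStrip (by norm_num) hΦ hinv, ← lintegral_const_mul' _ _ (by simp)]
  refine lintegral_mono fun z => mul_le_mul_left (?_ : ((cuspSet (51 / 100) z).ncard : ℝ≥0∞) ≤ 6) _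
  exact_mod_cast cuspSet_ncard_le_six (Y := 51 / 100) (by norm_num) z

theorem two_le_halfStrip {Φ : ℍ → ℝ≥0∞} (hΦ : Measurable Φ) (hinv : ∀ (g : SL(2, ℤ)) (z : ℍ), Φ (g • z) = Φ z) :
    2 * ∫⁻ z, Φ z ∂cuspMeas ≤ ∫⁻ z in halfStrip baseY, Φ z := by
  rw [lintegral_halfStrip baseY_pos hΦ hinv, ← lintegral_const_mul' _ _ (by simp)]
  refine lintegral_mono fun z => mul_le_mul_left (?_ : (2 : ℝ≥0∞) ≤ ((cuspSet baseY z).ncard : ℝ≥0∞)) _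
  exact_mod_cast two_le_cuspSet_ncard baseY_pos four_mul_baseY_sq.le z

theorem two_mul_strip_zero (h : IsSeed y₀ A α) (m : ℕ) (hY : 0 < Y) :
    2 * ∫⁻ z in halfStrip Y, cosetSum (poinPair m 0 α α) z =
      ∑ q : Cst, ∫⁻ y in Ioi Y, ENNReal.ofReal (y ^ (-1 / 2 : ℝ) * normTwo (cuspFun m (cuspIdx q) α) y) := by
  rw [two_mul_lintegral_cosetSum (continuous_poinPair h h m 0) (poinPair_self_nonneg m 0 α)
    (fun γ hγ z => poinPair_gamma_smul m 0 α hγ z) hY]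
  refine sum_congr rfl fun q _ => setLIntegral_congr_fun measurableSet_Ioi fun y hy => ?_
  have hy0 : 0 < y := hY.trans hy
  have h1 : ∀ x : ℝ, poinPair m 0 α α (cuspRep (cuspIdx q) • rectCoord (y, x)) =
      y ^ (3 / 2 : ℝ) * ‖cuspFun m (cuspIdx q) α (x + y * I)‖ ^ 2 := by
    intro x
    have hw : (⟨x, y⟩ : ℂ) = x + y * I := by apply Complex.ext <;> simp
    rw [poinPair_self, rectCoord, norm_cuspFun_sq m _ α (w := ⟨x, y⟩) hy0, ← hw]; ring
  rw [integral_congr fun x _ => h1 x, intervalIntegral.integral_const_mul, ← mul_assoc]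
  congr 2
  obtain ⟨f0, f1, f2, f3, f4, f5⟩ := rpow_half_facts hy0
  rw [f2]; field_simp

theorem two_mul_strip_one (h : IsSeed y₀ A (Dop α)) (m : ℕ) (hY : 0 < Y) :
    2 * ∫⁻ z in halfStrip Y, cosetSum (poinPair m 1 (Dop α) (Dop α)) z =
      ∑ q : Cst, ∫⁻ y in Ioi Y, ENNReal.ofReal (y ^ (3 / 2 : ℝ) * normTwo (cuspDbar m (cuspIdx q) α) y) := by
  rw [two_mul_lintegral_cosetSum (continuous_poinPair h h m 1) (poinPair_self_nonneg m 1 _)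
    (fun γ hγ z => poinPair_gamma_smul m 1 _ hγ z) hY]
  refine sum_congr rfl fun q _ => setLIntegral_congr_fun measurableSet_Ioi fun y hy => ?_
  have hy0 : 0 < y := hY.trans hy
  have h1 : ∀ x : ℝ, poinPair m 1 (Dop α) (Dop α) (cuspRep (cuspIdx q) • rectCoord (y, x)) =
      y ^ 2 * y ^ (3 / 2 : ℝ) * ‖cuspDbar m (cuspIdx q) α (x + y * I)‖ ^ 2 := by
    intro x
    have hw : (⟨x, y⟩ : ℂ) = x + y * I := by apply Complex.ext <;> simp
    rw [poinPair_self, rectCoord, norm_cuspDbar_sq m _ α (w := ⟨x, y⟩) hy0, ← hw]; ring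
  rw [integral_congr fun x _ => h1 x, intervalIntegral.integral_const_mul, ← mul_assoc]
  congr 2
  field_simp

/-- The spectral gap inequality for Poincaré series. -/
theorem bform_gap (h : IsSeed y₀ A α) (hD : IsSeed y₀ B (Dop α)) (hα : ContDiff ℝ 1 α)
    (hm : 1 ≤ m) : bform m 0 α α ≤ 3000 * bform m 1 (Dop α) (Dop α) := by
  have ha := bform_self_nonneg m 0 α
  have hb := bform_self_nonneg m 1 (Dop α)
  set a := bform m 0 α α with hadef
  set b := bform m 1 (Dop α) (Dop α) with hbdef
  set X : ℝ≥0∞ := ∑ q : Cst, ∫⁻ y in Ioi baseY, ENNReal.ofReal (y ^ (-1 / 2 : ℝ) * normTwo (cuspFun m (cuspIdx q) α) y) with hX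
  set Z : ℝ≥0∞ := ∑ q : Cst, ∫⁻ y in Set.Ioc (51 / 100) baseY,
    ENNReal.ofReal (y ^ (-1 / 2 : ℝ) * normTwo (cuspFun m (cuspIdx q) α) y) with hZ
  set H : ℝ≥0∞ := ∑ q : Cst, ∫⁻ y in Ioi (51 / 100),
    ENNReal.ofReal (y ^ (3 / 2 : ℝ) * normTwo (cuspDbar m (cuspIdx q) α) y) with hH
  have h0 : X ≤ ENNReal.ofReal (2 / 5) * Z + ENNReal.ofReal 200 * H := by
    rw [hX, hZ, hH, mul_sum, mul_sum, ← sum_add_distrib]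
    exact sum_le_sum fun q _ => cusp_gap h hD hα hm _
  have hm0 := measurable_cosetSum (continuous_poinPair h h m 0)
  have hm1 := measurable_cosetSum (continuous_poinPair hD hD m 1)
  have hi0 := fun g z => cosetSum_smul (fun γ hγ z => poinPair_gamma_smul m 0 α hγ z) g z
  have hi1 := fun g z => cosetSum_smul (fun γ hγ z => poinPair_gamma_smul m 1 (Dop α) hγ z) g z
  have h1 : X + Z ≤ ENNReal.ofReal (12 * a) := by
    have e1 := halfStrip_le_six hm0 hi0
    rw [lintegral_cosetSum h hm] at e1
    have e2 := mul_le_mul_right e1 (2 : ℝ≥0∞)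
    rw [two_mul_strip_zero h m (by norm_num)] at e2
    have e3 : X + Z = ∑ q : Cst, ∫⁻ y in Ioi (51 / 100), ENNReal.ofReal (y ^ (-1 / 2 : ℝ) * normTwo (cuspFun m (cuspIdx q) α) y) := by
      rw [hX, hZ, ← sum_add_distrib]
      refine sum_congr rfl fun q _ => ?_
      rw [← Set.Ioc_union_Ioi_eq_Ioi (a := (51 / 100 : ℝ)) (b := baseY) (by have := baseY_bounds; linarith),
        lintegral_union measurableSet_Ioi (Set.Ioc_disjoint_Ioi_same), add_comm]
    rw [e3]
    refine e2.trans (le_of_eq ?_)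
    simp; ring
  have h2 : ENNReal.ofReal (4 * a) ≤ X := by
    have e1 := two_le_halfStrip hm0 hi0
    rw [lintegral_cosetSum h hm] at e1
    have e2 := mul_le_mul_right e1 (2 : ℝ≥0∞)
    rw [two_mul_strip_zero h m baseY_pos] at e2
    refine le_trans (le_of_eq ?_) e2
    simp; ring
  have h3 : H ≤ ENNReal.ofReal (12 * b) := by
    have e1 := halfStrip_le_six hm1 hi1
    rw [lintegral_cosetSum hD hm] at e1
    have e2 := mul_le_mul_right e1 (2 : ℝ≥0∞)
    rw [two_mul_strip_one hD m (by norm_num)] at e2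
    refine e2.trans (le_of_eq ?_)
    simp; ring
  have hXt : X ≠ ⊤ := ne_top_of_le_ne_top ofReal_ne_top (le_self_add.trans h1)
  have hZt : Z ≠ ⊤ := ne_top_of_le_ne_top ofReal_ne_top (le_add_self.trans h1)
  have hHt : H ≠ ⊤ := ne_top_of_le_ne_top ofReal_ne_top h3
  clear_value X Z H
  lift X to NNReal using hXt
  lift Z to NNReal using hZt
  lift H to NNReal using hHt
  have g0 : (X : ℝ) ≤ 2 / 5 * Z + 200 * H := by
    have := ENNReal.toReal_mono (by finiteness) h0
    rw [ENNReal.toReal_add (by finiteness) (by finiteness), ENNReal.toReal_mul, ENNReal.toReal_mul, toReal_ofReal (by norm_num),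
      toReal_ofReal (by norm_num)] at this
    simpa using this
  have g1 : (X : ℝ) + Z ≤ 12 * a := by
    have := ENNReal.toReal_mono (by finiteness) h1
    rw [ENNReal.toReal_add (by finiteness) (by finiteness), toReal_ofReal (by positivity)] at this
    simpa using this
  have g2 : 4 * a ≤ X := by
    have := ENNReal.toReal_mono (by finiteness) h2
    rw [toReal_ofReal (by positivity)] at this
    simpa using this
  have g3 : (H : ℝ) ≤ 12 * b := by
    have := ENNReal.toReal_mono (by finiteness) h3
    rw [toReal_ofReal (by positivity)] at this
    simpa using this
  linarith

theorem rectCoord_eq (x y : ℝ) : rectCoord (y, x) = ofComplex (x + y * I) := by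
  rw [rectCoord]; congr 1; apply Complex.ext <;> simp

theorem fourC_eq_modeC (n m : ℕ) (α : ℝ → ℝ) (y : ℝ) (hy : 0 < y) : fourC n m 0 α y = modeC (cuspFun m 0 α) n y := by
  unfold fourC modeC cuspFun
  refine integral_congr fun x _ => ?_
  have hw : 0 < ((x : ℂ) + y * I).im := by simpa using hy
  simp only [rectCoord_eq, cuspRep_zero, one_smul, coe_ofComplex hw]
  norm_cast

theorem modeC_cuspDbar (n m : ℕ) (α : ℝ → ℝ) (y : ℝ) (hy : 0 < y) :
    I * modeC (cuspDbar m 0 α) n y = -(fourC n m 1 (Dop α) y / y) := by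
  unfold fourC modeC cuspDbar
  rw [← intervalIntegral.integral_div, ← intervalIntegral.integral_const_mul, ← intervalIntegral.integral_neg]
  refine integral_congr fun x _ => ?_
  have hw : 0 < ((x : ℂ) + y * I).im := by simpa using hy
  have him : ((x : ℂ) + y * I).im = y := by simp
  have hch : chiFac (cuspRep 0 1 0, cuspRep 0 1 1) (ofComplex (x + y * I)) = 1 := by
    simp [cuspRep_zero, chiFac, rowj]
  simp only [rectCoord_eq, him, hch, coe_ofComplex hw]
  rw [cuspRep_zero, one_smul]
  show I * (I / y * jacobiTheta _ ^ 3 * _ * _) = _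
  have : I * I = -1 := I_mul_I
  push_cast
  grind

theorem hasDerivAt_fourC (h : IsSeed y₀ A α) (hD : IsSeed y₀ B (Dop α)) (hα : ContDiff ℝ 1 α)
    (n m : ℕ) (hy : 0 < y) :
    HasDerivAt (fourC n m 0 α) (-(π * n) * fourC n m 0 α y + fourC n m 1 (Dop α) y / y) y := by
  have h1 := hasDerivAt_modeC (f := cuspFun m 0 α) (ν := n) (fun w hw => contDiffAt_cuspFun h hα m 0 hw)
    (fun w hw => by simpa [cuspNu] using cuspFun_add_two m 0 α hw n) hy
  have h2 : modeC (fun w => fderiv ℝ (cuspFun m 0 α) w 1 + I * fderiv ℝ (cuspFun m 0 α) w I) n y =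
      modeC (cuspDbar m 0 α) n y := by
    unfold modeC
    refine integral_congr fun x _ => ?_
    have hw : 0 < ((x : ℂ) + y * I).im := by simpa using hy
    simp only [dbar_cuspFun h hD hα m 0 hw]
  rw [h2, modeC_cuspDbar n m α y hy, ← fourC_eq_modeC n m α y hy, sub_neg_eq_add] at h1
  refine (h1.congr_of_eventuallyEq ?_).congr_deriv (by push_cast; ring)
  filter_upwards [lt_mem_nhds hy] with r hr
  exact fourC_eq_modeC n m α r hr

theorem norm_fourC_le (h : IsSeed y₀ A α) (hm : 1 ≤ m) (n κ : ℕ) (hy : 0 < y) :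
    ‖fourC n m κ α y‖ ≤ 2 * poinBd y₀ A * y ^ (-3 / 4 : ℝ) := by
  have : ‖fourC n m κ α y‖ ≤ (poinBd y₀ A * y ^ (-3 / 4 : ℝ)) * |2 - 0| := by
    refine intervalIntegral.norm_integral_le_of_norm_le_const fun x _ => ?_
    have he : ‖cexp (-(π * I * n * x))‖ = 1 := by
      rw [show -(π * I * n * x : ℂ) = ((-(π * n * x) : ℝ) : ℂ) * I by push_cast; ring, norm_exp_ofReal_mul_I]
    rw [norm_mul, he, mul_one, norm_mul, norm_pow]
    have h1 := h.norm_poin_le hm κ (rectCoord (y, x))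
    have h2 : √(thetaWt (rectCoord (y, x))) = ‖jacobiTheta (rectCoord (y, x))‖ ^ 3 * y ^ (3 / 4 : ℝ) := by
      rw [thetaWt, im_rectCoord (by exact hy), sqrt_eq_iff_mul_self_eq (by positivity) (by positivity)]
      have : y ^ (3 / 2 : ℝ) = y ^ (3 / 4 : ℝ) * y ^ (3 / 4 : ℝ) := by rw [← rpow_add hy]; norm_num
      rw [this]; ring
    rw [h2] at h1
    have h3 : y ^ (3 / 4 : ℝ) * y ^ (-3 / 4 : ℝ) = 1 := by rw [← rpow_add hy]; norm_num
    have h4 : 0 ≤ y ^ (-3 / 4 : ℝ) := by positivity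
    have := mul_le_mul_of_nonneg_right h1 h4
    refine le_trans (le_of_eq ?_) this
    grind
  linarith

theorem continuousOn_fourC (h : IsSeed y₀ A α) (n m κ : ℕ) :
    ContinuousOn (fourC n m κ α) (Ioi 0) := by
  have h1 : ContinuousOn (fun w : ℂ => jacobiTheta (ofComplex w : ℍ) ^ 3 * poin m κ α (ofComplex w)) {w : ℂ | 0 < w.im} := by
    have : Continuous fun z : ℍ => jacobiTheta z ^ 3 * poin m κ α z :=
      (continuous_jacobiTheta_uhp.pow 3).mul (h.continuous_poin m κ)
    have h2 : ContinuousOn ofComplex {w : ℂ | 0 < w.im} := by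
      intro w hw
      exact (UpperHalfPlane.contMDiffAt_ofComplex (n := 1) hw).continuousAt.continuousWithinAt
    exact this.comp_continuousOn h2
  refine (continuousOn_modeC h1 n).congr fun y hy => ?_
  unfold fourC modeC
  refine integral_congr fun x _ => ?_
  simp only [rectCoord_eq]
  simp

theorem rpow_le_mul_exp (h1 : 0 < y₁) (r : ℝ) : ∃ K : ℝ, 0 ≤ K ∧ ∀ y, y₁ ≤ y → y ^ r ≤ K * Real.exp y := by
  refine ⟨(⌈|r|⌉₊).factorial + y₁ ^ (-|r|), by positivity, fun y hy => ?_⟩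
  have hy0 : 0 < y := h1.trans_le hy
  have hp : 0 < y₁ ^ (-|r|) := by positivity
  have hN : |r| ≤ ⌈|r|⌉₊ := Nat.le_ceil _
  have he : 1 ≤ Real.exp y := one_le_exp hy0.le
  rcases le_total 1 y with h | h
  · have h2 : y ^ r ≤ y ^ (⌈|r|⌉₊ : ℝ) := rpow_le_rpow_of_exponent_le h ((le_abs_self r).trans hN)
    have h3 := pow_div_factorial_le_exp y hy0.le ⌈|r|⌉₊
    rw [div_le_iff₀ (by positivity)] at h3
    rw [rpow_natCast] at h2
    nlinarith
  · have h2 : y ^ r ≤ y ^ (-|r|) := rpow_le_rpow_of_exponent_ge hy0 h (neg_abs_le r)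
    have h3 : y ^ (-|r|) ≤ y₁ ^ (-|r|) := rpow_le_rpow_of_nonpos h1 hy (by simp)
    nlinarith

theorem seed_fourC_le {α γ : ℝ → ℝ} (hγ : IsSeed y₁ B γ) (h : IsSeed y₀ A α) (hm : 1 ≤ m)
    (n κ : ℕ) (s : ℝ) : ∃ K : ℝ, ∀ y, |γ y * y ^ s * Real.exp (-(π * m * y)) * (fourC n m κ α y).re| ≤ K * Real.exp (-y) := by
  obtain ⟨K, hK0, hK⟩ := rpow_le_mul_exp hγ.pos (s + (-3 / 4))
  have hB : 0 ≤ B := (abs_nonneg _).trans (hγ.bdd 0)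
  have hA : 0 ≤ A := (abs_nonneg _).trans (h.bdd 0)
  have hP : 0 ≤ poinBd y₀ A := by unfold poinBd; positivity
  refine ⟨B * K * (2 * poinBd y₀ A), fun y => ?_⟩
  rcases lt_or_ge y y₁ with hy | hy
  · rw [hγ.zero y hy]; simp; positivity
  have hy0 : 0 < y := hγ.pos.trans_le hy
  have h1 := (abs_re_le_norm _).trans (norm_fourC_le h hm n κ hy0)
  have h2 := hK y hy
  rw [rpow_add hy0] at h2
  have h3 : Real.exp (-(π * m * y)) ≤ Real.exp (-y) * Real.exp (-y) := by
    rw [← Real.exp_add, exp_le_exp]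
    have hm' : (1 : ℝ) ≤ m := by exact_mod_cast hm
    have hp := pi_gt_three
    nlinarith [mul_le_mul hp.le hm' zero_le_one pi_pos.le]
  have h5 : Real.exp y * Real.exp (-y) = 1 := by rw [← Real.exp_add]; simp
  rw [abs_mul, abs_mul, abs_mul, abs_of_pos (exp_pos _), abs_of_pos (rpow_pos_of_pos hy0 s)]
  calc |γ y| * y ^ s * Real.exp (-(π * m * y)) * |(fourC n m κ α y).re|
      ≤ B * y ^ s * (Real.exp (-y) * Real.exp (-y)) * (2 * poinBd y₀ A * y ^ (-3 / 4 : ℝ)) := by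
        gcongr
        exact hγ.bdd y
    _ = B * (2 * poinBd y₀ A) * (y ^ s * y ^ (-3 / 4 : ℝ)) * (Real.exp (-y) * Real.exp (-y)) := by ring
    _ ≤ B * (2 * poinBd y₀ A) * (K * Real.exp y) * (Real.exp (-y) * Real.exp (-y)) := by gcongr
    _ = B * K * (2 * poinBd y₀ A) * Real.exp (-y) := by grind

theorem integrableOn_seed_fourC {α γ : ℝ → ℝ} (hγ : IsSeed y₁ B γ) (h : IsSeed y₀ A α) (hm : 1 ≤ m)
    (n κ : ℕ) (s : ℝ) :
    IntegrableOn (fun y => γ y * y ^ s * Real.exp (-(π * m * y)) * (fourC n m κ α y).re) (Ioi 0) := by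
  obtain ⟨K, hK⟩ := seed_fourC_le hγ h hm n κ s
  have h1 : IntegrableOn (fun y : ℝ => K * Real.exp (-y)) (Ioi 0) := by
    have := (exp_neg_integrableOn_Ioi 0 one_pos).const_mul K
    aesop
  refine Integrable.mono' h1 ?_ (Filter.Eventually.of_forall fun y => by simp_all)
  refine ContinuousOn.aestronglyMeasurable ?_ measurableSet_Ioi
  exact ((hγ.cont.continuousOn.mul (continuousOn_rpow_pos s)).mul (by fun_prop)).mul
    (Complex.continuous_re.comp_continuousOn (continuousOn_fourC h n m κ))

theorem integral_add_add_sub {X : Type*} [MeasurableSpace X] {μ : Measure X} {f₀ f₁ f₂ f₃ : X → ℝ} (h₀ : Integrable f₀ μ) (h₁ : Integrable f₁ μ)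
    (h₂ : Integrable f₂ μ) (h₃ : Integrable f₃ μ) (a b : ℝ) :
    Integrable (fun x => f₀ x + (f₂ x + a * f₁ x - b * f₃ x)) μ ∧ ∫ x, f₀ x + (f₂ x + a * f₁ x - b * f₃ x) ∂μ =
      ∫ x, f₀ x ∂μ + (∫ x, f₂ x ∂μ + a * ∫ x, f₁ x ∂μ - b * ∫ x, f₃ x ∂μ) := by
  have e₁ := h₁.const_mul a
  have e₃ := h₃.const_mul b
  have e₄ : Integrable (fun x => f₂ x + a * f₁ x) μ := h₂.add e₁
  have e₅ : Integrable (fun x => f₂ x + a * f₁ x - b * f₃ x) μ := e₄.sub e₃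
  refine ⟨h₀.add e₅, ?_⟩
  rw [integral_add h₀ e₅, integral_sub e₄ e₃, integral_add h₂ e₁, integral_const_mul, integral_const_mul]

theorem bform_one_eq {y₀ A A' B₀ B₁ B₂ : ℝ} {α γ : ℝ → ℝ} (hγ : IsSeed y₀ B₀ γ) (hγD : IsSeed y₀ B₁ (Dop γ))
    (hγy : IsSeed y₀ B₂ fun y => y * γ y) (hγ1 : Differentiable ℝ γ)
    (h : IsSeed y₀ A α) (hD : IsSeed y₀ A' (Dop α)) (hα : ContDiff ℝ 1 α) (hm : 1 ≤ m) :
    bform m 1 γ (Dop α) = -(bform m 0 (Dop γ) α + 1 / 2 * bform m 0 γ α - 2 * π * m * bform m 0 (fun y => y * γ y) α) := by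
  rw [bform_eq_fourC hγ hD hm, bform_eq_fourC hγ h hm, bform_eq_fourC hγD h hm, bform_eq_fourC hγy h hm]
  have i0 := integrableOn_seed_fourC hγ hD hm m 1 (-1 / 2)
  have i1 := integrableOn_seed_fourC hγ h hm m 0 (-1 / 2)
  have i2 := integrableOn_seed_fourC hγD h hm m 0 (-1 / 2)
  have i3 := integrableOn_seed_fourC hγy h hm m 0 (-1 / 2)
  set F : ℝ → ℝ := fun y => γ y * y ^ (1 / 2 : ℝ) * Real.exp (-(π * m * y)) * (fourC m m 0 α y).re with hF
  have hF0 : F =ᶠ[𝓝 0] fun _ => 0 := by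
    filter_upwards [gt_mem_nhds hγ.pos] with y hy
    simp [hF, hγ.zero y hy]
  have hFi : Tendsto F atTop (𝓝 0) := by
    obtain ⟨K, hK⟩ := seed_fourC_le hγ h hm m 0 (1 / 2)
    have h0 := (tendsto_exp_neg_atTop_nhds_zero).const_mul K
    rw [mul_zero] at h0
    exact squeeze_zero_norm (fun y => hK y) h0
  have hd : ∀ y ∈ Ioi (0 : ℝ), HasDerivAt F
      (γ y * y ^ (-1 / 2 : ℝ) * Real.exp (-(π * m * y)) * (fourC m m 1 (Dop α) y).re +
        (Dop γ y * y ^ (-1 / 2 : ℝ) * Real.exp (-(π * m * y)) * (fourC m m 0 α y).re +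
        1 / 2 * (γ y * y ^ (-1 / 2 : ℝ) * Real.exp (-(π * m * y)) * (fourC m m 0 α y).re) -
        2 * π * m * ((y * γ y) * y ^ (-1 / 2 : ℝ) * Real.exp (-(π * m * y)) * (fourC m m 0 α y).re))) y := by
    intro y hy
    have hy0 : 0 < y := hy
    have d1 := (hγ1 y).hasDerivAt
    have d2 := hasDerivAt_rpow_const (x := y) (p := 1 / 2) (Or.inl hy0.ne')
    have d3 : HasDerivAt (fun y : ℝ => Real.exp (-(π * m * y))) (Real.exp (-(π * m * y)) * (-(π * m))) y := by
      have := ((hasDerivAt_id y).const_mul (π * m)).neg.exp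
      simpa using this
    have d4 := reCLM.hasFDerivAt.comp_hasDerivAt y (hasDerivAt_fourC h hD hα m m hy0)
    have := ((d1.mul d2).mul d3).mul d4
    refine this.congr_deriv ?_
    have e1 : y ^ (1 / 2 : ℝ) = y * y ^ (-1 / 2 : ℝ) := by
      nth_rewrite 2 [← rpow_one y]; rw [← rpow_add hy0]; norm_num
    have e2 : y ^ (1 / 2 - 1 : ℝ) = y ^ (-1 / 2 : ℝ) := by norm_num
    have e3 : (-(π * m : ℂ) * fourC m m 0 α y + fourC m m 1 (Dop α) y / y).re =
        -(π * m) * (fourC m m 0 α y).re + (fourC m m 1 (Dop α) y).re / y := by simp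
    simp only [Function.comp, reCLM_apply, e1, e2, Dop, Pi.mul_apply, id]
    rw [e3]
    field_simp
    ring
  obtain ⟨hi, he⟩ := integral_add_add_sub i0 i1 i2 i3 (1 / 2) (2 * π * m)
  have hint := integral_Ioi_of_hasDerivAt_of_tendsto (hF0.continuousAt.continuousWithinAt) hd hi hFi
  rw [hF0.self_of_nhds, he] at hint
  linarith

theorem halfStrip_le {Φ : ℍ → ℝ≥0∞} (hΦ : Measurable Φ) (hinv : ∀ (g : SL(2, ℤ)) (z : ℍ), Φ (g • z) = Φ z) (hY : 0 < Y) :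
    ∫⁻ z in halfStrip Y, Φ z ≤ ENNReal.ofReal ((4 / Y + 3) ^ 2) * ∫⁻ z, Φ z ∂cuspMeas := by
  rw [lintegral_halfStrip hY hΦ hinv, ← lintegral_const_mul' _ _ (by simp)]
  refine lintegral_mono fun z => mul_le_mul_left (?_ : ((cuspSet Y z).ncard : ℝ≥0∞) ≤ _) _
  rw [← ENNReal.ofReal_natCast]
  exact ofReal_le_ofReal (cuspSet_ncard_le hY z)

theorem lintegral_strip_le {P : ℍ → ℝ} (hP : Continuous P) (hn : ∀ z, 0 ≤ P z)
    (hinv : ∀ γ ∈ Γ₂, ∀ z, P (γ • z) = P z) (hY : 0 < Y) :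
    ∫⁻ y in Ioi Y, ENNReal.ofReal (1 / y ^ 2 * ∫ x in (0 : ℝ)..2, P (rectCoord (y, x))) ≤
      2 * (ENNReal.ofReal ((4 / Y + 3) ^ 2) * ∫⁻ z, cosetSum P z ∂cuspMeas) := by
  have h1 := mul_le_mul_right (halfStrip_le (measurable_cosetSum hP) (fun g z => cosetSum_smul hinv g z) hY) (2 : ℝ≥0∞)
  rw [two_mul_lintegral_cosetSum hP hn hinv hY] at h1
  refine le_trans ?_ h1
  refine le_trans (le_of_eq ?_) (Finset.single_le_sum (f := fun q : Cst => ∫⁻ y in Ioi Y, ENNReal.ofReal (1 / y ^ 2 *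
    ∫ x in (0 : ℝ)..2, P (cuspRep (cuspIdx q) • rectCoord (y, x)))) (fun _ _ => zero_le) (Finset.mem_univ ((1 : SL(2, ℤ)) : Cst)))
  refine setLIntegral_congr_fun measurableSet_Ioi fun y hy => ?_
  have hy0 : 0 < y := hY.trans hy
  have hmem : (((1 : SL(2, ℤ)) : Cst).out)⁻¹ ∈ Γ₂ := by
    have h := QuotientGroup.out_eq' ((1 : SL(2, ℤ)) : Cst)
    have h2 := QuotientGroup.eq.mp h
    simpa using h2
  rw [← integral_coset_line hinv _ hy0, integral_congr fun x _ => hinv _ hmem (rectCoord (y, x))]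

theorem norm_sq_interval_le {f : ℝ → ℂ} (hf : Continuous f) : ‖∫ x in (0 : ℝ)..2, f x‖ ^ 2 ≤ 2 * ∫ x in (0 : ℝ)..2, ‖f x‖ ^ 2 := by
  have h1 : ‖∫ x in (0 : ℝ)..2, f x‖ ≤ ∫ x in (0 : ℝ)..2, ‖f x‖ :=
    intervalIntegral.norm_integral_le_integral_norm (by norm_num)
  set M := ∫ x in (0 : ℝ)..2, ‖f x‖ with hM
  have i1 : IntervalIntegrable (fun x => ‖f x‖ ^ 2) volume 0 2 := (hf.norm.pow 2).intervalIntegrable _ _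
  have i2 : IntervalIntegrable (fun x => M * ‖f x‖) volume 0 2 := (continuous_const.mul hf.norm).intervalIntegrable _ _
  have h2 : 0 ≤ ∫ x in (0 : ℝ)..2, (‖f x‖ ^ 2 - M * ‖f x‖ + M ^ 2 / 4) :=
    intervalIntegral.integral_nonneg (by norm_num) fun x _ => by nlinarith [sq_nonneg (‖f x‖ - M / 2)]
  rw [intervalIntegral.integral_add (i1.sub i2) intervalIntegrable_const, intervalIntegral.integral_sub i1 i2,
    intervalIntegral.integral_const_mul, ← hM, intervalIntegral.integral_const] at h2
  norm_num at h2
  nlinarith [pow_le_pow_left₀ (norm_nonneg _) h1 2]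

theorem integral_fourC_le (h : IsSeed y₀ A α) (hm : 1 ≤ m) (n κ : ℕ) {a b : ℝ} (ha : 0 < a)
    (hab : a ≤ b) : ∫ y in a..b, y ^ (-1 / 2 : ℝ) * ‖fourC n m κ α y‖ ^ 2 ≤ 4 * (4 / a + 3) ^ 2 * bform m κ α α := by
  have h1 := lintegral_strip_le (continuous_poinPair h h m κ) (poinPair_self_nonneg m κ α)
    (fun γ hγ z => poinPair_gamma_smul m κ α hγ z) ha
  rw [lintegral_cosetSum h hm] at h1
  have hc : ContinuousOn (fun y : ℝ => y ^ (-1 / 2 : ℝ) * ‖fourC n m κ α y‖ ^ 2) (Ioi 0) :=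
    (continuousOn_rpow_pos _).mul ((continuousOn_fourC h n m κ).norm.pow 2)
  have h2 : ∀ y ∈ Ioi a, ENNReal.ofReal (y ^ (-1 / 2 : ℝ) * ‖fourC n m κ α y‖ ^ 2) ≤
      2 * ENNReal.ofReal (1 / y ^ 2 * ∫ x in (0 : ℝ)..2, poinPair m κ α α (rectCoord (y, x))) := by
    intro y hy
    have hy0 : 0 < y := ha.trans hy
    have e2 : (2 : ℝ≥0∞) = ENNReal.ofReal 2 := by simp
    rw [e2, ← ENNReal.ofReal_mul (by norm_num)]
    refine ofReal_le_ofReal ?_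
    set f : ℝ → ℂ := fun x => jacobiTheta (rectCoord (y, x)) ^ 3 * poin m κ α (rectCoord (y, x)) * cexp (-(π * I * n * x)) with hf
    have hfc : Continuous f :=
      (((continuous_jacobiTheta_uhp.comp (continuous_rectCoord hy0)).pow 3).mul
        ((h.continuous_poin m κ).comp (continuous_rectCoord hy0))).mul (by fun_prop)
    have h3 := norm_sq_interval_le hfc
    have h4 : ∀ x : ℝ, poinPair m κ α α (rectCoord (y, x)) = y ^ (3 / 2 : ℝ) * ‖f x‖ ^ 2 := by
      intro x
      have he : ‖cexp (-(π * I * n * x))‖ = 1 := by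
        rw [show -(π * I * n * x : ℂ) = ((-(π * n * x) : ℝ) : ℂ) * I by push_cast; ring, norm_exp_ofReal_mul_I]
      rw [poinPair_self, hf, norm_mul, he, norm_mul, norm_pow, thetaWt, im_rectCoord (by exact hy0)]
      ring
    rw [integral_congr fun x _ => h4 x, intervalIntegral.integral_const_mul, fourC]
    have e3 : 1 / y ^ 2 * y ^ (3 / 2 : ℝ) = y ^ (-1 / 2 : ℝ) := by
      obtain ⟨f0, f1, f2, f3, f4, f5⟩ := rpow_half_facts hy0
      rw [f2]; field_simp
    rw [← mul_assoc (1 / y ^ 2), e3]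
    have e4 : 0 ≤ y ^ (-1 / 2 : ℝ) := by positivity
    nlinarith
  have h5 : ENNReal.ofReal (∫ y in a..b, y ^ (-1 / 2 : ℝ) * ‖fourC n m κ α y‖ ^ 2) ≤
      ENNReal.ofReal (4 * (4 / a + 3) ^ 2 * bform m κ α α) := by
    rw [← lintegral_Ioc_eq hc (fun y hy => by positivity) ha hab]
    calc _ ≤ ∫⁻ y in Ioi a, ENNReal.ofReal (y ^ (-1 / 2 : ℝ) * ‖fourC n m κ α y‖ ^ 2) :=
          lintegral_mono_set Set.Ioc_subset_Ioi_self
      _ ≤ ∫⁻ y in Ioi a, 2 * ENNReal.ofReal (1 / y ^ 2 * ∫ x in (0 : ℝ)..2, poinPair m κ α α (rectCoord (y, x))) :=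
          setLIntegral_mono' measurableSet_Ioi h2
      _ ≤ 2 * (2 * (ENNReal.ofReal ((4 / a + 3) ^ 2) * ENNReal.ofReal (bform m κ α α))) := by
          rw [lintegral_const_mul' _ _ (by simp)]
          gcongr
      _ = _ := by
          rw [ENNReal.ofReal_mul (by positivity), ENNReal.ofReal_mul (by norm_num), ← mul_assoc, ← mul_assoc]
          norm_num
  exact (ENNReal.ofReal_le_ofReal_iff (mul_nonneg (by positivity) (bform_self_nonneg m κ α))).mp h5

theorem isMode_fourC (h : IsSeed y₀ A α) (hD : IsSeed y₀ B (Dop α)) (hα : ContDiff ℝ 1 α)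
    (n m : ℕ) : IsMode n (fourC n m 0 α) (fun y => I * (fourC n m 1 (Dop α) y / y)) where
  deriv y hy := (hasDerivAt_fourC h hD hα n m hy).congr_deriv (by
    push_cast; linear_combination (fourC n m 1 (Dop α) y / y) * I_mul_I)
  cont := continuousOn_const.mul ((continuousOn_fourC hD n m 1).div (by fun_prop) fun y hy => by aesop)

theorem norm_fourC_sq_le (h : IsSeed y₀ A α) (hD : IsSeed y₀ B (Dop α)) (hα : ContDiff ℝ 1 α)
    (n : ℕ) (hm : 1 ≤ m) (hy : 0 < y) :
    ‖fourC n m 0 α y‖ ^ 2 ≤ 16 * y ^ (-1 / 2 : ℝ) * (8 / y + 3) ^ 2 * (bform m 0 α α + bform m 1 (Dop α) (Dop α)) := by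
  have hM := isMode_fourC h hD hα n m
  have hyy : y / 2 ≤ y := by linarith
  have hy2 : 0 < y / 2 := by linarith
  have e1 : y ^ (1 / 2 : ℝ) = y * y ^ (-1 / 2 : ℝ) := by
    nth_rewrite 2 [← rpow_one y]; rw [← rpow_add hy]; norm_num
  have key := mode_bound hM (w := fun r => r - y / 2) (w' := fun _ => 1) (p := 2 * y ^ (1 / 2 : ℝ)) (q := y ^ (1 / 2 : ℝ))
    hy2 hyy (fun r _ => (hasDerivAt_id r).sub_const _) (by
      intro r hr e he
      have hr0 : 0 < r := hy2.trans hr.1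
      set c := ‖fourC n m 0 α r‖
      set k := ‖I * (fourC n m 1 (Dop α) r / r)‖
      have e2 := (abs_le.mp he).2
      have e3 : r ^ (1 / 2 : ℝ) ≤ y ^ (1 / 2 : ℝ) := rpow_le_rpow hr0.le hr.2.le (by norm_num)
      have e4 : r ^ (1 / 2 : ℝ) * r ^ (-1 / 2 : ℝ) = 1 := by rw [← rpow_add hr0]; norm_num
      have e5 : r ^ (1 / 2 : ℝ) * r ^ (3 / 2 : ℝ) = r ^ 2 := by rw [← rpow_add hr0, ← rpow_natCast]; norm_num
      have f1 : c ^ 2 ≤ y ^ (1 / 2 : ℝ) * (r ^ (-1 / 2 : ℝ) * c ^ 2) := by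
        calc c ^ 2 = r ^ (1 / 2 : ℝ) * (r ^ (-1 / 2 : ℝ) * c ^ 2) := by grind
          _ ≤ _ := by gcongr
      have f2 : r ^ 2 * k ^ 2 ≤ y ^ (1 / 2 : ℝ) * (r ^ (3 / 2 : ℝ) * k ^ 2) := by
        calc r ^ 2 * k ^ 2 = r ^ (1 / 2 : ℝ) * (r ^ (3 / 2 : ℝ) * k ^ 2) := by rw [← mul_assoc, e5]
          _ ≤ _ := by gcongr
      have g0 : 0 ≤ r - y / 2 := by linarith [hr.1]
      have g1 : r - y / 2 ≤ r / 2 := by linarith [hr.2]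
      have g2 : (r - y / 2) * e ≤ r * (c * k) := by
        calc (r - y / 2) * e ≤ (r - y / 2) * (2 * (c * k)) := by gcongr
          _ ≤ r / 2 * (2 * (c * k)) := by gcongr
          _ = _ := by ring
      have g3 : 0 ≤ (r - y / 2) * (π * n) * c ^ 2 := by positivity
      have g4 : r * (c * k) ≤ c ^ 2 + r ^ 2 * k ^ 2 := by nlinarith [sq_nonneg (c - r * k), sq_nonneg c, sq_nonneg (r * k)]
      nlinarith)
  have i1 := integral_fourC_le h hm n 0 hy2 hyy
  have i2 := integral_fourC_le hD hm n 1 hy2 hyy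
  have i3 : ∫ r in (y / 2)..y, r ^ (3 / 2 : ℝ) * ‖I * (fourC n m 1 (Dop α) r / r)‖ ^ 2 =
      ∫ r in (y / 2)..y, r ^ (-1 / 2 : ℝ) * ‖fourC n m 1 (Dop α) r‖ ^ 2 := by
    refine integral_congr fun r hr => ?_
    rw [Set.uIcc_of_le hyy] at hr
    have hr0 : 0 < r := hy2.trans_le hr.1
    obtain ⟨f0, f1, f2, f3, f4, f5⟩ := rpow_half_facts hr0
    rw [norm_mul, norm_I, one_mul, norm_div, norm_real, norm_eq_abs, abs_of_pos hr0, f2]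
    field_simp
  rw [i3] at key
  have e6 : (4 / (y / 2) + 3) = 8 / y + 3 := by field_simp; ring
  rw [e6] at i1 i2
  have hpos := bform_self_nonneg m 1 (Dop α)
  rw [e1] at key
  have j1 := mul_le_mul_of_nonneg_left i1 (by positivity : 0 ≤ 2 * (y * y ^ (-1 / 2 : ℝ)))
  have j2 := mul_le_mul_of_nonneg_left i2 (by positivity : 0 ≤ (y * y ^ (-1 / 2 : ℝ)))
  have j3 : 0 ≤ y * y ^ (-1 / 2 : ℝ) * (4 * (8 / y + 3) ^ 2 * bform m 1 (Dop α) (Dop α)) := by positivity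
  have key2 : y * ‖fourC n m 0 α y‖ ^ 2 ≤ y * (16 * y ^ (-1 / 2 : ℝ) * (8 / y + 3) ^ 2 * (bform m 0 α α + bform m 1 (Dop α) (Dop α))) := by grind
  simp_all

/-- The function `y ↦ P (1 / (e^t y))` on `e^t y ≥ 1`, extended constantly. -/
def prof (P : ℝ → ℝ) (t y : ℝ) : ℝ := P (max (Real.exp t * y) 1)⁻¹

theorem invMax_mem (x : ℝ) : (max x 1)⁻¹ ∈ Set.Icc (0 : ℝ) 1 :=
  ⟨by positivity, inv_le_one_of_one_le₀ (le_max_right _ _)⟩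

theorem continuous_invMax : Continuous fun x : ℝ => (max x 1)⁻¹ :=
  (continuous_id.max continuous_const).inv₀ fun x => (lt_of_lt_of_le one_pos (le_max_right x 1)).ne'

theorem prof_of_lt {P : ℝ → ℝ} (h1 : P 1 = 0) {t y : ℝ} (h : y ≤ Real.exp (-t)) : prof P t y = 0 := by
  have : Real.exp t * y ≤ 1 := by
    calc Real.exp t * y ≤ Real.exp t * Real.exp (-t) := by gcongr
      _ = 1 := by rw [← Real.exp_add]; simp
  rw [prof, max_eq_right this, inv_one, h1]

theorem isSeed_prof {P : ℝ → ℝ} (hP : Continuous P) (h1 : P 1 = 0) (hA : ∀ v ∈ Set.Icc (0 : ℝ) 1, |P v| ≤ A)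
    {t y₀ : ℝ} (hy₀ : 0 < y₀) (ht : y₀ ≤ Real.exp (-t)) : IsSeed y₀ A (prof P t) where
  pos := hy₀
  cont := hP.comp (continuous_invMax.comp (continuous_const.mul continuous_id))
  zero y hy := prof_of_lt h1 (hy.le.trans ht)
  bdd y := hA _ (invMax_mem _)

theorem hasDerivAt_comp_invMax {P P' : ℝ → ℝ} (hP : ∀ v, HasDerivAt P (P' v) v) (hc : Continuous P') (h1 : P' 1 = 0) (x : ℝ) :
    HasDerivAt (fun x => P (max x 1)⁻¹) (-(P' (max x 1)⁻¹ * ((max x 1)⁻¹) ^ 2)) x := by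
  have hPc : Continuous P := continuous_iff_continuousAt.mpr fun v => (hP v).continuousAt
  have hne : ∀ y, y ≠ 1 → HasDerivAt (fun x => P (max x 1)⁻¹) (-(P' (max y 1)⁻¹ * ((max y 1)⁻¹) ^ 2)) y := by
    intro y hy
    rcases lt_or_gt_of_ne hy with h | h
    · have e : (fun x => P (max x 1)⁻¹) =ᶠ[𝓝 y] fun _ => P 1 := by
        filter_upwards [gt_mem_nhds h] with r hr
        grind
      refine ((hasDerivAt_const y (P 1)).congr_of_eventuallyEq e).congr_deriv ?_
      grind
    · have e : (fun x => P (max x 1)⁻¹) =ᶠ[𝓝 y] fun x => P x⁻¹ := by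
        filter_upwards [lt_mem_nhds h] with r hr
        rw [max_eq_left hr.le]
      have hy0 : y ≠ 0 := by linarith
      refine (((hP y⁻¹).comp y (hasDerivAt_inv hy0)).congr_of_eventuallyEq e).congr_deriv ?_
      grind
  by_cases hx : x = 1
  · subst hx
    refine hasDerivAt_of_hasDerivAt_of_ne (f := fun x => P (max x 1)⁻¹)
      (g := fun x => -(P' (max x 1)⁻¹ * ((max x 1)⁻¹) ^ 2)) (fun y hy => hne y hy) ?_ ?_
    · fun_prop (disch := positivity)
    · fun_prop (disch := positivity)
  · exact hne x hx

theorem invMax_mul {P' : ℝ → ℝ} (h1 : P' 1 = 0) (x : ℝ) :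
    -(P' (max x 1)⁻¹ * ((max x 1)⁻¹) ^ 2) * x = -((max x 1)⁻¹ * P' (max x 1)⁻¹) := by grind

theorem hasDerivAt_prof {P P' : ℝ → ℝ} (hP : ∀ v, HasDerivAt P (P' v) v) (hc : Continuous P') (h1 : P' 1 = 0) (t y : ℝ) :
    HasDerivAt (prof P t) (-(P' (max (Real.exp t * y) 1)⁻¹ * ((max (Real.exp t * y) 1)⁻¹) ^ 2) * Real.exp t) y := by
  have := (hasDerivAt_comp_invMax hP hc h1 (Real.exp t * y)).comp y ((hasDerivAt_id y).const_mul (Real.exp t))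
  aesop

theorem Dop_prof {P P' : ℝ → ℝ} (hP : ∀ v, HasDerivAt P (P' v) v) (hc : Continuous P') (h1 : P' 1 = 0) (t : ℝ) :
    Dop (prof P t) = prof (fun v => -(v * P' v)) t := by
  ext y
  rw [Dop, (hasDerivAt_prof hP hc h1 t y).deriv, prof, ← invMax_mul h1]
  ring

theorem contDiff_prof {P P' : ℝ → ℝ} (hP : ∀ v, HasDerivAt P (P' v) v) (hc : Continuous P') (h1 : P' 1 = 0) (t : ℝ) :
    ContDiff ℝ 1 (prof P t) := by
  rw [contDiff_one_iff_deriv]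
  refine ⟨fun y => (hasDerivAt_prof hP hc h1 t y).differentiableAt, ?_⟩
  have : deriv (prof P t) = fun y => -(P' (max (Real.exp t * y) 1)⁻¹ * ((max (Real.exp t * y) 1)⁻¹) ^ 2) * Real.exp t :=
    funext fun y => (hasDerivAt_prof hP hc h1 t y).deriv
  rw [this]
  have hi : Continuous fun y : ℝ => (max (Real.exp t * y) 1)⁻¹ := continuous_invMax.comp (continuous_const.mul continuous_id)
  fun_prop

theorem hasDerivAt_prof_param {P P' : ℝ → ℝ} (hP : ∀ v, HasDerivAt P (P' v) v) (hc : Continuous P') (h1 : P' 1 = 0) (t y : ℝ) :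
    HasDerivAt (fun t => prof P t y) (prof (fun v => -(v * P' v)) t y) t := by
  have := (hasDerivAt_comp_invMax hP hc h1 (Real.exp t * y)).comp t ((Real.hasDerivAt_exp t).mul_const y)
  refine this.congr_deriv ?_
  rw [prof, ← invMax_mul h1]

theorem abs_exp_neg_sub_le {a b : ℝ} (ha : 0 ≤ a) (hb : 0 ≤ b) : |Real.exp (-a) - Real.exp (-b)| ≤ |a - b| := by
  wlog h : a ≤ b generalizing a b
  · grind
  rw [abs_of_nonneg (sub_nonneg.mpr (exp_le_exp.mpr (by linarith))), abs_of_nonpos (by linarith)]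
  have e : Real.exp (-b) = Real.exp (-a) * Real.exp (-(b - a)) := by rw [← Real.exp_add]; congr 1; ring
  have h1 := add_one_le_exp (-(b - a))
  have h2 : Real.exp (-a) ≤ 1 := exp_le_one_iff.mpr (by linarith)
  have h3 := exp_pos (-a)
  rw [e]
  nlinarith

theorem abs_invMax_sub_le (s t y : ℝ) : |(max (Real.exp s * y) 1)⁻¹ - (max (Real.exp t * y) 1)⁻¹| ≤ |s - t| := by
  rcases le_or_gt y 0 with hy | hy
  · rw [max_eq_right (by nlinarith [exp_pos s]), max_eq_right (by nlinarith [exp_pos t])]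
    simp
  · have e : ∀ t, (max (Real.exp t * y) 1)⁻¹ = Real.exp (-(max (t + Real.log y) 0)) := by
      intro t
      rw [Real.exp_neg, exp_monotone.map_max, Real.exp_add, Real.exp_log hy, Real.exp_zero]
    rw [e, e]
    refine (abs_exp_neg_sub_le (le_max_right _ _) (le_max_right _ _)).trans ?_
    refine (abs_max_sub_max_le_abs _ _ _).trans (le_of_eq ?_)
    congr 1; ring

theorem abs_prof_taylor {P P' Q' : ℝ → ℝ} (hP : ∀ v, HasDerivAt P (P' v) v) (hc : Continuous P') (h1 : P' 1 = 0)
    (hQ : ∀ v, HasDerivAt (fun v => -(v * P' v)) (Q' v) v) (hQc : Continuous Q') :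
    ∃ L : ℝ, 0 ≤ L ∧ ∀ t h y, |prof P (t + h) y - prof P t y - h * prof (fun v => -(v * P' v)) t y| ≤ L * h ^ 2 := by
  obtain ⟨L, hL⟩ := isCompact_Icc.exists_bound_of_continuousOn (s := Set.Icc (0:ℝ) 1) hQc.continuousOn
  have hL0 : 0 ≤ L := (norm_nonneg _).trans (hL 0 (by simp))
  have hlip : ∀ s t y, |prof (fun v => -(v * P' v)) s y - prof (fun v => -(v * P' v)) t y| ≤ L * |s - t| := by
    intro s t y
    have := (convex_Icc (0:ℝ) 1).norm_image_sub_le_of_norm_hasDerivWithin_le (fun v _ => (hQ v).hasDerivWithinAt) hL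
      (invMax_mem (Real.exp t * y)) (invMax_mem (Real.exp s * y))
    refine this.trans ?_
    gcongr
    exact abs_invMax_sub_le s t y
  refine ⟨L, hL0, fun t h y => ?_⟩
  have hd : ∀ s ∈ Set.uIcc t (t + h), HasDerivWithinAt (fun s => prof P s y - s * prof (fun v => -(v * P' v)) t y)
      (prof (fun v => -(v * P' v)) s y - prof (fun v => -(v * P' v)) t y) (Set.uIcc t (t + h)) s := fun s _ =>
    ((hasDerivAt_prof_param hP hc h1 s y).sub (by simpa using (hasDerivAt_id s).mul_const _)).hasDerivWithinAt
  have hb : ∀ s ∈ Set.uIcc t (t + h), ‖prof (fun v => -(v * P' v)) s y - prof (fun v => -(v * P' v)) t y‖ ≤ L * |h| := by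
    intro s hs
    have := Set.abs_sub_left_of_mem_uIcc hs
    rw [show t + h - t = h by ring] at this
    exact (hlip s t y).trans (mul_le_mul_of_nonneg_left this hL0)
  have := (convex_uIcc t (t + h)).norm_image_sub_le_of_norm_hasDerivWithin_le hd hb Set.left_mem_uIcc Set.right_mem_uIcc
  rw [norm_eq_abs, norm_eq_abs, show t + h - t = h by ring, mul_assoc, abs_mul_abs_self] at this
  grind

theorem IsSeed.mono {y₀ A A' : ℝ} (h : IsSeed y₀ A α) (hA : A ≤ A') : IsSeed y₀ A' α :=
  ⟨h.pos, h.cont, h.zero, fun y => (h.bdd y).trans hA⟩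

theorem hasDerivAt_bform_prof {P P' Q' : ℝ → ℝ} (hP : ∀ v, HasDerivAt P (P' v) v) (hc : Continuous P') (h1 : P' 1 = 0)
    (hP1 : P 1 = 0)
    (hQ : ∀ v, HasDerivAt (fun v => -(v * P' v)) (Q' v) v) (hQc : Continuous Q') (hm : 1 ≤ m) (κ : ℕ) (t : ℝ) :
    HasDerivAt (fun t => bform m κ (prof P t) (prof P t)) (2 * bform m κ (prof P t) (prof (fun v => -(v * P' v)) t)) t := by
  obtain ⟨L, hL0, hL⟩ := abs_prof_taylor hP hc h1 hQ hQc
  have hPc : Continuous P := continuous_iff_continuousAt.mpr fun v => (hP v).continuousAt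
  set Q : ℝ → ℝ := fun v => -(v * P' v) with hQd
  have hQcc : Continuous Q := (continuous_id.mul hc).neg
  obtain ⟨A, hA⟩ := isCompact_Icc.exists_bound_of_continuousOn (s := Set.Icc (0:ℝ) 1) hPc.continuousOn
  obtain ⟨B, hB⟩ := isCompact_Icc.exists_bound_of_continuousOn (s := Set.Icc (0:ℝ) 1) hQcc.continuousOn
  obtain ⟨C, hC0, hC⟩ := abs_bform_le (Real.exp (-t - 1))
  set K : ℝ := C * B * B + 2 * (C * A * L) + 2 * (C * B * L) + C * L * L with hK
  have hmain : ∀ h : ℝ, |h| < 1 → |bform m κ (prof P (t + h)) (prof P (t + h)) - bform m κ (prof P t) (prof P t) -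
      h * (2 * bform m κ (prof P t) (prof Q t))| ≤ K * h ^ 2 := by
    intro h hh
    obtain ⟨hh1, hh2⟩ := abs_lt.mp hh
    have sP : IsSeed (Real.exp (-t - 1)) A (prof P t) := isSeed_prof hPc hP1 hA (exp_pos _) (exp_le_exp.mpr (by linarith))
    have sQ : IsSeed (Real.exp (-t - 1)) B (prof Q t) := isSeed_prof hQcc (by simp [hQd, h1]) hB (exp_pos _)
      (exp_le_exp.mpr (by linarith))
    have sP' : IsSeed (Real.exp (-t - 1)) A (prof P (t + h)) :=
      isSeed_prof hPc hP1 hA (exp_pos _) (exp_le_exp.mpr (by linarith))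
    set R : ℝ → ℝ := fun y => prof P (t + h) y - prof P t y - h * prof Q t y with hR
    have sR : IsSeed (Real.exp (-t - 1)) (L * h ^ 2) R :=
      ⟨sP.pos, (sP'.cont.sub sP.cont).sub (continuous_const.mul sQ.cont), fun y hy => by
        simp only [hR, sP'.zero y hy, sP.zero y hy, sQ.zero y hy]; simp, fun y => hL t h y⟩
    have sS := sP.add (sQ.const_mul h)
    have e : prof P (t + h) = fun y => (prof P t y + h * prof Q t y) + R y := by grind
    rw [e, bform_add_left sS sR (sS.add sR) hm, bform_add_right sS sR sS hm, bform_add_right sS sR sR hm,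
      bform_add_left sP (sQ.const_mul h) sS hm, bform_add_right sP (sQ.const_mul h) sP hm,
      bform_add_right sP (sQ.const_mul h) (sQ.const_mul h) hm, bform_add_left sP (sQ.const_mul h) sR hm,
      bform_comm m κ R, bform_add_left sP (sQ.const_mul h) sR hm, bform_comm m κ (fun y => h * prof Q t y) (prof P t)]
    simp only [bform_const_mul_left, bform_const_mul_right]
    have b1 := hC m κ _ _ _ _ hm sQ sQ
    have b2 := hC m κ _ _ _ _ hm sP sR
    have b3 := hC m κ _ _ _ _ hm sQ sR
    have b4 := hC m κ _ _ _ _ hm sR sR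
    have hh3 : h ^ 2 ≤ 1 := by nlinarith
    have b3' : |h * bform m κ (prof Q t) R| ≤ C * B * L * h ^ 2 := by
      rw [abs_mul]
      calc |h| * |bform m κ (prof Q t) R| ≤ 1 * (C * B * (L * h ^ 2)) := by gcongr
        _ = _ := by ring
    have b4' : |bform m κ R R| ≤ C * L * L * h ^ 2 := by
      refine b4.trans ?_
      calc C * (L * h ^ 2) * (L * h ^ 2) = C * L * L * h ^ 2 * h ^ 2 := by ring
        _ ≤ C * L * L * h ^ 2 * 1 := by gcongr
        _ = _ := by ring
    have b1' : |h * (h * bform m κ (prof Q t) (prof Q t))| ≤ C * B * B * h ^ 2 := by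
      rw [← mul_assoc, abs_mul, ← pow_two, abs_of_nonneg (sq_nonneg h), mul_comm]
      gcongr
    rw [hK]
    rw [abs_le] at *
    grind
  rw [hasDerivAt_iff_isLittleO_nhds_zero]
  have : (fun h : ℝ => bform m κ (prof P (t + h)) (prof P (t + h)) - bform m κ (prof P t) (prof P t) -
      h • (2 * bform m κ (prof P t) (prof Q t))) =O[𝓝 0] fun h => h ^ 2 := by
    refine Asymptotics.IsBigO.of_bound K ?_
    filter_upwards [Metric.ball_mem_nhds (0:ℝ) one_pos] with h hh
    have hh' : |h| < 1 := by simpa using hh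
    rw [norm_eq_abs, norm_eq_abs, abs_of_nonneg (sq_nonneg h), smul_eq_mul]
    exact hmain h hh'
  exact this.trans_isLittleO (by simpa using Asymptotics.isLittleO_pow_id (one_lt_two))

/-- A differential inequality forcing exponential decay of a quadratic energy. -/
theorem energy_decay {a J p q : ℝ → ℝ} {K : ℝ} (hK : 0 ≤ K) (hp0 : ∀ t, 0 ≤ p t) (hq0 : ∀ t, 0 ≤ q t)
    (hgap : ∀ t, a t ≤ 3000 * q t) (hJ : ∀ t, J t ^ 2 ≤ a t * p t)
    (hJ' : ∀ t, HasDerivAt J (p t - 1 / 2 * J t - q t + K * Real.exp (-t) * (3 * a t + J t)) t)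
    (hpq : ∀ t, HasDerivAt (fun t => p t + q t) (-p t + 2 * K * Real.exp (-t) * (3 * J t + p t)) t) :
    ∃ C : ℝ, 0 ≤ C ∧ ∀ t, 0 ≤ t → a t + q t ≤ C * Real.exp (-(t / 2500)) := by
  have hJs : ∀ s : ℝ, 0 < s → ∀ t, |J t| ≤ (s * q t + 3000 * p t / s) / 2 := by
    intro s hs t
    refine abs_le_of_sq_le_sq ?_ (by bound)
    have h1 : J t ^ 2 ≤ 3000 * q t * p t := (hJ t).trans (mul_le_mul_of_nonneg_right (hgap t) (hp0 t))
    have e : ((s * q t + 3000 * p t / s) / 2) ^ 2 = 3000 * q t * p t + ((s * q t - 3000 * p t / s) / 2) ^ 2 := by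
      field_simp; ring
    nlinarith
  set V : ℝ → ℝ := fun t => (p t + q t) + J t / 1000 with hV
  have hV1 : ∀ t, 0.97 * (p t + q t) ≤ V t := by
    intro t
    have := hJs 50 (by norm_num) t
    grind
  have hV2 : ∀ t, V t ≤ 1.03 * (p t + q t) := by
    intro t
    have := hJs 50 (by norm_num) t
    grind
  set D : ℝ := 20000 * K with hD
  have hg : ∀ t, HasDerivAt (fun t => V t * Real.exp (t / 2500 + D * Real.exp (-t)))
      (((-p t + 2 * K * Real.exp (-t) * (3 * J t + p t)) + (p t - 1 / 2 * J t - q t + K * Real.exp (-t) * (3 * a t + J t)) / 1000) *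
        Real.exp (t / 2500 + D * Real.exp (-t)) + V t * (Real.exp (t / 2500 + D * Real.exp (-t)) * (1 / 2500 + D * (Real.exp (-t) * -1)))) t := by
    intro t
    have h1 : HasDerivAt V _ t := (hpq t).fun_add ((hJ' t).div_const 1000)
    exact h1.mul ((((hasDerivAt_id t).div_const 2500).fun_add (((hasDerivAt_neg t).exp).const_mul D)).exp)
  have hanti : Antitone fun t => V t * Real.exp (t / 2500 + D * Real.exp (-t)) := by
    refine antitone_of_deriv_nonpos (fun t => (hg t).differentiableAt) fun t => ?_
    rw [(hg t).deriv]
    have hE := exp_pos (t / 2500 + D * Real.exp (-t))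
    have hKe : 0 ≤ K * Real.exp (-t) := by positivity
    have b1 := abs_le.mp (hJs 2 (by norm_num) t)
    have b2 := hgap t
    have b3 := hp0 t
    have b4 := hq0 t
    have key : (-p t + 2 * K * Real.exp (-t) * (3 * J t + p t)) + (p t - 1 / 2 * J t - q t + K * Real.exp (-t) * (3 * a t + J t)) / 1000
        + V t * (1 / 2500 + D * (Real.exp (-t) * -1)) ≤ 0 := by
      have c2 : V t * (1 / 2500) ≤ (p t + q t) * 1.03 / 2500 := by linarith [hV2 t]
      have c3 : K * Real.exp (-t) * (2 * (3 * J t + p t) + (3 * a t + J t) / 1000 - 20000 * V t) ≤ 0 := by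
        refine mul_nonpos_of_nonneg_of_nonpos hKe ?_
        grind
      linarith
    nlinarith
  refine ⟨3001 * (V 0 * Real.exp D) / 0.97, ?_, fun t ht => ?_⟩
  · have := hV1 0
    have : 0 ≤ V 0 := by linarith [hp0 0, hq0 0]
    positivity
  have h1 := hanti ht
  simp only [zero_div, neg_zero, Real.exp_zero, zero_add, mul_one] at h1
  have hV0 : 0 ≤ V t := by grind
  have h2 : V t * Real.exp (t / 2500) ≤ V 0 * Real.exp D := by
    refine le_trans (mul_le_mul_of_nonneg_left (exp_le_exp.mpr ?_) hV0) h1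
    bound
  have h3 : V t ≤ V 0 * Real.exp D * Real.exp (-(t / 2500)) := by
    rw [Real.exp_neg, ← div_eq_mul_inv, le_div_iff₀ (exp_pos _)]; exact h2
  grind

/-- The profile `(1 - v)^3` and its images under `-v d/dv`. -/
def profA (v : ℝ) : ℝ := (1 - v) ^ 3

def profB (v : ℝ) : ℝ := 3 * v * (1 - v) ^ 2

def profC (v : ℝ) : ℝ := -(3 * v * (1 - v) ^ 2) + 6 * v ^ 2 * (1 - v)

theorem hasDerivAt_profA (v : ℝ) : HasDerivAt profA (-3 * (1 - v) ^ 2) v :=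
  ((((hasDerivAt_id v).const_sub 1).fun_pow 3)).congr_deriv (by simp)

theorem hasDerivAt_profB (v : ℝ) : HasDerivAt profB (3 * (1 - v) ^ 2 - 6 * v * (1 - v)) v := by
  have := ((hasDerivAt_id v).const_mul 3).mul (((hasDerivAt_id v).const_sub 1).fun_pow 2)
  exact this.congr_deriv (by simp; ring)

theorem neg_mul_derivA : (fun v : ℝ => -(v * (-3 * (1 - v) ^ 2))) = profB := by
  ext v; rw [profB]; ring

theorem neg_mul_derivB : (fun v : ℝ => -(v * (3 * (1 - v) ^ 2 - 6 * v * (1 - v)))) = profC := by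
  ext v; rw [profC]; ring

theorem hasDerivAt_profC (v : ℝ) : HasDerivAt profC (-(3 * (1 - v) ^ 2 - 6 * v * (1 - v)) + (12 * v - 18 * v ^ 2)) v := by
  have h1 := (hasDerivAt_profB v).fun_neg
  have h2 := (((hasDerivAt_id v).fun_pow 2).const_mul 6).mul ((hasDerivAt_id v).const_sub 1)
  exact (h1.fun_add h2).congr_deriv (by simp; ring)

theorem exists_isSeed_prof {P : ℝ → ℝ} (hP : Continuous P) (h1 : P 1 = 0) : ∃ A, ∀ t, IsSeed (Real.exp (-t)) A (prof P t) := by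
  obtain ⟨A, hA⟩ := isCompact_Icc.exists_bound_of_continuousOn (s := Set.Icc (0:ℝ) 1) hP.continuousOn
  exact ⟨A, fun t => isSeed_prof hP h1 hA (exp_pos _) le_rfl⟩

theorem mul_profB (t y : ℝ) : y * prof profB t y = Real.exp (-t) * (3 * prof profA t y + prof profB t y) := by
  rcases le_total y (Real.exp (-t)) with h | h
  · rw [prof_of_lt (by simp [profB]) h, prof_of_lt (by simp [profA]) h]; simp
  · have h1 : 1 ≤ Real.exp t * y := by
      calc 1 = Real.exp t * Real.exp (-t) := by rw [← Real.exp_add]; simp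
        _ ≤ _ := by gcongr
    rw [prof, prof, max_eq_left h1, profA, profB, Real.exp_neg]
    grind

theorem continuous_profA : Continuous profA := by unfold profA; fun_prop

theorem continuous_profB : Continuous profB := by unfold profB; fun_prop

theorem continuous_profC : Continuous profC := by unfold profC; fun_prop

theorem Dop_profA (t : ℝ) : Dop (prof profA t) = prof profB t := by
  rw [Dop_prof hasDerivAt_profA (by fun_prop) (by norm_num), neg_mul_derivA]

theorem Dop_profB (t : ℝ) : Dop (prof profB t) = prof profC t := by
  rw [Dop_prof hasDerivAt_profB (by fun_prop) (by norm_num), neg_mul_derivB]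

theorem bform_profA_decay (hm : 1 ≤ m) : ∃ C : ℝ, 0 ≤ C ∧ ∀ t, 0 ≤ t →
    bform m 0 (prof profA t) (prof profA t) + bform m 1 (prof profB t) (prof profB t) ≤ C * Real.exp (-(t / 2500)) := by
  obtain ⟨A, hA⟩ := exists_isSeed_prof continuous_profA (by simp [profA])
  obtain ⟨B, hB⟩ := exists_isSeed_prof continuous_profB (by simp [profB])
  obtain ⟨E, hE⟩ := exists_isSeed_prof continuous_profC (by simp [profC])
  have cA : ∀ t, ContDiff ℝ 1 (prof profA t) := contDiff_prof hasDerivAt_profA (by fun_prop) (by norm_num)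
  have cB : ∀ t, ContDiff ℝ 1 (prof profB t) := contDiff_prof hasDerivAt_profB (by fun_prop) (by norm_num)
  have hyB : ∀ t, (fun y => y * prof profB t y) = fun y => (Real.exp (-t) * 3) * prof profA t y + Real.exp (-t) * prof profB t y := by
    intro t; ext y; rw [mul_profB]; ring
  have sy : ∀ t, IsSeed (Real.exp (-t)) _ fun y => y * prof profB t y := fun t => by
    rw [hyB]; exact ((hA t).const_mul _).add ((hB t).const_mul _)
  have hb : ∀ t F β, IsSeed (Real.exp (-t)) F β → bform m 0 (fun y => y * prof profB t y) β =
      Real.exp (-t) * 3 * bform m 0 (prof profA t) β + Real.exp (-t) * bform m 0 (prof profB t) β := by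
    intro t F β hF
    rw [hyB, bform_add_left ((hA t).const_mul _) ((hB t).const_mul _) hF hm, bform_const_mul_left, bform_const_mul_left]
  set K := 2 * π * m with hK
  have h1 : ∀ t, bform m 1 (prof profB t) (prof profB t) = -(bform m 0 (prof profC t) (prof profA t) +
      1 / 2 * bform m 0 (prof profB t) (prof profA t) - K * (Real.exp (-t) * 3 * bform m 0 (prof profA t) (prof profA t) +
        Real.exp (-t) * bform m 0 (prof profB t) (prof profA t))) := by
    intro t
    have := bform_one_eq (hB t) (by rw [Dop_profB]; exact hE t) (sy t) (fun y => (hasDerivAt_prof hasDerivAt_profB (by fun_prop) (by norm_num) t y).differentiableAt)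
      (hA t) (by rw [Dop_profA]; exact hB t) (cA t) hm
    rw [Dop_profA, Dop_profB] at this
    grind
  have h2 : ∀ t, bform m 1 (prof profB t) (prof profC t) = -(bform m 0 (prof profC t) (prof profB t) +
      1 / 2 * bform m 0 (prof profB t) (prof profB t) - K * (Real.exp (-t) * 3 * bform m 0 (prof profA t) (prof profB t) +
        Real.exp (-t) * bform m 0 (prof profB t) (prof profB t))) := by
    intro t
    have := bform_one_eq (hB t) (by rw [Dop_profB]; exact hE t) (sy t) (fun y => (hasDerivAt_prof hasDerivAt_profB (by fun_prop) (by norm_num) t y).differentiableAt)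
      (hB t) (by rw [Dop_profB]; exact hE t) (cB t) hm
    rw [Dop_profB] at this
    grind
  have dA : ∀ t, HasDerivAt (fun t => bform m 0 (prof profA t) (prof profA t)) (2 * bform m 0 (prof profA t) (prof profB t)) t := by
    intro t
    have := hasDerivAt_bform_prof hasDerivAt_profA (by fun_prop) (by norm_num) (by simp [profA])
      (Q' := fun v => 3 * (1 - v) ^ 2 - 6 * v * (1 - v)) (by rw [neg_mul_derivA]; exact hasDerivAt_profB) (by fun_prop) hm 0 t
    rwa [neg_mul_derivA] at this
  have dB : ∀ κ t, HasDerivAt (fun t => bform m κ (prof profB t) (prof profB t)) (2 * bform m κ (prof profB t) (prof profC t)) t := by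
    intro κ t
    have := hasDerivAt_bform_prof hasDerivAt_profB (by fun_prop) (by norm_num) (by simp [profB])
      (Q' := _) (by rw [neg_mul_derivB]; exact hasDerivAt_profC) (by fun_prop) hm κ t
    rwa [neg_mul_derivB] at this
  have dAB : ∀ t, HasDerivAt (fun t => bform m 0 (prof (fun v => profA v + profB v) t) (prof (fun v => profA v + profB v) t))
      (2 * bform m 0 (prof (fun v => profA v + profB v) t) (prof (fun v => profB v + profC v) t)) t := by
    intro t
    have e : (fun v : ℝ => -(v * (-3 * (1 - v) ^ 2 + (3 * (1 - v) ^ 2 - 6 * v * (1 - v))))) = fun v => profB v + profC v := by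
      ext v; rw [profB, profC]; ring
    have := hasDerivAt_bform_prof (P := fun v => profA v + profB v) (fun v => (hasDerivAt_profA v).fun_add (hasDerivAt_profB v)) (by fun_prop) (by norm_num) (by simp [profA, profB])
      (Q' := _) (by rw [e]; exact fun v => (hasDerivAt_profB v).fun_add (hasDerivAt_profC v)) (by fun_prop) hm 0 t
    rwa [e] at this
  have eAB : ∀ t, bform m 0 (prof (fun v => profA v + profB v) t) (prof (fun v => profA v + profB v) t) =
      bform m 0 (prof profA t) (prof profA t) + 2 * bform m 0 (prof profA t) (prof profB t) + bform m 0 (prof profB t) (prof profB t) := by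
    intro t
    change bform m 0 (fun y => prof profA t y + prof profB t y) (fun y => prof profA t y + prof profB t y) = _
    rw [bform_add_left (hA t) (hB t) ((hA t).add (hB t)) hm, bform_add_right (hA t) (hB t) (hA t) hm, bform_add_right (hA t) (hB t) (hB t) hm,
      bform_comm m 0 (prof profB t) (prof profA t)]
    ring
  have eAB2 : ∀ t, bform m 0 (prof (fun v => profA v + profB v) t) (prof (fun v => profB v + profC v) t) =
      bform m 0 (prof profA t) (prof profB t) + bform m 0 (prof profA t) (prof profC t) + bform m 0 (prof profB t) (prof profB t) +
        bform m 0 (prof profB t) (prof profC t) := by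
    intro t
    change bform m 0 (fun y => prof profA t y + prof profB t y) (fun y => prof profB t y + prof profC t y) = _
    rw [bform_add_left (hA t) (hB t) ((hB t).add (hE t)) hm, bform_add_right (hB t) (hE t) (hA t) hm, bform_add_right (hB t) (hE t) (hB t) hm]
    ring
  refine energy_decay (a := fun t => bform m 0 (prof profA t) (prof profA t)) (J := fun t => bform m 0 (prof profA t) (prof profB t))
    (p := fun t => bform m 0 (prof profB t) (prof profB t)) (q := fun t => bform m 1 (prof profB t) (prof profB t)) (K := K)
    (by positivity) (fun t => bform_self_nonneg m 0 _) (fun t => bform_self_nonneg m 1 _) ?_ ?_ ?_ ?_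
  · intro t
    have := bform_gap (hA t) (by rw [Dop_profA]; exact hB t) (cA t) hm
    rwa [Dop_profA] at this
  · intro t
    have hd := fun ε => two_mul_bform_le (hA t) (hB t) hm 0 ε
    have := discrim_le_zero (a := bform m 0 (prof profA t) (prof profA t)) (b := -2 * bform m 0 (prof profA t) (prof profB t))
      (c := bform m 0 (prof profB t) (prof profB t)) (fun x => by linarith [hd x])
    rw [discrim] at this
    linarith
  · intro t
    have := (((dAB t).fun_sub (dA t)).fun_sub (dB 0 t)).div_const 2
    have e : (fun t => bform m 0 (prof profA t) (prof profB t)) = fun t => (bform m 0 (prof (fun v => profA v + profB v) t) (prof (fun v => profA v + profB v) t) -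
      bform m 0 (prof profA t) (prof profA t) - bform m 0 (prof profB t) (prof profB t)) / 2 := by
      ext t; rw [eAB]; ring
    rw [e]
    refine this.congr_deriv ?_
    rw [eAB2, h1, bform_comm m 0 (prof profB t) (prof profA t), bform_comm m 0 (prof profC t) (prof profA t)]
    ring
  · intro t
    refine ((dB 0 t).fun_add (dB 1 t)).congr_deriv ?_
    rw [h2, bform_comm m 0 (prof profC t) (prof profB t)]
    ring

/-- Decay of the Fourier coefficients of the Poincaré series as the cut-off is removed. -/
theorem norm_fourC_prof_le (hm : 1 ≤ m) : ∃ C : ℝ, 0 ≤ C ∧ ∀ t y, 0 ≤ t → 0 < y →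
    ‖fourC n m 0 (prof profA t) y‖ ^ 2 ≤ C * (y ^ (-1 / 2 : ℝ) * (8 / y + 3) ^ 2) * Real.exp (-(t / 2500)) := by
  obtain ⟨A, hA⟩ := exists_isSeed_prof continuous_profA (by simp [profA])
  obtain ⟨B, hB⟩ := exists_isSeed_prof continuous_profB (by simp [profB])
  obtain ⟨C, hC0, hC⟩ := bform_profA_decay hm
  refine ⟨16 * C, by positivity, fun t y ht hy => ?_⟩
  have := norm_fourC_sq_le (hA t) (by rw [Dop_profA]; exact hB t)
    (contDiff_prof hasDerivAt_profA (by fun_prop) (by norm_num) t) n hm hy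
  rw [Dop_profA] at this
  refine this.trans ?_
  calc 16 * y ^ (-1 / 2 : ℝ) * (8 / y + 3) ^ 2 * _ ≤ 16 * y ^ (-1 / 2 : ℝ) * (8 / y + 3) ^ 2 * (C * Real.exp (-(t / 2500))) :=
        mul_le_mul_of_nonneg_left (hC t ht) (by positivity)
    _ = _ := by ring

theorem ee_add (x y : ℂ) : ee (x + y) = ee x * ee y := by
  rw [ee, ee, ee, ← Complex.exp_add]; congr 1; ring

theorem ee_int (k : ℤ) : ee k = 1 := by
  rw [ee, mul_comm, exp_int_mul_two_pi_mul_I]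

/-- The summand of a Kloosterman sum attached to `d` and its inverse `a`. -/
def kloo (m n : ℤ) (c d a : ℕ) : ℂ :=
  epsFactor d ^ 3 * ((jacobiSym (2 * (c : ℤ)) d : ℤ) : ℂ) ^ 3 * ee (((m * a + n * d : ℤ) : ℂ) / (2 * (c : ℕ)))

/-- The archimedean integrand at denominator `c` and height `y`. -/
def lineKer (m n : ℕ) (α : ℝ → ℝ) (y : ℝ) (c : ℕ) (u : ℝ) : ℂ :=
  (α (y / (c ^ 2 * (u ^ 2 + y ^ 2))) : ℂ) * (y - u * I) ^ (-(3 / 2) : ℂ) * cexp (-(π * I * m / (c ^ 2 * (u + y * I)))) * cexp (-(π * I * n * u))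

theorem inv_cpow_half_cube {c : ℝ} (hc : 0 < c) (hw : 0 < w.re) :
    ((((c : ℂ) * (I * w)) ^ (1 / 2 : ℂ)) ^ 3)⁻¹ = ((c ^ (-(3 / 2) : ℝ) : ℝ) : ℂ) * ee (-(3 / 8)) * w ^ (-(3 / 2) : ℂ) := by
  have hw0 : w ≠ 0 := by rintro rfl; simp at hw
  have harg := abs_arg_lt_pi_div_two_iff.mpr (Or.inl hw)
  rw [abs_lt] at harg
  have hpi := pi_pos
  have hIw : I * w ≠ 0 := mul_ne_zero I_ne_zero hw0
  rw [← cpow_nat_mul, ← cpow_neg, ofReal_cpow hc.le,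
    cpow_def_of_ne_zero (mul_ne_zero (by exact_mod_cast hc.ne') hIw), log_ofReal_mul hc hIw,
    Complex.log_mul I_ne_zero hw0 (by rw [arg_I]; grind), log_I,
    cpow_def_of_ne_zero (by exact_mod_cast hc.ne'), cpow_def_of_ne_zero hw0, ee, ← Complex.exp_add, ← Complex.exp_add,
    ofReal_log hc.le]
  simp; ring

theorem thetaMul_inv_cube {c : ℤ} {d : ℕ} (hd : Odd d) (h : Int.gcd c d = 1) :
    (thetaMul c d ^ 3)⁻¹ = epsFactor d ^ 3 * ((jacobiSym (2 * c) d : ℤ) : ℂ) ^ 3 := by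
  have h2 : Int.gcd (2 * c) d = 1 := by
    have : Coprime 2 d := hd.coprime_two_left
    rw [Int.gcd_eq_natAbs] at h ⊢
    rw [Int.natAbs_mul]
    exact Coprime.mul_left this h
  have hJ : (jacobiSym (2 * c) d) ^ 2 = 1 := jacobiSym.sq_one h2
  have hJ' : (((jacobiSym (2 * c) d : ℤ) : ℂ) ^ 3)⁻¹ = ((jacobiSym (2 * c) d : ℤ) : ℂ) ^ 3 := by
    rcases eq_or_eq_neg_of_sq_eq_sq _ (1:ℤ) (hJ.trans (one_pow 2).symm) with h | h
    · rw [h]; simp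
    · rw [h]; norm_num
  rw [thetaMul, mul_pow, mul_inv, inv_pow, inv_inv, hJ']

theorem row_term {c d a : ℕ} (hc : Even c) (hc0 : 0 < c) (had : (a * d) % (2 * c) = 1)
    (v : Rw) (l : ℤ) (hv0 : v.1.1 = c) (hv1 : v.1.2 = d + 2 * c * l) (hy : 0 < y) (x : ℝ) :
    jacobiTheta (rectCoord (y, x)) ^ 3 * seedFn m α (rowRep v • rectCoord (y, x)) * cexp (-(π * I * n * x)) =
      kloo m n c d a * ee (-(3 / 8)) * ((c : ℝ) ^ (-(3 / 2) : ℝ) : ℝ) * lineKer m n α y c (x + d / c + 2 * l) := by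
  obtain ⟨k, hk⟩ : ∃ k : ℤ, (a : ℤ) * d = 1 + 2 * c * k := by
    refine ⟨(a * d / (2 * c) : ℕ), ?_⟩
    have := Nat.mod_add_div (a * d) (2 * c)
    lia
  have hd0 : 0 < d := by lia
  have hoddd : Odd d := by
    have h1 : Odd ((a : ℤ) * d) := by grind
    grind
  have hcd : Int.gcd c d = 1 := Int.isCoprime_iff_gcd_eq_one.mp ⟨-2 * k, a, by linear_combination hk⟩
  set z := rectCoord (y, x) with hz
  have hzc : (z : ℂ) = x + y * I := by rw [hz, coe_rectCoord hy]; apply Complex.ext <;> simp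
  -- matrix acting
  let g : SL(2, ℤ) := ⟨!![(a : ℤ), 2 * k + 2 * a * l; c, d + 2 * c * l], by simp; linarith⟩
  have g00 : g 0 0 = a := rfl
  have g01 : g 0 1 = 2 * k + 2 * a * l := rfl
  have g10 : g 1 0 = c := rfl
  have g11 : g 1 1 = d + 2 * c * l := rfl
  have hodda : Odd (a : ℤ) := by
    have h1 : Odd ((a : ℤ) * d) := by grind
    grind
  have hg : g ∈ Γ₂ := by
    rw [CongruenceSubgroup.Gamma_mem, g00, g01, g10, g11]
    refine ⟨(ZMod.intCast_eq_one_iff_odd).mpr hodda, (ZMod.intCast_eq_zero_iff_even).mpr ?_,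
      (ZMod.intCast_eq_zero_iff_even).mpr (by exact_mod_cast hc), (ZMod.intCast_eq_one_iff_odd).mpr ?_⟩
    · grind
    grind
  rw [← seedFn_smul_eq hg (by rw [g10, hv0]) (by rw [g11, hv1]) z]
  have hc0' : (c : ℂ) ≠ 0 := by exact_mod_cast hc0.ne'
  have hcR : (0 : ℝ) < c := by exact_mod_cast hc0
  set u : ℝ := x + d / c + 2 * l with hu
  set w : ℂ := (y : ℂ) - u * I with hw
  have hwre : 0 < w.re := by simp [hw, hy]
  have hIw : I * w = u + y * I := by rw [hw]; linear_combination -(u : ℂ) * I_sq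
  have hden : (c : ℂ) * (z + 2 * l) + d = c * (I * w) := by
    rw [hIw, hzc, hu]; push_cast; field_simp; ring
  have hden' : lowj g z = c * (I * w) := by
    rw [← hden, lowj, g10, g11]; push_cast; ring
  have hIw0 : I * w ≠ 0 := mul_ne_zero I_ne_zero (by rintro h; rw [h] at hwre; simp at hwre)
  have hgz : ((g • z : ℍ) : ℂ) = ((a : ℤ) * (z + 2 * l) + (2 * k : ℤ)) / ((c : ℤ) * (z + 2 * l) + (d : ℕ)) := by
    rw [coe_smul_eq_div, g00, g01, g10, g11]
    simp; ring
  have hgz2 : ((g • z : ℍ) : ℂ) = a / c - 1 / (c ^ 2 * (u + y * I)) := by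
    rw [hgz, ← hIw]
    have e : ((c : ℤ) : ℂ) * (z + 2 * l) + (d : ℕ) = c * (I * w) := by simp_all
    have e2 : (z : ℂ) + 2 * l = I * w - d / c := by grind
    have hk' : (a : ℂ) * d = 1 + 2 * c * k := by exact_mod_cast hk
    rw [e, e2]
    generalize I * w = W at *
    field_simp
    push_cast
    linear_combination -hk'
  have him : (g • z).im = y / (c ^ 2 * (u ^ 2 + y ^ 2)) := by
    rw [im_smul_lowj, hden', hIw]
    have : z.im = y := by rw [hz, im_rectCoord hy]
    rw [this, norm_mul, mul_pow, ← normSq_eq_norm_sq (u + y * I), normSq_add_mul_I]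
    simp
  have htheta : jacobiTheta (g • z : ℍ) = thetaMul c d * (c * (I * w)) ^ (1 / 2 : ℂ) * jacobiTheta z := by
    have h1 := jacobiTheta_transform_pos _ a (2 * k) c d ((z : ℂ) + 2 * l) (by simpa using z.im_pos) le_rfl hd0 (even_two_mul k)
      (by exact_mod_cast hc) (by linear_combination hk)
    rw [jacobiTheta_add_two_mul] at h1
    simp_all
  have hth0 := jacobiTheta_ne_zero z
  rw [seedFn, him, htheta, hgz2, kloo, lineKer, mul_pow, mul_pow, div_eq_mul_inv, mul_inv, mul_inv, thetaMul_inv_cube hoddd hcd,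
    show ((c : ℂ) * (I * w)) = (((c : ℝ) : ℂ) * (I * w)) by push_cast; rfl, inv_cpow_half_cube hcR hwre]
  have hexp : cexp (π * I * m * (a / c - 1 / (c ^ 2 * (u + y * I)))) * cexp (-(π * I * n * x)) =
      ee ((((m : ℤ) * a + (n : ℤ) * d : ℤ) : ℂ) / (2 * (c : ℕ))) * (cexp (-(π * I * m / (c ^ 2 * (u + y * I)))) * cexp (-(π * I * n * u))) := by
    rw [ee, ← Complex.exp_add, ← Complex.exp_add, ← Complex.exp_add]
    have : -(π * I * n * x : ℂ) = -(π * I * n * u) + π * I * n * (d / c) + ((n * l : ℤ) : ℂ) * (2 * π * I) := by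
      rw [hu]; push_cast; ring
    rw [this, ← add_assoc, Complex.exp_add _ (((n * l : ℤ) : ℂ) * (2 * π * I)), exp_int_mul_two_pi_mul_I, mul_one]
    push_cast; ring
  have h3 : jacobiTheta (z : ℂ) ^ 3 * (jacobiTheta (z : ℂ) ^ 3)⁻¹ = 1 := mul_inv_cancel₀ (pow_ne_zero 3 hth0)
  grind

theorem continuous_lineKer (hα : Continuous α) (hy : 0 < y) {c : ℕ} (hc : 0 < c) :
    Continuous (lineKer m n α y c) := by
  have hc' : (c : ℂ) ≠ 0 := by exact_mod_cast hc.ne'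
  have h0 : ∀ u : ℝ, (u : ℂ) + y * I ≠ 0 := fun u h => by
    have := congrArg Complex.im h; simp at this; exact hy.ne' this
  have h1 : Continuous fun u : ℝ => ((y : ℂ) - u * I) ^ (-(3 / 2) : ℂ) :=
    Continuous.cpow (by fun_prop) continuous_const fun u => Or.inl (by simp [hy])
  have h2 : Continuous fun u : ℝ => α (y / (c ^ 2 * (u ^ 2 + y ^ 2))) :=
    hα.comp (continuous_const.div (by fun_prop) fun u => by positivity)
  have h3 : Continuous fun u : ℝ => cexp (-(π * I * m / (c ^ 2 * (u + y * I)))) :=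
    Complex.continuous_exp.comp (continuous_const.div (by fun_prop) fun u => mul_ne_zero (pow_ne_zero 2 hc') (h0 u)).neg
  unfold lineKer
  exact (((continuous_ofReal.comp h2).mul h1).mul h3).mul (by fun_prop)

theorem lineKer_eq_zero (h : IsSeed y₀ A α) {c : ℕ} {u : ℝ}
    (hu : y / (c ^ 2 * (u ^ 2 + y ^ 2)) < y₀) : lineKer m n α y c u = 0 := by
  rw [lineKer, h.zero _ hu]; simp

theorem lineKer_eq_zero_of_high (h : IsSeed y₀ A α) (hy : 0 < y) {c : ℕ} (hc : 0 < c)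
    (hcy : 1 / (c ^ 2 * y) < y₀) (u : ℝ) : lineKer m n α y c u = 0 := by
  refine lineKer_eq_zero h (lt_of_le_of_lt ?_ hcy)
  rw [div_le_div_iff₀ (by positivity) (by positivity)]
  nlinarith

theorem integrable_lineKer (h : IsSeed y₀ A α) (hy : 0 < y) {c : ℕ} (hc : 0 < c) :
    Integrable (lineKer m n α y c) := by
  refine (continuous_lineKer h.cont hy hc).integrable_of_hasCompactSupport
    (HasCompactSupport.intro (isCompact_Icc (a := -(y / (c ^ 2 * y₀) + 1)) (b := y / (c ^ 2 * y₀) + 1)) fun u hu => ?_)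
  have hcR : (0 : ℝ) < c := by exact_mod_cast hc
  have hy₀ := h.pos
  refine lineKer_eq_zero h ?_
  have hb : 0 < y / (c ^ 2 * y₀) := by positivity
  have h2 : y / (c ^ 2 * y₀) < u ^ 2 := by
    have h3 : y / (c ^ 2 * y₀) + 1 < |u| := by grind
    rw [← sq_abs u]; nlinarith
  rw [div_lt_iff₀ (by positivity)] at h2 ⊢
  nlinarith [sq_nonneg y, mul_pos (mul_pos hcR hcR) hy₀, mul_nonneg (mul_pos (mul_pos hcR hcR) hy₀).le (sq_nonneg y)]

theorem hasSum_integral_period_two {f : ℝ → ℂ} (hf : Integrable f) (s : ℝ) :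
    HasSum (fun l : ℤ => ∫ x in (0 : ℝ)..2, f (x + s + 2 * l)) (∫ x, f x) := by
  have h1 := (hf.comp_mul_left' (R := 2) two_ne_zero).hasSum_intervalIntegral (s / 2)
  rw [Measure.integral_comp_mul_left f 2] at h1
  have h2 := h1.const_smul (2 : ℝ)
  rw [smul_smul, abs_of_pos (by norm_num), show (2 : ℝ) * 2⁻¹ = 1 by norm_num, one_smul] at h2
  refine h2.congr_fun ?_ |> fun h => h
  intro l
  rw [intervalIntegral.integral_comp_mul_left f two_ne_zero, smul_smul, show (2 : ℝ) * 2⁻¹ = 1 by norm_num, one_smul]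
  have e : ∀ x : ℝ, f (x + s + 2 * l) = f (x + (s + 2 * l)) := fun x => by rw [add_assoc]
  rw [integral_congr fun x _ => e x, integral_comp_add_right f]
  congr 1 <;> ring

/-- The contribution of one coset to the `n`-th Fourier coefficient, extended by zero to all integer pairs. -/
def rowInt (n m : ℕ) (α : ℝ → ℝ) (y : ℝ) (p : ℤ × ℤ) : ℂ :=
  open Classical in
  if h : IsCoprime p.1 p.2 ∧ Even p.1 then (∫ x in (0 : ℝ)..2, jacobiTheta (rectCoord (y, x)) ^ 3 *
    seedFn m α (rowRep ⟨p, h⟩ • rectCoord (y, x)) * cexp (-(π * I * n * x))) else 0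

theorem rowInt_val (n m : ℕ) (α : ℝ → ℝ) (y : ℝ) (v : Rw) : rowInt n m α y v.1 = ∫ x in (0 : ℝ)..2,
    jacobiTheta (rectCoord (y, x)) ^ 3 * seedFn m α (rowRep v • rectCoord (y, x)) * cexp (-(π * I * n * x)) := by
  rw [rowInt, dif_pos v.2]; rfl

theorem continuous_theta_seed (hα : Continuous α) (hy : 0 < y) (v : Rw) :
    Continuous fun x : ℝ => jacobiTheta (rectCoord (y, x)) ^ 3 * seedFn m α (rowRep v • rectCoord (y, x)) * cexp (-(π * I * n * x)) := by
  have hr := continuous_rectCoord hy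
  exact (((continuous_jacobiTheta_uhp.comp hr).pow 3).mul (((continuous_seedFn hα).comp (continuous_SL_smul _)).comp hr)).mul (by fun_prop)

theorem exists_rows_strip (h : IsSeed y₀ A α) (m : ℕ) (hy : 0 < y) :
    ∃ F : Finset Rw, ∀ x ∈ Set.Icc (0 : ℝ) 2, ∀ v ∉ F, seedFn m α (rowRep v • rectCoord (y, x)) = 0 := by
  classical
  refine isCompact_Icc.induction_on (p := fun s => ∃ F : Finset Rw, ∀ x ∈ s, ∀ v ∉ F, seedFn m α (rowRep v • rectCoord (y, x)) = 0)
    ⟨∅, by simp⟩ (fun s t hst ⟨F, hF⟩ => ⟨F, fun x hx => hF x (hst hx)⟩) (fun s t ⟨F, hF⟩ ⟨G, hG⟩ => ⟨F ∪ G, ?_⟩) ?_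
  · grind
  · intro x _
    obtain ⟨F, hF⟩ := h.exists_finset m (rectCoord (y, x))
    refine ⟨_, mem_nhdsWithin_of_mem_nhds (Metric.closedBall_mem_nhds x (half_pos hy)), F, fun x' hx' v hv => hF _ ?_ v hv⟩
    rw [coe_rectCoord hy, coe_rectCoord hy, im_rectCoord hy]
    rw [Metric.mem_closedBall, Real.dist_eq] at hx'
    have e : ((⟨(y, x').2, (y, x').1⟩ : ℂ) - ⟨(y, x).2, (y, x).1⟩) = ((x' - x : ℝ) : ℂ) := by apply Complex.ext <;> simp
    rw [e, norm_real, norm_eq_abs]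
    exact hx'

theorem hasSum_rowInt (h : IsSeed y₀ A α) (n m : ℕ) (hy : 0 < y) :
    HasSum (rowInt n m α y) (fourC n m 0 α y) := by
  obtain ⟨F, hF⟩ := exists_rows_strip h m hy
  have h0 : ∀ v ∉ F, rowInt n m α y v.1 = 0 := by
    intro v hv
    rw [rowInt_val]
    refine intervalIntegral.integral_zero_ae (ae_of_all _ fun x hx => ?_)
    grind
  have h1 : fourC n m 0 α y = ∑ v ∈ F, rowInt n m α y v.1 := by
    simp only [rowInt_val]
    rw [← intervalIntegral.integral_finsetSum fun v _ => (continuous_theta_seed h.cont hy v).intervalIntegrable _ _, fourC]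
    refine integral_congr fun x hx => ?_
    rw [Set.uIcc_of_le (by norm_num)] at hx
    simp only [poin, pow_zero, one_mul]
    rw [tsum_eq_sum (s := F) fun v hv => hF x hx v hv, mul_sum, sum_mul]
  rw [h1]
  have h2 : HasSum (fun v : Rw => rowInt n m α y v.1) (∑ v ∈ F, rowInt n m α y v.1) := hasSum_sum_of_ne_finset_zero h0
  refine (Function.Injective.hasSum_iff (g := fun v : Rw => v.1) Subtype.val_injective fun p hp => ?_).mp h2
  rw [rowInt, dif_neg fun hh => hp ⟨⟨p, hh⟩, rfl⟩]

theorem rowInt_neg (n m : ℕ) (α : ℝ → ℝ) (y : ℝ) (p : ℤ × ℤ) : rowInt n m α y (-p) = rowInt n m α y p := by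
  by_cases hp : IsCoprime p.1 p.2 ∧ Even p.1
  · have hp' : IsCoprime (-p).1 (-p).2 ∧ Even (-p).1 := ⟨hp.1.neg_neg, hp.2.neg⟩
    have e1 := rowInt_val n m α y ⟨p, hp⟩
    have e2 := rowInt_val n m α y ⟨-p, hp'⟩
    rw [e1, e2]
    refine integral_congr fun x _ => ?_
    rw [← seedFn_smul_eq (g := -rowRep ⟨p, hp⟩) (v := ⟨-p, hp'⟩)]
    · simp
    · have := rowRep_mem ⟨p, hp⟩
      simp_all
    · simpa using rowRep_zero ⟨p, hp⟩
    · simpa using rowRep_one ⟨p, hp⟩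
  · rw [rowInt, rowInt, dif_neg hp, dif_neg]
    rintro ⟨h1, h2⟩
    exact hp ⟨by simpa using h1.neg_neg, by simpa using h2.neg⟩

/-- The contribution of the residue `d` to a Kloosterman sum, zero unless `d` is invertible. -/
def klooRes (m n : ℤ) (c d : ℕ) : ℂ :=
  ∑ a ∈ Finset.Ico 1 (2 * c), if (a * d) % (2 * c) = 1 then kloo m n c d a else 0

theorem SKe_three_eq (m n : ℤ) {c : ℕ} (hc : 0 < c) : SKe m n c 3 = ∑ d : Fin (2 * c), klooRes m n c d := by
  have h : SKe m n c 3 = ∑ d ∈ Finset.Ico 1 (2 * c), klooRes m n c d := rfl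
  rw [h, ← Finset.sum_range (fun d => klooRes m n c d), Finset.range_eq_Ico,
    Finset.sum_eq_sum_Ico_succ_bot (a := 0) (by omega) (fun d => klooRes m n c d)]
  have h0 : klooRes m n c 0 = 0 := Finset.sum_eq_zero fun a _ => by simp
  rw [h0, zero_add]

theorem klooRes_of_inv (m n : ℤ) {c d a : ℕ} (ha : a ∈ Finset.Ico 1 (2 * c)) (had : (a * d) % (2 * c) = 1) :
    klooRes m n c d = kloo m n c d a := by
  rw [klooRes, Finset.sum_eq_single_of_mem a ha, if_pos had]
  intro b hb hba
  refine if_neg fun hbd => hba ?_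
  rw [Finset.mem_Ico] at ha hb
  have h1 : b * (a * d) ≡ b * 1 [MOD 2 * c] := Nat.ModEq.mul_left b (by rw [Nat.ModEq, had, Nat.mod_eq_of_lt (by omega)])
  have h2 : a * (b * d) ≡ a * 1 [MOD 2 * c] := Nat.ModEq.mul_left a (by rw [Nat.ModEq, hbd, Nat.mod_eq_of_lt (by omega)])
  have h3 : b ≡ a [MOD 2 * c] := by
    rw [mul_one] at h1 h2
    exact h1.symm.trans ((by rw [show b * (a * d) = a * (b * d) by ring] : b * (a * d) ≡ a * (b * d) [MOD 2 * c]).trans h2)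
  rwa [Nat.ModEq, Nat.mod_eq_of_lt hb.2, Nat.mod_eq_of_lt ha.2] at h3

theorem klooRes_of_not_coprime (m n : ℤ) {c d : ℕ} (h : ¬ Coprime d (2 * c)) : klooRes m n c d = 0 := by
  refine Finset.sum_eq_zero fun a _ => if_neg fun had => h ?_
  have h1 : Nat.gcd (a * d) (2 * c) = 1 := by
    rw [← Nat.gcd_comm, Nat.gcd_rec, had]; simp
  exact Coprime.coprime_mul_left h1

theorem rowInt_eq_zero {p : ℤ × ℤ} (hp : ¬(IsCoprime p.1 p.2 ∧ Even p.1)) :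
    rowInt n m α y p = 0 := by
  rw [rowInt, dif_neg hp]

theorem hasSum_rowInt_residue (h : IsSeed y₀ A α) (n m : ℕ) (hy : 0 < y) {c : ℕ} (hc0 : 0 < c)
    (hc : Even c) (d : ℕ) :
    HasSum (fun l : ℤ => rowInt n m α y ((c : ℤ), l * ((2 * c : ℕ) : ℤ) + d))
      (klooRes m n c d * (ee (-(3 / 8)) * ((c : ℝ) ^ (-(3 / 2) : ℝ) : ℝ) * ∫ u, lineKer m n α y c u)) := by
  by_cases hcop : Coprime d (2 * c)
  · obtain ⟨a, ha, had⟩ := Nat.exists_mul_mod_eq_one_of_coprime hcop (by omega)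
    rw [mul_comm] at had
    have ha0 : a ≠ 0 := by rintro rfl; simp at had
    rw [klooRes_of_inv m n (Finset.mem_Ico.mpr ⟨by omega, ha⟩) had]
    have key := (hasSum_integral_period_two (integrable_lineKer h (n := n) (m := m) hy hc0) (d / c)).mul_left
      (kloo m n c d a * ee (-(3 / 8)) * ((c : ℝ) ^ (-(3 / 2) : ℝ) : ℝ))
    rw [mul_assoc, mul_assoc] at key
    refine key.congr_fun fun l => ?_
    obtain ⟨v, hv⟩ : ∃ v : Rw, v.1 = ((c : ℤ), l * ((2 * c : ℕ) : ℤ) + d) := by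
      refine ⟨⟨_, ?_, (Int.even_coe_nat c).mpr hc⟩, rfl⟩
      have h1 : IsCoprime (c : ℤ) d := Nat.isCoprime_iff_coprime.mpr (hcop.coprime_mul_left_right).symm
      have h2 := h1.add_mul_left_right (2 * l)
      grind
    rw [← hv, rowInt_val, ← intervalIntegral.integral_const_mul]
    refine integral_congr fun x _ => ?_
    refine (row_term hc hc0 had v l (by rw [hv]) (by lia) hy x).trans ?_
    ring
  · rw [klooRes_of_not_coprime _ _ hcop, zero_mul]
    refine hasSum_zero.congr_fun fun l => rowInt_eq_zero fun hp => hcop ?_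
    have h1 : IsCoprime (c : ℤ) d := by
      have h2 := hp.1.add_mul_left_right (-(2 * l))
      grind
    have h3 : Coprime c d := Nat.isCoprime_iff_coprime.mp h1
    refine Coprime.mul_right ?_ h3.symm
    rw [Nat.coprime_two_right]
    refine Nat.not_even_iff_odd.mp fun hd2 => ?_
    have := Nat.dvd_gcd hc.two_dvd hd2.two_dvd
    lia

theorem rowInt_zero_one (n m : ℕ) (hy : 0 < y) :
    rowInt n m α y (0, 1) = if m = n then 2 * (α y : ℂ) * cexp (-(π * m * y)) else 0 := by
  have hp : IsCoprime (0 : ℤ) 1 ∧ Even (0 : ℤ) := ⟨isCoprime_one_right, Even.zero⟩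
  obtain ⟨v, hv⟩ : ∃ v : Rw, v.1 = ((0 : ℤ), (1 : ℤ)) := ⟨⟨_, hp⟩, rfl⟩
  have h1 : ∀ x : ℝ, jacobiTheta (rectCoord (y, x)) ^ 3 * seedFn m α (rowRep v • rectCoord (y, x)) * cexp (-(π * I * n * x))
      = (α y : ℂ) * cexp (-(π * m * y)) * cexp ((π * I * (m - n)) * x) := by
    intro x
    rw [← seedFn_smul_eq (g := 1) (one_mem _) (by rw [hv]; simp) (by rw [hv]; simp), one_smul, seedFn, im_rectCoord hy, coe_rectCoord hy, mul_div_cancel₀]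
    · rw [mul_assoc, ← Complex.exp_add, mul_assoc (α y : ℂ), ← Complex.exp_add]
      congr 2
      have : (⟨(y, x).2, (y, x).1⟩ : ℂ) = x + y * I := by apply Complex.ext <;> simp
      rw [this]
      linear_combination (π * m * y : ℂ) * I_sq
    · rw [← coe_rectCoord hy]
      exact pow_ne_zero 3 (jacobiTheta_ne_zero _)
  rw [← hv, rowInt_val, integral_congr fun x _ => h1 x, intervalIntegral.integral_const_mul]
  split_ifs with hmn
  · subst hmn; simp; ring
  · have hne : (π * I * (m - n) : ℂ) ≠ 0 := by
      have : (m : ℂ) - n ≠ 0 := sub_ne_zero.mpr (by exact_mod_cast hmn)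
      simp_all
    rw [integral_exp_mul_complex hne]
    have : cexp (π * I * (m - n) * (2 : ℝ)) = 1 := by
      have := exp_int_mul_two_pi_mul_I ((m : ℤ) - n)
      rw [← this]; congr 1; push_cast; ring
    rw [this]; simp

theorem tsum_rowInt_row (h : IsSeed y₀ A α) (n m : ℕ) (hy : 0 < y) {c : ℕ} (hc0 : 0 < c)
    (hc : Even c) : ∑' D : ℤ, rowInt n m α y ((c : ℤ), D) =
      SKe m n c 3 * (ee (-(3 / 8)) * ((c : ℝ) ^ (-(3 / 2) : ℝ) : ℝ) * ∫ u, lineKer m n α y c u) := by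
  have : NeZero (2 * c) := ⟨by omega⟩
  have hs : Summable fun D : ℤ => rowInt n m α y ((c : ℤ), D) :=
    (hasSum_rowInt h n m hy).summable.comp_injective fun a b hab => (Prod.mk.inj hab).2
  rw [← ((Equiv.prodComm (Fin (2 * c)) ℤ).trans (Int.divModEquiv (2 * c)).symm).tsum_eq]
  refine (Summable.tsum_prod (((Equiv.prodComm (Fin (2 * c)) ℤ).trans (Int.divModEquiv (2 * c)).symm).summable_iff.mpr hs)).trans ?_
  rw [tsum_fintype, SKe_three_eq _ _ hc0, sum_mul]
  refine sum_congr rfl fun d _ => ?_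
  exact (hasSum_rowInt_residue h n m hy hc0 hc d).tsum_eq

theorem tsum_rowInt_zero (n m : ℕ) (hy : 0 < y) : ∑' D : ℤ, rowInt n m α y (0, D) =
    if m = n then 4 * (α y : ℂ) * cexp (-(π * m * y)) else 0 := by
  rw [tsum_eq_sum (s := {1, -1}), Finset.sum_pair (by norm_num)]
  · have e : ((0 : ℤ), (-1 : ℤ)) = -((0 : ℤ), (1 : ℤ)) := rfl
    rw [e, rowInt_neg, rowInt_zero_one n m hy]
    split_ifs <;> ring
  · intro D hD
    refine rowInt_eq_zero fun hp => hD ?_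
    have h1 : IsUnit D := isCoprime_zero_left.mp hp.1
    rcases Int.isUnit_iff.mp h1 with h | h <;> simp [h]

theorem fourC_eq (h : IsSeed y₀ A α) (n m : ℕ) (hy : 0 < y) {N : ℕ}
    (hN : ∀ c : ℕ, N < c → 1 / (c ^ 2 * y) < y₀) :
    fourC n m 0 α y = (if m = n then 4 * (α y : ℂ) * cexp (-(π * m * y)) else 0) +
      2 * ee (-(3 / 8)) * ∑ c ∈ range (N + 1), if Even c ∧ 0 < c then
        SKe m n c 3 * ((c : ℝ) ^ (-(3 / 2) : ℝ) : ℝ) * ∫ u, lineKer m n α y c u else 0 := by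
  have hs := (hasSum_rowInt h n m hy).summable
  have hG : Function.Even fun C : ℤ => ∑' D : ℤ, rowInt n m α y (C, D) := by
    intro C
    dsimp only
    rw [← (Equiv.neg ℤ).tsum_eq]
    exact tsum_congr fun D => rowInt_neg n m α y (C, D)
  have hz : ∀ c : ℕ, 0 < c → (∑' D : ℤ, rowInt n m α y ((c : ℤ), D)) = if Even c ∧ 0 < c then
      SKe m n c 3 * (ee (-(3 / 8)) * ((c : ℝ) ^ (-(3 / 2) : ℝ) : ℝ) * ∫ u, lineKer m n α y c u) else 0 := by
    intro c hc
    by_cases he : Even c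
    · rw [if_pos ⟨he, hc⟩, tsum_rowInt_row h n m hy hc he]
    · rw [if_neg fun hh => he hh.1]
      refine (tsum_congr fun D => rowInt_eq_zero fun hp => he ?_).trans tsum_zero
      grind
  rw [← (hasSum_rowInt h n m hy).tsum_eq, hs.tsum_prod, tsum_int_eq_zero_add_two_mul_tsum_pnat hG hs.prod, tsum_rowInt_zero n m hy,
    tsum_pnat_eq_tsum_succ (f := fun c : ℕ => ∑' D : ℤ, rowInt n m α y ((c : ℤ), D)), tsum_eq_sum (s := range N),
    Finset.sum_range_succ']
  · have h00 : ¬(Even 0 ∧ 0 < 0) := by simp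
    rw [if_neg h00, add_zero, nsmul_eq_mul, mul_sum, mul_sum]
    grind
  · intro c hc
    rw [mem_range, not_lt] at hc
    rw [hz _ c.succ_pos]
    split_ifs
    · have : ∫ u, lineKer m n α y (c + 1) u = 0 := by
        exact integral_eq_zero_of_ae (ae_of_all _ fun u => lineKer_eq_zero_of_high h hy c.succ_pos (hN _ (by omega)) u)
      rw [this]; simp
    · rfl

/-- The cubic cutoff. -/
def chi (s : ℝ) : ℝ := (1 - min s 1) ^ 3

theorem continuous_chi : Continuous chi := by unfold chi; fun_prop

theorem chi_mem {s : ℝ} (hs : 0 ≤ s) : 0 ≤ chi s ∧ chi s ≤ 1 := by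
  have h1 : min s 1 ≤ 1 := min_le_right _ _
  have h0 : 0 ≤ min s 1 := le_min hs zero_le_one
  exact ⟨pow_nonneg (by linarith) 3, pow_le_one₀ (by linarith) (by linarith)⟩

theorem abs_chi_sub_one_le {s : ℝ} (hs : 0 ≤ s) : |chi s - 1| ≤ 3 * s ^ (1 / 4 : ℝ) := by
  have h1 : min s 1 ≤ 1 := min_le_right _ _
  have h0 : 0 ≤ min s 1 := le_min hs zero_le_one
  have h2 : min s 1 ≤ s ^ (1 / 4 : ℝ) :=
    calc min s 1 = (min s 1) ^ (1 : ℝ) := (rpow_one _).symm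
      _ ≤ (min s 1) ^ (1 / 4 : ℝ) := rpow_le_rpow_of_exponent_ge' h0 h1 (by norm_num) (by norm_num)
      _ ≤ s ^ (1 / 4 : ℝ) := rpow_le_rpow h0 (min_le_left _ _) (by norm_num)
  have h3 : |chi s - 1| ≤ 3 * min s 1 := by
    unfold chi
    rw [abs_le]
    constructor <;> nlinarith [mul_nonneg h0 h0, mul_nonneg h0 (sub_nonneg.mpr h1), mul_nonneg (mul_nonneg h0 h0) (sub_nonneg.mpr h1)]
  linarith

/-- The coefficients of the averaging weight. -/
def wtCoef (n : ℕ) (j : ℕ) : ℝ := (π * n) ^ (j + 3 / 2 : ℝ) / Real.Gamma (j + 3 / 2)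

/-- The averaging weight in the height variable. -/
def wt (n : ℕ) (y : ℝ) : ℝ :=
  (3 / 8 * wtCoef n 1 * y ^ 2 + 3 / 8 * wtCoef n 2 * y ^ 3 + 1 / 4 * wtCoef n 3 * y ^ 4) * Real.exp (-(π * n * y))

theorem wtCoef_pos (hn : 1 ≤ n) (j : ℕ) : 0 < wtCoef n j := by
  unfold wtCoef
  positivity

theorem wt_pos (hn : 1 ≤ n) (hy : 0 < y) : 0 < wt n y := by
  have h1 := wtCoef_pos hn 1
  have h2 := wtCoef_pos hn 2
  have h3 := wtCoef_pos hn 3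
  unfold wt; positivity

theorem continuous_wt (n : ℕ) : Continuous (wt n) := by unfold wt; fun_prop

theorem integrableOn_wt_mul_rpow (hn : 1 ≤ n) {s : ℝ} (hs : -3 < s) :
    IntegrableOn (fun y => wt n y * y ^ s) (Ioi 0) := by
  have hpn : 0 < π * n := mul_pos pi_pos (by exact_mod_cast hn)
  have h : ∀ k : ℕ, 2 ≤ k → IntegrableOn (fun y : ℝ => y ^ (k + s) * Real.exp (-(π * n) * y ^ (1 : ℝ))) (Ioi 0) := fun k hk =>
    integrableOn_rpow_mul_exp_neg_mul_rpow (by have : (2 : ℝ) ≤ k := by exact_mod_cast hk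
                                               linarith) one_pos hpn
  have h' : IntegrableOn (fun y : ℝ => 3 / 8 * wtCoef n 1 * (y ^ ((2 : ℕ) + s) * Real.exp (-(π * n) * y ^ (1 : ℝ))) +
      3 / 8 * wtCoef n 2 * (y ^ ((3 : ℕ) + s) * Real.exp (-(π * n) * y ^ (1 : ℝ))) +
      1 / 4 * wtCoef n 3 * (y ^ ((4 : ℕ) + s) * Real.exp (-(π * n) * y ^ (1 : ℝ)))) (Ioi 0) :=
    (((h 2 le_rfl).const_mul _).add ((h 3 (by norm_num)).const_mul _)).add ((h 4 (by norm_num)).const_mul _)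
  refine IntegrableOn.congr_fun h' (fun y hy => ?_) measurableSet_Ioi
  have hy' : (0 : ℝ) < y := hy
  simp only [rpow_one, wt]
  rw [rpow_add hy', rpow_add hy', rpow_add hy', rpow_natCast, rpow_natCast, rpow_natCast, neg_mul]
  ring

/-- The measure `dy du` on the upper half-plane. -/
def gMeas : Measure (ℝ × ℝ) := (volume.restrict (Ioi 0)).prod volume

instance : SFinite gMeas := by unfold gMeas; infer_instance

/-- The archimedean kernel after rescaling, with parameter `b = m / c ^ 2`. -/
def gKer (n : ℕ) (b : ℝ) (p : ℝ × ℝ) : ℂ :=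
  ((wt n p.1 * p.1 ^ (-1 / 2 : ℝ) : ℝ) : ℂ) * (1 - p.2 * I) ^ (-(3 / 2) : ℂ) * cexp (-(π * I * n * p.1 * p.2)) *
    cexp (-(π * I * b / (p.1 * (p.2 + I))))

theorem measurable_gKer (n : ℕ) (b : ℝ) : Measurable (gKer n b) := by
  have h1 : Measurable fun p : ℝ × ℝ => wt n p.1 := (continuous_wt n).measurable.comp measurable_fst
  unfold gKer
  fun_prop

theorem norm_one_sub_mul_I (u : ℝ) : ‖(1 - u * I : ℂ)‖ = √(1 + u ^ 2) := by
  rw [norm_eq_sqrt_sq_add_sq]; simp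

theorem norm_one_sub_cpow (u : ℝ) : ‖(1 - u * I : ℂ) ^ (-(3 / 2) : ℂ)‖ = (1 + u ^ 2) ^ (-(3 / 4) : ℝ) := by
  have e : (-(3 / 2) : ℂ) = ((-(3 / 2) : ℝ) : ℂ) := by push_cast; ring
  rw [e, norm_cpow_real, norm_one_sub_mul_I, sqrt_eq_rpow, ← rpow_mul (by positivity)]
  norm_num

theorem inv_add_I (u : ℝ) : (1 / (u + I) : ℂ) = (u - I) / ((1 + u ^ 2 : ℝ) : ℂ) := by
  have h0 : (u + I : ℂ) ≠ 0 := fun h => by have := congrArg Complex.im h; simp at this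
  have h1 : ((1 + u ^ 2 : ℝ) : ℂ) ≠ 0 := by exact_mod_cast (by positivity : (1 + u ^ 2 : ℝ) ≠ 0)
  rw [div_eq_div_iff h0 h1]; push_cast; linear_combination I_sq

theorem gKer_exp_re {b : ℝ} (hy : 0 < y) (u : ℝ) : (-(π * I * b / (y * (u + I))) : ℂ).re = -(π * b / (y * (1 + u ^ 2))) := by
  have h : (-(π * I * b / (y * (u + I))) : ℂ) = ((π * b / (y * (1 + u ^ 2)) : ℝ) : ℂ) * (-(1 + u * I)) := by
    have := inv_add_I u
    have h1 : (1 + (u : ℂ) ^ 2) ≠ 0 := by exact_mod_cast (by positivity : (1 + u ^ 2 : ℝ) ≠ 0)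
    have hy' : (y : ℂ) ≠ 0 := by exact_mod_cast hy.ne'
    rw [show (π * I * b / (y * (u + I)) : ℂ) = π * I * b / y * (1 / (u + I)) by field_simp, this]
    push_cast
    field_simp
    linear_combination (b : ℂ) * I_sq
  rw [h, re_ofReal_mul]; simp

theorem norm_gKer_le (hn : 1 ≤ n) {b : ℝ} (hb : 0 ≤ b) (hy : 0 < y) (u : ℝ) :
    ‖gKer n b (y, u)‖ ≤ wt n y * y ^ (-1 / 2 : ℝ) * (1 + u ^ 2) ^ (-(3 / 4) : ℝ) := by
  have h1 := (wt_pos hn hy).le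
  have h2 : ‖cexp (-(π * I * n * y * u))‖ = 1 := by
    rw [show -(π * I * n * y * u : ℂ) = ((-(π * n * y * u) : ℝ) : ℂ) * I by push_cast; ring, norm_exp_ofReal_mul_I]
  have h3 : ‖cexp (-(π * I * b / (y * (u + I))))‖ ≤ 1 := by
    rw [norm_exp, gKer_exp_re hy, exp_le_one_iff, neg_nonpos]
    positivity
  simp only [gKer]
  rw [norm_mul, norm_mul, norm_mul, h2, mul_one, norm_one_sub_cpow, norm_real, norm_eq_abs, abs_of_nonneg (by positivity)]
  bound

theorem ae_gMeas : ∀ᵐ p ∂gMeas, (0 : ℝ) < p.1 := by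
  have h : gMeas = (volume : Measure (ℝ × ℝ)).restrict (Ioi 0 ×ˢ Set.univ) := by
    rw [gMeas, Measure.volume_eq_prod, ← Measure.prod_restrict, Measure.restrict_univ]
  rw [h]
  exact (ae_restrict_mem (measurableSet_Ioi.prod MeasurableSet.univ)).mono fun p hp => hp.1

theorem integrable_one_add_sq {r : ℝ} (hr : 1 / 2 < r) : Integrable fun u : ℝ => (1 + u ^ 2) ^ (-r) := by
  have := integrable_rpow_neg_one_add_norm_sq (E := ℝ) (μ := volume) (r := 2 * r) (by simp; linarith)
  simpa [neg_mul, neg_div] using this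

theorem integrable_wt_prod (hn : 1 ≤ n) {s r : ℝ} (hs : -3 < s) (hr : 1 / 2 < r) :
    Integrable (fun p : ℝ × ℝ => wt n p.1 * p.1 ^ s * (1 + p.2 ^ 2) ^ (-r)) gMeas :=
  (integrableOn_wt_mul_rpow hn hs).mul_prod (integrable_one_add_sq hr)

theorem integrable_gKer (hn : 1 ≤ n) {b : ℝ} (hb : 0 ≤ b) {f : ℝ → ℝ} (hf : Continuous f) (hf1 : ∀ u, |f u| ≤ 1) :
    Integrable (fun p => gKer n b p * (f p.2 : ℂ)) gMeas := by
  refine (integrable_wt_prod hn (s := -1 / 2) (r := 3 / 4) (by norm_num) (by norm_num)).mono' ?_ ?_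
  · exact ((measurable_gKer n b).mul (by fun_prop)).aestronglyMeasurable
  · filter_upwards [ae_gMeas] with p hp
    rw [norm_mul, norm_real]
    refine (mul_le_of_le_one_right (norm_nonneg _) (hf1 _)).trans ?_
    exact norm_gKer_le hn hb hp p.2

/-- The averaged archimedean integral with cutoff parameter `lam`. -/
def gInt (n : ℕ) (b lam : ℝ) : ℂ := ∫ p, gKer n b p * (chi (lam * (1 + p.2 ^ 2)) : ℂ) ∂gMeas

theorem integrable_gKer_chi (hn : 1 ≤ n) {b lam : ℝ} (hb : 0 ≤ b) (hl : 0 ≤ lam) :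
    Integrable (fun p => gKer n b p * (chi (lam * (1 + p.2 ^ 2)) : ℂ)) gMeas :=
  integrable_gKer hn hb (f := fun u => chi (lam * (1 + u ^ 2))) (continuous_chi.comp (by fun_prop)) fun u => by
    have := chi_mem (s := lam * (1 + u ^ 2)) (by positivity)
    grind

theorem norm_exp_sub_one_le_two_mul {z : ℂ} (hz : z.re ≤ 0) : ‖cexp z - 1‖ ≤ 2 * ‖z‖ := by
  by_cases h : ‖z‖ ≤ 1
  · exact norm_exp_sub_one_le h
  · have h1 : ‖cexp z‖ ≤ 1 := by rw [norm_exp]; simp_all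
    calc ‖cexp z - 1‖ ≤ ‖cexp z‖ + ‖(1 : ℂ)‖ := norm_sub_le _ _
      _ ≤ 2 * ‖z‖ := by simp; linarith

theorem norm_gKer_sub_le (hn : 1 ≤ n) {b : ℝ} (hb : 0 ≤ b) (hy : 0 < y) (u : ℝ) :
    ‖gKer n b (y, u) - gKer n 0 (y, u)‖ ≤ 2 * π * b * (wt n y * y ^ (-3 / 2 : ℝ) * (1 + u ^ 2) ^ (-(5 / 4) : ℝ)) := by
  have hpi := pi_pos
  have h0 : gKer n b (y, u) - gKer n 0 (y, u) = gKer n 0 (y, u) * (cexp (-(π * I * b / (y * (u + I)))) - 1) := by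
    simp only [gKer]; simp; ring
  have h1 : ‖(-(π * I * b / (y * (u + I))) : ℂ)‖ = π * b * y⁻¹ * (1 + u ^ 2) ^ (-(1 / 2) : ℝ) := by
    have e : ‖(u + I : ℂ)‖ = √(1 + u ^ 2) := by
      rw [norm_eq_sqrt_sq_add_sq]; simp [add_comm]
    rw [norm_neg, norm_div, norm_mul, norm_mul, norm_mul, e, norm_I, norm_real, norm_real, norm_real,
      norm_of_nonneg hpi.le, norm_of_nonneg hb, norm_of_nonneg hy.le, sqrt_eq_rpow, rpow_neg (by positivity)]
    field_simp
  have h2 : ‖cexp (-(π * I * b / (y * (u + I)))) - 1‖ ≤ 2 * (π * b * y⁻¹ * (1 + u ^ 2) ^ (-(1 / 2) : ℝ)) := by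
    rw [← h1]
    refine norm_exp_sub_one_le_two_mul ?_
    rw [gKer_exp_re hy]
    have : 0 ≤ π * b / (y * (1 + u ^ 2)) := by positivity
    linarith
  have hw := (wt_pos hn hy).le
  rw [h0, norm_mul]
  calc _ ≤ (wt n y * y ^ (-1 / 2 : ℝ) * (1 + u ^ 2) ^ (-(3 / 4) : ℝ)) * (2 * (π * b * y⁻¹ * (1 + u ^ 2) ^ (-(1 / 2) : ℝ))) :=
        mul_le_mul (norm_gKer_le hn le_rfl hy u) h2 (norm_nonneg _) (by positivity)
    _ = 2 * π * b * (wt n y * (y ^ (-1 / 2 : ℝ) * y⁻¹) * ((1 + u ^ 2) ^ (-(3 / 4) : ℝ) * (1 + u ^ 2) ^ (-(1 / 2) : ℝ))) := by ring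
    _ = _ := by
      rw [← rpow_add (by positivity), ← rpow_neg_one y, ← rpow_add hy]
      norm_num

theorem exists_gInt_sub_le (hn : 1 ≤ n) : ∃ C : ℝ, 0 ≤ C ∧ (∀ b : ℝ, 0 ≤ b → ‖gInt n b 0 - gInt n 0 0‖ ≤ C * b) ∧
    ∀ b lam : ℝ, 0 ≤ b → 0 ≤ lam →
      ‖(gInt n b lam - gInt n 0 lam) - (gInt n b 0 - gInt n 0 0)‖ ≤ C * b * lam ^ (1 / 4 : ℝ) := by
  have hpi := pi_pos
  set B1 := ∫ p, wt n p.1 * p.1 ^ (-3 / 2 : ℝ) * (1 + p.2 ^ 2) ^ (-(5 / 4) : ℝ) ∂gMeas with hB1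
  set B2 := ∫ p, wt n p.1 * p.1 ^ (-3 / 2 : ℝ) * (1 + p.2 ^ 2) ^ (-1 : ℝ) ∂gMeas with hB2
  have nn : ∀ r : ℝ, 0 ≤ ∫ p, wt n p.1 * p.1 ^ (-3 / 2 : ℝ) * (1 + p.2 ^ 2) ^ r ∂gMeas := fun r => by
    refine integral_nonneg_of_ae ?_
    filter_upwards [ae_gMeas] with p hp
    have := (wt_pos hn hp).le
    positivity
  have hB1' : 0 ≤ B1 := nn _
  have hB2' : 0 ≤ B2 := nn _
  have i1 := integrable_wt_prod hn (s := -3 / 2) (r := 5 / 4) (by norm_num) (by norm_num)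
  have i2 := integrable_wt_prod hn (s := -3 / 2) (r := 1) (by norm_num) (by norm_num)
  refine ⟨2 * π * B1 + 6 * π * B2, by positivity, fun b hb => ?_, fun b lam hb hl => ?_⟩
  · rw [gInt, gInt, ← integral_sub (integrable_gKer_chi hn hb le_rfl) (integrable_gKer_chi hn le_rfl le_rfl)]
    have : ‖∫ p, gKer n b p * (chi (0 * (1 + p.2 ^ 2)) : ℂ) - gKer n 0 p * (chi (0 * (1 + p.2 ^ 2)) : ℂ) ∂gMeas‖ ≤
        ∫ p, 2 * π * b * (wt n p.1 * p.1 ^ (-3 / 2 : ℝ) * (1 + p.2 ^ 2) ^ (-(5 / 4) : ℝ)) ∂gMeas := by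
      refine norm_integral_le_of_norm_le (i1.const_mul _) ?_
      filter_upwards [ae_gMeas] with p hp
      have := norm_gKer_sub_le hn hb hp p.2
      simpa [chi] using this
    rw [integral_const_mul] at this
    refine this.trans ?_
    rw [← hB1]
    nlinarith [mul_nonneg (mul_nonneg hpi.le hB2') hb]
  · have s1 : ∀ l : ℝ, 0 ≤ l → Integrable (fun p => gKer n b p * (chi (l * (1 + p.2 ^ 2)) : ℂ) - gKer n 0 p * (chi (l * (1 + p.2 ^ 2)) : ℂ))
        gMeas := fun l hl => (integrable_gKer_chi hn hb hl).sub (integrable_gKer_chi hn le_rfl hl)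
    rw [gInt, gInt, gInt, gInt, ← integral_sub (integrable_gKer_chi hn hb hl) (integrable_gKer_chi hn le_rfl hl),
      ← integral_sub (integrable_gKer_chi hn hb le_rfl) (integrable_gKer_chi hn le_rfl le_rfl), ← integral_sub (s1 _ hl) (s1 _ le_rfl)]
    refine (norm_integral_le_of_norm_le (i2.const_mul (6 * π * b * lam ^ (1 / 4 : ℝ))) ?_).trans ?_
    · filter_upwards [ae_gMeas] with p hp
      have h1 := norm_gKer_sub_le hn hb hp p.2
      have h2 := abs_chi_sub_one_le (s := lam * (1 + p.2 ^ 2)) (by positivity)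
      have e : gKer n b p * (chi (lam * (1 + p.2 ^ 2)) : ℂ) - gKer n 0 p * (chi (lam * (1 + p.2 ^ 2)) : ℂ) -
          (gKer n b p * (chi (0 * (1 + p.2 ^ 2)) : ℂ) - gKer n 0 p * (chi (0 * (1 + p.2 ^ 2)) : ℂ)) =
          (gKer n b p - gKer n 0 p) * ((chi (lam * (1 + p.2 ^ 2)) - 1 : ℝ) : ℂ) := by
        have : chi (0 * (1 + p.2 ^ 2)) = 1 := by simp [chi]
        rw [this]; push_cast; ring
      rw [e, norm_mul, norm_real, norm_eq_abs]
      have hw := (wt_pos hn hp).le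
      calc _ ≤ 2 * π * b * (wt n p.1 * p.1 ^ (-3 / 2 : ℝ) * (1 + p.2 ^ 2) ^ (-(5 / 4) : ℝ)) * (3 * (lam * (1 + p.2 ^ 2)) ^ (1 / 4 : ℝ)) :=
            mul_le_mul h1 h2 (abs_nonneg _) (by positivity)
        _ = 6 * π * b * lam ^ (1 / 4 : ℝ) * (wt n p.1 * p.1 ^ (-3 / 2 : ℝ) * ((1 + p.2 ^ 2) ^ (-(5 / 4) : ℝ) * (1 + p.2 ^ 2) ^ (1 / 4 : ℝ))) := by
            rw [mul_rpow hl (by positivity)]; ring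
        _ = _ := by rw [← rpow_add (by positivity)]; norm_num
    · rw [integral_const_mul, ← hB2]
      have : 0 ≤ 2 * π * B1 * (b * lam ^ (1 / 4 : ℝ)) := by positivity
      linarith

theorem prof_log {a z : ℝ} (ha : 0 < a) (hz : 0 < z) : prof profA (Real.log a) z = chi (1 / (a * z)) := by
  have haz := mul_pos ha hz
  rw [prof, Real.exp_log ha, profA, chi]
  congr 2
  rcases le_total (a * z) 1 with h | h
  · rw [max_eq_right h, min_eq_right (by bound), inv_one]
  · rw [max_eq_left h, min_eq_left (by rwa [div_le_one haz]), one_div]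

theorem cpow_ofReal_mul (hy : 0 < y) {z : ℂ} (hz : z ≠ 0) (s : ℝ) : ((y : ℂ) * z) ^ (s : ℂ) = ((y ^ s : ℝ) : ℂ) * z ^ (s : ℂ) := by
  have hy' : (y : ℂ) ≠ 0 := by exact_mod_cast hy.ne'
  rw [cpow_def_of_ne_zero (mul_ne_zero hy' hz), log_ofReal_mul hy hz, ofReal_cpow hy.le,
    cpow_def_of_ne_zero hy', cpow_def_of_ne_zero hz, ← Complex.exp_add, ofReal_log hy.le]
  congr 1; ring

theorem wt_mul_integral_lineKer (m n : ℕ) {X y : ℝ} (hX : 0 < X) (hy : 0 < y) {c : ℕ} (hc : 0 < c) :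
    (wt n y : ℂ) * ∫ u, lineKer m n (prof profA (Real.log (X * y))) y c u =
      ∫ u, gKer n (m / c ^ 2) (y, u) * (chi (c ^ 2 / X * (1 + u ^ 2)) : ℂ) := by
  have hcC : (c : ℂ) ≠ 0 := by exact_mod_cast hc.ne'
  have hyC : (y : ℂ) ≠ 0 := by exact_mod_cast hy.ne'
  have h := Measure.integral_comp_mul_left (fun u => lineKer m n (prof profA (Real.log (X * y))) y c u) y
  have h' : ∫ u, lineKer m n (prof profA (Real.log (X * y))) y c u = y * ∫ u, lineKer m n (prof profA (Real.log (X * y))) y c (y * u) := by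
    rw [h, abs_of_pos (by positivity), real_smul, ← mul_assoc]; simp [hyC]
  rw [h', ← mul_assoc, ← integral_const_mul]
  refine integral_congr_ae (ae_of_all _ fun u => ?_)
  have h0 : (1 - u * I : ℂ) ≠ 0 := fun h => by have := congrArg Complex.re h; simp at this
  have h1 : (u + I : ℂ) ≠ 0 := fun h => by have := congrArg Complex.im h; simp at this
  have e1 : prof profA (Real.log (X * y)) (y / (c ^ 2 * ((y * u) ^ 2 + y ^ 2))) = chi (c ^ 2 / X * (1 + u ^ 2)) := by
    rw [prof_log (by positivity) (by positivity)]
    grind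
  have e2 : ((y : ℂ) - ((y * u : ℝ) : ℂ) * I) ^ (-(3 / 2) : ℂ) = ((y ^ (-3 / 2 : ℝ) : ℝ) : ℂ) * (1 - u * I) ^ (-(3 / 2) : ℂ) := by
    have e : (-(3 / 2) : ℂ) = ((-3 / 2 : ℝ) : ℂ) := by push_cast; ring
    rw [e, ← cpow_ofReal_mul hy h0]; congr 1; push_cast; ring
  have e3 : (y : ℝ) * y ^ (-3 / 2 : ℝ) = y ^ (-1 / 2 : ℝ) := by
    nth_rewrite 1 [← rpow_one y]; rw [← rpow_add hy]; norm_num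
  have e4 : (π * I * m / (c ^ 2 * (((y * u : ℝ) : ℂ) + y * I)) : ℂ) = π * I * ((m / c ^ 2 : ℝ) : ℂ) / (y * (u + I)) := by
    push_cast
    field_simp
  simp only [lineKer, gKer]
  rw [e1, e2, e4, ← e3]
  push_cast
  ring_nf

/-- The normalised Kloosterman coefficients. -/
def bcoef (m n : ℕ) (c : ℕ) : ℂ := if Even c ∧ 0 < c then SKe m n c 3 * ((c : ℝ) ^ (-(3 / 2) : ℝ) : ℝ) else 0

/-- The total mass of the diagonal contribution. -/
def diagMass (n : ℕ) : ℝ := ∫ y in Ioi 0, wt n y * Real.exp (-(π * n * y))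

theorem integrableOn_wt_mul_exp (hn : 1 ≤ n) {f : ℝ → ℝ} (hf : ContinuousOn f (Ioi 0)) (hf1 : ∀ y > 0, |f y| ≤ 1) :
    IntegrableOn (fun y => wt n y * f y * Real.exp (-(π * n * y))) (Ioi 0) := by
  have h := integrableOn_wt_mul_rpow hn (s := 0) (by norm_num)
  refine Integrable.mono' h ?_ ?_
  · refine ContinuousOn.aestronglyMeasurable ?_ measurableSet_Ioi
    exact ((continuous_wt n).continuousOn.mul hf).mul (by fun_prop)
  · filter_upwards [ae_restrict_mem measurableSet_Ioi] with y hy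
    have hy' : (0 : ℝ) < y := hy
    have hw := (wt_pos hn hy').le
    have he : Real.exp (-(π * n * y)) ≤ 1 := exp_le_one_iff.mpr (by have := pi_pos; simp_all)
    rw [norm_eq_abs, abs_mul, abs_mul, abs_of_nonneg hw, abs_of_pos (exp_pos _), rpow_zero, mul_assoc]
    bound

theorem diagMass_pos (hn : 1 ≤ n) : 0 < diagMass n := by
  have h := integrableOn_wt_mul_exp hn (f := fun _ => 1) continuousOn_const (by simp)
  simp only [mul_one] at h
  rw [diagMass, setIntegral_pos_iff_support_of_nonneg_ae _ h]
  · have : Function.support (fun y => wt n y * Real.exp (-(π * n * y))) ∩ Ioi 0 = Ioi 0 :=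
      Set.inter_eq_right.mpr fun y hy => (mul_pos (wt_pos hn hy) (exp_pos _)).ne'
    rw [this]; simp
  · filter_upwards [ae_restrict_mem measurableSet_Ioi] with y hy
    exact (mul_pos (wt_pos hn hy) (exp_pos _)).le

theorem continuousOn_chi_inv {X : ℝ} (hX : 0 < X) : ContinuousOn (fun y => chi (1 / (X * y * y))) (Ioi 0) :=
  continuous_chi.comp_continuousOn (ContinuousOn.div continuousOn_const (by fun_prop) fun y hy => by aesop)

theorem abs_chi_le_one {s : ℝ} (hs : 0 ≤ s) : |chi s| ≤ 1 := by
  rw [abs_of_nonneg (chi_mem hs).1]; exact (chi_mem hs).2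

theorem exists_abs_diag_sub_le (hn : 1 ≤ n) : ∃ C : ℝ, 0 ≤ C ∧ ∀ X : ℝ, 0 < X →
    |(∫ y in Ioi 0, wt n y * chi (1 / (X * y * y)) * Real.exp (-(π * n * y))) - diagMass n| ≤ C * X ^ (-(1 / 4) : ℝ) := by
  have i1 := integrableOn_wt_mul_rpow hn (s := -1 / 2) (by norm_num)
  refine ⟨3 * ∫ y in Ioi 0, wt n y * y ^ (-1 / 2 : ℝ), ?_, fun X hX => ?_⟩
  · refine mul_nonneg (by norm_num) (setIntegral_nonneg measurableSet_Ioi fun y hy => ?_)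
    have hy' : (0 : ℝ) < y := hy
    have := wt_pos hn hy'
    positivity
  · have h1 := integrableOn_wt_mul_exp hn (continuousOn_chi_inv hX) fun y hy => abs_chi_le_one (s := 1 / (X * y * y)) (by positivity)
    have h2 := integrableOn_wt_mul_exp hn (f := fun _ => 1) continuousOn_const (by simp)
    simp only [mul_one] at h2
    rw [diagMass, ← integral_sub h1 h2, ← norm_eq_abs]
    refine (norm_integral_le_of_norm_le (i1.const_mul (3 * X ^ (-(1 / 4) : ℝ))) ?_).trans (le_of_eq ?_)
    · filter_upwards [ae_restrict_mem measurableSet_Ioi] with y hy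
      have hy' : (0 : ℝ) < y := hy
      have hw := (wt_pos hn hy').le
      have he : Real.exp (-(π * n * y)) ≤ 1 := exp_le_one_iff.mpr (by have := pi_pos; simp_all)
      have h3 := abs_chi_sub_one_le (s := 1 / (X * y * y)) (by positivity)
      have e : (1 / (X * y * y)) ^ (1 / 4 : ℝ) = X ^ (-(1 / 4) : ℝ) * y ^ (-1 / 2 : ℝ) := by
        rw [one_div, inv_rpow (by positivity), ← rpow_neg (by positivity), mul_assoc, mul_rpow hX.le (by positivity),
          mul_rpow hy'.le hy'.le, ← rpow_add hy']
        norm_num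
      rw [e] at h3
      have e2 : wt n y * chi (1 / (X * y * y)) * Real.exp (-(π * n * y)) - wt n y * Real.exp (-(π * n * y)) =
          wt n y * ((chi (1 / (X * y * y)) - 1) * Real.exp (-(π * n * y))) := by ring
      rw [e2, norm_eq_abs, abs_mul, abs_mul, abs_of_nonneg hw, abs_of_pos (exp_pos _)]
      calc _ ≤ wt n y * (3 * (X ^ (-(1 / 4) : ℝ) * y ^ (-1 / 2 : ℝ)) * 1) := by gcongr
        _ = _ := by ring
    · rw [integral_const_mul]; ring

theorem isSeed_prof_log {a : ℝ} (ha : 0 < a) : IsSeed (1 / a) 1 (prof profA (Real.log a)) := by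
  refine isSeed_prof continuous_profA (by simp [profA]) (fun v hv => ?_) (by positivity) ?_
  · rw [profA, abs_of_nonneg (pow_nonneg (by linarith [hv.2]) 3)]
    exact pow_le_one₀ (by linarith [hv.2]) (by linarith [hv.1])
  · rw [Real.exp_neg, Real.exp_log ha, one_div]

theorem exists_norm_fourC_log_le (hm : 1 ≤ m) : ∃ C : ℝ, 0 ≤ C ∧ ∀ X y : ℝ, 0 < X → 0 < y →
    ‖fourC n m 0 (prof profA (Real.log (X * y))) y‖ ≤ C * ((X * y) ^ (-(1 / 5000) : ℝ) * (y ^ (-1 / 4 : ℝ) * (8 / y + 3))) := by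
  obtain ⟨C, hC0, hC⟩ := norm_fourC_prof_le (m := m) (n := n) hm
  refine ⟨√C + 98, by positivity, fun X y hX hy => ?_⟩
  have hXy : 0 < X * y := mul_pos hX hy
  rcases le_or_gt 1 (X * y) with h | h
  · have h1 := hC (Real.log (X * y)) y (log_nonneg h) hy
    have e1 : Real.exp (-(Real.log (X * y) / 2500)) = ((X * y) ^ (-(1 / 5000) : ℝ)) ^ 2 := by
      rw [rpow_def_of_pos hXy, ← Real.exp_nat_mul]; ring
    have e2 : y ^ (-1 / 2 : ℝ) = (y ^ (-1 / 4 : ℝ)) ^ 2 := by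
      rw [← rpow_natCast, ← rpow_mul hy.le]; norm_num
    have e3 : C * (y ^ (-1 / 2 : ℝ) * (8 / y + 3) ^ 2) * Real.exp (-(Real.log (X * y) / 2500)) =
        (√C * ((X * y) ^ (-(1 / 5000) : ℝ) * (y ^ (-1 / 4 : ℝ) * (8 / y + 3)))) ^ 2 := by grind
    rw [e3] at h1
    have h2 := (sq_le_sq₀ (norm_nonneg _) (by positivity)).mp h1
    refine h2.trans (mul_le_mul_of_nonneg_right (by linarith) (by positivity))
  · have h1 := norm_fourC_le (isSeed_prof_log hXy) hm n 0 hy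
    have h2 : poinBd (1 / (X * y)) 1 ≤ 49 := by
      rw [poinBd, div_div_eq_mul_div, div_one]; nlinarith
    have h3 : y ^ (-3 / 4 : ℝ) = y ^ (-1 / 4 : ℝ) * y ^ (-1 / 2 : ℝ) := by rw [← rpow_add hy]; norm_num
    have h4 : y ^ (-1 / 2 : ℝ) ≤ 8 / y + 3 := by
      have e : y ^ (-1 / 2 : ℝ) = (√y)⁻¹ := by rw [sqrt_eq_rpow, ← rpow_neg hy.le]; norm_num
      have e' : y⁻¹ = (√y)⁻¹ ^ 2 := by grind
      rw [e, div_eq_mul_inv, e']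
      nlinarith
    have h5 : 1 ≤ (X * y) ^ (-(1 / 5000) : ℝ) := one_le_rpow_of_pos_of_le_one_of_nonpos hXy h.le (by norm_num)
    calc _ ≤ 2 * poinBd (1 / (X * y)) 1 * y ^ (-3 / 4 : ℝ) := h1
      _ ≤ 2 * 49 * (y ^ (-1 / 4 : ℝ) * (8 / y + 3)) := by rw [h3]; gcongr
      _ ≤ (√C + 98) * (1 * (y ^ (-1 / 4 : ℝ) * (8 / y + 3))) := by
          rw [one_mul]; bound
      _ ≤ _ := by gcongr

theorem exists_norm_integral_wt_fourC_le (hm : 1 ≤ m) (hn : 1 ≤ n) : ∃ C : ℝ, 0 ≤ C ∧ ∀ X : ℝ, 0 < X →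
    ‖∫ y in Ioi 0, (wt n y : ℂ) * fourC n m 0 (prof profA (Real.log (X * y))) y‖ ≤ C * X ^ (-(1 / 5000) : ℝ) := by
  obtain ⟨C, hC0, hC⟩ := exists_norm_fourC_log_le (m := m) (n := n) hm
  have i1 := integrableOn_wt_mul_rpow hn (s := -(1 / 5000) - 5 / 4) (by norm_num)
  have i2 := integrableOn_wt_mul_rpow hn (s := -(1 / 5000) - 1 / 4) (by norm_num)
  have i3 : IntegrableOn (fun y => 8 * (wt n y * y ^ (-(1 / 5000) - 5 / 4 : ℝ)) + 3 * (wt n y * y ^ (-(1 / 5000) - 1 / 4 : ℝ))) (Ioi 0) :=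
    (i1.const_mul 8).add (i2.const_mul 3)
  refine ⟨C * ∫ y in Ioi 0, (8 * (wt n y * y ^ (-(1 / 5000) - 5 / 4 : ℝ)) + 3 * (wt n y * y ^ (-(1 / 5000) - 1 / 4 : ℝ))), ?_, fun X hX => ?_⟩
  · refine mul_nonneg hC0 (setIntegral_nonneg measurableSet_Ioi fun y hy => ?_)
    have hy' : (0 : ℝ) < y := hy
    have := wt_pos hn hy'
    positivity
  · refine (norm_integral_le_of_norm_le (i3.const_mul (C * X ^ (-(1 / 5000) : ℝ))) ?_).trans (le_of_eq ?_)
    · filter_upwards [ae_restrict_mem measurableSet_Ioi] with y hy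
      have hy' : (0 : ℝ) < y := hy
      have hw := (wt_pos hn hy').le
      rw [norm_mul, norm_real, norm_of_nonneg hw]
      refine (mul_le_mul_of_nonneg_left (hC X y hX hy') hw).trans (le_of_eq ?_)
      have e1 : y ^ (-(1 / 5000) - 5 / 4 : ℝ) = y ^ (-(1 / 5000) : ℝ) * (y ^ (-1 / 4 : ℝ) * y⁻¹) := by
        rw [← rpow_neg_one y, ← rpow_add hy', ← rpow_add hy']; norm_num
      have e2 : y ^ (-(1 / 5000) - 1 / 4 : ℝ) = y ^ (-(1 / 5000) : ℝ) * y ^ (-1 / 4 : ℝ) := by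
        rw [← rpow_add hy']; norm_num
      rw [mul_rpow hX.le hy'.le, e1, e2]; ring
    · rw [integral_const_mul]; ring

theorem integral_wt_fourC_eq (hn : 1 ≤ n) {X : ℝ} (hX : 0 < X) {N : ℕ} (hN : ∀ c : ℕ, N < c → X < c ^ 2) :
    ∫ y in Ioi 0, (wt n y : ℂ) * fourC n m 0 (prof profA (Real.log (X * y))) y =
      (if m = n then 4 * ((∫ y in Ioi 0, wt n y * chi (1 / (X * y * y)) * Real.exp (-(π * n * y)) : ℝ) : ℂ) else 0) +
        2 * ee (-(3 / 8)) * ∑ c ∈ range (N + 1), bcoef m n c * gInt n (m / c ^ 2) (c ^ 2 / X) := by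
  have hpt : ∀ y ∈ Ioi (0 : ℝ), (wt n y : ℂ) * fourC n m 0 (prof profA (Real.log (X * y))) y =
      (if m = n then 4 * ((wt n y * chi (1 / (X * y * y)) * Real.exp (-(π * n * y)) : ℝ) : ℂ) else 0) +
        2 * ee (-(3 / 8)) * ∑ c ∈ range (N + 1), bcoef m n c *
          ∫ u, gKer n (m / c ^ 2) (y, u) * (chi (c ^ 2 / X * (1 + u ^ 2)) : ℂ) := by
    intro y hy
    have hy' : (0 : ℝ) < y := hy
    have hXy : 0 < X * y := mul_pos hX hy'
    rw [fourC_eq (isSeed_prof_log hXy) n m hy' (N := N) fun c hc => ?_, mul_add, mul_left_comm, mul_sum, prof_log hXy hy']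
    · congr 1
      · split_ifs with h
        · subst h; push_cast; ring
        · simp
      · congr 1
        refine sum_congr rfl fun c _ => ?_
        rw [bcoef]
        split_ifs with h
        · rw [← wt_mul_integral_lineKer m n hX hy' h.2]; ring
        · simp
    bound
  have hg : ∀ c : ℕ, Integrable (fun p => gKer n (m / c ^ 2) p * (chi (c ^ 2 / X * (1 + p.2 ^ 2)) : ℂ)) gMeas := fun c =>
    integrable_gKer_chi hn (by positivity) (by positivity)
  have hi : ∀ c : ℕ, IntegrableOn (fun y => bcoef m n c * ∫ u, gKer n (m / c ^ 2) (y, u) * (chi (c ^ 2 / X * (1 + u ^ 2)) : ℂ)) (Ioi 0) :=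
    fun c => (hg c).integral_prod_left.const_mul _
  rw [setIntegral_congr_fun measurableSet_Ioi hpt, integral_add, integral_const_mul, integral_finsetSum _ fun c _ => hi c]
  · congr 1
    · split_ifs with h
      · rw [integral_const_mul, integral_complex_ofReal]
      · simp
    · congr 1
      refine sum_congr rfl fun c _ => ?_
      rw [integral_const_mul, gInt, gMeas, integral_prod _ (hg c)]
  · split_ifs
    · exact ((integrableOn_wt_mul_exp hn (continuousOn_chi_inv hX) fun y hy =>
        abs_chi_le_one (s := 1 / (X * y * y)) (by positivity)).ofReal).const_mul _
    simp
  · exact (integrable_finsetSum _ fun c _ => hi c).const_mul _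

theorem exists_norm_sum_gInt_le (hm : 1 ≤ m) (hn : 1 ≤ n) : ∃ C : ℝ, 0 ≤ C ∧ ∀ X : ℝ, 1 ≤ X → ∀ N : ℕ,
    (∀ c : ℕ, N < c → X < c ^ 2) →
    ‖(∑ c ∈ range (N + 1), bcoef m n c * gInt n (m / c ^ 2) (c ^ 2 / X)) -
      (if m = n then -(2 * ee (3 / 8) * diagMass n) else 0)‖ ≤ C * X ^ (-(1 / 5000) : ℝ) := by
  obtain ⟨C₁, hC₁, h₁⟩ := exists_norm_integral_wt_fourC_le (m := m) (n := n) hm hn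
  obtain ⟨C₂, hC₂, h₂⟩ := exists_abs_diag_sub_le hn
  refine ⟨C₁ + 2 * C₂, by positivity, fun X hX N hN => ?_⟩
  have hX0 : 0 < X := by linarith
  have hT := integral_wt_fourC_eq (m := m) hn hX0 hN
  have hTb := h₁ X hX0
  have hd := h₂ X hX0
  have hXX : X ^ (-(1 / 4) : ℝ) ≤ X ^ (-(1 / 5000) : ℝ) := rpow_le_rpow_of_exponent_le hX (by norm_num)
  set T := ∫ y in Ioi 0, (wt n y : ℂ) * fourC n m 0 (prof profA (Real.log (X * y))) y
  set D := ∫ y in Ioi 0, wt n y * chi (1 / (X * y * y)) * Real.exp (-(π * n * y))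
  set S := ∑ c ∈ range (N + 1), bcoef m n c * gInt n (m / c ^ 2) (c ^ 2 / X)
  have hee : ee (3 / 8) * ee (-(3 / 8)) = 1 := by rw [← ee_add]; simp [ee]
  have hn1 : ‖ee (3 / 8)‖ = 1 := by
    rw [ee, norm_exp]; simp
  have e : S - (if m = n then -(2 * ee (3 / 8) * diagMass n) else 0) =
      ee (3 / 8) * (T / 2 - if m = n then 2 * ((D - diagMass n : ℝ) : ℂ) else 0) := by
    rw [hT]
    split_ifs
    · push_cast; grind
    grind
  rw [e, norm_mul, hn1, one_mul]
  have hr : 0 ≤ X ^ (-(1 / 5000) : ℝ) := by positivity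
  calc _ ≤ ‖T / 2‖ + ‖if m = n then 2 * ((D - diagMass n : ℝ) : ℂ) else 0‖ := norm_sub_le _ _
    _ ≤ C₁ * X ^ (-(1 / 5000) : ℝ) + 2 * (C₂ * X ^ (-(1 / 5000) : ℝ)) := by
        refine add_le_add ?_ ?_
        · rw [norm_div]; norm_num; nlinarith
        · split_ifs
          · rw [norm_mul, norm_real, norm_eq_abs]; norm_num
            nlinarith
          · simp; positivity
    _ = _ := by ring

theorem integrableOn_rpow_mul_cexp {s : ℝ} (hs : 0 < s) {r : ℂ} (hr : 0 < r.re) :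
    IntegrableOn (fun t : ℝ => ((t ^ (s - 1) : ℝ) : ℂ) * cexp (-(r * t))) (Ioi 0) := by
  refine Integrable.mono' (integrableOn_rpow_mul_exp_neg_mul_rpow (p := 1) (s := s - 1) (by linarith) one_pos hr) ?_ ?_
  · exact Measurable.aestronglyMeasurable (by fun_prop)
  · filter_upwards [ae_restrict_mem measurableSet_Ioi] with y hy
    have hy' : (0 : ℝ) < y := hy
    rw [norm_mul, norm_real, norm_of_nonneg (by positivity), norm_exp]
    simp

/-- The Gamma integral with a complex rate. -/
theorem integral_rpow_mul_cexp {s : ℝ} (hs : 0 < s) {r : ℂ} (hr : 0 < r.re) :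
    ∫ t in Ioi (0 : ℝ), ((t ^ (s - 1) : ℝ) : ℂ) * cexp (-(r * t)) = (1 / r) ^ (s : ℂ) * Complex.Gamma s := by
  set μ := (volume.restrict (Ioi (0 : ℝ))).withDensity fun t => ENNReal.ofReal (t ^ (s - 1)) with hμ
  have hm : Measurable fun t : ℝ => ENNReal.ofReal (t ^ (s - 1)) := by fun_prop
  have key : ∀ z : ℂ, ProbabilityTheory.complexMGF id μ z = ∫ t in Ioi (0 : ℝ), ((t ^ (s - 1) : ℝ) : ℂ) * cexp (-(-z * t)) := fun z => by
    rw [ProbabilityTheory.complexMGF, hμ, integral_withDensity_eq_integral_toReal_smul hm (ae_of_all _ fun _ => ofReal_lt_top)]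
    refine setIntegral_congr_fun measurableSet_Ioi fun t ht => ?_
    have ht' : (0 : ℝ) < t := ht
    simp only [id]
    rw [toReal_ofReal (by positivity), real_smul]; simp
  have hset : Set.Iio 0 ⊆ ProbabilityTheory.integrableExpSet id μ := fun x hx => by
    have hx' : x < 0 := hx
    rw [ProbabilityTheory.integrableExpSet, Set.mem_ofPred_eq, hμ, integrable_withDensity_iff_integrable_smul' hm (ae_of_all _ fun _ => ofReal_lt_top)]
    have h := integrableOn_rpow_mul_exp_neg_mul_rpow (p := 1) (s := s - 1) (by linarith) one_pos (neg_pos.mpr hx')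
    refine IntegrableOn.congr_fun h (fun t ht => ?_) measurableSet_Ioi
    have ht' : (0 : ℝ) < t := ht
    simp [toReal_ofReal (show 0 ≤ t ^ (s - 1) by positivity)]
  have hA : AnalyticOnNhd ℂ (ProbabilityTheory.complexMGF id μ) {z : ℂ | z.re < 0} := fun z hz =>
    ProbabilityTheory.analyticAt_complexMGF (interior_mono hset (by simp_all))
  have hB : AnalyticOnNhd ℂ (fun z : ℂ => (1 / (-z)) ^ (s : ℂ) * Complex.Gamma s) {z : ℂ | z.re < 0} := by
    refine DifferentiableOn.analyticOnNhd (fun z hz => ?_) (isOpen_lt Complex.continuous_re continuous_const)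
    have hz' : z.re < 0 := hz
    have hz0 : -z ≠ 0 := fun h => by simp_all
    refine DifferentiableAt.differentiableWithinAt (DifferentiableAt.mul_const (DifferentiableAt.cpow_const (by fun_prop) ?_) _)
    left
    rw [one_div, inv_re]
    simp_all
  have hAB : Set.EqOn (ProbabilityTheory.complexMGF id μ) (fun z : ℂ => (1 / (-z)) ^ (s : ℂ) * Complex.Gamma s) {z : ℂ | z.re < 0} := by
    refine hA.eqOn_of_preconnected_of_frequently_eq hB (convex_halfSpace_re_lt 0).isPreconnected (z₀ := -1) (by simp) ?_
    have ht : Tendsto (fun x : ℝ => (x : ℂ)) (𝓝[≠] (-1)) (𝓝[≠] (-1)) := by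
      refine tendsto_nhdsWithin_of_tendsto_nhds_of_eventually_within _ ?_ ?_
      · have := (continuous_ofReal.tendsto (-1)).mono_left (nhdsWithin_le_nhds (s := {(-1 : ℝ)}ᶜ))
        simpa using this
      · filter_upwards [self_mem_nhdsWithin] with x hx
        intro h; apply hx; exact_mod_cast (by simpa using h : (x : ℂ) = -1)
    refine ht.frequently (Eventually.frequently ?_)
    filter_upwards [nhdsWithin_le_nhds (Iio_mem_nhds (show (-1 : ℝ) < 0 by norm_num))] with x hx
    have hx' : x < 0 := hx
    have := integral_cpow_mul_exp_neg_mul_Ioi (a := s) (r := -x) (by simpa using hs) (by linarith)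
    rw [key]
    push_cast at this
    rw [← this]
    refine setIntegral_congr_fun measurableSet_Ioi fun t ht => ?_
    have ht' : (0 : ℝ) < t := ht
    rw [ofReal_cpow ht'.le]; push_cast; rfl
  have := hAB (show (-r) ∈ {z : ℂ | z.re < 0} by simpa using hr)
  grind

theorem one_sub_mul_I_ne_zero (u : ℝ) : (1 - u * I : ℂ) ≠ 0 := fun h => by have := congrArg Complex.re h; simp at this

theorem integral_cpow_mul_exp_shift (hn : 1 ≤ n) (j : ℕ) (u : ℝ) :
    (wtCoef n j : ℂ) * ∫ y in Ioi (0 : ℝ), ((y ^ ((j + 3 / 2 : ℝ) - 1) : ℝ) : ℂ) * cexp (-(π * n * (1 + u * I) * y)) =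
      ((1 - u * I) / ((1 + u ^ 2 : ℝ) : ℂ)) ^ j * (((1 + u ^ 2) ^ (-3 / 2 : ℝ) : ℝ) : ℂ) * (1 - u * I) ^ (3 / 2 : ℂ) := by
  have hpn : 0 < π * n := mul_pos pi_pos (by exact_mod_cast hn)
  have hv : 0 < 1 + u ^ 2 := by positivity
  have hw := one_sub_mul_I_ne_zero u
  have hr : 0 < (π * n * (1 + u * I) : ℂ).re := by simp_all
  rw [integral_rpow_mul_cexp (by positivity) hr]
  have e1 : (1 / (π * n * (1 + u * I)) : ℂ) = (((π * n)⁻¹ * (1 + u ^ 2)⁻¹ : ℝ) : ℂ) * (1 - u * I) := by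
    have h1 : (1 + u * I : ℂ) ≠ 0 := fun h => by simp_all
    have h2 : (π * n : ℂ) ≠ 0 := by exact_mod_cast hpn.ne'
    have h3 : (1 + (u : ℂ) ^ 2) ≠ 0 := by exact_mod_cast hv.ne'
    push_cast
    rw [← mul_inv, ← div_eq_inv_mul, div_eq_div_iff (mul_ne_zero h2 h1) (mul_ne_zero h2 h3)]
    linear_combination (π * n * u ^ 2 : ℂ) * I_sq
  have e2 : (j + 3 / 2 : ℂ) = ((j + 3 / 2 : ℝ) : ℂ) := by push_cast; ring
  have e4 : wtCoef n j * ((π * n)⁻¹ * (1 + u ^ 2)⁻¹) ^ (j + 3 / 2 : ℝ) * Real.Gamma (j + 3 / 2) =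
      ((1 + u ^ 2)⁻¹) ^ j * (1 + u ^ 2) ^ (-3 / 2 : ℝ) := by
    rw [wtCoef, mul_rpow (inv_pos.mpr hpn).le (inv_pos.mpr hv).le, inv_rpow hpn.le, rpow_add (inv_pos.mpr hv), rpow_natCast,
      inv_rpow hv.le, neg_div, rpow_neg hv.le]
    field_simp
  rw [e1, Gamma_ofReal, cpow_ofReal_mul (by positivity) hw, ← e2, cpow_add _ _ hw, cpow_natCast, div_pow]
  have e5 := congrArg (fun x : ℝ => (x : ℂ)) e4
  push_cast at e5 ⊢
  have e6 : ((1 - u * I : ℂ)) ^ j / (1 + (u : ℂ) ^ 2) ^ j = ((1 + (u : ℂ) ^ 2)⁻¹) ^ j * (1 - u * I) ^ j := by ring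
  grind

/-- The averaged rational kernel. -/
def ratKer (u : ℝ) : ℂ :=
  (((1 + u ^ 2) ^ (-3 / 2 : ℝ) : ℝ) : ℂ) * (3 / 8 * ((1 - u * I) / ((1 + u ^ 2 : ℝ) : ℂ)) ^ 1 + 3 / 8 * ((1 - u * I) / ((1 + u ^ 2 : ℝ) : ℂ)) ^ 2 +
    1 / 4 * ((1 - u * I) / ((1 + u ^ 2 : ℝ) : ℂ)) ^ 3)

theorem integral_gKer_zero (hn : 1 ≤ n) (u : ℝ) : ∫ y in Ioi 0, gKer n 0 (y, u) = ratKer u := by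
  have hw := one_sub_mul_I_ne_zero u
  have hpn : 0 < π * n := mul_pos pi_pos (by exact_mod_cast hn)
  have hr : 0 < (π * n * (1 + u * I) : ℂ).re := by simp_all
  have hi : ∀ j : ℕ, IntegrableOn (fun y : ℝ => ((y ^ ((j + 3 / 2 : ℝ) - 1) : ℝ) : ℂ) * cexp (-(π * n * (1 + u * I) * y))) (Ioi 0) :=
    fun j => integrableOn_rpow_mul_cexp (by positivity) hr
  have hpt : ∀ y ∈ Ioi (0 : ℝ), gKer n 0 (y, u) = (1 - u * I) ^ (-(3 / 2) : ℂ) *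
      (3 / 8 * (wtCoef n 1 * (((y ^ (((1 : ℕ) + 3 / 2 : ℝ) - 1) : ℝ) : ℂ) * cexp (-(π * n * (1 + u * I) * y)))) +
        3 / 8 * (wtCoef n 2 * (((y ^ (((2 : ℕ) + 3 / 2 : ℝ) - 1) : ℝ) : ℂ) * cexp (-(π * n * (1 + u * I) * y)))) +
        1 / 4 * (wtCoef n 3 * (((y ^ (((3 : ℕ) + 3 / 2 : ℝ) - 1) : ℝ) : ℂ) * cexp (-(π * n * (1 + u * I) * y))))) := by
    intro y hy
    have hy' : (0 : ℝ) < y := hy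
    have e : ∀ j : ℕ, y ^ ((j + 3 / 2 : ℝ) - 1) = y ^ (j + 1) * y ^ (-1 / 2 : ℝ) := fun j => by
      rw [← rpow_natCast, ← rpow_add hy']; grind
    have e2 : cexp (-(π * n * (1 + u * I) * y)) = ((Real.exp (-(π * n * y)) : ℝ) : ℂ) * cexp (-(π * I * n * y * u)) := by
      rw [ofReal_exp, ← Complex.exp_add]; congr 1; push_cast; ring
    rw [e, e, e, e2]
    simp only [gKer, wt]
    simp; ring
  have i1 := fun j : ℕ => (hi j).const_mul (wtCoef n j : ℂ)
  have i2 : IntegrableOn (fun y : ℝ => (3 / 8 : ℂ) * (wtCoef n 1 * (((y ^ (((1 : ℕ) + 3 / 2 : ℝ) - 1) : ℝ) : ℂ) * cexp (-(π * n * (1 + u * I) * y)))) +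
      3 / 8 * (wtCoef n 2 * (((y ^ (((2 : ℕ) + 3 / 2 : ℝ) - 1) : ℝ) : ℂ) * cexp (-(π * n * (1 + u * I) * y))))) (Ioi 0) :=
    ((i1 1).const_mul _).add ((i1 2).const_mul _)
  rw [setIntegral_congr_fun measurableSet_Ioi hpt, integral_const_mul, integral_add i2 ((i1 3).const_mul _),
    integral_add ((i1 1).const_mul _) ((i1 2).const_mul _)]
  simp only [integral_const_mul]
  rw [integral_cpow_mul_exp_shift hn, integral_cpow_mul_exp_shift hn, integral_cpow_mul_exp_shift hn, ratKer]
  have e3 : (1 - u * I : ℂ) ^ (-(3 / 2) : ℂ) * (1 - u * I) ^ (3 / 2 : ℂ) = 1 := by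
    rw [← cpow_add _ _ hw]; simp
  grind

theorem ratKer_add_neg (u : ℝ) : ratKer u + ratKer (-u) = ((2 * ((1 + u ^ 2) ^ (-3 / 2 : ℝ) * ((1 + u ^ 2)⁻¹) ^ 3) : ℝ) : ℂ) := by
  have hv : (1 + (u : ℂ) ^ 2) ≠ 0 := by exact_mod_cast (by positivity : (1 + u ^ 2 : ℝ) ≠ 0)
  unfold ratKer
  rw [show (-u) ^ 2 = u ^ 2 by ring]
  push_cast
  generalize (((1 + (u : ℂ) ^ 2) ^ (-3 / 2 : ℂ) : ℂ)) = V at *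
  field_simp
  have h2 := I_sq
  grind

theorem gInt_zero_eq (hn : 1 ≤ n) {lam : ℝ} (hl : 0 ≤ lam) :
    gInt n 0 lam = ((∫ u : ℝ, chi (lam * (1 + u ^ 2)) * ((1 + u ^ 2) ^ (-3 / 2 : ℝ) * ((1 + u ^ 2)⁻¹) ^ 3) : ℝ) : ℂ) := by
  have hI := integrable_gKer_chi hn (le_refl 0) hl
  have hin : ∀ u : ℝ, (∫ y in Ioi 0, gKer n 0 (y, u) * (chi (lam * (1 + u ^ 2)) : ℂ)) = ratKer u * (chi (lam * (1 + u ^ 2)) : ℂ) := fun u => by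
    rw [integral_mul_const, integral_gKer_zero hn]
  have e1 : gInt n 0 lam = ∫ u, ratKer u * (chi (lam * (1 + u ^ 2)) : ℂ) := by
    rw [gInt]
    have := integral_prod_symm _ hI
    aesop
  have hi : Integrable (fun u : ℝ => ratKer u * (chi (lam * (1 + u ^ 2)) : ℂ)) := by
    have := hI.integral_prod_right
    simp_all
  have e2 : (∫ u, ratKer u * (chi (lam * (1 + u ^ 2)) : ℂ)) = ∫ u, ratKer (-u) * (chi (lam * (1 + u ^ 2)) : ℂ) := by
    rw [← integral_neg_eq_self]; simp
  have hi2 : Integrable (fun u : ℝ => ratKer (-u) * (chi (lam * (1 + u ^ 2)) : ℂ)) := by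
    simpa using hi.comp_neg
  have e3 : 2 * gInt n 0 lam = 2 * ∫ u : ℝ, ((chi (lam * (1 + u ^ 2)) * ((1 + u ^ 2) ^ (-3 / 2 : ℝ) * ((1 + u ^ 2)⁻¹) ^ 3) : ℝ) : ℂ) := by
    rw [two_mul, e1]
    nth_rewrite 2 [e2]
    rw [← integral_add hi hi2, ← integral_const_mul]
    refine integral_congr_ae (ae_of_all _ fun u => ?_)
    have := ratKer_add_neg u
    dsimp only
    rw [← add_mul, this]; push_cast; ring
  rw [mul_right_injective₀ two_ne_zero e3, integral_complex_ofReal]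

theorem hasDerivAt_div_sqrt_one_add_sq (u : ℝ) : HasDerivAt (fun u : ℝ => u / √(1 + u ^ 2)) ((1 + u ^ 2) ^ (-3 / 2 : ℝ)) u := by
  have hv : 0 < 1 + u ^ 2 := by positivity
  have h1 : HasDerivAt (fun u : ℝ => 1 + u ^ 2) (2 * u) u := by
    simpa using (hasDerivAt_pow 2 u).const_add 1
  refine ((hasDerivAt_id u).div (h1.sqrt hv.ne') (sqrt_pos.mpr hv).ne').congr_deriv ?_
  have e : (1 + u ^ 2) ^ (-3 / 2 : ℝ) = ((√(1 + u ^ 2)) ^ 3)⁻¹ := by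
    rw [sqrt_eq_rpow, ← rpow_natCast _ 3, ← rpow_mul hv.le, ← rpow_neg hv.le]; norm_num
  grind

theorem tendsto_div_sqrt_one_add_sq : Tendsto (fun u : ℝ => u / √(1 + u ^ 2)) atTop (𝓝 1) := by
  have h1 : Tendsto (fun u : ℝ => (√(1 + u⁻¹ ^ 2))⁻¹) atTop (𝓝 1) := by
    have : Tendsto (fun u : ℝ => (√(1 + u⁻¹ ^ 2))⁻¹) atTop (𝓝 (√(1 + 0 ^ 2))⁻¹) :=
      Tendsto.inv₀ ((continuous_sqrt.tendsto _).comp ((tendsto_inv_atTop_zero.pow 2).const_add 1)) (by simp)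
    simpa using this
  refine h1.congr' ?_
  filter_upwards [eventually_gt_atTop 0] with u hu
  have e : 1 + u ^ 2 = u ^ 2 * (1 + u⁻¹ ^ 2) := by field_simp; ring
  rw [e, sqrt_mul (by positivity), sqrt_sq hu.le]
  field_simp

theorem integral_max_sub_sq {κ : ℝ} (hκ : κ ≤ 1) : ∫ t in (-1 : ℝ)..1, (max (κ - t ^ 2) 0) ^ 3 = 32 / 35 * (κ ^ 3 * √κ) := by
  rcases le_or_gt κ 0 with h | h
  · rw [sqrt_eq_zero_of_nonpos h, mul_zero, mul_zero]
    rw [integral_congr (g := fun _ => 0) fun t _ => ?_]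
    · simp
    · dsimp only; rw [max_eq_right (by nlinarith)]; simp
  · set r := √κ
    have hr : 0 < r := sqrt_pos.mpr h
    have hr2 : r ^ 2 = κ := sq_sqrt h.le
    have hr1 : r ≤ 1 := by nlinarith
    have hc : Continuous fun t : ℝ => (max (κ - t ^ 2) 0) ^ 3 := by fun_prop
    rw [← integral_add_adjacent_intervals (hc.intervalIntegrable (-1) (-r)) (hc.intervalIntegrable _ _),
      ← integral_add_adjacent_intervals (hc.intervalIntegrable (-r) r) (hc.intervalIntegrable _ _)]
    have e1 : ∫ t in (-1 : ℝ)..-r, (max (κ - t ^ 2) 0) ^ 3 = 0 := by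
      rw [integral_congr (g := fun _ => 0) fun t ht => ?_]
      · simp
      · rw [Set.uIcc_of_le (by linarith)] at ht
        dsimp only; rw [max_eq_right (by nlinarith [ht.2])]; simp
    have e3 : ∫ t in r..1, (max (κ - t ^ 2) 0) ^ 3 = 0 := by
      rw [integral_congr (g := fun _ => 0) fun t ht => ?_]
      · simp
      · rw [Set.uIcc_of_le (by linarith)] at ht
        dsimp only; rw [max_eq_right (by nlinarith [ht.1])]; simp
    have e2 : ∫ t in (-r)..r, (max (κ - t ^ 2) 0) ^ 3 = ∫ t in (-r)..r, (κ ^ 3 - 3 * κ ^ 2 * t ^ 2 + 3 * κ * t ^ 4 - t ^ 6) := by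
      refine integral_congr fun t ht => ?_
      rw [Set.uIcc_of_le (by linarith)] at ht
      rw [max_eq_left (by nlinarith [ht.1, ht.2])]; ring
    rw [e1, e2, e3, intervalIntegral.integral_eq_sub_of_hasDerivAt (f := fun t => κ ^ 3 * t - κ ^ 2 * t ^ 3 + 3 / 5 * κ * t ^ 5 - t ^ 7 / 7)
      (fun t _ => ?_) (Continuous.intervalIntegrable (by fun_prop) _ _)]
    · rw [← hr2]; ring
    · have := ((((hasDerivAt_id t).const_mul (κ ^ 3)).fun_sub ((hasDerivAt_pow 3 t).const_mul (κ ^ 2))).fun_add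
        ((hasDerivAt_pow 5 t).const_mul (3 / 5 * κ))).fun_sub ((hasDerivAt_pow 7 t).div_const 7)
      grind

theorem gInt_zero (hn : 1 ≤ n) {lam : ℝ} (hl : 0 ≤ lam) :
    gInt n 0 lam = ((32 / 35 * ((1 - lam) ^ 3 * √(1 - lam)) : ℝ) : ℂ) := by
  rw [gInt_zero_eq hn hl, ← integral_max_sub_sq (by linarith)]
  congr 1
  set Q : ℝ → ℝ := fun s => ∫ t in (0 : ℝ)..s, (max (1 - lam - t ^ 2) 0) ^ 3
  have hc : Continuous fun t : ℝ => (max (1 - lam - t ^ 2) 0) ^ 3 := by fun_prop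
  have hQ : ∀ s, HasDerivAt Q ((max (1 - lam - s ^ 2) 0) ^ 3) s := fun s =>
    intervalIntegral.integral_hasDerivAt_right (hc.intervalIntegrable _ _) (hc.stronglyMeasurableAtFilter _ _) hc.continuousAt
  have hQc : Continuous Q := continuous_iff_continuousAt.mpr fun s => (hQ s).continuousAt
  have h1 : ∀ u : ℝ, chi (lam * (1 + u ^ 2)) * ((1 + u ^ 2) ^ (-3 / 2 : ℝ) * ((1 + u ^ 2)⁻¹) ^ 3) =
      (max (1 - lam - (u / √(1 + u ^ 2)) ^ 2) 0) ^ 3 * (1 + u ^ 2) ^ (-3 / 2 : ℝ) := fun u => by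
    have hv : 0 < 1 + u ^ 2 := by positivity
    have e : max (1 - lam - (u / √(1 + u ^ 2)) ^ 2) 0 = (1 - min (lam * (1 + u ^ 2)) 1) * (1 + u ^ 2)⁻¹ := by
      rw [div_pow, sq_sqrt hv.le]
      have e0 : 1 - lam - u ^ 2 / (1 + u ^ 2) = (1 - lam * (1 + u ^ 2)) * (1 + u ^ 2)⁻¹ := by field_simp; ring
      rw [e0]
      rcases le_total (lam * (1 + u ^ 2)) 1 with h | h
      · simp_all
      · rw [min_eq_right h, max_eq_right (mul_nonpos_of_nonpos_of_nonneg (by linarith) (inv_pos.mpr hv).le)]; simp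
    rw [e, chi]; ring
  have hder : ∀ u : ℝ, HasDerivAt (fun u => Q (u / √(1 + u ^ 2)))
      (chi (lam * (1 + u ^ 2)) * ((1 + u ^ 2) ^ (-3 / 2 : ℝ) * ((1 + u ^ 2)⁻¹) ^ 3)) u := fun u => by
    rw [h1]; exact (hQ _).comp u (hasDerivAt_div_sqrt_one_add_sq u)
  have hi : Integrable fun u : ℝ => chi (lam * (1 + u ^ 2)) * ((1 + u ^ 2) ^ (-3 / 2 : ℝ) * ((1 + u ^ 2)⁻¹) ^ 3) := by
    refine (integrable_one_add_sq (r := 3 / 2) (by norm_num)).mono' ?_ (ae_of_all _ fun u => ?_)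
    · refine Continuous.aestronglyMeasurable ?_
      have hne : ∀ u : ℝ, 1 + u ^ 2 ≠ 0 := fun u => by positivity
      exact (continuous_chi.comp (by fun_prop)).mul ((Continuous.rpow_const (by fun_prop) fun u => Or.inl (hne u)).mul
        ((Continuous.inv₀ (by fun_prop) hne).pow 3))
    · have hx := chi_mem (s := lam * (1 + u ^ 2)) (by positivity)
      have h2 : (1 + u ^ 2)⁻¹ ^ 3 ≤ 1 := pow_le_one₀ (by positivity) (inv_le_one_of_one_le₀ (by nlinarith))
      rw [norm_of_nonneg (mul_nonneg hx.1 (by positivity)), neg_div]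
      calc _ ≤ 1 * ((1 + u ^ 2) ^ (-(3 / 2) : ℝ) * 1) := by gcongr; exact hx.2
        _ = _ := by ring
  have ht : Tendsto (fun u => Q (u / √(1 + u ^ 2))) atTop (𝓝 (Q 1)) := (hQc.tendsto 1).comp tendsto_div_sqrt_one_add_sq
  have hb : Tendsto (fun u => Q (u / √(1 + u ^ 2))) atBot (𝓝 (Q (-1))) := by
    refine (hQc.tendsto (-1)).comp ?_
    have := (tendsto_div_sqrt_one_add_sq.comp tendsto_neg_atBot_atTop).neg
    grind
  rw [integral_of_hasDerivAt_of_tendsto hder hi hb ht, intervalIntegral.integral_interval_sub_left (hc.intervalIntegrable _ _) (hc.intervalIntegrable _ _)]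

/-- The coefficients of the Bessel-type series for `sin (2 * √(B * t))`. -/
def sinCoef (B : ℝ) (k : ℕ) : ℝ := √(π * B) * ((-B) ^ k / (k.factorial * Real.Gamma (k + 3 / 2)))

theorem hasSum_sinCoef {B t : ℝ} (hB : 0 < B) (ht : 0 < t) :
    HasSum (fun k => sinCoef B k * t ^ ((k + 3 / 2 : ℝ) - 1)) (Real.sin (2 * √(B * t))) := by
  refine (Real.hasSum_sin (2 * √(B * t))).congr_fun fun k => ?_
  have hG := Real.Gamma_mul_Gamma_add_half (k + 1)
  rw [Real.Gamma_nat_eq_factorial, show (2 * (k + 1 : ℝ)) = ((2 * k + 1 : ℕ) : ℝ) + 1 by push_cast; ring, Real.Gamma_nat_eq_factorial,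
    show (k + 1 + 1 / 2 : ℝ) = k + 3 / 2 by ring] at hG
  have e1 : (2 : ℝ) ^ (1 - (((2 * k + 1 : ℕ) : ℝ) + 1)) = ((2 : ℝ) ^ (2 * k + 1))⁻¹ := by
    rw [← rpow_natCast, ← rpow_neg (by norm_num)]; congr 1; ring
  rw [e1] at hG
  have e2 : t ^ ((k + 3 / 2 : ℝ) - 1) = t ^ k * √t := by
    rw [sqrt_eq_rpow, ← rpow_natCast, ← rpow_add ht]; congr 1; ring
  have e3 : √B ^ (2 * k + 1) = B ^ k * √B := by rw [pow_succ, pow_mul, sq_sqrt hB.le]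
  have e4 : √t ^ (2 * k + 1) = t ^ k * √t := by rw [pow_succ, pow_mul, sq_sqrt ht.le]
  have h3 : ((2 * k + 1).factorial : ℝ) ≠ 0 := by positivity
  rw [sinCoef, e2, sqrt_mul hB.le, mul_pow, mul_pow, e3, e4, sqrt_mul pi_pos.le, hG, neg_pow]
  field_simp

theorem one_div_cpow_add {p : ℂ} (hp : 0 < p.re) (k : ℕ) : (1 / p) ^ (((k + 3 / 2 : ℝ) : ℝ) : ℂ) = (1 / p) ^ k * p ^ (-(3 / 2) : ℂ) := by
  have hp0 : p ≠ 0 := by rintro rfl; simp at hp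
  have harg : p.arg ≠ π := fun h => by
    have := abs_arg_lt_pi_div_two_iff.mpr (Or.inl hp)
    grind
  push_cast
  rw [cpow_add _ _ (one_div_ne_zero hp0), cpow_natCast, one_div, inv_cpow _ _ harg, cpow_neg]

/-- The Laplace transform of `sin (2 * √(B * t))`. -/
theorem integral_sin_sqrt_mul_cexp (hB : 0 < B) {p : ℂ} (hp : 0 < p.re) :
    ∫ t in Ioi (0 : ℝ), ((Real.sin (2 * √(B * t)) : ℝ) : ℂ) * cexp (-(p * t)) = √(π * B) * (p ^ (-(3 / 2) : ℂ) * cexp (-(B / p))) := by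
  have hGpos : ∀ k : ℕ, 0 < Real.Gamma (k + 3 / 2) := fun k => Gamma_pos_of_pos (by positivity)
  set F : ℕ → ℝ → ℂ := fun k t => (sinCoef B k : ℂ) * (((t ^ ((k + 3 / 2 : ℝ) - 1) : ℝ) : ℂ) * cexp (-(p * t)))
  have h1 : ∀ k, Integrable (F k) (volume.restrict (Ioi 0)) := fun k => (integrableOn_rpow_mul_cexp (by positivity) hp).const_mul _
  have hnorm : ∀ k, ∫ t in Ioi (0 : ℝ), ‖F k t‖ = √(π * B) * (1 / p.re) ^ (3 / 2 : ℝ) * ((B / p.re) ^ k / k.factorial) := fun k => by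
    have e : ∀ t ∈ Ioi (0 : ℝ), ‖F k t‖ = |sinCoef B k| * (t ^ ((k + 3 / 2 : ℝ) - 1) * Real.exp (-(p.re * t))) := fun t ht => by
      have ht' : (0 : ℝ) < t := ht
      rw [norm_mul, norm_mul, norm_real, norm_real, norm_exp, norm_eq_abs,
        norm_of_nonneg (by positivity)]
      simp
    rw [setIntegral_congr_fun measurableSet_Ioi e, integral_const_mul, integral_rpow_mul_exp_neg_mul_Ioi (by positivity) hp,
      rpow_add (by positivity), rpow_natCast, sinCoef, abs_mul, abs_div, abs_mul, abs_of_pos (hGpos k), abs_pow, abs_neg,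
      abs_of_pos hB, Nat.abs_cast, abs_of_nonneg (sqrt_nonneg _), div_pow, div_pow]
    field_simp; ring
  have h2 : Summable fun k => ∫ t in Ioi (0 : ℝ), ‖F k t‖ := by
    simp only [hnorm]
    exact (summable_pow_div_factorial _).mul_left _
  have h3 := hasSum_integral_of_summable_integral_norm h1 h2
  have h4 : ∫ t in Ioi (0 : ℝ), ∑' k, F k t = ∫ t in Ioi (0 : ℝ), ((Real.sin (2 * √(B * t)) : ℝ) : ℂ) * cexp (-(p * t)) := by
    refine setIntegral_congr_fun measurableSet_Ioi fun t ht => ?_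
    have := (hasSum_ofReal.mpr (hasSum_sinCoef hB ht)).mul_right (cexp (-(p * t)))
    refine (this.congr_fun fun k => ?_).tsum_eq
    simp; ring
  rw [h4] at h3
  refine h3.unique ?_
  have h5 : HasSum (fun k : ℕ => (-(B / p)) ^ k / (k.factorial : ℂ)) (cexp (-(B / p))) := by
    rw [exp_eq_exp_ℂ]; exact NormedSpace.expSeries_div_hasSum_exp _
  refine (h5.mul_left (√(π * B) * p ^ (-(3 / 2) : ℂ))).congr_fun (fun k => ?_) |>.congr_fun (fun k => rfl) |> fun h => by rwa [mul_assoc] at h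
  have hG0 : ((Real.Gamma (k + 3 / 2) : ℝ) : ℂ) ≠ 0 := by exact_mod_cast (hGpos k).ne'
  have h6 : (k.factorial : ℂ) ≠ 0 := by exact_mod_cast k.factorial_ne_zero
  simp only [F]
  rw [integral_const_mul, integral_rpow_mul_cexp (by positivity) hp, one_div_cpow_add hp, Gamma_ofReal, sinCoef]
  push_cast
  generalize ((Real.Gamma (k + 3 / 2) : ℝ) : ℂ) = G at *
  field_simp; ring

theorem integral_bromwich (hB : 0 < B) (v : ℝ) :
    ∫ u : ℝ, (1 - u * I : ℂ) ^ (-(3 / 2) : ℂ) * cexp (-(B / (1 - u * I))) * cexp (-(v * u * I)) =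
      2 * π * (((Real.sin (2 * √(B * v)) * Real.exp (-v) : ℝ) : ℂ) / √(π * B)) := by
  have hpi := pi_pos
  set f : ℝ → ℂ := fun t => ((Real.sin (2 * √(B * t)) * Real.exp (-t) : ℝ) : ℂ)
  set g : ℝ → ℂ := fun u => (1 - u * I : ℂ) ^ (-(3 / 2) : ℂ) * cexp (-(B / (1 - u * I)))
  have hf0 : ∀ t ∉ Ioi (0 : ℝ), f t = 0 := fun t ht => by
    have : B * t ≤ 0 := mul_nonpos_of_nonneg_of_nonpos hB.le (by simpa using ht)
    simp [f, sqrt_eq_zero_of_nonpos this]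
  have hfc : Continuous f := by fun_prop
  have hfi : Integrable f := by
    rw [← integrableOn_iff_integrable_of_support_subset (s := Ioi 0) fun t ht => by by_contra h; exact ht (hf0 t h)]
    refine Integrable.mono' (exp_neg_integrableOn_Ioi 0 one_pos) hfc.aestronglyMeasurable (ae_of_all _ fun t => ?_)
    rw [norm_real, norm_mul, norm_of_nonneg (exp_pos _).le]
    have := abs_sin_le_one (2 * √(B * t))
    calc _ ≤ 1 * Real.exp (-t) := mul_le_mul_of_nonneg_right this (exp_pos _).le
      _ = _ := by simp
  have hF : ∀ x : ℝ, FourierTransform.fourier f x = √(π * B) * g (-(2 * π) * x) := fun x => by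
    have hp : 0 < (1 - ((-(2 * π) * x : ℝ) : ℂ) * I).re := by simp
    rw [fourier_real_eq_integral_exp_smul, ← integral_sin_sqrt_mul_cexp hB hp,
      ← setIntegral_eq_integral_of_forall_compl_eq_zero (s := Ioi 0) fun t ht => by simp_all]
    refine setIntegral_congr_fun measurableSet_Ioi fun t _ => ?_
    simp only [f, smul_eq_mul]
    push_cast
    rw [mul_comm, mul_assoc, ← Complex.exp_add]
    congr 2; ring
  have hgi : Integrable g := by
    refine (integrable_one_add_sq (r := 3 / 4) (by norm_num)).mono' (Measurable.aestronglyMeasurable (by fun_prop)) (ae_of_all _ fun u => ?_)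
    rw [norm_mul, norm_one_sub_cpow, norm_exp]
    refine mul_le_of_le_one_right (by positivity) (exp_le_one_iff.mpr ?_)
    rw [neg_re, div_eq_mul_inv, re_ofReal_mul, inv_re, neg_nonpos]
    refine mul_nonneg hB.le (div_nonneg (by simp) (normSq_nonneg _))
  have hFi : Integrable (FourierTransform.fourier f) := by
    rw [funext hF]
    exact (hgi.comp_mul_left' (by simp [hpi.ne'])).const_mul _
  have hinv := hfi.fourierInv_fourier_eq hFi (v := v) hfc.continuousAt
  rw [fourierInv_eq', funext hF] at hinv
  have hs := Measure.integral_comp_mul_left (fun u => g u * cexp (-(v * u * I))) (-(2 * π))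
  have e : ∫ x : ℝ, cexp (((2 * π * inner ℝ x v : ℝ) : ℂ) * I) • (√(π * B) * g (-(2 * π) * x)) =
      √(π * B) * ∫ x : ℝ, g (-(2 * π) * x) * cexp (-(v * ((-(2 * π) * x : ℝ) : ℂ) * I)) := by
    rw [← integral_const_mul]
    refine integral_congr_ae (ae_of_all _ fun x => ?_)
    simp; ring
  rw [e, hs, abs_inv, abs_neg, abs_of_pos (by positivity), real_smul] at hinv
  have h1 : ((√(π * B) : ℝ) : ℂ) ≠ 0 := by exact_mod_cast (sqrt_pos.mpr (mul_pos hpi hB)).ne'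
  have h2 : (π : ℂ) ≠ 0 := by exact_mod_cast hpi.ne'
  change ∫ u : ℝ, g u * cexp (-(v * u * I)) = 2 * π * (f v / _)
  rw [← hinv]
  generalize (∫ u : ℝ, g u * cexp (-(v * u * I))) = J
  push_cast
  field_simp

theorem gInt_cutoff_zero (hn : 1 ≤ n) {b : ℝ} (hb : 0 < b) :
    gInt n b 0 = ((diagMass n * (2 / √b * Real.sin (2 * π * √(b * n))) : ℝ) : ℂ) := by
  have hpi := pi_pos
  have hI := integrable_gKer_chi hn hb.le (le_refl 0)
  rw [gInt, gMeas, integral_prod _ hI, diagMass, ← integral_mul_const, ← integral_complex_ofReal]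
  refine setIntegral_congr_fun measurableSet_Ioi fun y hy => ?_
  have hy' : (0 : ℝ) < y := hy
  have hyC : (y : ℂ) ≠ 0 := by exact_mod_cast hy'.ne'
  have hB : 0 < π * b / y := by positivity
  have e1 : ∀ u : ℝ, gKer n b (y, u) * (chi (0 * (1 + u ^ 2)) : ℂ) = ((wt n y * y ^ (-1 / 2 : ℝ) : ℝ) : ℂ) *
      ((1 - u * I : ℂ) ^ (-(3 / 2) : ℂ) * cexp (-(((π * b / y : ℝ) : ℂ) / (1 - u * I))) * cexp (-(((π * n * y : ℝ) : ℂ) * u * I))) := fun u => by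
    have h : (π * I * b / (y * (u + I)) : ℂ) = ((π * b / y : ℝ) : ℂ) / (1 - u * I) := by
      have hu : (u + I : ℂ) = I * (1 - u * I) := by linear_combination (u : ℂ) * I_sq
      rw [hu]; push_cast
      field_simp
    simp only [gKer]
    rw [h, show chi (0 * (1 + u ^ 2)) = 1 by simp [chi]]
    push_cast
    ring_nf
  simp only [e1]
  rw [integral_const_mul, integral_bromwich hB]
  have e2 : √(π * b / y * (π * n * y)) = π * √(b * n) := by
    rw [show π * b / y * (π * n * y) = π ^ 2 * (b * n) by field_simp, sqrt_mul (by positivity), sqrt_sq hpi.le]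
  have e3 : √(π * (π * b / y)) = π * √b * y ^ (-1 / 2 : ℝ) := by
    rw [show π * (π * b / y) = π ^ 2 * b * y⁻¹ by field_simp, sqrt_mul (by positivity), sqrt_mul (by positivity), sqrt_sq hpi.le,
      sqrt_inv, neg_div, rpow_neg hy'.le, sqrt_eq_rpow y]
  rw [e2, e3]
  have h1 : ((√b : ℝ) : ℂ) ≠ 0 := by exact_mod_cast (sqrt_pos.mpr hb).ne'
  have h2 : ((y ^ (-1 / 2 : ℝ) : ℝ) : ℂ) ≠ 0 := by exact_mod_cast (rpow_pos_of_pos hy' _).ne'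
  have h3 : (π : ℂ) ≠ 0 := by exact_mod_cast hpi.ne'
  rw [← mul_assoc 2 π]
  generalize y ^ (-1 / 2 : ℝ) = Y at h2 ⊢
  push_cast
  field_simp

/-- The Beta-type constant `∫₀¹ t^{7/2} (1-t)^{1/2} dt`. -/
def betaHalf : ℝ := ∫ t in (0 : ℝ)..1, t ^ 3 * √t * √(1 - t)

theorem betaHalf_pos : 0 < betaHalf := by
  refine intervalIntegral.intervalIntegral_pos_of_pos_on (by fun_prop |> fun h : Continuous fun t : ℝ => t ^ 3 * √t * √(1 - t) => h.intervalIntegrable 0 1) (fun t ht => ?_) one_pos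
  simp_all

theorem integral_riesz_zero {T : ℝ} (hT : 0 ≤ T) : ∫ s in (0 : ℝ)..T, s ^ 3 * √s * √(T - s) = betaHalf * T ^ 5 := by
  have h := intervalIntegral.smul_integral_comp_mul_left (a := 0) (b := 1) (fun s => s ^ 3 * √s * √(T - s)) T
  rw [mul_zero, mul_one] at h
  rw [← h, betaHalf, smul_eq_mul, ← intervalIntegral.integral_const_mul, ← intervalIntegral.integral_mul_const]
  congr 1; ext t
  rw [show T - T * t = T * (1 - t) by ring, sqrt_mul hT, sqrt_mul hT]
  grind

theorem integral_riesz {X k : ℝ} (hX : 0 ≤ X) (hk : 0 ≤ k) :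
    ∫ s in (0 : ℝ)..X, (s - k) ^ 3 * √(s - k) * √(X - s) = betaHalf * max (X - k) 0 ^ 5 := by
  have hc : Continuous fun s : ℝ => (s - k) ^ 3 * √(s - k) * √(X - s) := by fun_prop
  have hz : ∀ s, s ≤ k → (s - k) ^ 3 * √(s - k) * √(X - s) = 0 := fun s hs => by grind
  rcases le_total X k with h | h
  · rw [max_eq_right (sub_nonpos.mpr h)]
    rw [integral_congr (g := fun _ => 0) fun s hs => hz s ?_]
    · simp
    · rw [Set.uIcc_of_le hX] at hs; exact hs.2.trans h
  · rw [max_eq_left (sub_nonneg.mpr h), ← integral_add_adjacent_intervals (hc.intervalIntegrable 0 k) (hc.intervalIntegrable k X),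
      integral_congr (a := 0) (g := fun _ => 0) fun s hs => hz s ?_, ← integral_riesz_zero (sub_nonneg.mpr h)]
    · have := intervalIntegral.integral_comp_sub_right (a := k) (b := X) (fun s => s ^ 3 * √s * √(X - k - s)) k
      simp_all
    simp_all

theorem exists_riesz_five {a : ℕ → ℂ} (ha : a 0 = 0) {L : ℂ} {δ C : ℝ} (hδ : δ ≤ 1) (hδ0 : 0 < δ)
    (h : ∀ X : ℝ, 1 ≤ X → ∀ N : ℕ, (∀ c : ℕ, N < c → X < (c : ℝ) ^ 2) →
      ‖(∑ c ∈ range (N + 1), a c * (((1 - (c : ℝ) ^ 2 / X) ^ 3 * √(1 - (c : ℝ) ^ 2 / X) : ℝ) : ℂ)) - L‖ ≤ C * X ^ (-δ)) :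
    ∃ C' : ℝ, 0 ≤ C' ∧ ∀ X : ℝ, 0 < X → ∀ N : ℕ, (∀ c : ℕ, N < c → X < (c : ℝ) ^ 2) →
      ‖(∑ c ∈ range (N + 1), a c * ((max (X - (c : ℝ) ^ 2) 0 ^ 5 : ℝ) : ℂ)) - L * (X ^ 5 : ℝ)‖ ≤ C' * X ^ (5 - δ) := by
  have hB := betaHalf_pos
  refine ⟨max C ‖L‖ / betaHalf, by positivity, fun X hX N hN => ?_⟩
  have key : ∀ Y : ℝ, 0 < Y → Y ≤ X → ‖(∑ c ∈ range (N + 1), a c * (((Y - (c : ℝ) ^ 2) ^ 3 * √(Y - (c : ℝ) ^ 2) : ℝ) : ℂ)) - L * (Y ^ 3 * √Y : ℝ)‖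
      ≤ max C ‖L‖ * Y ^ (7 / 2 - δ) := fun Y hY hYX => by
    have hpow : Y ^ 3 * √Y = Y ^ (7 / 2 : ℝ) := by
      rw [sqrt_eq_rpow, ← rpow_natCast, ← rpow_add hY]; norm_num
    have e : ∀ k : ℝ, (Y - k) ^ 3 * √(Y - k) = (Y ^ 3 * √Y) * ((1 - k / Y) ^ 3 * √(1 - k / Y)) := fun k => by
      rw [show Y - k = Y * (1 - k / Y) by field_simp, sqrt_mul hY.le]; ring
    rcases le_or_gt 1 Y with h1 | h1
    · have := h Y h1 N fun c hc => hYX.trans_lt (hN c hc)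
      simp only [e]
      rw [show ∀ A : ℂ, A - L * ((Y ^ 3 * √Y : ℝ) : ℂ) = ((Y ^ 3 * √Y : ℝ) : ℂ) * (A / ((Y ^ 3 * √Y : ℝ) : ℂ) - L) from fun A => by
        have : ((Y ^ 3 * √Y : ℝ) : ℂ) ≠ 0 := by exact_mod_cast (by positivity : Y ^ 3 * √Y ≠ 0)
        field_simp, Finset.sum_div, norm_mul, norm_real, norm_of_nonneg (by positivity), hpow,
        show 7 / 2 - δ = 7 / 2 + -δ by ring, rpow_add hY, mul_left_comm]
      refine mul_le_mul_of_nonneg_left (le_trans (le_of_eq ?_) (this.trans (mul_le_mul_of_nonneg_right (le_max_left _ _) (by positivity)))) (by positivity)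
      congr 2
      refine sum_congr rfl fun c _ => ?_
      have : ((Y ^ (7 / 2 : ℝ) : ℝ) : ℂ) ≠ 0 := by exact_mod_cast (by positivity : Y ^ (7 / 2 : ℝ) ≠ 0)
      rw [ofReal_mul]; field_simp
    · rw [Finset.sum_eq_zero fun c _ => ?_, zero_sub, norm_neg, norm_mul, norm_real, norm_of_nonneg (by positivity), hpow]
      · bound
      · rcases Nat.eq_zero_or_pos c with rfl | hc
        · rw [ha, zero_mul]
        · have : (1 : ℝ) ≤ (c : ℝ) ^ 2 := one_le_pow₀ (by exact_mod_cast hc)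
          rw [sqrt_eq_zero_of_nonpos (by linarith)]; simp
  have hI : ((betaHalf : ℝ) : ℂ) * ((∑ c ∈ range (N + 1), a c * ((max (X - (c : ℝ) ^ 2) 0 ^ 5 : ℝ) : ℂ)) - L * (X ^ 5 : ℝ)) =
      ∫ Y in (0 : ℝ)..X, ((∑ c ∈ range (N + 1), a c * (((Y - (c : ℝ) ^ 2) ^ 3 * √(Y - (c : ℝ) ^ 2) : ℝ) : ℂ)) - L * (Y ^ 3 * √Y : ℝ)) * (√(X - Y) : ℝ) := by
    have e : ∀ Y : ℝ, ((∑ c ∈ range (N + 1), a c * (((Y - (c : ℝ) ^ 2) ^ 3 * √(Y - (c : ℝ) ^ 2) : ℝ) : ℂ)) - L * (Y ^ 3 * √Y : ℝ)) * (√(X - Y) : ℝ) =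
        (∑ c ∈ range (N + 1), a c * (((Y - (c : ℝ) ^ 2) ^ 3 * √(Y - (c : ℝ) ^ 2) * √(X - Y) : ℝ) : ℂ)) - L * (Y ^ 3 * √Y * √(X - Y) : ℝ) := fun Y => by
      rw [sub_mul, sum_mul, mul_assoc, ← ofReal_mul]
      simp only [mul_assoc, ← ofReal_mul]
    have hc : ∀ k : ℝ, Continuous fun Y : ℝ => (((Y - k) ^ 3 * √(Y - k) * √(X - Y) : ℝ) : ℂ) := fun k => continuous_ofReal.comp (by fun_prop)
    have hc0 : Continuous fun Y : ℝ => ((Y ^ 3 * √Y * √(X - Y) : ℝ) : ℂ) := continuous_ofReal.comp (by fun_prop)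
    have i1 : ∀ c : ℕ, IntervalIntegrable (fun Y : ℝ => a c * (((Y - (c : ℝ) ^ 2) ^ 3 * √(Y - (c : ℝ) ^ 2) * √(X - Y) : ℝ) : ℂ)) volume 0 X :=
      fun c => (continuous_const.mul (hc _)).intervalIntegrable 0 X
    have i2 : IntervalIntegrable (fun Y : ℝ => L * ((Y ^ 3 * √Y * √(X - Y) : ℝ) : ℂ)) volume 0 X := (continuous_const.mul hc0).intervalIntegrable 0 X
    have i3 : IntervalIntegrable (fun Y : ℝ => ∑ c ∈ range (N + 1), a c * (((Y - (c : ℝ) ^ 2) ^ 3 * √(Y - (c : ℝ) ^ 2) * √(X - Y) : ℝ) : ℂ)) volume 0 X :=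
      (continuous_finsetSum _ fun c _ => continuous_const.mul (hc _)).intervalIntegrable 0 X
    simp only [e]
    rw [intervalIntegral.integral_sub i3 i2, intervalIntegral.integral_finsetSum fun c _ => i1 c, intervalIntegral.integral_const_mul,
      intervalIntegral.integral_ofReal, integral_riesz_zero hX.le, mul_sub, mul_sum]
    congr 1
    · refine sum_congr rfl fun c _ => ?_
      rw [intervalIntegral.integral_const_mul, intervalIntegral.integral_ofReal, integral_riesz hX.le (sq_nonneg _)]
      push_cast; ring
    · push_cast; ring
  have hb : ‖∫ Y in (0 : ℝ)..X, ((∑ c ∈ range (N + 1), a c * (((Y - (c : ℝ) ^ 2) ^ 3 * √(Y - (c : ℝ) ^ 2) : ℝ) : ℂ)) - L * (Y ^ 3 * √Y : ℝ)) * (√(X - Y) : ℝ)‖ ≤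
      (max C ‖L‖ * X ^ (7 / 2 - δ) * √X) * |X - 0| := by
    refine intervalIntegral.norm_integral_le_of_norm_le_const fun Y hY => ?_
    rw [Set.uIoc_of_le hX.le] at hY
    rw [norm_mul, norm_real, norm_of_nonneg (sqrt_nonneg _)]
    refine mul_le_mul ((key Y hY.1 hY.2).trans (mul_le_mul_of_nonneg_left (rpow_le_rpow hY.1.le hY.2 (by linarith)) (by positivity)))
      (sqrt_le_sqrt (by linarith [hY.1])) (sqrt_nonneg _) (by positivity)
  rw [← hI, norm_mul, norm_real, norm_of_nonneg hB.le, sub_zero, abs_of_pos hX] at hb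
  rw [div_mul_eq_mul_div, le_div_iff₀ hB, mul_comm _ betaHalf]
  refine hb.trans (le_of_eq ?_)
  rw [sqrt_eq_rpow, mul_assoc, mul_assoc, ← rpow_add_one hX.ne', ← rpow_add hX]
  ring

/-- The fifth forward difference with step `h` of `Y ↦ max (Y - k) 0 ^ 5` at `X`. -/
def diffFive (X h k : ℝ) : ℝ :=
  max (X + 5 * h - k) 0 ^ 5 - 5 * max (X + 4 * h - k) 0 ^ 5 + 10 * max (X + 3 * h - k) 0 ^ 5 - 10 * max (X + 2 * h - k) 0 ^ 5 +
    5 * max (X + h - k) 0 ^ 5 - max (X - k) 0 ^ 5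

theorem diffFive_of_le {X h k : ℝ} (hh : 0 ≤ h) (hk : k ≤ X) : diffFive X h k = 120 * h ^ 5 := by
  rw [diffFive, max_eq_left (by linarith), max_eq_left (by linarith), max_eq_left (by linarith), max_eq_left (by linarith), max_eq_left (by linarith), max_eq_left (by linarith)]
  ring

theorem diffFive_of_ge {X h k : ℝ} (hh : 0 ≤ h) (hk : X + 5 * h ≤ k) : diffFive X h k = 0 := by
  rw [diffFive, max_eq_right (by linarith), max_eq_right (by linarith), max_eq_right (by linarith), max_eq_right (by linarith), max_eq_right (by linarith), max_eq_right (by linarith)]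
  ring

theorem abs_diffFive_le {X h k : ℝ} (hh : 0 ≤ h) (hk : X ≤ k) : |diffFive X h k| ≤ 32 * (5 * h) ^ 5 := by
  have e : ∀ t, t ≤ X + 5 * h → 0 ≤ max (t - k) 0 ^ 5 ∧ max (t - k) 0 ^ 5 ≤ (5 * h) ^ 5 := fun t ht =>
    ⟨by positivity, pow_le_pow_left₀ (le_max_right _ _) (max_le (by linarith) (by linarith)) 5⟩
  have h0 := e X (by linarith)
  have h1 := e (X + h) (by linarith)
  have h2 := e (X + 2 * h) (by linarith)
  have h3 := e (X + 3 * h) (by linarith)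
  have h4 := e (X + 4 * h) (by linarith)
  have h5 := e (X + 5 * h) (by linarith)
  rw [diffFive, abs_le]
  grind

theorem norm_sum_sub_le {a : ℕ → ℂ} {L : ℂ} {δ C C' ε : ℝ} (hδ : δ ≤ 1) (hC : 0 ≤ C) (hC' : 0 ≤ C') (hε : ε ≤ 1)
    (hF : ∀ X : ℝ, 0 < X → ∀ N : ℕ, (∀ c : ℕ, N < c → X < (c : ℝ) ^ 2) →
      ‖(∑ c ∈ range (N + 1), a c * ((max (X - (c : ℝ) ^ 2) 0 ^ 5 : ℝ) : ℂ)) - L * (X ^ 5 : ℝ)‖ ≤ C * X ^ (5 - δ))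
    (ha : ∀ c : ℕ, 1 ≤ c → ‖a c‖ ≤ C' * (c : ℝ) ^ (-1 + ε)) {M : ℕ} (hM : 1 ≤ M) {h : ℝ} (hh : 0 < h) (hhM : h ≤ (M : ℝ) ^ 2) :
    ‖(∑ c ∈ range (M + 1), a c) - L‖ ≤ C * (6 * (M : ℝ) ^ 2) ^ (5 - δ) / h ^ 5 + 5000 * C' * ((M : ℝ) ^ (-1 + ε) * (h / M)) := by
  have hM' : (0 : ℝ) < M := by exact_mod_cast hM
  have hM1 : (1 : ℝ) ≤ M := by exact_mod_cast hM
  set X : ℝ := (M : ℝ) ^ 2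
  have hX : 0 < X := by positivity
  set N : ℕ := 6 * M ^ 2
  have hMN : M ≤ N := by simp only [N]; nlinarith
  have hN : ∀ c : ℕ, N < c → 6 * X < (c : ℝ) ^ 2 := fun c hc => by
    have h1 : (6 * M ^ 2 : ℝ) < c := by exact_mod_cast hc
    nlinarith [one_le_pow₀ (n := 2) hM1]
  set P : ℝ → ℂ := fun Y => (∑ c ∈ range (N + 1), a c * ((max (Y - (c : ℝ) ^ 2) 0 ^ 5 : ℝ) : ℂ)) - L * (Y ^ 5 : ℝ)
  have hP : ∀ Y, 0 < Y → Y ≤ X + 5 * h → ‖P Y‖ ≤ C * (6 * X) ^ (5 - δ) := fun Y hY hYX =>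
    (hF Y hY N fun c hc => by linarith [hN c hc]).trans (mul_le_mul_of_nonneg_left (rpow_le_rpow hY.le (by linarith) (by linarith)) hC)
  have e1 : P (X + 5 * h) - 5 * P (X + 4 * h) + 10 * P (X + 3 * h) - 10 * P (X + 2 * h) + 5 * P (X + h) - P X =
      (∑ c ∈ range (N + 1), a c * (diffFive X h ((c : ℝ) ^ 2) : ℂ)) - 120 * (h : ℂ) ^ 5 * L := by
    have : ∀ c, a c * (diffFive X h ((c : ℝ) ^ 2) : ℂ) = a c * ((max (X + 5 * h - (c : ℝ) ^ 2) 0 ^ 5 : ℝ) : ℂ) - 5 * (a c * ((max (X + 4 * h - (c : ℝ) ^ 2) 0 ^ 5 : ℝ) : ℂ)) +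
        10 * (a c * ((max (X + 3 * h - (c : ℝ) ^ 2) 0 ^ 5 : ℝ) : ℂ)) - 10 * (a c * ((max (X + 2 * h - (c : ℝ) ^ 2) 0 ^ 5 : ℝ) : ℂ)) +
        5 * (a c * ((max (X + h - (c : ℝ) ^ 2) 0 ^ 5 : ℝ) : ℂ)) - a c * ((max (X - (c : ℝ) ^ 2) 0 ^ 5 : ℝ) : ℂ) := fun c => by
      simp only [diffFive, ofReal_sub, ofReal_add, ofReal_mul]
      push_cast; ring
    simp only [this, sum_sub_distrib, sum_add_distrib, ← mul_sum, P]
    push_cast; ring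
  have e2 : ∑ c ∈ range (N + 1), a c * (diffFive X h ((c : ℝ) ^ 2) : ℂ) =
      120 * (h : ℂ) ^ 5 * (∑ c ∈ range (M + 1), a c) + ∑ c ∈ Finset.Ico (M + 1) (N + 1), a c * (diffFive X h ((c : ℝ) ^ 2) : ℂ) := by
    rw [← Finset.sum_range_add_sum_Ico _ (by lia : M + 1 ≤ N + 1), mul_sum]
    congr 1
    refine sum_congr rfl fun c hc => ?_
    have : (c : ℝ) ≤ M := by exact_mod_cast Nat.lt_succ_iff.mp (mem_range.mp hc)
    rw [diffFive_of_le hh.le (pow_le_pow_left₀ (Nat.cast_nonneg c) this 2)]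
    push_cast; ring
  have e3 : ‖∑ c ∈ Finset.Ico (M + 1) (N + 1), a c * (diffFive X h ((c : ℝ) ^ 2) : ℂ)‖ ≤ 5 * (h / M) * (C' * (M : ℝ) ^ (-1 + ε) * (32 * (5 * h) ^ 5)) := by
    have hsub : Finset.Ioc M ⌊M + 5 * (h / M)⌋₊ ∩ Finset.Ico (M + 1) (N + 1) ⊆ Finset.Ico (M + 1) (N + 1) := Finset.inter_subset_right
    rw [← Finset.sum_subset hsub fun c hc hc' => ?_]
    · refine (norm_sum_le _ _).trans ?_
      refine (Finset.sum_le_card_nsmul _ _ (C' * (M : ℝ) ^ (-1 + ε) * (32 * (5 * h) ^ 5)) fun c hc => ?_).trans ?_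
      · have hcM := (Finset.mem_Ioc.mp (Finset.mem_inter.mp hc).1).1
        have hcM' : (M : ℝ) ≤ c := by exact_mod_cast hcM.le
        rw [norm_mul, norm_real, norm_eq_abs]
        refine mul_le_mul ((ha c (by lia)).trans (mul_le_mul_of_nonneg_left ?_ hC')) (abs_diffFive_le hh.le (pow_le_pow_left₀ hM'.le hcM' 2)) (abs_nonneg _) (by positivity)
        exact rpow_le_rpow_of_nonpos hM' hcM' (by linarith)
      · rw [nsmul_eq_mul]
        refine mul_le_mul_of_nonneg_right ?_ (by positivity)
        have h1 : ((Finset.Ioc M ⌊M + 5 * (h / M)⌋₊ ∩ Finset.Ico (M + 1) (N + 1)).card : ℝ) ≤ ((⌊M + 5 * (h / M)⌋₊ - M : ℕ) : ℝ) := by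
          rw [← Nat.card_Ioc]
          exact_mod_cast Finset.card_le_card Finset.inter_subset_left
        have h2 : M ≤ ⌊M + 5 * (h / M)⌋₊ := Nat.le_floor (by bound)
        have h3 := Nat.floor_le (by positivity : 0 ≤ M + 5 * (h / M))
        rw [Nat.cast_sub h2] at h1
        linarith
    · have h1 : ¬ c ≤ ⌊M + 5 * (h / M)⌋₊ := fun hle => hc' (Finset.mem_inter.mpr ⟨Finset.mem_Ioc.mpr ⟨by grind, hle⟩, hc⟩)
      have h2 := Nat.lt_of_floor_lt (not_le.mp h1)
      have h3 : X + 5 * h ≤ (c : ℝ) ^ 2 := by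
        have h4 : (0 : ℝ) ≤ h / M := by positivity
        have h5 : M * (h / M) = h := by field_simp
        nlinarith
      rw [diffFive_of_ge hh.le h3]; simp
  have e4 : ‖P (X + 5 * h) - 5 * P (X + 4 * h) + 10 * P (X + 3 * h) - 10 * P (X + 2 * h) + 5 * P (X + h) - P X‖ ≤ 32 * (C * (6 * X) ^ (5 - δ)) := by
    have h0 := hP X hX (by linarith)
    have h1 := hP (X + h) (by linarith) (by linarith)
    have h2 := hP (X + 2 * h) (by linarith) (by linarith)
    have h3 := hP (X + 3 * h) (by linarith) (by linarith)
    have h4 := hP (X + 4 * h) (by linarith) (by linarith)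
    have h5 := hP (X + 5 * h) (by linarith) (by linarith)
    refine (norm_sub_le _ _).trans ((add_le_add_left ((norm_add_le _ _).trans (add_le_add_left ((norm_sub_le _ _).trans
      (add_le_add_left ((norm_add_le _ _).trans (add_le_add_left (norm_sub_le _ _) _)) _)) _)) _).trans ?_)
    simp; linarith
  rw [e1, e2, show ∀ u v : ℂ, 120 * (h : ℂ) ^ 5 * u + v - 120 * (h : ℂ) ^ 5 * L = 120 * (h : ℂ) ^ 5 * (u - L) + v from fun u v => by ring] at e4
  have e6 := (norm_sub_le _ _).trans (add_le_add e4 e3)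
  rw [add_sub_cancel_right, norm_mul, norm_mul, norm_pow, norm_real, norm_of_nonneg hh.le] at e6
  rw [← mul_le_mul_iff_right₀ (by positivity : 0 < 120 * h ^ 5)]
  have h7 : ‖(120 : ℂ)‖ = 120 := by simp
  rw [h7] at e6
  refine e6.trans ?_
  have h8 : 0 ≤ C * (6 * X) ^ (5 - δ) := by positivity
  have h9 : 120 * h ^ 5 * (C * (6 * X) ^ (5 - δ) / h ^ 5 + 5000 * C' * ((M : ℝ) ^ (-1 + ε) * (h / M))) =
      120 * (C * (6 * X) ^ (5 - δ)) + 600000 * (h ^ 5 * (C' * ((M : ℝ) ^ (-1 + ε) * (h / M)))) := by field_simp; ring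
  rw [h9]
  have h10 : 0 ≤ h ^ 5 * (C' * ((M : ℝ) ^ (-1 + ε) * (h / M))) := by positivity
  nlinarith

theorem tendsto_of_riesz {a : ℕ → ℂ} (ha0 : a 0 = 0) {L : ℂ} {δ C : ℝ} (hδ : δ ≤ 1) (hδ0 : 0 < δ)
    (h : ∀ X : ℝ, 1 ≤ X → ∀ N : ℕ, (∀ c : ℕ, N < c → X < (c : ℝ) ^ 2) →
      ‖(∑ c ∈ range (N + 1), a c * (((1 - (c : ℝ) ^ 2 / X) ^ 3 * √(1 - (c : ℝ) ^ 2 / X) : ℝ) : ℂ)) - L‖ ≤ C * X ^ (-δ))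
    (ha : ∀ ε : ℝ, 0 < ε → ∃ C' : ℝ, 0 ≤ C' ∧ ∀ c : ℕ, 1 ≤ c → ‖a c‖ ≤ C' * (c : ℝ) ^ (-1 + ε)) :
    Tendsto (fun N : ℕ => ∑ c ∈ range (N + 1), a c) atTop (nhds L) := by
  obtain ⟨K, hK, hF⟩ := exists_riesz_five ha0 hδ hδ0 h
  obtain ⟨C', hC', hb⟩ := ha (δ / 10) (by positivity)
  rw [tendsto_iff_norm_sub_tendsto_zero]
  have hlim : Tendsto (fun M : ℕ => (K * 6 ^ (5 - δ)) * (M : ℝ) ^ (-δ) + 5000 * C' * (M : ℝ) ^ (-(δ / 10))) atTop (nhds 0) := by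
    have h1 := ((tendsto_rpow_neg_atTop hδ0).comp tendsto_natCast_atTop_atTop).const_mul (K * 6 ^ (5 - δ))
    have h2 := ((tendsto_rpow_neg_atTop (by positivity : 0 < δ / 10)).comp tendsto_natCast_atTop_atTop).const_mul (5000 * C')
    simpa using h1.add h2
  refine squeeze_zero' (Eventually.of_forall fun _ => norm_nonneg _) ?_ hlim
  filter_upwards [eventually_ge_atTop 1] with M hM
  have hM' : (0 : ℝ) < M := by exact_mod_cast hM
  have hM1 : (1 : ℝ) ≤ M := by exact_mod_cast hM
  refine (norm_sum_sub_le hδ hK hC' (by linarith : δ / 10 ≤ 1) hF hb hM (h := (M : ℝ) ^ (2 - δ / 5)) (by positivity) ?_).trans (le_of_eq ?_)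
  · rw [← rpow_natCast]
    bound
  · have p1 : (6 * (M : ℝ) ^ 2) ^ (5 - δ) / ((M : ℝ) ^ (2 - δ / 5)) ^ 5 = 6 ^ (5 - δ) * (M : ℝ) ^ (-δ) := by
      rw [mul_rpow (by norm_num) (by positivity), ← rpow_natCast, ← rpow_natCast, ← rpow_mul hM'.le, ← rpow_mul hM'.le,
        mul_div_assoc, ← rpow_sub hM']
      ring
    have p2 : (M : ℝ) ^ (-1 + δ / 10) * ((M : ℝ) ^ (2 - δ / 5) / M) = (M : ℝ) ^ (-(δ / 10)) := by
      rw [← rpow_sub_one hM'.ne', ← rpow_add hM']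
      congr 1; ring
    grind

theorem bcoef_zero (m n : ℕ) : bcoef m n 0 = 0 := by simp [bcoef]

theorem tendsto_sum_bcoef_mul_gInt (hm : 1 ≤ m) (hn : 1 ≤ n)
    (hb : ∀ ε : ℝ, 0 < ε → ∃ C : ℝ, 0 ≤ C ∧ ∀ c : ℕ, 1 ≤ c → ‖bcoef m n c‖ ≤ C * (c : ℝ) ^ (-1 + ε)) :
    Tendsto (fun N : ℕ => ∑ c ∈ range (N + 1), bcoef m n c * gInt n (m / (c : ℝ) ^ 2) 0) atTop
      (nhds (if m = n then -(2 * ee (3 / 8) * diagMass n) else 0)) := by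
  obtain ⟨A, hA, hm1⟩ := exists_norm_sum_gInt_le hm hn
  obtain ⟨G, hG, hg1, hg2⟩ := exists_gInt_sub_le hn
  obtain ⟨B, hB, hb1⟩ := hb (1 / 2) (by norm_num)
  set D : ℂ := if m = n then -(2 * ee (3 / 8) * diagMass n) else 0
  have h00 : gInt n 0 0 = 32 / 35 := by rw [gInt_zero hn le_rfl]; norm_num
  set g : ℕ → ℂ := fun c => bcoef m n c * (gInt n (m / (c : ℝ) ^ 2) 0 - gInt n 0 0)
  have hrp : ∀ c : ℕ, 1 ≤ c → (c : ℝ) ^ (-(1 / 2) : ℝ) * (m / (c : ℝ) ^ 2) = m * ((c : ℝ) ^ (-2 : ℝ) * (c : ℝ) ^ (-(1 / 2) : ℝ)) := fun c hc => by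
    simp; ring
  have hgb : ∀ c : ℕ, ‖g c‖ ≤ B * G * m * ((c : ℝ) ^ (-2 : ℝ) * (c : ℝ) ^ (-(1 / 2) : ℝ)) := fun c => by
    rcases Nat.eq_zero_or_pos c with rfl | hc
    · simp only [g, bcoef_zero, zero_mul, norm_zero]; positivity
    · rw [norm_mul]
      refine (mul_le_mul (hb1 c hc) (hg1 (m / (c : ℝ) ^ 2) (by positivity)) (norm_nonneg _) (by positivity)).trans (le_of_eq ?_)
      grind
  have hs2 : Summable fun c : ℕ => (c : ℝ) ^ (-2 : ℝ) := summable_nat_rpow.mpr (by norm_num)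
  have hle1 : ∀ c : ℕ, (c : ℝ) ^ (-2 : ℝ) * (c : ℝ) ^ (-(1 / 2) : ℝ) ≤ (c : ℝ) ^ (-2 : ℝ) := fun c => by
    rcases Nat.eq_zero_or_pos c with rfl | hc
    · simp
    · exact mul_le_of_le_one_right (by positivity) (rpow_le_one_of_one_le_of_nonpos (by exact_mod_cast hc) (by norm_num))
  have hgs : Summable g := Summable.of_norm_bounded (hs2.mul_left (B * G * m)) fun c => (hgb c).trans (mul_le_mul_of_nonneg_left (hle1 c) (by positivity))
  set S2 : ℝ := ∑' c : ℕ, (c : ℝ) ^ (-2 : ℝ)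
  set L : ℂ := (D - ∑' c, g c) * (35 / 32)
  have hR := tendsto_of_riesz (bcoef_zero m n) (L := L) (δ := 1 / 5000) (C := 35 / 32 * (A + 2 * (B * G * m * S2))) (by norm_num) (by norm_num)
    (fun X hX N hN => ?_) hb
  · have h1 := (hR.mul_const (32 / 35)).add (hgs.hasSum.tendsto_sum_nat.comp (tendsto_add_atTop_nat 1))
    rw [show L * (32 / 35) + ∑' c, g c = D by simp only [L]; ring] at h1
    refine h1.congr fun N => ?_
    simp only [Function.comp]
    rw [sum_mul, ← sum_add_distrib]
    refine sum_congr rfl fun c _ => ?_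
    grind
  · have hX0 : 0 < X := by linarith
    have hXp : X ^ (-(1 / 4) : ℝ) ≤ X ^ (-(1 / 5000) : ℝ) := rpow_le_rpow_of_exponent_le hX (by norm_num)
    set w : ℕ → ℝ := fun c => (1 - (c : ℝ) ^ 2 / X) ^ 3 * √(1 - (c : ℝ) ^ 2 / X)
    have e1 : ∀ c : ℕ, bcoef m n c * (w c : ℂ) * (32 / 35) = bcoef m n c * gInt n (m / (c : ℝ) ^ 2) ((c : ℝ) ^ 2 / X) - g c -
        bcoef m n c * ((gInt n (m / (c : ℝ) ^ 2) ((c : ℝ) ^ 2 / X) - gInt n 0 ((c : ℝ) ^ 2 / X)) - (gInt n (m / (c : ℝ) ^ 2) 0 - gInt n 0 0)) := fun c => by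
      have : gInt n 0 ((c : ℝ) ^ 2 / X) = 32 / 35 * (w c : ℂ) := by
        rw [gInt_zero hn (by positivity)]
        change ((32 / 35 * w c : ℝ) : ℂ) = _
        simp
      grind
    have e2 : ‖∑ c ∈ range (N + 1), bcoef m n c * ((gInt n (m / (c : ℝ) ^ 2) ((c : ℝ) ^ 2 / X) - gInt n 0 ((c : ℝ) ^ 2 / X)) - (gInt n (m / (c : ℝ) ^ 2) 0 - gInt n 0 0))‖
        ≤ B * G * m * S2 * X ^ (-(1 / 4) : ℝ) := by
      refine (norm_sum_le _ _).trans ((sum_le_sum (g := fun c : ℕ => B * G * m * (c : ℝ) ^ (-2 : ℝ) * X ^ (-(1 / 4) : ℝ)) fun c _ => ?_).trans ?_)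
      · rcases Nat.eq_zero_or_pos c with rfl | hc
        · simp
        · have hc' : (0 : ℝ) < c := by exact_mod_cast hc
          rw [norm_mul]
          refine (mul_le_mul (hb1 c hc) (hg2 (m / (c : ℝ) ^ 2) ((c : ℝ) ^ 2 / X) (by positivity) (by positivity)) (norm_nonneg _) (by positivity)).trans (le_of_eq ?_)
          have h1 : ((c : ℝ) ^ 2 / X) ^ (1 / 4 : ℝ) = (c : ℝ) ^ (1 / 2 : ℝ) * X ^ (-(1 / 4) : ℝ) := by
            rw [div_rpow (by positivity) hX0.le, ← rpow_natCast, ← rpow_mul hc'.le, rpow_neg hX0.le, div_eq_mul_inv]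
            norm_num
          have h2 : (c : ℝ) ^ (-(1 / 2) : ℝ) * (c : ℝ) ^ (1 / 2 : ℝ) = 1 := by rw [← rpow_add hc']; norm_num
          grind
      · rw [← sum_mul, ← mul_sum]
        exact mul_le_mul_of_nonneg_right (mul_le_mul_of_nonneg_left (hs2.sum_le_tsum _ fun _ _ => by positivity) (by positivity)) (by positivity)
    have e3 : ‖∑' c, g c - ∑ c ∈ range (N + 1), g c‖ ≤ B * G * m * S2 * X ^ (-(1 / 4) : ℝ) := by
      rw [← hgs.sum_add_tsum_nat_add (N + 1), add_sub_cancel_left]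
      have hs3 := (((summable_nat_add_iff (N + 1)).mpr hs2).mul_left (B * G * m)).mul_right (X ^ (-(1 / 4) : ℝ))
      refine (tsum_of_norm_bounded hs3.hasSum fun j => ?_).trans ?_
      · refine (hgb _).trans ?_
        rw [mul_assoc _ (_ ^ _) (X ^ _)]
        refine mul_le_mul_of_nonneg_left (mul_le_mul_of_nonneg_left ?_ (by positivity)) (by positivity)
        have h1 := hN (j + (N + 1)) (by lia)
        have h2 := rpow_le_rpow_of_nonpos hX0 h1.le (by norm_num : -(1 / 4) ≤ (0 : ℝ))
        rw [← rpow_natCast, ← rpow_mul (by positivity)] at h2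
        linarith
      · rw [tsum_mul_right, tsum_mul_left]
        have h1 := hs2.sum_add_tsum_nat_add (N + 1)
        have h2 : 0 ≤ ∑ c ∈ range (N + 1), (c : ℝ) ^ (-2 : ℝ) := sum_nonneg fun _ _ => by positivity
        bound
    have e4 := hm1 X hX N hN
    have e5 : (∑ c ∈ range (N + 1), bcoef m n c * (w c : ℂ)) - L = 35 / 32 * (((∑ c ∈ range (N + 1), bcoef m n c * gInt n (m / (c : ℝ) ^ 2) ((c : ℝ) ^ 2 / X)) - D) +
        (∑' c, g c - ∑ c ∈ range (N + 1), g c) -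
        ∑ c ∈ range (N + 1), bcoef m n c * ((gInt n (m / (c : ℝ) ^ 2) ((c : ℝ) ^ 2 / X) - gInt n 0 ((c : ℝ) ^ 2 / X)) - (gInt n (m / (c : ℝ) ^ 2) 0 - gInt n 0 0))) := by
      have := sum_congr (rfl : range (N + 1) = _) fun c _ => e1 c
      rw [← sum_mul, sum_sub_distrib, sum_sub_distrib] at this
      grind
    rw [e5, norm_mul, show ‖(35 / 32 : ℂ)‖ = 35 / 32 by norm_num, mul_assoc]
    refine mul_le_mul_of_nonneg_left ((norm_sub_le _ _).trans ((add_le_add ((norm_add_le _ _).trans (add_le_add e4 e3)) e2).trans ?_)) (by norm_num)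
    have : 0 ≤ B * G * m * S2 := by positivity
    nlinarith

theorem tendsto_sum_of_bound (hm : 1 ≤ m) (hn : 1 ≤ n)
    (hb : ∀ ε : ℝ, 0 < ε → ∃ C : ℝ, 0 ≤ C ∧ ∀ c : ℕ, 1 ≤ c → ‖bcoef m n c‖ ≤ C * (c : ℝ) ^ (-1 + ε)) :
    Tendsto (fun N : ℕ => ∑ c ∈ range (N + 1), if Even c ∧ 0 < c then
        SKe m n c 3 / ((√(c : ℝ) : ℝ) : ℂ) * ((Real.sin (2 * π * √((m : ℝ) * n) / c) : ℝ) : ℂ) else 0) atTop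
      (nhds (if m = n then ee (-(1 : ℂ) / 8) * ((√(m : ℝ) : ℝ) : ℂ) else 0)) := by
  have hM := diagMass_pos hn
  have h1 : ((diagMass n : ℝ) : ℂ) ≠ 0 := by exact_mod_cast hM.ne'
  have h2 : ((√(m : ℝ) : ℝ) : ℂ) ≠ 0 := by simp; linarith
  have h := (tendsto_sum_bcoef_mul_gInt hm hn hb).mul_const (((√(m : ℝ) : ℝ) : ℂ) / (2 * diagMass n))
  convert h using 2
  · rw [sum_mul]
    refine sum_congr rfl fun c _ => ?_
    rw [bcoef]
    split_ifs with hc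
    · have hc' : (0 : ℝ) < c := by exact_mod_cast hc.2
      have hs : ((√(c : ℝ) : ℝ) : ℂ) ≠ 0 := by simp; linarith
      have hcC : ((c : ℝ) : ℂ) ≠ 0 := by exact_mod_cast hc'.ne'
      have h3 : √(m / (c : ℝ) ^ 2 * n) = √((m : ℝ) * n) / c := by simp; ring
      have h4 : (((c : ℝ) ^ (-(3 / 2) : ℝ) : ℝ) : ℂ) = 1 / (((c : ℝ) : ℂ) * (√(c : ℝ) : ℝ)) := by
        rw [rpow_neg hc'.le, show (3 / 2 : ℝ) = 1 + 1 / 2 by norm_num, rpow_add hc', rpow_one, ← sqrt_eq_rpow]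
        push_cast; rw [one_div]
      rw [gInt_cutoff_zero hn (by positivity), h3, sqrt_div (by positivity), sqrt_sq hc'.le, h4, mul_div_assoc (2 * π)]
      generalize Real.sin (2 * π * (√((m : ℝ) * n) / c)) = s
      simp only [ofReal_mul, ofReal_div, ofReal_ofNat]
      field_simp
    · simp
  · split_ifs with hmn
    · have h5 : ee (3 / 8) = -ee (-1 / 8) := by
        rw [show (3 / 8 : ℂ) = 1 / 2 + -1 / 8 by norm_num, ee_add, show ee (1 / 2) = -1 by
          rw [ee, show (2 * π * I * (1 / 2) : ℂ) = π * I by ring, exp_pi_mul_I], neg_one_mul]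
      rw [h5]; field_simp
    · simp

theorem tendsto_cosKernel (a : UnitAddCircle) : Tendsto (HurwitzZeta.cosKernel a) atTop (nhds 1) := by
  obtain ⟨p, hp, h⟩ := HurwitzZeta.isBigO_atTop_cosKernel_sub a
  have h1 : Tendsto (fun x : ℝ => Real.exp (-p * x)) atTop (nhds 0) :=
    tendsto_exp_atBot.comp (tendsto_id.const_mul_atTop_of_neg (neg_neg_of_pos hp))
  simpa using (h.trans_tendsto h1).add_const 1

theorem jacobiTheta_rational {C : ℕ} (hC : 0 < C) (a : ℤ) {T : ℝ} (hT : 0 < T) :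
    jacobiTheta (a / C + ((1 / (C ^ 2 * T) : ℝ) : ℂ) * I) =
      ∑ r : Fin (2 * C), ee (a * (r : ℕ) ^ 2 / (2 * C)) * (((T / 4) ^ (1 / 2 : ℝ) * HurwitzZeta.cosKernel (((r : ℕ) / (2 * C : ℝ) : ℝ) : UnitAddCircle) (T / 4) : ℝ) : ℂ) := by
  have hCC : (C : ℂ) ≠ 0 := by exact_mod_cast hC.ne'
  have : NeZero (2 * C) := ⟨by lia⟩
  set τ : ℂ := a / C + ((1 / (C ^ 2 * T) : ℝ) : ℂ) * I
  have him : 0 < τ.im := by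
    have h1 : ((a : ℂ) / C).im = 0 := by simp
    simp only [τ, add_im, h1, im_ofReal_mul, Complex.I_im]
    positivity
  have h0 : HasSum (fun k : ℤ => cexp (π * I * k ^ 2 * τ)) (jacobiTheta τ) := by
    have := hasSum_jacobiTheta₂_term 0 him
    rw [← jacobiTheta_eq_jacobiTheta₂] at this
    simpa only [jacobiTheta₂_term, mul_zero, zero_add] using this
  have h1 : ∀ r : Fin (2 * C), HasSum (fun l : ℤ => cexp (π * I * ((l * ((2 * C : ℕ) : ℤ) + (r : ℕ) : ℤ) : ℂ) ^ 2 * τ))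
      (ee (a * (r : ℕ) ^ 2 / (2 * C)) * (((T / 4) ^ (1 / 2 : ℝ) * HurwitzZeta.cosKernel (((r : ℕ) / (2 * C : ℝ) : ℝ) : UnitAddCircle) (T / 4) : ℝ) : ℂ)) := fun r => by
    have e := HurwitzZeta.evenKernel_functional_equation (((r : ℕ) / (2 * C : ℝ) : ℝ) : UnitAddCircle) (4 / T)
    rw [one_div_div, one_div, ← inv_rpow (by positivity), inv_div] at e
    have h2 := (hasSum_ofReal.mpr (HurwitzZeta.hasSum_int_evenKernel ((r : ℕ) / (2 * C : ℝ)) (by positivity : 0 < 4 / T))).mul_left (ee (a * (r : ℕ) ^ 2 / (2 * C)))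
    rw [e] at h2
    refine h2.congr_fun fun l => ?_
    have e2 : cexp (π * I * ((l * ((2 * C : ℕ) : ℤ) + (r : ℕ) : ℤ) : ℂ) ^ 2 * τ) =
        ee ((2 * C * a * l ^ 2 + 2 * a * l * (r : ℕ) : ℤ)) * ee (a * (r : ℕ) ^ 2 / (2 * C)) * cexp ((-π * (l + (r : ℕ) / (2 * C : ℝ)) ^ 2 * (4 / T) : ℝ)) := by
      rw [ee, ee, ← Complex.exp_add, ← Complex.exp_add]
      congr 1
      have hTC : (T : ℂ) ≠ 0 := by exact_mod_cast hT.ne'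
      simp only [τ]
      push_cast
      field_simp
      linear_combination (4 * (2 * l * C + (r : ℕ)) ^ 2 : ℂ) * I_sq
    rw [e2, ee_int, one_mul, ofReal_exp]
  have h2 := (Int.divModEquiv (2 * C)).symm.hasSum_iff.mpr h0
  have h3 := (Equiv.prodComm (Fin (2 * C)) ℤ).hasSum_iff.mpr h2
  exact (h3.prod_fiberwise h1).unique (hasSum_fintype _)

theorem gauss_eq {C : ℕ} (hC : 0 < C) (hCe : Even C) {a d : ℕ} (had : (a * d) % (2 * C) = 1) :
    ∑ r : Fin (2 * C), ee (a * (r : ℕ) ^ 2 / (2 * C)) = ee (1 / 8) * (√(4 * C) : ℝ) * thetaMul C d := by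
  have hCC : (C : ℂ) ≠ 0 := by exact_mod_cast hC.ne'
  obtain ⟨k, hk⟩ : ∃ k, a * d = 1 + 2 * C * k := ⟨a * d / (2 * C), by rw [← had]; exact (Nat.mod_add_div _ _).symm⟩
  have hd : 0 < d := Nat.pos_of_ne_zero (by rintro rfl; simp at had)
  have hdet : (a : ℤ) * d - (2 * k : ℕ) * (C : ℕ) = 1 := by lia
  have him : ∀ T : ℝ, (-d / C + T * I : ℂ).im = T := fun T => by simp
  have h1 : ∀ T : ℝ, 0 < T → ∑ r : Fin (2 * C), ee (a * (r : ℕ) ^ 2 / (2 * C)) * (HurwitzZeta.cosKernel (((r : ℕ) / (2 * C : ℝ) : ℝ) : UnitAddCircle) (T / 4) : ℂ) =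
      ee (1 / 8) * (√(4 * C) : ℝ) * thetaMul C d * jacobiTheta (-d / C + T * I) := fun T hT => by
    have hTC : (T : ℂ) ≠ 0 := by exact_mod_cast hT.ne'
    have h2 := jacobiTheta_transform_pos ((C : ℤ).natAbs + d) a (2 * k : ℕ) C d (-d / C + T * I) (by rw [him]; exact hT) le_rfl hd
      (by simp) (by exact_mod_cast hCe) hdet
    have e1 : ((a : ℤ) * (-d / C + T * I) + ((2 * k : ℕ) : ℤ) : ℂ) / ((C : ℤ) * (-d / C + T * I) + d) = (a : ℤ) / C + ((1 / (C ^ 2 * T) : ℝ) : ℂ) * I := by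
      have h3 : ((C : ℤ) * (-d / C + T * I) + d : ℂ) = C * T * I := by push_cast; field_simp; ring
      have h4 : (a : ℂ) * d = 1 + 2 * C * k := by exact_mod_cast hk
      rw [h3]
      have := I_ne_zero
      push_cast
      field_simp
      linear_combination -h4 - I_sq
    have e2 : ((C : ℤ) * (-d / C + T * I) + d : ℂ) ^ (1 / 2 : ℂ) = ((C * T) ^ (1 / 2 : ℝ) : ℝ) * ee (1 / 8) := by
      have h3 : ((C : ℤ) * (-d / C + T * I) + d : ℂ) = ((C * T : ℝ) : ℂ) * I := by push_cast; field_simp; ring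
      have h5 := cpow_ofReal_mul (by positivity : 0 < C * T) I_ne_zero (1 / 2)
      rw [h3, show (1 / 2 : ℂ) = ((1 / 2 : ℝ) : ℂ) by norm_num, h5]
      congr 1
      rw [cpow_def_of_ne_zero I_ne_zero, log_I, ee]
      congr 1; push_cast; ring
    rw [e1, jacobiTheta_rational hC a hT, e2] at h2
    have h6 : (T / 4) ^ (1 / 2 : ℝ) * √(4 * C) = (C * T) ^ (1 / 2 : ℝ) := by
      rw [sqrt_eq_rpow, ← mul_rpow (by positivity) (by positivity)]; congr 1; ring
    have h7 : (((T / 4) ^ (1 / 2 : ℝ) : ℝ) : ℂ) ≠ 0 := by exact_mod_cast (by positivity : (T / 4) ^ (1 / 2 : ℝ) ≠ 0)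
    rw [← h6] at h2
    simp only [ofReal_mul, mul_left_comm _ (((T / 4) ^ (1 / 2 : ℝ) : ℝ) : ℂ), ← mul_sum] at h2
    refine mul_left_cancel₀ h7 (Eq.trans ?_ (h2.trans ?_))
    · rfl
    · ring
  have l1 : Tendsto (fun T : ℝ => ∑ r : Fin (2 * C), ee (a * (r : ℕ) ^ 2 / (2 * C)) * (HurwitzZeta.cosKernel (((r : ℕ) / (2 * C : ℝ) : ℝ) : UnitAddCircle) (T / 4) : ℂ)) atTop
      (nhds (∑ r : Fin (2 * C), ee (a * (r : ℕ) ^ 2 / (2 * C)) * ((1 : ℝ) : ℂ))) :=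
    tendsto_finsetSum _ fun r _ => (continuous_ofReal.continuousAt.tendsto.comp
      ((tendsto_cosKernel _).comp (tendsto_id.atTop_div_const (by norm_num)))).const_mul _
  have l2 : Tendsto (fun T : ℝ => jacobiTheta (-d / C + T * I)) atTop (nhds 1) := by
    have h2 : Tendsto (fun T : ℝ => (-d / C + T * I : ℂ)) atTop (comap Complex.im atTop) :=
      tendsto_comap_iff.mpr (tendsto_id.congr fun T => (him T).symm)
    have h3 : Tendsto (fun T : ℝ => Real.exp (-π * (-d / C + T * I : ℂ).im)) atTop (nhds 0) := by
      simp only [him]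
      exact tendsto_exp_atBot.comp (tendsto_id.const_mul_atTop_of_neg (neg_neg_of_pos pi_pos))
    simpa using ((isBigO_at_im_infty_jacobiTheta_sub_one.comp_tendsto h2).trans_tendsto h3).add_const 1
  have l3 := l2.const_mul (ee (1 / 8) * (√(4 * C) : ℝ) * thetaMul C d)
  simp only [ofReal_one, mul_one] at l1 l3
  exact tendsto_nhds_unique (l1.congr' ((eventually_gt_atTop 0).mono fun T hT => h1 T hT)) l3

theorem dvd_mul_sub_of_gcd_eq {M D g : ℕ} (hg : 0 < g) {y₀ y y' : ℤ} (h₀ : (g : ℤ) ∣ M * (y₀ ^ 2 - D)) (h : (g : ℤ) ∣ M * (y ^ 2 - D)) (h' : (g : ℤ) ∣ M * (y' ^ 2 - D))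
    (hgcd : Int.gcd g (y - y₀) = Int.gcd g (y' - y₀)) : (g : ℤ) ∣ 2 * M ^ 2 * D * (y - y') := by
  set k : ℤ := ((Int.gcd (g : ℤ) (y - y₀) : ℕ) : ℤ) with hk
  obtain ⟨l, hl⟩ : k ∣ (g : ℤ) := Int.gcd_dvd_left ..
  have hk0 : k ≠ 0 := by positivity
  have main : ∀ z : ℤ, (g : ℤ) ∣ M * (z ^ 2 - D) → k = ((Int.gcd (g : ℤ) (z - y₀) : ℕ) : ℤ) → k ∣ z - y₀ ∧ l ∣ M * (z + y₀) := fun z hz hkz => by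
    have h1 : k ∣ z - y₀ := by rw [hkz]; exact Int.gcd_dvd_right ..
    refine ⟨h1, ?_⟩
    obtain ⟨s, hs⟩ := h1
    have h2 : IsCoprime l s := by
      have h3 : Int.gcd (k * l) (k * s) = k.natAbs := by grind
      rw [Int.gcd_mul_left] at h3
      rw [Int.isCoprime_iff_gcd_eq_one]
      exact Nat.eq_of_mul_eq_mul_left (Int.natAbs_pos.mpr hk0) (by rw [h3, mul_one])
    have h3 : k * l ∣ k * (s * (M * (z + y₀))) := by
      have := dvd_sub hz h₀
      grind
    exact h2.dvd_of_dvd_mul_left (Int.dvd_of_mul_dvd_mul_left hk0 h3)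
  obtain ⟨a1, a2⟩ := main y h rfl
  obtain ⟨b1, b2⟩ := main y' h' (by rw [hk, hgcd])
  have c1 : k ∣ M * (y - y') := (by simpa using dvd_sub a1 b1 : k ∣ y - y').mul_left _
  have c2 : l ∣ M * (y - y') := by have := dvd_sub a2 b2; grind
  have c3 : (Int.gcd k l : ℤ) ∣ 2 * M * D := by
    have d1 := (Int.gcd_dvd_left k l).trans a1
    have d2 := (Int.gcd_dvd_right k l).trans a2
    have d3 := (Int.gcd_dvd_left k l).trans ((Dvd.intro l hl.symm).trans h₀)
    have := ((d2.sub (d1.mul_left M)).mul_left y₀).sub (d3.mul_left 2)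
    grind
  have c4 : (Int.lcm k l : ℤ) ∣ M * (y - y') := Int.coe_lcm_dvd c1 c2
  have c5 : (g : ℤ) ∣ Int.gcd k l * Int.lcm k l := by
    rw [← Int.natCast_mul, Int.gcd_mul_lcm, hl]; rw [← Int.natAbs_mul]; exact Int.dvd_natAbs.mpr dvd_rfl
  refine (c5.trans (mul_dvd_mul c3 c4)).trans ⟨1, by ring⟩

theorem card_quadratic_le {M D f g : ℕ} (hM : 0 < M) (hD : 0 < D) (hg : 0 < g) :
    ((range (f * g)).filter fun y : ℕ => (g : ℤ) ∣ M * ((y : ℤ) ^ 2 - D)).card ≤ g.divisors.card * (2 * M ^ 2 * D * f) := by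
  rcases ((range (f * g)).filter fun y : ℕ => (g : ℤ) ∣ M * ((y : ℤ) ^ 2 - D)).eq_empty_or_nonempty with h0 | ⟨y₀, h0⟩
  · rw [h0]; simp
  set P := 2 * M ^ 2 * D
  have hP : 0 < P := by positivity
  rw [← Finset.card_range (P * f), ← Finset.card_product]
  refine Finset.card_le_card_of_injOn (fun y : ℕ => (Int.gcd g (y - y₀), P * y / g)) (fun y hy => ?_) fun y hy y' hy' h => ?_
  · have hy1 := mem_range.mp (mem_filter.mp hy).1
    refine Finset.mem_product.mpr ⟨Nat.mem_divisors.mpr ⟨?_, hg.ne'⟩, mem_range.mpr ?_⟩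
    · exact_mod_cast Int.gcd_dvd_left (g : ℤ) (y - y₀)
    · rw [Nat.div_lt_iff_lt_mul hg]
      nlinarith
  · obtain ⟨h1, h2⟩ := Prod.mk.inj h
    have h3 := dvd_mul_sub_of_gcd_eq hg (mem_filter.mp h0).2 (mem_filter.mp hy).2 (mem_filter.mp hy').2 h1
    have h4 : P * y % g = P * y' % g := by
      refine (Nat.modEq_iff_dvd.mpr ?_ : P * y' ≡ P * y [MOD g]).symm
      grind
    have h5 : P * y = P * y' := by rw [← Nat.mod_add_div (P * y) g, ← Nat.mod_add_div (P * y') g, h4]; rw [h2]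
    exact Nat.eq_of_mul_eq_mul_left hP h5

theorem exists_card_divisors_le {ε : ℝ} (hε : 0 < ε) : ∃ C : ℝ, 1 ≤ C ∧ ∀ n : ℕ, 0 < n → (n.divisors.card : ℝ) ≤ C * (n : ℝ) ^ ε := by
  obtain ⟨P, hP⟩ := exists_nat_ge ((2 : ℝ) ^ (1 / ε))
  set K : ℝ := 1 + 1 / (ε * Real.log 2)
  have hl2 : 0 < Real.log 2 := log_pos one_lt_two
  have hK : 1 ≤ K := by bound
  refine ⟨K ^ P, one_le_pow₀ hK, fun n hn => ?_⟩
  have h1 : (n : ℝ) ^ ε = ∏ p ∈ n.primeFactors, ((p : ℝ) ^ ε) ^ n.factorization p := by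
    conv_lhs => rw [← Nat.prod_factorization_pow_eq_self hn.ne']
    rw [Finsupp.prod, Nat.support_factorization, Nat.cast_prod, ← finsetProd_rpow _ _ fun p _ => by positivity]
    refine Finset.prod_congr rfl fun p _ => ?_
    rw [Nat.cast_pow, ← rpow_natCast, ← rpow_natCast, ← rpow_mul (by positivity), ← rpow_mul (by positivity), mul_comm]
  have h2 : ∏ p ∈ n.primeFactors, (if p < P then K else 1) ≤ K ^ P := by
    rw [Finset.prod_ite, Finset.prod_const, Finset.prod_const_one, mul_one]
    refine pow_le_pow_right₀ hK ?_
    calc _ ≤ (range P).card := Finset.card_le_card fun p hp => mem_range.mpr (mem_filter.mp hp).2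
      _ = P := Finset.card_range P
  rw [Nat.card_divisors hn.ne', h1, Nat.cast_prod]
  refine le_trans ?_ (mul_le_mul_of_nonneg_right h2 (Finset.prod_nonneg fun p _ => by positivity))
  rw [← Finset.prod_mul_distrib]
  refine Finset.prod_le_prod (fun p _ => by positivity) fun p hp => ?_
  have hp2 : (2 : ℝ) ≤ p := by exact_mod_cast (Nat.prime_of_mem_primeFactors hp).two_le
  set v := n.factorization p
  push_cast
  split_ifs with hpP
  · have h3 : (2 : ℝ) ^ ε ≤ (p : ℝ) ^ ε := rpow_le_rpow (by norm_num) hp2 hε.le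
    have h4 : 1 + (v : ℝ) * (ε * Real.log 2) ≤ ((2 : ℝ) ^ ε) ^ v := by
      rw [← rpow_natCast, ← rpow_mul (by norm_num), rpow_def_of_pos two_pos]
      have := add_one_le_exp (Real.log 2 * (ε * v))
      linarith
    have h5 : (v : ℝ) + 1 ≤ K * (1 + (v : ℝ) * (ε * Real.log 2)) := by
      have h6 : 1 / (ε * Real.log 2) * ((v : ℝ) * (ε * Real.log 2)) = v := by field_simp
      have h8 : 0 ≤ (v : ℝ) * (ε * Real.log 2) := by positivity
      linarith
    exact h5.trans (mul_le_mul_of_nonneg_left (h4.trans (pow_le_pow_left₀ (by positivity) h3 v)) (by linarith))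
  · have h3 : (2 : ℝ) ≤ (p : ℝ) ^ ε := by
      have : (2 : ℝ) ^ (1 / ε) ≤ p := hP.trans (by simp_all)
      have := rpow_le_rpow (by positivity) this hε.le
      rwa [← rpow_mul (by norm_num), one_div_mul_cancel hε.ne', rpow_one] at this
    rw [one_mul]
    refine le_trans ?_ (pow_le_pow_left₀ (by norm_num) h3 v)
    exact_mod_cast Nat.lt_two_pow_self

theorem sum_zmod_eq_sum_range {Q : ℕ} [NeZero Q] {R : Type*} [AddCommMonoid R] (F : ZMod Q → R) :
    ∑ x, F x = ∑ k ∈ range Q, F k := by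
  refine Finset.sum_nbij' (fun x => x.val) (fun k => (k : ZMod Q)) (fun x _ => mem_range.mpr x.val_lt)
    (fun _ _ => Finset.mem_univ _) (fun x _ => ZMod.natCast_zmod_val x)
    (fun k hk => ZMod.val_cast_of_lt (mem_range.mp hk)) fun x _ => by simp

theorem sum_moebius_dvd {Q v : ℕ} (hQ : 0 < Q) :
    ∑ f ∈ Q.divisors, (if f ∣ v then ArithmeticFunction.moebius f else 0) = if v.Coprime Q then 1 else 0 := by
  have h := congrArg (fun F : ArithmeticFunction ℤ => F (v.gcd Q)) ArithmeticFunction.moebius_mul_coe_zeta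
  simp only [ArithmeticFunction.coe_mul_zeta_apply, ArithmeticFunction.one_apply] at h
  rw [← Finset.sum_filter]
  refine Eq.trans (sum_congr (Finset.ext fun f => ?_) fun _ _ => rfl) h
  simp only [mem_filter, Nat.mem_divisors, Nat.dvd_gcd_iff]
  grind

theorem norm_sum_units_le {Q : ℕ} [NeZero Q] {r : ZMod Q → ℂ} (hr : ∀ x, ‖r x‖ ≤ 1) {M : ℕ} (hM : ∀ x t, r (x + M * t) = r x) (A : ZMod Q) :
    ‖∑ V : (ZMod Q)ˣ, r V * ZMod.stdAddChar ((V : ZMod Q) * A)‖ ≤ ∑ f ∈ Q.divisors, if (M * f * A : ZMod Q) = 0 then ((Q / f : ℕ) : ℝ) else 0 := by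
  have hQ : 0 < Q := NeZero.pos Q
  set F : ZMod Q → ℂ := fun x => r x * ZMod.stdAddChar (x * A)
  have hF : ∀ x, ‖F x‖ ≤ 1 := fun x => by aesop
  have h1 : ∑ V : (ZMod Q)ˣ, F V = ∑ f ∈ Q.divisors, (ArithmeticFunction.moebius f : ℂ) * ∑ x, if f ∣ x.val then F x else 0 := by
    have h2 : ∀ x : ZMod Q, (∑ f ∈ Q.divisors, (ArithmeticFunction.moebius f : ℂ) * if f ∣ x.val then F x else 0) = if IsUnit x then F x else 0 := fun x => by
      have h3 := congrArg (fun k : ℤ => (k : ℂ) * F x) (sum_moebius_dvd (v := x.val) hQ)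
      have h4 : x.val.Coprime Q ↔ IsUnit x := by rw [← ZMod.isUnit_iff_coprime, ZMod.natCast_zmod_val]
      simp only [h4] at h3
      push_cast at h3
      rw [sum_mul] at h3
      grind
    simp_rw [mul_sum]
    rw [Finset.sum_comm, sum_congr rfl fun x _ => h2 x, ← Finset.sum_filter]
    refine Finset.sum_bij (fun V _ => (V : ZMod Q)) (fun V _ => by simp) (fun _ _ _ _ h => Units.ext h) (fun x hx => ?_) fun _ _ => rfl
    aesop
  rw [show ∑ V : (ZMod Q)ˣ, r V * ZMod.stdAddChar ((V : ZMod Q) * A) = ∑ V : (ZMod Q)ˣ, F V from rfl, h1]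
  refine (norm_sum_le _ _).trans (sum_le_sum fun f hf => ?_)
  have hfQ := Nat.dvd_of_mem_divisors hf
  have h4 : ‖(ArithmeticFunction.moebius f : ℂ)‖ ≤ 1 := by
    rw [norm_intCast]; exact_mod_cast ArithmeticFunction.abs_moebius_le_one
  rw [norm_mul]
  refine (mul_le_of_le_one_left (norm_nonneg _) h4).trans ?_
  split_ifs with hA
  · rw [sum_zmod_eq_sum_range, sum_congr rfl fun k hk => by rw [ZMod.val_cast_of_lt (mem_range.mp hk)], ← Finset.sum_filter]
    refine (norm_sum_le_of_le _ fun (k : ℕ) _ => hF (k : ZMod Q)).trans ?_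
    rw [sum_const, nsmul_eq_mul, mul_one, Nat.cast_le]
    calc _ ≤ ((range (Q / f)).image (f * ·)).card := Finset.card_le_card fun k hk => by
            obtain ⟨h5, l, rfl⟩ := mem_filter.mp hk
            refine Finset.mem_image_of_mem _ (mem_range.mpr ?_)
            rw [Nat.lt_div_iff_mul_lt' hfQ]
            simpa using h5
      _ ≤ _ := Finset.card_image_le.trans (Finset.card_range _).le
  · refine (norm_eq_zero.mpr ?_).le
    set T := ∑ x : ZMod Q, if f ∣ x.val then F x else 0
    have h5 : T = ZMod.stdAddChar (M * f * A : ZMod Q) * T := by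
      simp only [T]
      rw [mul_sum, ← Equiv.sum_comp (Equiv.addRight ((M : ZMod Q) * f))]
      refine sum_congr rfl fun x _ => ?_
      have h6 : f ∣ (x + M * f).val ↔ f ∣ x.val := by
        rw [← ZMod.natCast_eq_zero_iff, ← ZMod.natCast_eq_zero_iff, ZMod.natCast_val, ZMod.natCast_val, ZMod.cast_add hfQ,
          ZMod.cast_mul hfQ, ZMod.cast_natCast hfQ f]
        simp
      simp only [Equiv.coe_addRight, h6, F, hM]
      rw [add_mul, AddChar.map_add_eq_mul]
      grind
    have h7 : (1 - ZMod.stdAddChar (M * f * A : ZMod Q)) * T = 0 := by linear_combination h5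
    refine (mul_eq_zero.mp h7).resolve_left fun h8 => hA (ZMod.injective_stdAddChar ?_)
    rw [AddChar.map_zero_eq_one]
    grind

theorem sum_count_le {Q : ℕ} [NeZero Q] {M D : ℕ} (hM : 0 < M) (hD : 0 < D) :
    ∑ y : ZMod Q, ∑ f ∈ Q.divisors, (if (M * f * (D - y ^ 2) : ZMod Q) = 0 then ((Q / f : ℕ) : ℝ) else 0) ≤
      Q * (2 * M ^ 2 * D) * (Q.divisors.card : ℝ) ^ 2 := by
  have hQ : 0 < Q := NeZero.pos Q
  rw [Finset.sum_comm]
  have h : ∀ f ∈ Q.divisors, (∑ y : ZMod Q, (if (M * f * (D - y ^ 2) : ZMod Q) = 0 then ((Q / f : ℕ) : ℝ) else 0)) ≤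
      Q * (2 * M ^ 2 * D) * Q.divisors.card := fun f hf => by
    obtain ⟨g, hg⟩ := Nat.dvd_of_mem_divisors hf
    have hf0 := Nat.pos_of_mem_divisors hf
    have hg0 : 0 < g := Nat.pos_of_ne_zero (by rintro rfl; omega)
    rw [sum_zmod_eq_sum_range, ← Finset.sum_filter, sum_const, nsmul_eq_mul]
    have h1 : ∀ y : ℕ, (M * f * (D - (y : ZMod Q) ^ 2) : ZMod Q) = 0 ↔ (g : ℤ) ∣ M * ((y : ℤ) ^ 2 - D) := fun y => by
      have : (M * f * (D - (y : ZMod Q) ^ 2) : ZMod Q) = ((f * -(M * ((y : ℤ) ^ 2 - D)) : ℤ) : ZMod Q) := by push_cast; ring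
      rw [this, ZMod.intCast_zmod_eq_zero_iff_dvd, hg, Nat.cast_mul, mul_dvd_mul_iff_left (by exact_mod_cast hf0.ne'), dvd_neg]
    simp only [h1]
    have h2 := card_quadratic_le (f := f) hM hD hg0
    have h3 : g.divisors.card ≤ Q.divisors.card := Finset.card_le_card (Nat.divisors_subset_of_dvd hQ.ne' (hg ▸ dvd_mul_left g f))
    have h4 : Q / f = g := by simp_all
    rw [h4, ← Nat.cast_mul]
    have h5 : ((range Q).filter fun y : ℕ => (g : ℤ) ∣ M * ((y : ℤ) ^ 2 - D)).card * g ≤ Q * (2 * M ^ 2 * D) * Q.divisors.card := by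
      conv_lhs => rw [hg]
      refine (Nat.mul_le_mul_right g (h2.trans (Nat.mul_le_mul_right _ h3))).trans (le_of_eq ?_)
      rw [hg]; ring
    exact_mod_cast h5
  refine (sum_le_sum h).trans (le_of_eq ?_)
  simp; ring

theorem val_mul_val_inv {Q : ℕ} (hQ : 1 < Q) (V : (ZMod Q)ˣ) : ((V : ZMod Q).val * ((V⁻¹ : (ZMod Q)ˣ) : ZMod Q).val) % Q = 1 := by
  have : Fact (1 < Q) := ⟨hQ⟩
  rw [← ZMod.val_mul, Units.mul_inv, ZMod.val_one]

theorem odd_and_coprime_of_mul_mod {Q A D : ℕ} (hQ : 2 ∣ Q) (h : (A * D) % Q = 1) : Odd D ∧ Coprime D Q := by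
  have h2 : Coprime D Q := by
    have h1 : Nat.gcd (A * D) Q = 1 := by rw [← Nat.gcd_comm, Nat.gcd_rec, h]; simp
    exact Coprime.coprime_mul_left h1
  exact ⟨Nat.coprime_two_right.mp (h2.coprime_dvd_right hQ), h2⟩

theorem conj_gauss_eq {C : ℕ} [NeZero (2 * C)] (hC : 0 < C) (hCe : Even C) (V : (ZMod (2 * C))ˣ) :
    ∑ x : ZMod (2 * C), ZMod.stdAddChar (-((V : ZMod (2 * C)) * x ^ 2)) =
      conj (ee (1 / 8) * (√(4 * C) : ℝ)) * conj (thetaMul C ((V⁻¹ : (ZMod (2 * C))ˣ) : ZMod (2 * C)).val) := by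
  rw [← map_mul, ← gauss_eq hC hCe (val_mul_val_inv (by omega) V), map_sum, sum_zmod_eq_sum_range, ← Finset.sum_range (fun r => conj (ee ((V : ZMod (2 * C)).val * (r : ℕ) ^ 2 / (2 * C))))]
  refine sum_congr rfl fun k _ => ?_
  have h : (-((V : ZMod (2 * C)) * (k : ZMod (2 * C)) ^ 2)) = ((-((V : ZMod (2 * C)).val * (k : ℤ) ^ 2) : ℤ) : ZMod (2 * C)) := by simp
  rw [h, ZMod.stdAddChar_coe, ee, ← exp_conj]
  congr 1
  have h2 : conj (2 : ℂ) = 2 := conj_ofNat 2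
  simp only [map_mul, map_div₀, map_pow, conj_I, conj_ofReal, conj_natCast, h2]
  push_cast
  ring

/-- The part of a Kloosterman summand that only depends on the residue modulo `4 * n`. -/
def klooTwist (n d : ℕ) : ℂ := epsFactor d ^ 2 * ((jacobiSym n d : ℤ) : ℂ)

theorem norm_epsFactor (d : ℕ) : ‖epsFactor d‖ = 1 := by
  rw [epsFactor]; split_ifs <;> simp

theorem norm_klooTwist_le (n d : ℕ) : ‖klooTwist n d‖ ≤ 1 := by
  rw [klooTwist, norm_mul, norm_pow, norm_epsFactor, one_pow, one_mul, norm_intCast]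
  rcases jacobiSym.trichotomy n d with h | h | h <;> simp [h]

theorem klooTwist_mod {n d : ℕ} (hd : Odd d) : klooTwist n (d % (4 * n)) = klooTwist n d := by
  rw [klooTwist, klooTwist, jacobiSym.mod_right n hd, Int.natAbs_natCast, epsFactor_mod_four (Nat.mod_mul_right_mod d 4 n)]

/-- The twist as a function on all residues, evaluated at the inverse. -/
def klooTwistInv (n Q : ℕ) (x : ZMod Q) : ℂ := klooTwist n ((x.cast : ZMod (4 * n))⁻¹).val

theorem klooTwistInv_add {n Q : ℕ} (h : 4 * n ∣ Q) (x t : ZMod Q) : klooTwistInv n Q (x + (4 * n : ℕ) * t) = klooTwistInv n Q x := by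
  rw [klooTwistInv, klooTwistInv, ZMod.cast_add h, ZMod.cast_mul h, ZMod.cast_natCast h, ZMod.natCast_self, zero_mul, add_zero]

theorem klooTwistInv_unit {n Q : ℕ} [NeZero Q] (h : 4 * n ∣ Q) (V : (ZMod Q)ˣ) (hV : Odd ((V⁻¹ : (ZMod Q)ˣ) : ZMod Q).val) :
    klooTwistInv n Q V = klooTwist n ((V⁻¹ : (ZMod Q)ˣ) : ZMod Q).val := by
  rw [klooTwistInv, ZMod.inv_eq_of_mul_eq_one (4 * n) _ (((V⁻¹ : (ZMod Q)ˣ) : ZMod Q).cast), ZMod.cast_eq_val ((V⁻¹ : (ZMod Q)ˣ) : ZMod Q), ZMod.val_natCast,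
    klooTwist_mod hV]
  rw [← ZMod.cast_mul h, Units.mul_inv, ZMod.cast_one h]

theorem epsFactor_mul_jacobiSym_congr {c d d' : ℕ} (hc : Even c) (hd : Odd d) (hd' : Odd d') (h : d % (2 * c) = d' % (2 * c)) :
    epsFactor d = epsFactor d' ∧ jacobiSym (2 * c) d = jacobiSym (2 * c) d' := by
  have h1 : epsFactor d = epsFactor d' := by
    obtain ⟨e, rfl⟩ := hc
    refine epsFactor_mod_four ?_
    have := congrArg (· % 4) h
    rwa [show 2 * (e + e) = 4 * e by ring, Nat.mod_mul_right_mod, Nat.mod_mul_right_mod] at this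
  have h2 := thetaMul_congr ((Int.even_coe_nat c).mpr hc) hd hd' (by simpa using h)
  rw [thetaMul, thetaMul, h1] at h2
  have h3 : (epsFactor d')⁻¹ ≠ 0 := inv_ne_zero (norm_ne_zero_iff.mp (by rw [norm_epsFactor]; simp))
  simp_all

theorem jacobiSym_sq_of_coprime {a d : ℕ} (h : Coprime d a) : ((jacobiSym a d : ℤ) : ℂ) ^ 2 = 1 := by
  exact_mod_cast jacobiSym.sq_one (a := a) (b := d) (by rw [Int.gcd_natCast_natCast]; exact h.symm)

theorem klooRes_eq (m : ℕ) {n c Q : ℕ} [NeZero Q] (hQ : Q = 2 * (4 * n * c)) (hn : 0 < n) (hc0 : 0 < c) (hc : Even c) (h : 2 * c ∣ Q) (V : (ZMod Q)ˣ) :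
    klooRes m n c (ZMod.unitsMap h V⁻¹ : ZMod (2 * c)).val =
      klooTwistInv n Q V * conj (thetaMul (4 * n * c : ℕ) ((V⁻¹ : (ZMod Q)ˣ) : ZMod Q).val) *
        ZMod.stdAddChar (4 * (n : ZMod Q) * ((m : ZMod Q) * (V : ZMod Q) + (n : ZMod Q) * ((V⁻¹ : (ZMod Q)ˣ) : ZMod Q))) := by
  have hnc : 0 < n * c := by positivity
  have hQ1 : 1 < Q := by linarith
  have had := val_mul_val_inv hQ1 V
  have hAc := ZMod.natCast_zmod_val (V : ZMod Q)
  have hDc := ZMod.natCast_zmod_val ((V⁻¹ : (ZMod Q)ˣ) : ZMod Q)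
  obtain ⟨hD, hcop⟩ := odd_and_coprime_of_mul_mod (hQ ▸ Dvd.intro _ rfl) had
  rw [klooTwistInv_unit (by rw [hQ]; exact ⟨2 * c, by ring⟩) V hD, ZMod.unitsMap_val, ZMod.cast_eq_val, ZMod.val_natCast]
  generalize ((V⁻¹ : (ZMod Q)ˣ) : ZMod Q).val = D at *
  generalize (V : ZMod Q).val = A at *
  have had' : (A % (2 * c) * (D % (2 * c))) % (2 * c) = 1 := by
    rw [← Nat.mul_mod, ← Nat.mod_mod_of_dvd _ h, had, Nat.mod_eq_of_lt (by omega)]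
  have hA0 : A % (2 * c) ≠ 0 := fun h0 => by simp_all
  rw [klooRes_of_inv m n (Finset.mem_Ico.mpr ⟨by omega, Nat.mod_lt _ (by omega)⟩) had']
  obtain ⟨e1, e2⟩ := epsFactor_mul_jacobiSym_congr hc (odd_and_coprime_of_mul_mod (Dvd.intro _ rfl) had').1 hD (Nat.mod_mod D (2 * c))
  have e3 : jacobiSym (2 * ((4 * n * c : ℕ) : ℤ)) D = jacobiSym (2 * c) D * jacobiSym n D := by
    rw [← jacobiSym.mul_left, ← jacobiSym_two_mul_even (2 * c * n) hD]; grind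
  have e4 : conj (thetaMul (4 * n * c : ℕ) D) = epsFactor D * (((jacobiSym (2 * c) D : ℤ) : ℂ) * ((jacobiSym n D : ℤ) : ℂ)) := by
    rw [thetaMul, e3, map_mul, map_inv₀, map_intCast]
    congr 1
    · rw [epsFactor]; split_ifs <;> simp
    · push_cast; rfl
  have e5 : ee ((((m : ℤ) * (A % (2 * c) : ℕ) + (n : ℤ) * (D % (2 * c) : ℕ) : ℤ) : ℂ) / (2 * (c : ℕ))) =
      ZMod.stdAddChar (4 * (n : ZMod Q) * ((m : ZMod Q) * (V : ZMod Q) + (n : ZMod Q) * ((V⁻¹ : (ZMod Q)ˣ) : ZMod Q))) := by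
    have h1 : (4 * (n : ZMod Q) * ((m : ZMod Q) * (V : ZMod Q) + (n : ZMod Q) * ((V⁻¹ : (ZMod Q)ˣ) : ZMod Q))) = ((4 * n * (m * A + n * D) : ℤ) : ZMod Q) := by
      simp_all
    have h2 : ((4 * n * (m * A + n * D) : ℤ) : ℂ) / Q = (((m : ℤ) * (A % (2 * c) : ℕ) + (n : ℤ) * (D % (2 * c) : ℕ) : ℤ) : ℂ) / (2 * (c : ℕ)) +
        ((m * (A / (2 * c) : ℕ) + n * (D / (2 * c) : ℕ) : ℤ) : ℂ) := by
      have hA := congrArg (Nat.cast : ℕ → ℂ) (Nat.mod_add_div A (2 * c))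
      have hD := congrArg (Nat.cast : ℕ → ℂ) (Nat.mod_add_div D (2 * c))
      have hc' : (c : ℂ) ≠ 0 := by exact_mod_cast hc0.ne'
      have hn' : (n : ℂ) ≠ 0 := by exact_mod_cast hn.ne'
      generalize A % (2 * c) = a at *
      generalize A / (2 * c) = a' at *
      generalize D % (2 * c) = d at *
      generalize D / (2 * c) = d' at *
      rw [hQ]
      push_cast at hA hD ⊢
      grind
    rw [h1, ZMod.stdAddChar_coe, mul_div_assoc, h2, ← ee, ee_add, ee_int, mul_one]
  have e6 : ((jacobiSym n D : ℤ) : ℂ) ^ 2 = 1 := jacobiSym_sq_of_coprime (hcop.coprime_dvd_right (by rw [hQ]; exact ⟨8 * c, by ring⟩))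
  have e7 : ((jacobiSym (2 * (c : ℤ)) D : ℤ) : ℂ) ^ 2 = 1 := by
    have := jacobiSym_sq_of_coprime (hcop.coprime_dvd_right h); exact_mod_cast this
  rw [kloo, e1, e2, e4, e5, klooTwist]
  grind

theorem norm_sum_le_norm_sum_comp {G H : Type*} [Group G] [Fintype G] [Group H] [Fintype H] (φ : G →* H) (hφ : Function.Surjective φ) (f : H → ℂ) :
    ‖∑ h, f h‖ ≤ ‖∑ g, f (φ g)‖ := by
  classical
  set k := (Finset.univ.filter fun g => φ g = 1).card
  have h1 : ∑ g, f (φ g) = k * ∑ h, f h := by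
    rw [← Finset.sum_fiberwise_of_maps_to (t := Finset.univ) (g := φ) fun _ _ => Finset.mem_univ _, mul_sum]
    refine sum_congr rfl fun h _ => ?_
    rw [sum_congr rfl fun g hg => by rw [(mem_filter.mp hg).2], sum_const, nsmul_eq_mul]
    rw [MonoidHom.card_fiber_eq_of_mem_range φ (hφ h) (hφ 1)]
  have h2 : 1 ≤ k := Finset.card_pos.mpr ⟨1, by simp⟩
  rw [h1, norm_mul, Complex.norm_natCast]
  exact le_mul_of_one_le_left (norm_nonneg _) (by exact_mod_cast h2)

theorem SKe_eq_sum_units (m n : ℤ) {c : ℕ} (hc : 0 < c) [NeZero (2 * c)] : SKe m n c 3 = ∑ u : (ZMod (2 * c))ˣ, klooRes m n c (u : ZMod (2 * c)).val := by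
  have h1 : ∑ x : ZMod (2 * c), klooRes m n c x.val = ∑ k ∈ range (2 * c), klooRes m n c k :=
    (sum_zmod_eq_sum_range _).trans (sum_congr rfl fun k hk => by rw [ZMod.val_cast_of_lt (mem_range.mp hk)])
  rw [SKe_three_eq m n hc, ← Finset.sum_range fun k => klooRes m n c k, ← h1]
  symm
  refine Finset.sum_of_injOn (fun u : (ZMod (2 * c))ˣ => (u : ZMod (2 * c))) (fun _ _ _ _ h => Units.ext h) (fun _ _ => by simp) (fun x _ hx => ?_) fun _ _ => rfl
  refine klooRes_of_not_coprime m n fun h => hx ?_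
  rw [← ZMod.isUnit_iff_coprime, ZMod.natCast_zmod_val] at h
  exact ⟨h.unit, by simp⟩

theorem norm_SKe_le {m n c : ℕ} (hm : 1 ≤ m) (hn : 1 ≤ n) (hc0 : 0 < c) (hc : Even c) :
    ‖SKe m n c 3‖ ≤ √(8 * n * c) * (2 * (4 * n : ℕ) ^ 2 * (4 * n * m : ℕ)) * ((8 * n * c).divisors.card : ℝ) ^ 2 := by
  obtain ⟨Q, hQ⟩ : ∃ Q, Q = 2 * (4 * n * c) := ⟨_, rfl⟩
  have hnc : 0 < n * c := by positivity
  have : NeZero Q := ⟨by rw [hQ]; positivity⟩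
  have : NeZero (2 * c) := ⟨by positivity⟩
  have h2c : 2 * c ∣ Q := by rw [hQ]; exact ⟨4 * n, by ring⟩
  set κ : ℂ := conj (ee (1 / 8) * (√(4 * (4 * n * c : ℕ)) : ℝ))
  have hκ : ‖κ‖ = √(2 * Q) := by
    simp only [κ]
    rw [norm_conj, norm_mul, ee, norm_exp, norm_real, norm_of_nonneg (sqrt_nonneg _), hQ]
    have : (2 * π * I * (1 / 8 : ℂ)).re = 0 := by simp
    rw [this, Real.exp_zero, one_mul]
    grind
  have h1 : ‖SKe m n c 3‖ ≤ ‖∑ V : (ZMod Q)ˣ, klooRes m n c (ZMod.unitsMap h2c V⁻¹ : ZMod (2 * c)).val‖ := by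
    rw [SKe_eq_sum_units m n hc0]
    refine le_of_le_of_eq ?_ (congrArg norm (Equiv.sum_comp (Equiv.inv (ZMod Q)ˣ) fun V => klooRes m n c (ZMod.unitsMap h2c V : ZMod (2 * c)).val).symm)
    exact norm_sum_le_norm_sum_comp (ZMod.unitsMap h2c) (ZMod.unitsMap_surjective h2c) fun u => klooRes m n c (u : ZMod (2 * c)).val
  set r := klooTwistInv n Q
  set ψ : AddChar (ZMod Q) ℂ := ZMod.stdAddChar
  have h2 : κ * ∑ V : (ZMod Q)ˣ, klooRes m n c (ZMod.unitsMap h2c V⁻¹ : ZMod (2 * c)).val =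
      ∑ y : ZMod Q, ψ (-(4 * n * y)) * ∑ V : (ZMod Q)ˣ, r V * ψ ((V : ZMod Q) * ((4 * n * m : ℕ) - y ^ 2)) := by
    simp_rw [mul_sum]
    rw [Finset.sum_comm]
    refine sum_congr rfl fun V _ => ?_
    have hg : ∑ x : ZMod Q, ψ (-((V : ZMod Q) * x ^ 2)) = κ * conj (thetaMul (4 * n * c : ℕ) ((V⁻¹ : (ZMod Q)ˣ) : ZMod Q).val) := by
      subst hQ
      exact conj_gauss_eq (by positivity) (by norm_num) V
    rw [klooRes_eq m hQ hn hc0 hc h2c V, mul_assoc, mul_left_comm, ← mul_assoc κ, ← hg, ← Equiv.sum_comp (Equiv.addRight (2 * (n : ZMod Q) * ((V⁻¹ : (ZMod Q)ˣ) : ZMod Q))),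
      sum_mul, mul_sum]
    refine sum_congr rfl fun y _ => ?_
    change r V * (ψ _ * ψ _) = _
    rw [mul_left_comm (ψ (-(4 * n * y))), ← AddChar.map_add_eq_mul, ← AddChar.map_add_eq_mul, Equiv.coe_addRight]
    congr 2
    have hV := V.mul_inv
    grind
  have h3 : √(2 * Q) * ‖SKe m n c 3‖ ≤ Q * (2 * (4 * n : ℕ) ^ 2 * (4 * n * m : ℕ)) * (Q.divisors.card : ℝ) ^ 2 := by
    refine le_trans ?_ (sum_count_le (Q := Q) (M := 4 * n) (D := 4 * n * m) (by positivity) (by positivity))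
    rw [← hκ]
    refine (mul_le_mul_of_nonneg_left h1 (norm_nonneg _)).trans ?_
    rw [← norm_mul, h2]
    refine norm_sum_le_of_le _ fun y _ => ?_
    rw [norm_mul, AddChar.norm_apply, one_mul]
    have h4n : 4 * n ∣ Q := by rw [hQ]; exact ⟨2 * c, by ring⟩
    exact norm_sum_units_le (r := r) (M := 4 * n) (fun x => norm_klooTwist_le _ _) (fun x t => klooTwistInv_add h4n x t) ((4 * n * m : ℕ) - y ^ 2)
  have hQ' : Q = 8 * n * c := by rw [hQ]; ring
  have hQR : (0 : ℝ) < Q := by simp_all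
  rw [show (8 * n * c : ℝ) = Q by aesop, ← hQ']
  have h4 : √Q ≤ √(2 * Q) := sqrt_le_sqrt (by linarith)
  have h5 := (mul_le_mul_of_nonneg_right h4 (norm_nonneg (SKe m n c 3))).trans h3
  nth_rewrite 2 [← mul_self_sqrt hQR.le] at h5
  rw [mul_assoc, mul_assoc] at h5
  rw [mul_assoc]
  exact le_of_mul_le_mul_left (by linarith) (sqrt_pos.mpr hQR)

theorem norm_bcoef_le (hm : 1 ≤ m) (hn : 1 ≤ n) {ε : ℝ} (hε : 0 < ε) :
    ∃ C, 0 ≤ C ∧ ∀ c : ℕ, 1 ≤ c → ‖bcoef m n c‖ ≤ C * (c : ℝ) ^ (-1 + ε) := by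
  obtain ⟨K, hK, hd⟩ := exists_card_divisors_le (half_pos hε)
  refine ⟨√(8 * n) * (2 * (4 * n : ℕ) ^ 2 * (4 * n * m : ℕ)) * (K ^ 2 * (8 * n : ℝ) ^ ε), by positivity, fun c hc => ?_⟩
  have hc' : (0 : ℝ) < c := by exact_mod_cast hc
  rw [bcoef]
  split_ifs with he
  swap
  · rw [norm_zero]; positivity
  have h1 := norm_SKe_le hm hn he.2 he.1
  have h2 : ((8 * n * c).divisors.card : ℝ) ^ 2 ≤ K ^ 2 * (8 * n : ℝ) ^ ε * (c : ℝ) ^ ε := by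
    refine (pow_le_pow_left₀ (by positivity) (hd (8 * n * c) (by positivity)) 2).trans (le_of_eq ?_)
    rw [mul_pow, ← rpow_natCast (_ ^ _), ← rpow_mul (by positivity), mul_assoc (K ^ 2), ← mul_rpow (by positivity) hc'.le]
    simp
  have h3 : √(8 * n * c) * ((c : ℝ) ^ (-(3 / 2) : ℝ) * (c : ℝ) ^ ε) = √(8 * n) * (c : ℝ) ^ (-1 + ε) := by
    rw [sqrt_mul (by positivity), mul_assoc, sqrt_eq_rpow (c : ℝ), ← rpow_add hc', ← rpow_add hc']
    congr 2; ring
  rw [norm_mul, norm_real, norm_of_nonneg (by positivity)]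
  refine (mul_le_mul_of_nonneg_right (h1.trans (mul_le_mul_of_nonneg_left h2 (by positivity))) (by positivity)).trans (le_of_eq ?_)
  grind

end

/-- **Interpolation identity for weight-3/2 Kloosterman sums at even moduli**: for integers
`m, n ≥ 1`, the series `Σ_{even c>0} (S(m,n,c,ν_Θ³)/√c)·sin(2π√(mn)/c)` converges (as the
limit of its partial sums over even `c ≤ N`), to `e(−1/8)·√m` if `m = n` and to `0`
otherwise. -/
theorem kloosterman_interpolation_even (m n : ℕ) (hm : 1 ≤ m) (hn : 1 ≤ n) :
    Filter.Tendsto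
      (fun N : ℕ => ∑ c ∈ Finset.range (N + 1),
        if Even c ∧ 0 < c then
          SKe m n c 3 / ((Real.sqrt c : ℝ) : ℂ) *
            ((Real.sin (2 * π * Real.sqrt ((m : ℝ) * n) / c) : ℝ) : ℂ)
        else 0)
      Filter.atTop
      (nhds (if m = n then ee (-(1 : ℂ) / 8) * ((Real.sqrt m : ℝ) : ℂ) else 0)) := by
  exact tendsto_sum_of_bound hm hn fun ε hε => norm_bcoef_le hm hn hε

end
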